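/- Let m > 1 be squarefree and let ⋆ be one of I, II, III. Let E^{OG,⋆}_m denote the space of even weak elliptic forms φ of index m with C_φ(Δ,ℓ) = 0 for all Δ < −1 which in addition satisfy: (I) ∑ C_φ(−1,r) = 0, the sum over integers r with 0 < r < m and r² ≡ 1 (mod 4m); respectively (II) c_φ(0,1) = 0; respectively (III) c_φ(0,0) = 0. Then every even weak elliptic form of index m can be written as ψ + e with ψ a weak Jacobi form of weight 2 and index m and e ∈ E^{OG,⋆}_m, and the intersection of E^{OG,⋆}_m with the space of weak Jacobi forms of weight 2 and index m equals the space of holomorphic Jacobi forms of weight 2 and index m — so the decomposition is unique up to adding a holomorphic Jacobi form to one summand and subtracting it from the other. Moreover, for arbitrary m > 1 the same two assertions hold when 'even weak elliptic form of index m' is replaced throughout by 'even weak elliptic form φ of index m satisfying R_{m₁',m₂'}(φ|u_t) = 0 for every t > 1 with t² | m and every unordered factorization m/t² = m₁'·m₂'', and E^{OG,⋆}_m by its intersection with this subspace. -/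

import Mathlib

noncomputable section

open Complex Filter Topology MeasureTheory
open scoped Classical

/-- `ee x = e^{2πix}`. -/
def ee (x : ℂ) : ℂ := Complex.exp (2 * (Real.pi : ℂ) * Complex.I * x)

/-- The index-`m` elliptic transformation law on `ℍ × ℂ`. -/
def EllipticLaw (m : ℕ) (φ : ℂ → ℂ → ℂ) : Prop :=
  ∀ τ : ℂ, 0 < τ.im → ∀ z : ℂ, ∀ lam mu : ℤ,
    φ τ (z + (lam : ℂ) * τ + (mu : ℂ)) =
      ee (-(m : ℂ) * ((lam : ℂ) ^ 2 * τ + 2 * (lam : ℂ) * z)) * φ τ z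

/-- The weight-`k` index-`m` modular transformation law on `ℍ × ℂ`. -/
def ModularLaw (k : ℤ) (m : ℕ) (φ : ℂ → ℂ → ℂ) : Prop :=
  ∀ τ : ℂ, 0 < τ.im → ∀ z : ℂ, ∀ a b c d : ℤ, a * d - b * c = 1 →
    φ (((a : ℂ) * τ + (b : ℂ)) / ((c : ℂ) * τ + (d : ℂ))) (z / ((c : ℂ) * τ + (d : ℂ))) =
      ((c : ℂ) * τ + (d : ℂ)) ^ k *
        ee ((m : ℂ) * (c : ℂ) * z ^ 2 / ((c : ℂ) * τ + (d : ℂ))) * φ τ z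

/-- The theta function `θ_{m,ℓ}(τ,z) = ∑_{r ≡ ℓ (mod 2m)} q^{r²/4m} y^r`. -/
def jTheta (m : ℕ) (l : ℤ) (τ z : ℂ) : ℂ :=
  ∑' n : ℤ, ee (((l : ℂ) + 2 * (m : ℂ) * (n : ℂ)) ^ 2 / (4 * (m : ℂ)) * τ +
      ((l : ℂ) + 2 * (m : ℂ) * (n : ℂ)) * z)

/-- The point `z_s = ατ + β` for `s = (α,β) ∈ ℚ²`. -/
def zpt (s : ℚ × ℚ) (τ : ℂ) : ℂ := (s.1 : ℚ) * τ + (s.2 : ℚ)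

/-- A holomorphic function on `ℍ × ℂ` satisfying the index-`m` elliptic transformation law,
together with its Fourier coefficient data `coeff Δ ℓ = C(Δ,ℓ)` (so that
`c(n,r) = C(4nm - r², r)`, `C(Δ,ℓ)` depends on `ℓ` only modulo `2m`, and `C(Δ,ℓ) = 0` on
pairs with `Δ + ℓ² ≢ 0 (mod 4m)`). -/
structure EllFormData (m : ℕ) where
  toFun : ℂ → ℂ → ℂ
  coeff : ℤ → ℤ → ℂ
  holo : ∀ τ z : ℂ, 0 < τ.im → DifferentiableAt ℂ (fun p : ℂ × ℂ => toFun p.1 p.2) (τ, z)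
  elliptic : EllipticLaw m toFun
  expansion : ∀ τ z : ℂ, 0 < τ.im →
    HasSum (fun p : ℤ × ℤ => coeff (4 * (m : ℤ) * p.1 - p.2 ^ 2) p.2 *
      ee ((p.1 : ℂ) * τ + (p.2 : ℂ) * z)) (toFun τ z)
  periodic : ∀ Δ l : ℤ, coeff Δ (l + 2 * (m : ℤ)) = coeff Δ l
  support : ∀ Δ l : ℤ, ¬ (4 * (m : ℤ)) ∣ (Δ + l ^ 2) → coeff Δ l = 0

/-- An elliptic form is weak if `c(n,r) = 0` for `n < 0`. -/
def IsWeakC (m : ℕ) (C : ℤ → ℤ → ℂ) : Prop :=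
  ∀ n r : ℤ, n < 0 → C (4 * (m : ℤ) * n - r ^ 2) r = 0

/-- Even coefficients: `C(Δ,-ℓ) = C(Δ,ℓ)`. -/
def IsEvenC (C : ℤ → ℤ → ℂ) : Prop := ∀ Δ l : ℤ, C Δ (-l) = C Δ l

/-- Holomorphic (as opposed to weak): `C(Δ,ℓ) = 0` for `Δ < 0`. -/
def IsHolC (C : ℤ → ℤ → ℂ) : Prop := ∀ Δ l : ℤ, Δ < 0 → C Δ l = 0

/-- Cuspidal: `C(Δ,ℓ) = 0` for `Δ ≤ 0`. -/
def IsCuspC (C : ℤ → ℤ → ℂ) : Prop := ∀ Δ l : ℤ, Δ ≤ 0 → C Δ l = 0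

/-- Optimal growth: `C(Δ,ℓ) = 0` for `Δ < -1`. -/
def IsOGC (C : ℤ → ℤ → ℂ) : Prop := ∀ Δ l : ℤ, Δ < -1 → C Δ l = 0

/-- A representative `ℓ* = ℓ·(a·x - b·y)` (with `ax + by = gcd(a,b) = 1`) of the residue
class determined by `ℓ* ≡ -ℓ (mod 2a)`, `ℓ* ≡ ℓ (mod 2b)`, used to define the
Atkin–Lehner involution `W_a` on coefficients. -/
def lstar (a b : ℕ) (l : ℤ) : ℤ := l * ((a : ℤ) * Nat.gcdA a b - (b : ℤ) * Nat.gcdB a b)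

/-- The coefficients of `φ|u_t` (index `m/t²`):
`C_{φ|u_t}(Δ,ℓ) = ∑_{r mod 2m/t, r ≡ ℓ (mod 2m/t²)} C_φ(Δt², rt)`. -/
def CoeffU (m t : ℕ) (C : ℤ → ℤ → ℂ) (Δ l : ℤ) : ℂ :=
  ∑ j ∈ Finset.range t,
    C (Δ * (t : ℤ) ^ 2) ((l + 2 * (m : ℤ) / (t : ℤ) ^ 2 * (j : ℤ)) * (t : ℤ))

/-- For an unordered factorization `m = m₁·m₂` with `t = gcd(m₁,m₂)`,
`R_{m₁,m₂}(φ) = R[(φ|u_t)|W_{m₁/t}] = ∑_{r∈ℤ} C_{(φ|u_t)|W_{m₁/t}}(-r², r)`. -/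
def Rfactor (m : ℕ) (C : ℤ → ℤ → ℂ) (m₁ m₂ : ℕ) : ℂ :=
  ∑' r : ℤ, CoeffU m (Nat.gcd m₁ m₂) C (-(r ^ 2))
      (lstar (m₁ / Nat.gcd m₁ m₂) (m₂ / Nat.gcd m₁ m₂) r)

/-- The extra normalizing condition `⋆ ∈ {I, II, III}`:
(I) `∑_{0<r<m, r²≡1 (4m)} C(-1,r) = 0`; (II) `c(0,1) = C(-1,1) = 0`;
(III) `c(0,0) = C(0,0) = 0`. -/
def StarCond (m : ℕ) (st : Fin 3) (C : ℤ → ℤ → ℂ) : Prop :=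
  if st = 0 then
    (∑ r ∈ (Finset.range m).filter (fun r => 0 < r ∧ (4 * (m : ℤ)) ∣ ((r : ℤ) ^ 2 - 1)),
      C (-1) (r : ℤ)) = 0
  else if st = 1 then C (-1) 1 = 0
  else C 0 0 = 0

/-- `φ` satisfies `R_{m₁',m₂'}(φ|u_t) = 0` for every `t > 1` with `t² ∣ m` and every
unordered factorization `m/t² = m₁'·m₂'`. -/
def ResPrim (m : ℕ) (C : ℤ → ℤ → ℂ) : Prop :=
  ∀ t : ℕ, 1 < t → t ^ 2 ∣ m → ∀ m₁ m₂ : ℕ, m₁ * m₂ = m / t ^ 2 →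
    Rfactor (m / t ^ 2) (CoeffU m t C) m₁ m₂ = 0

/-- `φ = ψ + e` as functions on `ℍ × ℂ`. -/
def SumEq (m : ℕ) (φ ψ e : EllFormData m) : Prop :=
  ∀ τ z : ℂ, 0 < τ.im → φ.toFun τ z = ψ.toFun τ z + e.toFun τ z

section
open Finset
local notation "ℤℤ" => (ℤ → ℤ → ℂ)
local notation "ℂℂ" => (ℂ → ℂ → ℂ)
def Hol (F : ℂ → ℂ) : Prop := DifferentiableOn ℂ F (Metric.ball 0 1)

def ps (F : ℂ → ℂ) : PowerSeries ℂ :=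
  .mk fun m ↦ (↑m.factorial)⁻¹ * iteratedDeriv m F 0

lemma ball_nhds0 : Metric.ball (0:ℂ) 1 ∈ 𝓝 (0:ℂ) := Metric.ball_mem_nhds 0 one_pos

lemma Hol.an {F : ℂ → ℂ} (h : Hol F) : AnalyticAt ℂ F 0 := DifferentiableOn.analyticAt h ball_nhds0

lemma ps_congr {F G : ℂ → ℂ} (h : ∀ q, ‖q‖ < 1 → F q = G q) : ps F = ps G := by
  ext n
  have : F =ᶠ[𝓝 0] G := by
    filter_upwards [ball_nhds0] with q hq using h q (by simpa using hq)
  simp [ps, this.iteratedDeriv_eq n]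

lemma Hol.congr' {F G : ℂ → ℂ} (hF : Hol F) (h : ∀ q, ‖q‖ < 1 → G q = F q) : Hol G :=
  DifferentiableOn.congr hF fun q hq => h q (by simpa using hq)

lemma ps_mul {F G : ℂ → ℂ} (hF : Hol F) (hG : Hol G) : ps (fun q => F q * G q) = ps F * ps G := by
  ext n
  have := iteratedDeriv_mul (n := n) hF.an.contDiffAt hG.an.contDiffAt
  simp only [ps, PowerSeries.coeff_mk, PowerSeries.coeff_mul,
    Finset.Nat.sum_antidiagonal_eq_sum_range_succ_mk]
  rw [show (fun q => F q * G q) = F * G from rfl, this, mul_sum]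
  refine sum_congr rfl fun i hi ↦ ?_
  rw [Nat.cast_choose _ (by grind)]
  field_simp [Nat.factorial_ne_zero]

lemma ps_add {F G : ℂ → ℂ} (hF : Hol F) (hG : Hol G) : ps (fun q => F q + G q) = ps F + ps G := by
  ext n
  have := iteratedDeriv_add (n := n) hF.an.contDiffAt hG.an.contDiffAt
  simp only [ps, PowerSeries.coeff_mk, map_add]
  rw [show (fun q => F q + G q) = F + G from rfl, this, mul_add]

lemma hol_hasSum {F : ℂ → ℂ} (hF : Hol F) {q : ℂ} (hq : ‖q‖ < 1) :
    HasSum (fun n : ℕ => (ps F).coeff n * q ^ n) (F q) := by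
  convert! hasSum_taylorSeries_on_ball hF (by simpa using hq) using 2 with m
  simp [ps]; ring

lemma hasFP_of_summable (c : ℕ → ℂ) (hc : ∀ q : ℂ, ‖q‖ < 1 → Summable fun n => c n * q ^ n) :
    HasFPowerSeriesOnBall (fun q => ∑' n, c n * q ^ n)
      (FormalMultilinearSeries.ofScalars ℂ c) 0 1 := by
  constructor
  · refine ENNReal.le_of_forall_nnreal_lt fun r hr => ?_
    have hr1 : (r : ℝ) < 1 := by exact_mod_cast hr
    have := hc (r : ℂ) (by simpa using hr1)
    refine FormalMultilinearSeries.le_radius_of_summable_norm _ ?_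
    refine this.norm.congr fun n => ?_
    simp
  · simp
  · intro y hy
    have hy' : ‖y‖ < 1 := by simpa [← ENNReal.coe_one, enorm] using hy
    have := (hc y hy').hasSum
    simpa [FormalMultilinearSeries.ofScalars_apply_eq, smul_eq_mul, mul_comm] using this

lemma hol_tsum (c : ℕ → ℂ) (hc : ∀ q : ℂ, ‖q‖ < 1 → Summable fun n => c n * q ^ n) :
    Hol (fun q => ∑' n, c n * q ^ n) ∧ ps (fun q => ∑' n, c n * q ^ n) = .mk c := by
  have h := hasFP_of_summable c hc
  refine ⟨?_, ?_⟩
  · have := h.differentiableOn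
    intro q hq
    refine (this q ?_).mono ?_
    · simpa [Metric.mem_eball, edist_dist, ← ENNReal.ofReal_one, ENNReal.ofReal_lt_ofReal_iff] using hq
    · intro x hx
      simpa [Metric.mem_eball, edist_dist, ← ENNReal.ofReal_one, ENNReal.ofReal_lt_ofReal_iff] using hx
  · ext n
    have h2 := h.hasFPowerSeriesAt.eq_formalMultilinearSeries
      (AnalyticAt.hasFPowerSeriesAt h.analyticAt)
    have := congr_arg (FormalMultilinearSeries.coeff · n) h2
    simp at this
    simp [ps, this, div_eq_inv_mul]

lemma ps_const (a : ℂ) : ps (fun _ => a) = PowerSeries.C a := by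
  ext n
  simp [ps, iteratedDeriv_const, PowerSeries.coeff_C]
  split_ifs <;> simp_all

lemma ps_id : ps (fun q => q) = PowerSeries.X := by
  ext n
  rw [PowerSeries.coeff_X]
  rcases n with _ | _ | n
  · simp [ps]
  · simp [ps]
  · simp only [ps, PowerSeries.coeff_mk, iteratedDeriv_succ']
    simp

lemma ps_coeff_zero (F : ℂ → ℂ) : (ps F).coeff 0 = F 0 := by simp [ps]

lemma ps_deriv (F : ℂ → ℂ) (n : ℕ) : (ps (deriv F)).coeff n = (n + 1) * (ps F).coeff (n + 1) := by
  simp only [ps, PowerSeries.coeff_mk, iteratedDeriv_succ', Nat.factorial_succ]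
  have : (n.factorial : ℂ) ≠ 0 := by exact_mod_cast n.factorial_ne_zero
  have h2 : ((n : ℂ) + 1) ≠ 0 := by exact_mod_cast n.succ_ne_zero
  push_cast
  field_simp

lemma Hol.deriv {F : ℂ → ℂ} (hF : Hol F) : Hol (deriv F) :=
  DifferentiableOn.deriv hF Metric.isOpen_ball

lemma Hol.mul {F G : ℂ → ℂ} (hF : Hol F) (hG : Hol G) : Hol (fun q => F q * G q) :=
  DifferentiableOn.mul hF hG

lemma Hol.add {F G : ℂ → ℂ} (hF : Hol F) (hG : Hol G) : Hol (fun q => F q + G q) :=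
  DifferentiableOn.add hF hG

lemma Hol.const (a : ℂ) : Hol (fun _ => a) := differentiableOn_const a

lemma Hol.id : Hol (fun q => q) := differentiableOn_id

lemma Hol.pow {F : ℂ → ℂ} (hF : Hol F) (n : ℕ) : Hol (fun q => F q ^ n) := DifferentiableOn.pow hF n

lemma Hol.inv {F : ℂ → ℂ} (hF : Hol F) (h : ∀ q, ‖q‖ < 1 → F q ≠ 0) : Hol (fun q => (F q)⁻¹) :=
  DifferentiableOn.inv hF fun q hq => h q (by simpa using hq)

lemma Hol.sum {ι : Type*} {s : Finset ι} {F : ι → ℂ → ℂ} (hF : ∀ i ∈ s, Hol (F i)) :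
    Hol (fun q => ∑ i ∈ s, F i q) := DifferentiableOn.fun_sum hF

lemma ps_sum {ι : Type*} {s : Finset ι} {F : ι → ℂ → ℂ} (hF : ∀ i ∈ s, Hol (F i)) :
    ps (fun q => ∑ i ∈ s, F i q) = ∑ i ∈ s, ps (F i) := by
  induction s using cons_induction with
  | empty => simpa using ps_const 0
  | cons a s ha ih =>
    simp only [sum_cons]
    rw [ps_add (hF a (by simp)) (Hol.sum fun i hi => hF i (by simp [hi])), ih fun i hi => hF i (by simp [hi])]

lemma ps_smul {F : ℂ → ℂ} (hF : Hol F) (a : ℂ) : ps (fun q => a * F q) = PowerSeries.C a * ps F := by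
  rw [ps_mul (Hol.const a) hF, ps_const]

lemma norm_ee {τ : ℂ} (h : 0 < τ.im) : ‖ee τ‖ < 1 := by
  rw [ee, Complex.norm_exp]
  simp
  positivity

lemma ee_add (a b : ℂ) : ee (a + b) = ee a * ee b := by simp [ee, mul_add, Complex.exp_add]

lemma ee_ne (a : ℂ) : ee a ≠ 0 := Complex.exp_ne_zero _

lemma ee_zero : ee 0 = 1 := by simp [ee]

lemma ee_int (n : ℤ) : ee n = 1 := by
  rw [ee, Complex.exp_eq_one_iff]; exact ⟨n, by ring⟩

lemma ee_neg (a : ℂ) : ee (-a) = (ee a)⁻¹ := by simp [ee, Complex.exp_neg]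

lemma ee_natmul (n : ℕ) (a : ℂ) : ee (n * a) = ee a ^ n := by
  rw [ee, ee, ← Complex.exp_nat_mul]; congr 1; ring

lemma ee_hasDeriv (τ : ℂ) : HasDerivAt ee (2 * Real.pi * I * ee τ) τ := by
  have : HasDerivAt (fun x : ℂ => 2 * (Real.pi : ℂ) * I * x) (2 * Real.pi * I) τ := by
    simpa using (hasDerivAt_id τ).const_mul (2 * (Real.pi : ℂ) * I)
  have h2 : HasDerivAt ee _ τ := this.cexp
  convert h2 using 1
  simp only [ee]; ring

lemma ee_surj {q : ℂ} (h : ‖q‖ < 1) (h0 : q ≠ 0) : ∃ τ : ℂ, 0 < τ.im ∧ ee τ = q := by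
  refine ⟨Function.Periodic.invQParam 1 q,
    Function.Periodic.im_invQParam_pos_of_norm_lt_one one_pos h h0, ?_⟩
  have := Function.Periodic.qParam_right_inv (h := 1) one_ne_zero h0
  simpa [ee, Function.Periodic.qParam] using this

lemma im_S {τ : ℂ} (h : 0 < τ.im) : 0 < (-1 / τ).im := by
  have : τ ≠ 0 := by rintro rfl; simp at h
  rw [neg_div, one_div, neg_im, inv_im]
  have := Complex.normSq_pos.mpr this
  have : 0 < τ.im / normSq τ := by positivity
  rw [neg_div, neg_neg]; exact this

lemma ne0_of_im {τ : ℂ} (h : 0 < τ.im) : τ ≠ 0 := by rintro rfl; simp at h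

lemma hol_eq {F G : ℂ → ℂ} (hF : Hol F) (hG : Hol G)
    (h : ∀ τ : ℂ, 0 < τ.im → F (ee τ) = G (ee τ)) {q : ℂ} (hq : ‖q‖ < 1) : F q = G q := by
  by_cases h0 : q = 0
  · subst h0
    have hF0 : Tendsto F (𝓝[≠] 0) (𝓝 (F 0)) := hF.an.continuousAt.continuousWithinAt
    have hG0 : Tendsto G (𝓝[≠] 0) (𝓝 (G 0)) := hG.an.continuousAt.continuousWithinAt
    refine tendsto_nhds_unique_of_eventuallyEq hF0 hG0 ?_
    filter_upwards [self_mem_nhdsWithin, nhdsWithin_le_nhds ball_nhds0] with q hq0 hq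
    obtain ⟨τ, h1, rfl⟩ := ee_surj (by simpa using hq) hq0
    exact h τ h1
  · obtain ⟨τ, h1, rfl⟩ := ee_surj hq h0
    exact h τ h1

def MF (k : ℤ) (F : ℂ → ℂ) : Prop :=
  Hol F ∧ ∀ τ : ℂ, 0 < τ.im → F (ee (-1 / τ)) = τ ^ k * F (ee τ)
section
open UpperHalfPlane ModularForm ModularFormClass MatrixGroups

lemma qParam_eq (τ : ℂ) : Function.Periodic.qParam 1 τ = ee τ := by
  simp [Function.Periodic.qParam, ee]

lemma MF.toForm {k : ℤ} {F : ℂ → ℂ} (h : MF k F) :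
    ∃ f : ModularForm 𝒮ℒ k, (∀ τ : ℍ, f τ = F (ee τ)) ∧ qExpansion 1 f = ps F := by
  have hsum : ∀ τ : ℍ, HasSum (fun m ↦ (ps F).coeff m • Function.Periodic.qParam 1 τ ^ m)
      (F (ee τ)) := by
    intro τ
    simpa [qParam_eq] using hol_hasSum h.1 (norm_ee τ.im_pos)
  have hb := isBoundedAtImInfty_of_hasSum_qExpansion (f := fun τ : ℍ => F (ee τ)) one_pos hsum
  have hS : (fun τ : ℍ => F (ee τ)) ∣[k] ModularGroup.S = fun τ : ℍ => F (ee τ) := by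
    ext z
    rw [SlashInvariantForm.slash_S_apply]
    have := h.2 z z.im_pos
    have hz : (z : ℂ) ≠ 0 := ne0_of_im z.im_pos
    have e : (-1 / (z : ℂ)) = (-(z : ℂ))⁻¹ := by rw [neg_div, one_div, inv_neg]
    rw [e] at this
    rw [this, zpow_neg]
    field_simp
  have hT : (fun τ : ℍ => F (ee τ)) ∣[k] ModularGroup.T = fun τ : ℍ => F (ee τ) := by
    ext z
    rw [SL_slash_apply, modular_T_smul]
    have hd : denom (ModularGroup.T : SL(2, ℤ)) z = 1 := by
      rw [ModularGroup.denom_apply]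
      simp [ModularGroup.T]
    rw [hd]
    simp [ee_add, show ee 1 = 1 by simpa using ee_int 1]
  have hall := SlashInvariantForm.slash_action_generators_SL2Z hS hT
  let f : ModularForm 𝒮ℒ k :=
    { toFun := fun τ : ℍ => F (ee τ)
      slash_action_eq' := by
        rintro _ ⟨A, rfl⟩
        exact hall A
      holo' := by
        rw [UpperHalfPlane.mdifferentiable_iff]
        have : DifferentiableOn ℂ (fun τ => F (ee τ)) {z | 0 < z.im} := by
          refine DifferentiableOn.comp h.1
            (fun τ _ => (ee_hasDeriv τ).differentiableAt.differentiableWithinAt) ?_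
          intro τ hτ
          simpa using norm_ee hτ
        refine this.congr fun z hz ↦ ?_
        simp [ofComplex_apply_of_im_pos hz]
      bdd_at_cusps' := by
        intro c hc
        rw [Subgroup.IsArithmetic.isCusp_iff_isCusp_SL2Z] at hc
        rw [OnePoint.isBoundedAt_iff_forall_SL2Z hc]
        intro γ _
        rw [hall]
        exact hb }
  refine ⟨f, fun τ => rfl, ?_⟩
  ext n
  exact (ModularFormClass.qExpansion_coeff_unique (k := k) (f := f) one_pos
    one_mem_strictPeriods_SL hsum n).symm

lemma exists_MF {k : ℤ} (f : ModularForm 𝒮ℒ k) :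
    ∃ F, MF k F ∧ (∀ τ : ℍ, f τ = F (ee τ)) ∧ qExpansion 1 f = ps F := by
  have h0 : ∀ τ : ℍ, cuspFunction 1 f (ee τ) = f τ := fun τ => by
    rw [← qParam_eq]
    exact SlashInvariantFormClass.eq_cuspFunction f τ one_mem_strictPeriods_SL one_ne_zero
  refine ⟨cuspFunction 1 f, ⟨?_, ?_⟩, fun τ => (h0 τ).symm, rfl⟩
  · intro q hq
    exact (ModularFormClass.differentiableAt_cuspFunction f one_pos one_mem_strictPeriods_SL
      (by simpa using hq)).differentiableWithinAt
  · intro τ hτ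
    have h1 : (⇑f) ∣[k] (ModularGroup.S) = ⇑f :=
      SlashInvariantFormClass.slash_action_eq f _ ⟨ModularGroup.S, rfl⟩
    have h2 := congrFun h1 ⟨τ, hτ⟩
    rw [SlashInvariantForm.slash_S_apply] at h2
    have e : (-1 / τ) = (-τ)⁻¹ := by rw [neg_div, one_div, inv_neg]
    have h3 := h0 ⟨τ, hτ⟩
    have h4 := h0 (.mk _ (UpperHalfPlane.im_inv_neg_coe_pos ⟨τ, hτ⟩))
    simp only [UpperHalfPlane.coe_mk] at h2 h3 h4
    rw [e, h3, h4, ← h2, zpow_neg]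
    have hz := ne0_of_im hτ
    field_simp
end

lemma HasSum.congr_fun' {ι : Type*} {f g : ι → ℂ} {a : ℂ} (h : HasSum f a) (e : ∀ i, g i = f i) :
    HasSum g a := (funext e : g = f) ▸ h

def DExp (c : ℕ → ℤ → ℂ) (Φ : ℂℂ) : Prop := ∀ q z : ℂ, ‖q‖ < 1 →
  HasSum (fun p : ℕ × ℤ => c p.1 p.2 * (q ^ p.1 * ee (p.2 * z))) (Φ q z)

def WX (S : Subring ℂ) (Φ : ℂℂ) : Prop := ∃ c : ℕ → ℤ → ℂ, (∀ n r, c n r ∈ S) ∧ DExp c Φ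
section
variable {S : Subring ℂ}

lemma WX.congr {Φ Ψ : ℂℂ} (h : WX S Φ) (e : ∀ q z, ‖q‖ < 1 → Ψ q z = Φ q z) : WX S Ψ := by
  obtain ⟨c, h1, h2⟩ := h
  exact ⟨c, h1, fun q z hq => by rw [e q z hq]; exact h2 q z hq⟩

lemma WX.add {Φ Ψ : ℂℂ} (h : WX S Φ) (h' : WX S Ψ) : WX S (fun q z => Φ q z + Ψ q z) := by
  obtain ⟨c, h1, h2⟩ := h
  obtain ⟨d, h3, h4⟩ := h'
  refine ⟨fun n r => c n r + d n r, fun n r => S.add_mem (h1 n r) (h3 n r), fun q z hq => ?_⟩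
  simpa [add_mul] using (h2 q z hq).add (h4 q z hq)

lemma WX.mul (hS : IsClosed (S : Set ℂ)) {Φ Ψ : ℂℂ} (h : WX S Φ) (h' : WX S Ψ) :
    WX S (fun q z => Φ q z * Ψ q z) := by
  obtain ⟨c, h1, h2⟩ := h
  obtain ⟨d, h3, h4⟩ := h'
  let g : (ℕ × ℤ) × (ℕ × ℤ) → ℕ × ℤ := fun x => x.1 + x.2
  refine ⟨fun n r => ∑' b : g ⁻¹' {(n, r)}, c b.1.1.1 b.1.1.2 * d b.1.2.1 b.1.2.2,
    fun n r => ?_, fun q z hq => ?_⟩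
  · exact tsum_mem hS fun b => S.mul_mem (h1 _ _) (h3 _ _)
  · have a2 := h2 q z hq
    have a4 := h4 q z hq
    have a5 := summable_mul_of_summable_norm a2.summable.norm a4.summable.norm
    have A := HasSum.mul a2 a4 a5
    have B := A.tsum_fiberwise g
    refine B.congr_fun' ?_
    rintro ⟨n, r⟩
    simp only
    rw [← tsum_mul_right]
    refine tsum_congr fun b => ?_
    obtain ⟨⟨⟨i, s⟩, ⟨j, t⟩⟩, hb⟩ := b
    simp only [g, Set.mem_preimage, Set.mem_singleton_iff, Prod.mk_add_mk, Prod.mk.injEq] at hb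
    obtain ⟨rfl, rfl⟩ := hb
    simp only
    push_cast
    rw [add_mul, ee_add, pow_add]
    ring

lemma WX.disc {F : ℂ → ℂ} (hF : Hol F) (h : ∀ n, (ps F).coeff n ∈ S) : WX S (fun q _ => F q) := by
  refine ⟨fun n r => if r = 0 then (ps F).coeff n else 0, fun n r => ?_, fun q z hq => ?_⟩
  · simp only; split_ifs
    · exact h n
    · exact S.zero_mem
  · have := hol_hasSum hF hq
    let i : ℕ → ℕ × ℤ := fun n => (n, 0)
    have hi : Function.Injective i := fun a b h => by simpa [i] using h
    rw [← hi.hasSum_iff]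
    · convert this using 2 with n
      simp [i, ee_zero]
    · rintro ⟨n, r⟩ hx
      have : r ≠ 0 := by rintro rfl; exact hx ⟨n, rfl⟩
      simp [this]

lemma WX.const (a : ℂ) (ha : a ∈ S) : WX S (fun _ _ => a) :=
  WX.disc (Hol.const a) fun n => by
    rw [ps_const, PowerSeries.coeff_C]; split_ifs
    · exact ha
    · exact S.zero_mem

lemma WX.pow (hS : IsClosed (S : Set ℂ)) {Φ : ℂℂ} (h : WX S Φ) (n : ℕ) :
    WX S (fun q z => Φ q z ^ n) := by
  induction n with
  | zero => simpa using WX.const 1 S.one_mem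
  | succ n ih => simpa [pow_succ] using ih.mul hS h

lemma WX.id : WX S (fun q _ => q) := WX.disc Hol.id fun n => by
  rw [ps_id, PowerSeries.coeff_X]; split_ifs
  · exact S.one_mem
  · exact S.zero_mem

def Xf (q z : ℂ) : ℂ := ∑' k : ℤ, q ^ ((k ^ 2).toNat) * ee ((2 * k : ℤ) * z)

def Yf (q z : ℂ) : ℂ := ∑' k : ℤ, q ^ ((k ^ 2 + k).toNat) * ee ((2 * k + 1 : ℤ) * z)

lemma kk_nonneg (k : ℤ) : 0 ≤ k ^ 2 + k := by nlinarith [sq_nonneg (2 * k + 1)]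

lemma ee_pow_toNat (τ : ℂ) {k : ℤ} (hk : 0 ≤ k) : ee τ ^ k.toNat = ee (k * τ) := by
  rw [← ee_natmul]
  congr 2
  exact_mod_cast Int.toNat_of_nonneg hk

lemma Xterm (τ z : ℂ) (k : ℤ) : jacobiTheta₂_term k (2 * z) (2 * τ) =
    ee τ ^ ((k ^ 2).toNat) * ee ((2 * k : ℤ) * z) := by
  rw [ee_pow_toNat _ (sq_nonneg k), ← ee_add, jacobiTheta₂_term, ee]
  congr 1; push_cast; ring

lemma Yterm (τ z : ℂ) (k : ℤ) : ee z * jacobiTheta₂_term k (2 * z + τ) (2 * τ) =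
    ee τ ^ ((k ^ 2 + k).toNat) * ee ((2 * k + 1 : ℤ) * z) := by
  rw [ee_pow_toNat _ (kk_nonneg k), ← ee_add, jacobiTheta₂_term, ee, ee, ← Complex.exp_add]
  congr 1; push_cast; ring

lemma two_im {τ : ℂ} (h : 0 < τ.im) : 0 < (2 * τ).im := by simpa using h

lemma Xf_hasSum_H {τ : ℂ} (h : 0 < τ.im) (z : ℂ) :
    HasSum (fun k : ℤ => ee τ ^ ((k ^ 2).toNat) * ee ((2 * k : ℤ) * z))
      (jacobiTheta₂ (2 * z) (2 * τ)) := by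
  simpa only [Xterm] using hasSum_jacobiTheta₂_term (2 * z) (two_im h)

lemma Yf_hasSum_H {τ : ℂ} (h : 0 < τ.im) (z : ℂ) :
    HasSum (fun k : ℤ => ee τ ^ ((k ^ 2 + k).toNat) * ee ((2 * k + 1 : ℤ) * z))
      (ee z * jacobiTheta₂ (2 * z + τ) (2 * τ)) := by
  simpa only [Yterm] using (hasSum_jacobiTheta₂_term (2 * z + τ) (two_im h)).mul_left (ee z)

lemma Xf_eq {τ : ℂ} (h : 0 < τ.im) (z : ℂ) : Xf (ee τ) z = jacobiTheta₂ (2 * z) (2 * τ) :=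
  (Xf_hasSum_H h z).tsum_eq

lemma Yf_eq {τ : ℂ} (h : 0 < τ.im) (z : ℂ) :
    Yf (ee τ) z = ee z * jacobiTheta₂ (2 * z + τ) (2 * τ) := (Yf_hasSum_H h z).tsum_eq

lemma kk_zero {k : ℤ} (h : k ^ 2 + k ≤ 0) : k = 0 ∨ k = -1 := by
  have h1 := kk_nonneg k
  have h2 : k * (k + 1) = 0 := by linarith [h, h1, sq k]
  rcases mul_eq_zero.1 h2 with h | h
  · left; exact h
  · right; linarith

lemma Xf_hasSum {q : ℂ} (hq : ‖q‖ < 1) (z : ℂ) :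
    HasSum (fun k : ℤ => q ^ ((k ^ 2).toNat) * ee ((2 * k : ℤ) * z)) (Xf q z) := by
  by_cases h0 : q = 0
  · refine Summable.hasSum (summable_of_ne_finset_zero (s := {0}) fun k hk => ?_)
    have : (k ^ 2).toNat ≠ 0 := by
      have : 0 < k ^ 2 := by have : k ≠ 0 := by simpa using hk
                             positivity
      omega
    simp [h0, this]
  · obtain ⟨τ, h, rfl⟩ := ee_surj hq h0
    rw [Xf_eq h]; exact Xf_hasSum_H h z

lemma Yf_hasSum {q : ℂ} (hq : ‖q‖ < 1) (z : ℂ) :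
    HasSum (fun k : ℤ => q ^ ((k ^ 2 + k).toNat) * ee ((2 * k + 1 : ℤ) * z)) (Yf q z) := by
  by_cases h0 : q = 0
  · refine Summable.hasSum (summable_of_ne_finset_zero (s := {0, -1}) fun k hk => ?_)
    have : (k ^ 2 + k).toNat ≠ 0 := by
      intro h
      have := kk_zero (k := k) (by omega)
      simp at hk; tauto
    simp [h0, this]
  · obtain ⟨τ, h, rfl⟩ := ee_surj hq h0
    rw [Yf_eq h]; exact Yf_hasSum_H h z

lemma Xf_zero (z : ℂ) : Xf 0 z = 1 := by
  rw [Xf, tsum_eq_single 0]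
  · simp [ee_zero]
  · intro k hk
    have : (k ^ 2).toNat ≠ 0 := by
      have : 0 < k ^ 2 := by positivity
      omega
    simp [this]

lemma Yf_zero (z : ℂ) : Yf 0 z = ee z + ee (-z) := by
  rw [Yf, tsum_eq_sum (s := {0, -1})]
  · rw [sum_pair (by norm_num)]
    norm_num
  · intro k hk
    have : (k ^ 2 + k).toNat ≠ 0 := by
      intro h
      have := kk_zero (k := k) (by omega)
      simp at hk; tauto
    simp [this]

lemma WX_of_sum {e : ℤ → ℕ} {l : ℤ → ℤ} (hl : Function.Injective l) {Φ : ℂℂ}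
    (h : ∀ q z, ‖q‖ < 1 → HasSum (fun k : ℤ => q ^ e k * ee (l k * z)) (Φ q z)) : WX S Φ := by
  let i : ℤ → ℕ × ℤ := fun k => (e k, l k)
  have hi : Function.Injective i := fun a b h => hl (congrArg Prod.snd h)
  refine ⟨fun n r => if (n, r) ∈ Set.range i then 1 else 0, fun n r => ?_, fun q z hq => ?_⟩
  · simp only; split_ifs
    · exact S.one_mem
    · exact S.zero_mem
  · rw [← hi.hasSum_iff]
    · convert h q z hq using 2 with k
      have : (e k, l k) ∈ Set.range i := ⟨k, rfl⟩
      simp only [Function.comp, i]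
      rw [if_pos this, one_mul]
    · rintro ⟨n, r⟩ hx
      simp only
      rw [if_neg hx, zero_mul]

lemma WX_X : WX S Xf := WX_of_sum (fun a b h => by simpa using h) fun _ z hq => Xf_hasSum hq z

lemma WX_Y : WX S Yf := WX_of_sum (fun a b h => by simpa using h) fun _ z hq => Yf_hasSum hq z
end

lemma hasSum_int_even_odd {f : ℤ → ℂ} {a b : ℂ} (he : HasSum (fun k : ℤ => f (2 * k)) a)
    (ho : HasSum (fun k : ℤ => f (2 * k + 1)) b) : HasSum f (a + b) := by
  have h2 : Function.Injective (fun k : ℤ => 2 * k) := fun a b h => by simpa using h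
  have h3 : Function.Injective (fun k : ℤ => 2 * k + 1) := fun a b h => by simpa using h
  have h4 := h2.hasSum_range_iff.2 he
  have h5 := h3.hasSum_range_iff.2 ho
  refine h4.add_isCompl ?_ h5
  have e1 : Set.range (fun k : ℤ => 2 * k) = {n | Even n} := by
    ext k; simp only [Set.mem_range, Set.mem_ofPred_eq, even_iff_exists_two_mul]
    exact exists_congr fun _ => eq_comm
  have e2 : Set.range (fun k : ℤ => 2 * k + 1) = {n | Odd n} := by
    ext k; simp only [Set.mem_range, Set.mem_ofPred_eq, Odd]
    exact exists_congr fun _ => eq_comm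
  rw [e1, e2]; exact Int.isCompl_even_odd

lemma theta_half {τ : ℂ} (h : 0 < τ.im) (z : ℂ) :
    jacobiTheta₂ z (τ / 2) = Xf (ee τ) z + ee (τ / 4) * Yf (ee τ) z := by
  have h' : 0 < (τ / 2).im := by
    have : (τ / 2).im = τ.im / 2 := by simp
    rw [this]; linarith
  refine (hasSum_jacobiTheta₂_term z h').unique (hasSum_int_even_odd ?_ ?_)
  · refine (Xf_hasSum (norm_ee h) z).congr_fun' fun k => ?_
    rw [← Xterm]
    simp only [jacobiTheta₂_term]; congr 1; push_cast; ring
  · refine ((Yf_hasSum (norm_ee h) z).mul_left (ee (τ / 4))).congr_fun' fun k => ?_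
    rw [← Yterm]
    simp only [jacobiTheta₂_term, ee, ← Complex.exp_add]; congr 1; push_cast; ring

lemma Xf_half (q z : ℂ) : Xf q (z + 1 / 2) = Xf q z := by
  refine tsum_congr fun k => ?_
  rw [show ((2 * k : ℤ) : ℂ) * (z + 1 / 2) = (2 * k : ℤ) * z + (k : ℤ) by push_cast; ring, ee_add, ee_int, mul_one]

lemma ee_half : ee (1 / 2) = -1 := by
  rw [ee, show 2 * (Real.pi : ℂ) * I * (1 / 2) = Real.pi * I by ring, Complex.exp_pi_mul_I]

lemma Yf_half (q z : ℂ) : Yf q (z + 1 / 2) = - Yf q z := by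
  rw [Yf, Yf, ← tsum_neg]
  refine tsum_congr fun k => ?_
  rw [show ((2 * k + 1 : ℤ) : ℂ) * (z + 1 / 2) = (2 * k + 1 : ℤ) * z + ((k : ℤ) + 1 / 2) by push_cast; ring, ee_add,
    ee_add, ee_int, ee_half]
  ring

lemma theta_S {τ : ℂ} (h : 0 < τ.im) : ∃ s : ℂ, s ^ 2 = -I * τ / 2 ∧ ∀ z : ℂ,
    Xf (ee (-1 / τ)) (z / τ) = s * ee (z ^ 2 / τ) * (Xf (ee τ) z + ee (τ / 4) * Yf (ee τ) z) ∧
    ee (-1 / τ / 4) * Yf (ee (-1 / τ)) (z / τ) =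
      s * ee (z ^ 2 / τ) * (Xf (ee τ) z - ee (τ / 4) * Yf (ee τ) z) := by
  have ht := ne0_of_im h
  have key : ∀ z : ℂ, jacobiTheta₂ (2 * z / τ) (2 * (-1 / τ)) =
      (-I * (τ / 2)) ^ (1 / 2 : ℂ) * ee (z ^ 2 / τ) * (Xf (ee τ) z + ee (τ / 4) * Yf (ee τ) z) := by
    intro z
    have := jacobiTheta₂_functional_equation z (τ / 2)
    rw [theta_half h] at this
    have hs : (-I * (τ / 2)) ^ (1 / 2 : ℂ) ≠ 0 := by
      rw [Ne, Complex.cpow_eq_zero_iff]; simp [ht]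
    rw [this, show z / (τ / 2) = 2 * z / τ by field_simp, show -1 / (τ / 2) = 2 * (-1 / τ) by field_simp]
    have : cexp (-Real.pi * I * z ^ 2 / (τ / 2)) = (ee (z ^ 2 / τ))⁻¹ := by
      rw [← ee_neg, ee]; congr 1; field_simp
    rw [this]
    have := ee_ne (z ^ 2 / τ)
    field_simp
  refine ⟨(-I * (τ / 2)) ^ (1 / 2 : ℂ), ?_, fun z => ⟨?_, ?_⟩⟩
  · rw [← Complex.cpow_nat_mul]; norm_num; ring
  · rw [Xf_eq (im_S h), show 2 * (z / τ) = 2 * z / τ by ring, key]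
  · rw [Yf_eq (im_S h), show 2 * (z / τ) + -1 / τ = 2 * (z - 1 / 2) / τ by field_simp; ring, key]
    have e1 := Xf_half (ee τ) (z - 1 / 2)
    have e2 := Yf_half (ee τ) (z - 1 / 2)
    rw [sub_add_cancel] at e1 e2
    rw [e1, e2]
    have : ee (-1 / τ / 4) * (ee (z / τ) * ee ((z - 1 / 2) ^ 2 / τ)) = ee (z ^ 2 / τ) := by
      rw [← ee_add, ← ee_add]; congr 1; field_simp; ring
    rw [← this]; ring
section
variable {S : Subring ℂ}

lemma WX.holS (hS : IsClosed (S : Set ℂ)) {Φ : ℂℂ} (h : WX S Φ) (z : ℂ) :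
    Hol (fun q => Φ q z) ∧ (z = 0 → ∀ n, (ps (fun q => Φ q z)).coeff n ∈ S) := by
  obtain ⟨c, h1, h2⟩ := h
  have key : ∀ q : ℂ, ‖q‖ < 1 → HasSum (fun n : ℕ => (∑' r, c n r * ee (r * z)) * q ^ n) (Φ q z) := by
    intro q hq
    have A := h2 q z hq
    have B := A.prod_fiberwise (fun n => ((A.summable.prod_factor n).hasSum))
    refine B.congr_fun' fun n => ?_
    rw [← tsum_mul_right]
    exact tsum_congr fun r => by ring
  obtain ⟨a, b⟩ := hol_tsum _ fun q hq => (key q hq).summable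
  have e : ∀ q, ‖q‖ < 1 → Φ q z = ∑' n, (∑' r, c n r * ee (r * z)) * q ^ n :=
    fun q hq => (key q hq).tsum_eq.symm
  refine ⟨a.congr' e, ?_⟩
  rintro rfl n
  rw [ps_congr e, b, PowerSeries.coeff_mk]
  refine tsum_mem hS fun r => ?_
  simpa [ee_zero] using h1 n r

lemma bv_hasSum {q : ℂ} (hq : ‖q‖ < 1) :
    HasSum (fun n : ℕ => q ^ (n ^ 2 + n)) (Yf q 0 / 2) := by
  have h := Yf_hasSum hq 0
  have h2 := h.nat_add_neg_add_one
  have := h2.div_const 2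
  refine this.congr_fun' fun n => ?_
  have e1 : (((n : ℤ)) ^ 2 + n).toNat = n ^ 2 + n := by
    have : ((n : ℤ)) ^ 2 + n = ((n ^ 2 + n : ℕ) : ℤ) := by push_cast; ring
    rw [this]; exact Int.toNat_natCast _
  have e2 : ((-((n : ℤ) + 1)) ^ 2 + -((n : ℤ) + 1)).toNat = n ^ 2 + n := by
    have : (-((n : ℤ) + 1)) ^ 2 + -((n : ℤ) + 1) = ((n ^ 2 + n : ℕ) : ℤ) := by push_cast; ring
    rw [this]; exact Int.toNat_natCast _
  simp only [mul_zero, ee_zero, mul_one, e1, e2]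
  ring
end

def av (q : ℂ) : ℂ := Xf q 0

def bv (q : ℂ) : ℂ := Yf q 0 / 2

def Wv (q : ℂ) : ℂ := av q * bv q * (av q ^ 4 - 16 * q * bv q ^ 4)

def Uv (q : ℂ) : ℂ := Wv q ^ 4

def e4 (q : ℂ) : ℂ := av q ^ 8 + 224 * q * av q ^ 4 * bv q ^ 4 + 256 * q ^ 2 * bv q ^ 8

def e6 (q : ℂ) : ℂ := av q ^ 12 - 528 * q * av q ^ 8 * bv q ^ 4 - 8448 * q ^ 2 * av q ^ 4 * bv q ^ 8
  + 4096 * q ^ 3 * bv q ^ 12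
section
variable {S : Subring ℂ}

lemma WX_av (hS : IsClosed (S : Set ℂ)) : WX S (fun q _ => av q) :=
  WX.disc (WX.holS hS (WX_X (S := S)) 0).1 ((WX.holS hS (WX_X (S := S)) 0).2 rfl)

lemma WX_bv : WX S (fun q _ => bv q) := by
  have : WX S (fun q _ => bv q) := by
    let i : ℕ → ℕ × ℤ := fun k => (k ^ 2 + k, 0)
    have hi : Function.Injective i := fun a b h => by
      have h1 : a ^ 2 + a = b ^ 2 + b := congrArg Prod.fst h
      rcases lt_trichotomy a b with h2 | h2 | h2
      · nlinarith
      · exact h2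
      · nlinarith
    refine ⟨fun n r => if (n, r) ∈ Set.range i then 1 else 0, fun n r => ?_, fun q z hq => ?_⟩
    · simp only; split_ifs
      · exact S.one_mem
      · exact S.zero_mem
    · rw [← hi.hasSum_iff]
      · refine (bv_hasSum hq).congr_fun' fun k => ?_
        have : (k ^ 2 + k, (0 : ℤ)) ∈ Set.range i := ⟨k, rfl⟩
        simp only [Function.comp, i]
        rw [if_pos this, one_mul]
        simp [ee_zero]
      · rintro ⟨n, r⟩ hx
        simp only
        rw [if_neg hx, zero_mul]
  exact this

lemma WX_int (n : ℤ) : WX S (fun _ _ => (n : ℂ)) := WX.const _ (intCast_mem S n)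
end

def Aff (q z : ℂ) : ℂ := (av q * Yf q z - 2 * bv q * Xf q z) * (Wv q)⁻¹

def Bff (q z : ℂ) : ℂ := ((10 * av q ^ 4 * bv q - 32 * q * bv q ^ 5) * Xf q z +
  (av q ^ 5 - 80 * q * av q * bv q ^ 4) * Yf q z) * (Wv q)⁻¹

def Eff (q z : ℂ) : ℂ := (av q ^ 7 + 112 * q * av q ^ 3 * bv q ^ 4) * Xf q z +
  (56 * q * av q ^ 4 * bv q ^ 3 + 128 * q ^ 2 * bv q ^ 7) * Yf q z

def SLaw (k : ℤ) (m : ℕ) (Φ : ℂℂ) : Prop := ∀ τ z : ℂ, 0 < τ.im →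
  Φ (ee (-1 / τ)) (z / τ) = τ ^ k * ee (m * (z ^ 2 / τ)) * Φ (ee τ) z

lemma ee_quarter (τ : ℂ) : ee (τ / 4) ^ 4 = ee τ := by
  rw [← ee_natmul]; congr 1; push_cast; ring

lemma theta_pack {τ : ℂ} (h : 0 < τ.im) : ∃ s ρ ρ' : ℂ, s ^ 4 = -τ ^ 2 / 4 ∧ ρ ≠ 0 ∧ ρ' ≠ 0 ∧
    ρ ^ 4 = ee τ ∧ ρ' ^ 4 = ee (-1 / τ) ∧
    av (ee (-1 / τ)) = s * (av (ee τ) + 2 * ρ * bv (ee τ)) ∧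
    2 * ρ' * bv (ee (-1 / τ)) = s * (av (ee τ) - 2 * ρ * bv (ee τ)) ∧ ∀ z,
    Xf (ee (-1 / τ)) (z / τ) = s * ee (z ^ 2 / τ) * (Xf (ee τ) z + ρ * Yf (ee τ) z) ∧
    ρ' * Yf (ee (-1 / τ)) (z / τ) = s * ee (z ^ 2 / τ) * (Xf (ee τ) z - ρ * Yf (ee τ) z) := by
  obtain ⟨s, h1, h2⟩ := theta_S h
  refine ⟨s, ee (τ / 4), ee (-1 / τ / 4), ?_, ee_ne _, ee_ne _, ee_quarter _, ee_quarter _, ?_, ?_, h2⟩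
  · linear_combination (s ^ 2 - I * τ / 2) * h1 + τ ^ 2 / 4 * I_sq
  · have := (h2 0).1
    simp only [zero_div, ne_eq, OfNat.ofNat_ne_zero, not_false_eq_true, zero_pow, ee_zero] at this
    rw [av, this, av, bv]; ring
  · have := (h2 0).2
    simp only [zero_div, ne_eq, OfNat.ofNat_ne_zero, not_false_eq_true, zero_pow, ee_zero] at this
    rw [bv, av, bv]; linear_combination this

lemma hol_av : Hol av := (WX.holS (S := ⊤) isClosed_univ WX_X 0).1

lemma hol_bv : Hol bv := by
  have := (WX.holS (S := ⊤) isClosed_univ WX_Y 0).1.mul (Hol.const (2⁻¹))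
  exact this.congr' fun q _ => by rw [bv]; ring

lemma hol_Wv : Hol Wv := by
  unfold Wv Hol; have := hol_av; have := hol_bv; unfold Hol at *; fun_prop

lemma hol_Uv : Hol Uv := hol_Wv.pow 4

lemma MF_e4 : MF 4 e4 := by
  refine ⟨?_, fun τ h => ?_⟩
  · unfold e4 Hol; have := hol_av; have := hol_bv; unfold Hol at *; fun_prop
  · obtain ⟨s, ρ, ρ', hs, _, _, h1, h2, ha, hb, -⟩ := theta_pack h
    have g : ∀ ρ q : ℂ, ρ ^ 4 = q → e4 q = av q ^ 8 + 14 * av q ^ 4 * (2 * ρ * bv q) ^ 4 + (2 * ρ * bv q) ^ 8 := by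
      rintro ρ q rfl; unfold e4; ring
    rw [g _ _ h1, g _ _ h2, hb, ha]
    generalize av (ee τ) = a
    generalize 2 * ρ * bv (ee τ) = b
    have s8 : s ^ 8 = τ ^ 4 / 16 := by linear_combination (s ^ 4 - τ ^ 2 / 4) * hs
    rw [zpow_ofNat]
    linear_combination 16 * (a ^ 8 + 14 * a ^ 4 * b ^ 4 + b ^ 8) * s8

lemma MF_e6 : MF 6 e6 := by
  refine ⟨?_, fun τ h => ?_⟩
  · unfold e6 Hol; have := hol_av; have := hol_bv; unfold Hol at *; fun_prop
  · obtain ⟨s, ρ, ρ', hs, _, _, h1, h2, ha, hb, -⟩ := theta_pack h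
    have g : ∀ ρ q : ℂ, ρ ^ 4 = q → e6 q = av q ^ 12 - 33 * av q ^ 8 * (2 * ρ * bv q) ^ 4
        - 33 * av q ^ 4 * (2 * ρ * bv q) ^ 8 + (2 * ρ * bv q) ^ 12 := by
      rintro ρ q rfl; unfold e6; ring
    rw [g _ _ h1, g _ _ h2, hb, ha]
    generalize av (ee τ) = a
    generalize 2 * ρ * bv (ee τ) = b
    have s12 : s ^ 12 = -τ ^ 6 / 64 := by
      linear_combination (s ^ 8 - s ^ 4 * τ ^ 2 / 4 + τ ^ 4 / 16) * hs
    rw [zpow_ofNat]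
    linear_combination -64 * (a ^ 12 - 33 * a ^ 8 * b ^ 4 - 33 * a ^ 4 * b ^ 8 + b ^ 12) * s12

lemma Wv_eq (ρ q : ℂ) (h : ρ ^ 4 = q) : 2 * ρ * Wv q =
    av q * (2 * ρ * bv q) * (av q ^ 4 - (2 * ρ * bv q) ^ 4) := by
  subst h; unfold Wv; ring

lemma Wv_S {τ s ρ ρ' : ℂ} (h1 : ρ ^ 4 = ee τ) (h2 : ρ' ^ 4 = ee (-1 / τ))
    (ha : av (ee (-1 / τ)) = s * (av (ee τ) + 2 * ρ * bv (ee τ)))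
    (hb : 2 * ρ' * bv (ee (-1 / τ)) = s * (av (ee τ) - 2 * ρ * bv (ee τ))) :
    2 * ρ' * Wv (ee (-1 / τ)) = 8 * s ^ 6 * (2 * ρ * Wv (ee τ)) := by
  rw [Wv_eq _ _ h1, Wv_eq _ _ h2, hb, ha]; ring

def Dh (q : ℂ) : ℂ := q * Uv q

lemma MF_Dh : MF 12 Dh := by
  refine ⟨Hol.id.mul hol_Uv, fun τ h => ?_⟩
  obtain ⟨s, ρ, ρ', hs, _, _, h1, h2, ha, hb, -⟩ := theta_pack h
  have g : ∀ ρ q : ℂ, ρ ^ 4 = q → Dh q = (2 * ρ * Wv q) ^ 4 / 16 := by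
    rintro ρ q rfl; unfold Dh Uv; ring
  rw [g _ _ h1, g _ _ h2, Wv_S h1 h2 ha hb]
  have s24 : s ^ 24 = τ ^ 12 / 4096 := by
    have s8 : s ^ 8 = τ ^ 4 / 16 := by linear_combination (s ^ 4 - τ ^ 2 / 4) * hs
    linear_combination (s ^ 16 + s ^ 8 * τ ^ 4 / 16 + τ ^ 8 / 256) * s8
  rw [zpow_ofNat]
  linear_combination 256 * (2 * ρ * Wv (ee τ)) ^ 4 * s24

lemma av_zero : av 0 = 1 := Xf_zero 0

lemma bv_zero : bv 0 = 1 := by rw [bv, Yf_zero, neg_zero, ee_zero]; norm_num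

lemma Wv_zero : Wv 0 = 1 := by simp [Wv, av_zero, bv_zero]

lemma Uv_zero : Uv 0 = 1 := by simp [Uv, Wv_zero]

lemma e4_zero : e4 0 = 1 := by simp [e4, av_zero]

lemma e6_zero : e6 0 = 1 := by simp [e6, av_zero]
section
open UpperHalfPlane ModularForm ModularFormClass MatrixGroups

lemma Uv_ne {q : ℂ} (hq : ‖q‖ < 1) : Uv q ≠ 0 := by
  by_cases h0 : q = 0
  · rw [h0, Uv_zero]; exact one_ne_zero
  obtain ⟨τ, h, rfl⟩ := ee_surj hq h0
  obtain ⟨f, hf, hf'⟩ := MF_Dh.toForm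
  have hz : (qExpansion 1 f).coeff 0 = 0 := by rw [hf', ps_coeff_zero]; simp [Dh]
  obtain ⟨c, hc⟩ := CuspForm.exists_smul_discriminant_of_weight_eq_twelve (toCuspForm f hz)
  have hc' : ∀ τ : ℍ, c * discriminant τ = f τ := fun τ => by
    have := congrArg (fun g : CuspForm 𝒮ℒ 12 => g τ) hc
    simpa using this
  have hcne : c ≠ 0 := by
    rintro rfl
    have : ∀ q, ‖q‖ < 1 → Dh q = (fun _ => 0) q := fun q hq => hol_eq MF_Dh.1 (Hol.const 0) (fun τ h => by
      have := hc' ⟨τ, h⟩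
      rw [hf] at this
      simpa using this.symm) hq
    have e : ps Dh = 0 := by
      rw [ps_congr this, ps_const]; simp
    have e2 : ps Dh = PowerSeries.X * ps Uv := by
      unfold Dh; rw [ps_mul Hol.id hol_Uv, ps_id]
    have e3 := congrArg (PowerSeries.coeff 1) (e2.symm.trans e)
    rw [show 1 = 0 + 1 from rfl, PowerSeries.coeff_succ_X_mul, ps_coeff_zero, Uv_zero] at e3
    simp at e3
  intro hU
  have := hc' ⟨τ, h⟩
  rw [hf] at this
  simp only [Dh] at this
  rw [hU, mul_zero] at this
  exact mul_ne_zero hcne (discriminant_ne_zero _) this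
end

lemma Wv_ne {q : ℂ} (hq : ‖q‖ < 1) : Wv q ≠ 0 := fun h => Uv_ne hq (by rw [Uv, h]; simp)

lemma SLaw_A : SLaw (-2) 1 Aff := by
  intro τ z h
  have ht := ne0_of_im h
  obtain ⟨s, ρ, ρ', hs, r0, r0', h1, h2, ha, hb, hz⟩ := theta_pack h
  obtain ⟨hX, hY⟩ := hz z
  have hW := Wv_ne (norm_ee h)
  have hW' := Wv_ne (norm_ee (im_S h))
  have hWS := Wv_S h1 h2 ha hb
  have hs0 : s ≠ 0 := by
    rintro rfl; exact ht ((pow_eq_zero_iff two_ne_zero).1 (by linear_combination 4 * hs))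
  unfold Aff
  have e1 : (av (ee (-1 / τ)) * Yf (ee (-1 / τ)) (z / τ) - 2 * bv (ee (-1 / τ)) * Xf (ee (-1 / τ)) (z / τ)) * ρ'
     = -2 * s ^ 2 * ee (z ^ 2 / τ) * ((av (ee τ) * Yf (ee τ) z - 2 * bv (ee τ) * Xf (ee τ) z) * ρ) := by
    linear_combination (exp := 1) av (ee (-1 / τ)) * hY - Xf (ee (-1 / τ)) (z / τ) * hb +
      s * ee (z ^ 2 / τ) * (Xf (ee τ) z - ρ * Yf (ee τ) z) * ha - s * (av (ee τ) - 2 * ρ * bv (ee τ)) * hX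
  rw [← div_eq_mul_inv, ← div_eq_mul_inv, zpow_neg, zpow_ofNat, Nat.cast_one, one_mul]
  generalize (av (ee (-1 / τ)) * Yf (ee (-1 / τ)) (z / τ) - 2 * bv (ee (-1 / τ)) * Xf (ee (-1 / τ)) (z / τ)) = n' at *
  generalize (av (ee τ) * Yf (ee τ) z - 2 * bv (ee τ) * Xf (ee τ) z) = n at *
  generalize Wv (ee (-1 / τ)) = W' at *
  generalize Wv (ee τ) = W at *
  have e2 : n' = -2 * s ^ 2 * ee (z ^ 2 / τ) * (n * ρ) / ρ' := by rw [← e1]; field_simp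
  have e3 : W' = 8 * s ^ 6 * (2 * ρ * W) / (2 * ρ') := by rw [← hWS]; field_simp
  have e4 : τ ^ 2 = -4 * s ^ 4 := by rw [hs]; ring
  rw [e2, e3, e4]
  field_simp
  ring

lemma SLaw_B : SLaw 0 1 Bff := by
  intro τ z h
  obtain ⟨s, ρ, ρ', hs, r0, r0', h1, h2, ha, hb, hz⟩ := theta_pack h
  obtain ⟨hX, hY⟩ := hz z
  have ht := ne0_of_im h
  have hW := Wv_ne (norm_ee h)
  have hW' := Wv_ne (norm_ee (im_S h))
  have hWS := Wv_S h1 h2 ha hb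
  have hs0 : s ≠ 0 := by
    rintro rfl; exact ht ((pow_eq_zero_iff two_ne_zero).1 (by linear_combination 4 * hs))
  have g : ∀ ρ q z : ℂ, ρ ^ 4 = q → ρ ≠ 0 → Wv q ≠ 0 → Bff q z = 2 * ((5 * av q ^ 4 * (2 * ρ * bv q) - (2 * ρ * bv q) ^ 5) * Xf q z
      + (av q ^ 5 - 5 * av q * (2 * ρ * bv q) ^ 4) * (ρ * Yf q z)) / (2 * ρ * Wv q) := by
    rintro ρ q z rfl h h'; unfold Bff; field_simp; ring
  rw [g _ _ _ h1 r0 hW, g _ _ _ h2 r0' hW', hWS, ha, hb, hX, hY, zpow_zero, Nat.cast_one, one_mul, one_mul]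
  generalize 2 * ρ * bv (ee τ) = b
  have : 2 * ρ * Wv (ee τ) ≠ 0 := mul_ne_zero (mul_ne_zero two_ne_zero r0) hW
  generalize 2 * ρ * Wv (ee τ) = W at *
  field_simp
  ring

lemma SLaw_E : SLaw 4 1 Eff := by
  intro τ z h
  obtain ⟨s, ρ, ρ', hs, r0, r0', h1, h2, ha, hb, hz⟩ := theta_pack h
  obtain ⟨hX, hY⟩ := hz z
  have g : ∀ ρ q z : ℂ, ρ ^ 4 = q → Eff q z = (av q ^ 7 + 7 * av q ^ 3 * (2 * ρ * bv q) ^ 4) * Xf q z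
      + (7 * av q ^ 4 * (2 * ρ * bv q) ^ 3 + (2 * ρ * bv q) ^ 7) * (ρ * Yf q z) := by
    rintro ρ q z rfl; unfold Eff; ring
  rw [g _ _ _ h1, g _ _ _ h2, ha, hb, hX, hY, zpow_ofNat, Nat.cast_one, one_mul]
  have s8 : s ^ 8 = τ ^ 4 / 16 := by linear_combination (s ^ 4 - τ ^ 2 / 4) * hs
  generalize 2 * ρ * bv (ee τ) = b
  generalize ρ * Yf (ee τ) z = Y
  generalize Xf (ee τ) z = X
  generalize av (ee τ) = a
  linear_combination 16 * ee (z ^ 2 / τ) * ((a ^ 7 + 7 * a ^ 3 * b ^ 4) * X + (7 * a ^ 4 * b ^ 3 + b ^ 7) * Y) * s8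

lemma A_at0 (q : ℂ) : Aff q 0 = 0 := by
  have : Yf q 0 = 2 * bv q := by rw [bv]; ring
  rw [Aff, this, ← av]; ring

lemma B_at0 {q : ℂ} (hq : ‖q‖ < 1) : Bff q 0 = 12 := by
  have : Yf q 0 = 2 * bv q := by rw [bv]; ring
  rw [Bff, this, ← av]
  have h := Wv_ne hq
  rw [← div_eq_mul_inv, div_eq_iff h, Wv]; ring

lemma A_ne {q : ℂ} (hq : ‖q‖ < 1) : ∃ z, Aff q z ≠ 0 := by
  by_contra! h
  have hW := Wv_ne hq
  have key : ∀ z, av q * Yf q z - 2 * bv q * Xf q z = 0 := fun z => by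
    have := h z
    rw [Aff] at this
    simpa [hW] using this
  have h1 := key 0
  have h2 := key (0 + 1 / 2)
  rw [Xf_half, Yf_half] at h2
  have h3 : bv q * av q = 0 := by rw [av] at *; linear_combination (-1 / 4) * h1 + (-1 / 4) * h2
  apply hW
  rw [Wv]; linear_combination (av q ^ 4 - 16 * q * bv q ^ 4) * h3

lemma A_q0 (z : ℂ) : Aff 0 z = ee z - 2 + ee (-z) := by
  rw [Aff, av_zero, bv_zero, Wv_zero, Xf_zero, Yf_zero]; norm_num; ring

lemma E_q0 (z : ℂ) : Eff 0 z = 1 := by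
  rw [Eff, av_zero, Xf_zero]; norm_num
section
variable {S : Subring ℂ}

lemma inv_coeff_mem {P Q : PowerSeries ℂ} (h : P * Q = 1) (h0 : P.coeff 0 = 1) (hP : ∀ n, P.coeff n ∈ S) :
    ∀ n, Q.coeff n ∈ S := by
  intro n
  induction n using Nat.strong_induction_on with
  | _ n ih =>
    have := congrArg (PowerSeries.coeff n) h
    rw [PowerSeries.coeff_mul, Finset.Nat.sum_antidiagonal_eq_sum_range_succ_mk, sum_range_succ'] at this
    simp only [h0, one_mul, tsub_zero] at this
    have e : Q.coeff n = (PowerSeries.coeff n (1 : PowerSeries ℂ)) -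
      ∑ k ∈ range n, P.coeff (k + 1) * Q.coeff (n - (k + 1)) := by rw [← this]; ring
    rw [e]
    refine S.sub_mem ?_ (S.sum_mem fun k hk => S.mul_mem (hP _) (ih _ ?_))
    · rw [PowerSeries.coeff_one]; split_ifs
      · exact S.one_mem
      · exact S.zero_mem
    · have := mem_range.1 hk; omega

lemma WX.inv (hS : IsClosed (S : Set ℂ)) {F : ℂ → ℂ} (h : WX S (fun q _ => F q)) (h0 : F 0 = 1)
    (hne : ∀ q, ‖q‖ < 1 → F q ≠ 0) : WX S (fun q _ => (F q)⁻¹) := by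
  obtain ⟨a, b⟩ := h.holS hS 0
  refine WX.disc (a.inv hne) (inv_coeff_mem (P := ps F) ?_ (by rw [ps_coeff_zero, h0]) (b rfl))
  rw [← ps_mul a (a.inv hne), ps_congr (G := fun _ => 1) fun q hq => mul_inv_cancel₀ (hne q hq), ps_const, map_one]

lemma WX_W (hS : IsClosed (S : Set ℂ)) : WX S (fun q _ => Wv q) := by
  have ha := WX_av hS; have hb := WX_bv (S := S); have hi := WX.id (S := S)
  have := ((ha.mul hS hb).mul hS ((ha.pow hS 4).add (((WX_int (-16)).mul hS hi).mul hS (hb.pow hS 4))))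
  exact this.congr fun q z _ => by unfold Wv; push_cast; ring

lemma WX_Winv (hS : IsClosed (S : Set ℂ)) : WX S (fun q _ => (Wv q)⁻¹) :=
  (WX_W hS).inv hS Wv_zero fun _ h => Wv_ne h

lemma WX_Uinv (hS : IsClosed (S : Set ℂ)) : WX S (fun q _ => (Uv q)⁻¹) :=
  ((WX_Winv hS).pow hS 4).congr fun q z _ => by rw [Uv, inv_pow]

lemma WX_e4 (hS : IsClosed (S : Set ℂ)) : WX S (fun q _ => e4 q) := by
  have ha := WX_av hS; have hb := WX_bv (S := S); have hi := WX.id (S := S)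
  have := ((ha.pow hS 8).add ((((WX_int 224).mul hS hi).mul hS (ha.pow hS 4)).mul hS (hb.pow hS 4))).add
    (((WX_int 256).mul hS (hi.pow hS 2)).mul hS (hb.pow hS 8))
  exact this.congr fun q z _ => by unfold e4; push_cast; ring

lemma WX_e6 (hS : IsClosed (S : Set ℂ)) : WX S (fun q _ => e6 q) := by
  have ha := WX_av hS; have hb := WX_bv (S := S); have hi := WX.id (S := S)
  have := (((ha.pow hS 12).add ((((WX_int (-528)).mul hS hi).mul hS (ha.pow hS 8)).mul hS (hb.pow hS 4))).add
    ((((WX_int (-8448)).mul hS (hi.pow hS 2)).mul hS (ha.pow hS 4)).mul hS (hb.pow hS 8))).add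
    (((WX_int 4096).mul hS (hi.pow hS 3)).mul hS (hb.pow hS 12))
  exact this.congr fun q z _ => by unfold e6; push_cast; ring

lemma WX_A (hS : IsClosed (S : Set ℂ)) : WX S Aff := by
  have ha := WX_av hS; have hb := WX_bv (S := S)
  have := ((ha.mul hS WX_Y).add (((WX_int (-2)).mul hS hb).mul hS WX_X)).mul hS (WX_Winv hS)
  exact this.congr fun q z _ => by unfold Aff; push_cast; ring

lemma WX_B (hS : IsClosed (S : Set ℂ)) : WX S Bff := by
  have ha := WX_av hS; have hb := WX_bv (S := S); have hi := WX.id (S := S)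
  have := ((((((WX_int 10).mul hS (ha.pow hS 4)).mul hS hb).add
    (((WX_int (-32)).mul hS hi).mul hS (hb.pow hS 5))).mul hS WX_X).add
    (((ha.pow hS 5).add ((((WX_int (-80)).mul hS hi).mul hS ha).mul hS (hb.pow hS 4))).mul hS WX_Y)).mul hS (WX_Winv hS)
  exact this.congr fun q z _ => by unfold Bff; push_cast; ring

lemma WX_E (hS : IsClosed (S : Set ℂ)) : WX S Eff := by
  have ha := WX_av hS; have hb := WX_bv (S := S); have hi := WX.id (S := S)
  have := (((ha.pow hS 7).add ((((WX_int 112).mul hS hi).mul hS (ha.pow hS 3)).mul hS (hb.pow hS 4))).mul hS WX_X).add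
    (((((WX_int 56).mul hS hi).mul hS (ha.pow hS 4)).mul hS (hb.pow hS 3)).add
      (((WX_int 128).mul hS (hi.pow hS 2)).mul hS (hb.pow hS 7)) |>.mul hS WX_Y)
  exact this.congr fun q z _ => by unfold Eff; push_cast; ring
end

def RW2 (N : ℕ) (F : ℂ → ℂ) : Prop :=
  Hol F ∧ ∀ τ : ℂ, 0 < τ.im → F (ee (-1 / τ)) * ee τ ^ N = τ ^ 2 * F (ee τ) * ee (-1 / τ) ^ N
section
open UpperHalfPlane ModularForm ModularFormClass MatrixGroups

lemma MF2_zero {F : ℂ → ℂ} (h : MF 2 F) : ps F = 0 := by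
  obtain ⟨f, hf, hf'⟩ := h.toForm
  have := (rank_zero_iff_forall_zero.1 levelOne_weight_two_rank_zero) f
  rw [← hf', this]; exact qExpansion_zero 1
end

def hres (n : ℕ) (q : ℂ) : ℂ := e4 q ^ (3 * n) * (Uv q)⁻¹ ^ n

def Vres (n : ℕ) (q : ℂ) : ℂ := q * deriv (hres n) q - n * hres n q

lemma hol_hres (n : ℕ) : Hol (hres n) :=
  (MF_e4.1.pow _).mul ((hol_Uv.inv fun _ h => Uv_ne h).pow _)

lemma hres_S (n : ℕ) {τ : ℂ} (h : 0 < τ.im) :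
    hres n (ee (-1 / τ)) * ee (-(n * (-1 / τ))) = hres n (ee τ) * ee (-(n * τ)) := by
  have ht := ne0_of_im h
  have h4 := MF_e4.2 τ h
  have hD := MF_Dh.2 τ h
  have key : ∀ q, q ≠ 0 → hres n q * (q ^ n)⁻¹ = (e4 q ^ 3 / Dh q) ^ n := fun q hq => by
    rw [hres, Dh, div_pow, mul_pow, inv_pow, ← pow_mul, div_eq_mul_inv, mul_inv]; ring
  rw [ee_neg, ee_neg, ee_natmul, ee_natmul, key _ (ee_ne _), key _ (ee_ne _), h4, hD]
  congr 1
  rw [zpow_ofNat, zpow_ofNat]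
  field_simp

lemma Vres_RW (n : ℕ) : RW2 n (Vres n) := by
  refine ⟨?_, fun τ h => ?_⟩
  · have := (Hol.id.mul (hol_hres n).deriv).add ((Hol.const (-n)).mul (hol_hres n))
    exact this.congr' fun q _ => by rw [Vres]; ring
  have ht := ne0_of_im h
  have hd : ∀ τ : ℂ, 0 < τ.im → HasDerivAt (fun τ => hres n (ee τ) * ee (-(n * τ)))
      (2 * Real.pi * I * (Vres n (ee τ)) * ee (-(n * τ))) τ := fun τ h => by
    have h1 : HasDerivAt (hres n) (deriv (hres n) (ee τ)) (ee τ) := by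
      apply DifferentiableAt.hasDerivAt
      exact (hol_hres n).differentiableAt (Metric.isOpen_ball.mem_nhds (by simpa using norm_ee h))
    have h2 := h1.comp τ (ee_hasDeriv τ)
    have h3 : HasDerivAt (fun τ : ℂ => -((n:ℂ) * τ)) (-n) τ := by
      exact (((hasDerivAt_id τ).const_mul (n : ℂ)).neg).congr_deriv (by simp)
    have h4 := (ee_hasDeriv (-(n * τ))).comp τ h3
    have h5 := h2.mul h4
    refine h5.congr_deriv ?_
    simp only [Function.comp, Vres]; ring
  have hS : HasDerivAt (fun τ : ℂ => -1 / τ) (1 / τ ^ 2) τ := by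
    have := (hasDerivAt_inv ht).neg
    refine (this.congr_deriv (by simp)).congr_of_eventuallyEq (Eventually.of_forall fun x => ?_)
    simp [neg_div]
  have h1 := (hd _ (im_S h)).comp τ hS
  have h2 : HasDerivAt ((fun τ => hres n (ee τ) * ee (-(n * τ))) ∘ fun τ : ℂ => -1 / τ)
      (2 * Real.pi * I * (Vres n (ee τ)) * ee (-(n * τ))) τ := by
    refine (hd τ h).congr_of_eventuallyEq ?_
    have : {τ : ℂ | 0 < τ.im} ∈ 𝓝 τ := (isOpen_lt continuous_const Complex.continuous_im).mem_nhds h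
    filter_upwards [this] with x hx
    exact hres_S n hx
  have h3 := h1.unique h2
  have hpi : (2 * Real.pi * I : ℂ) ≠ 0 := Complex.two_pi_I_ne_zero
  rw [ee_neg, ee_neg, ee_natmul, ee_natmul] at h3
  have e1 := ee_ne τ
  have e2 := ee_ne (-1 / τ)
  generalize ee τ = q at *
  generalize ee (-1 / τ) = q' at *
  field_simp at h3
  have h3' := mul_left_cancel₀ hpi (a := 2 * Real.pi * I) (b := Vres n q' * q ^ n) (c := τ ^ 2 * Vres n q * q' ^ n)
    (by linear_combination (2 * (Real.pi : ℂ) * I) * h3)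
  exact h3'

lemma ps_Vres (n k : ℕ) : (ps (Vres n)).coeff k = (k - n) * (ps (hres n)).coeff k := by
  have e : ps (Vres n) = PowerSeries.X * ps (deriv (hres n)) + PowerSeries.C (-n : ℂ) * ps (hres n) := by
    rw [← ps_id, ← ps_mul Hol.id (hol_hres n).deriv, ← ps_smul (hol_hres n),
      ← ps_add (Hol.id.mul (hol_hres n).deriv) ((Hol.const _).mul (hol_hres n))]
    exact ps_congr fun q _ => by rw [Vres]; ring
  rw [e, map_add, PowerSeries.coeff_C_mul]
  rcases k with _ | k
  · simp
  · rw [PowerSeries.coeff_succ_X_mul, ps_deriv]; push_cast; ring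

lemma div_q {F : ℂ → ℂ} (hF : Hol F) (h0 : F 0 = 0) : ∃ G, Hol G ∧ ∀ q, F q = q * G q := by
  refine ⟨dslope F 0, (Complex.differentiableOn_dslope ball_nhds0).2 hF, fun q => ?_⟩
  have := sub_smul_dslope F 0 q
  simp [h0] at this
  rw [this]

theorem residue_thm (N : ℕ) : ∀ F, RW2 N F → (ps F).coeff N = 0 := by
  induction N with
  | zero =>
    intro F h
    rw [MF2_zero ⟨h.1, fun τ ht => by have := h.2 τ ht; simpa using this⟩]; simp
  | succ N ih =>
    intro F h
    have hn : ((N + 1 : ℕ) : ℂ) ≠ 0 := by exact_mod_cast Nat.succ_ne_zero N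
    set V := Vres (N + 1) with hV
    have hVR := Vres_RW (N + 1)
    have hV0 : V 0 = -((N + 1 : ℕ) : ℂ) := by
      simp [hV, Vres, hres, e4_zero, Uv_zero]
    set c : ℂ := F 0 / ((N + 1 : ℕ) : ℂ)
    have hF' : Hol (fun q => F q + c * V q) := h.1.add ((Hol.const c).mul hVR.1)
    obtain ⟨G, hG, hG'⟩ := div_q hF' (by simp only [hV0]; simp only [c]; field_simp; ring)
    have hcoef : (ps (fun q => F q + c * V q)).coeff (N + 1) = (ps F).coeff (N + 1) := by
      rw [ps_add h.1 ((Hol.const c).mul hVR.1), ps_smul hVR.1, map_add, PowerSeries.coeff_C_mul, ps_Vres]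
      simp
    have e2 : ps (fun q => F q + c * V q) = PowerSeries.X * ps G := by
      rw [← ps_id, ← ps_mul Hol.id hG]; exact ps_congr fun q _ => hG' q
    rw [← hcoef, e2, PowerSeries.coeff_succ_X_mul]
    apply ih
    refine ⟨hG, fun τ ht => ?_⟩
    have a1 := h.2 τ ht
    have a2 := hVR.2 τ ht
    have b1 := hG' (ee τ)
    have b2 := hG' (ee (-1 / τ))
    have e1 := ee_ne τ
    have e2 := ee_ne (-1 / τ)
    apply mul_left_cancel₀ (mul_ne_zero e1 e2)
    linear_combination a1 + c * a2 - b2 * ee τ ^ (N + 1) + τ ^ 2 * b1 * ee (-1 / τ) ^ (N + 1)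

lemma MF.mul {k l : ℤ} {F G : ℂ → ℂ} (hF : MF k F) (hG : MF l G) : MF (k + l) (fun q => F q * G q) :=
  ⟨hF.1.mul hG.1, fun τ h => by
    simp only []; rw [hF.2 τ h, hG.2 τ h, zpow_add₀ (ne0_of_im h)]; ring⟩

lemma MF.pow {k : ℤ} {F : ℂ → ℂ} (hF : MF k F) (n : ℕ) : MF (n * k) (fun q => F q ^ n) :=
  ⟨hF.1.pow n, fun τ h => by
    simp only [hF.2 τ h, mul_pow]
    rw [mul_comm (n : ℤ), zpow_mul, zpow_natCast]⟩

lemma hol_Uinv (n : ℕ) : Hol (fun q => (Uv q)⁻¹ ^ n) := (hol_Uv.inv fun _ h => Uv_ne h).pow n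

lemma MF.RW2 {N : ℕ} {G : ℂ → ℂ} (h : MF (12 * N + 2) G) : RW2 N (fun q => G q * (Uv q)⁻¹ ^ N) := by
  refine ⟨h.1.mul (hol_Uinv N), fun τ ht => ?_⟩
  have h1 := h.2 τ ht
  have h2 := (MF_Dh.pow N).2 τ ht
  have t0 := ne0_of_im ht
  simp only [Dh] at h2
  have u1 := Uv_ne (norm_ee ht)
  have u2 := Uv_ne (norm_ee (im_S ht))
  simp only []
  rw [h1, zpow_add₀ t0, mul_comm (12 : ℤ), zpow_ofNat]
  simp only [mul_pow, inv_pow] at h2 ⊢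
  generalize ee (-1 / τ) = q' at *
  field_simp
  linear_combination (-(G (ee τ))) * h2
section
open UpperHalfPlane ModularForm ModularFormClass MatrixGroups

def qe (k : ℤ) : ModularForm 𝒮ℒ k →ₗ[ℂ] PowerSeries ℂ where
  toFun f := qExpansion 1 f
  map_add' f g := ModularForm.qExpansion_add one_pos one_mem_strictPeriods_SL f g
  map_smul' a f := by
    have := ModularForm.qExpansion_smul one_pos one_mem_strictPeriods_SL a f
    simpa using this

lemma sturm {k R : ℕ} (hk : k / 12 ≤ R) {f : ModularForm 𝒮ℒ (k : ℤ)} (h : ∀ n ≤ R, (qe k f).coeff n = 0) : f = 0 := by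
  apply sturm_bound_levelOne_nat
  refine lt_of_lt_of_le ?_ (PowerSeries.nat_le_order _ (R + 1) fun i hi => h i (by omega))
  exact_mod_cast Nat.lt_succ_of_le hk

def trunc (R : ℕ) : PowerSeries ℂ →ₗ[ℂ] (Fin (R + 1) → ℂ) where
  toFun P i := P.coeff i
  map_add' _ _ := by ext; simp
  map_smul' _ _ := by ext; simp

def rtrunc (R : ℕ) (Q : PowerSeries ℂ) : PowerSeries ℂ →ₗ[ℂ] (Fin (R + 1) → ℂ) where
  toFun P i := (P * Q).coeff (R - i)
  map_add' _ _ := by ext; simp [add_mul]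
  map_smul' _ _ := by ext; simp

lemma coeff_mul_fin (R : ℕ) (x y : PowerSeries ℂ) :
    (x * y).coeff R = ∑ i : Fin (R + 1), x.coeff i * y.coeff (R - i) := by
  rw [PowerSeries.coeff_mul, Finset.Nat.sum_antidiagonal_eq_sum_range_succ_mk, ← Fin.sum_univ_eq_sum_range
    (fun i => x.coeff i * y.coeff (R - i))]

theorem duality {k R : ℕ} (hk : Even k) (hR : k ≤ 12 * R + 2) (p : ℕ → ℂ)
    (hp : ∀ F, MF k F → ∑ n ∈ range (R + 1), p n * (ps F).coeff n = 0) :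
    ∃ f, MF ((12 * R + 2 - k : ℕ) : ℤ) f ∧ ∀ x : PowerSeries ℂ,
      ∑ n ∈ range (R + 1), p n * x.coeff n = (x * ps (fun q => f q * (Uv q)⁻¹ ^ R)).coeff R := by
  set k' := 12 * R + 2 - k with hk'
  set Q := ps (fun q => (Uv q)⁻¹ ^ R)
  have hQ0 : Q.coeff 0 = 1 := by rw [ps_coeff_zero, Uv_zero]; simp
  let A : ModularForm 𝒮ℒ (k : ℤ) →ₗ[ℂ] (Fin (R + 1) → ℂ) := trunc R ∘ₗ qe k
  let B : ModularForm 𝒮ℒ (k' : ℤ) →ₗ[ℂ] (Fin (R + 1) → ℂ) := rtrunc R Q ∘ₗ qe k'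
  have hA : Function.Injective A := by
    rw [← LinearMap.ker_eq_bot, LinearMap.ker_eq_bot']
    intro f hf
    apply sturm (k := k) (R := R) (by omega)
    intro n hn
    exact congrFun hf ⟨n, by omega⟩
  have hB : Function.Injective B := by
    rw [← LinearMap.ker_eq_bot, LinearMap.ker_eq_bot']
    intro f hf
    apply sturm (k := k') (R := R) (by omega)
    have h2 : ∀ n ≤ R, (qe k' f * Q).coeff n = 0 := fun n hn => by
      have := congrFun hf ⟨R - n, by omega⟩
      simp only [B, rtrunc, LinearMap.comp_apply, LinearMap.coe_mk, AddHom.coe_mk, Pi.zero_apply] at this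
      rwa [show R - (R - n) = n by omega] at this
    intro n
    induction n using Nat.strong_induction_on with
    | _ n ih =>
      intro hn
      have := h2 n hn
      rw [coeff_mul_fin, Fin.sum_univ_castSucc, sum_eq_zero] at this
      · simpa [hQ0] using this
      · intro i _
        simp [ih i i.2 (by omega)]
  let L : (Fin (R + 1) → ℂ) →ₗ[ℂ] Module.Dual ℂ (ModularForm 𝒮ℒ (k : ℤ)) :=
    A.dualMap ∘ₗ (dotProductEquiv ℂ (Fin (R + 1))).toLinearMap
  have hL : Function.Surjective L := by
    have := LinearMap.dualMap_surjective_of_injective hA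
    exact this.comp (dotProductEquiv ℂ (Fin (R + 1))).surjective
  have hLap : ∀ (v : Fin (R + 1) → ℂ) f, L v f = ∑ i, v i * (qe k f).coeff i := fun v f => rfl
  have hle : LinearMap.range B ≤ LinearMap.ker L := by
    rintro _ ⟨f, rfl⟩
    rw [LinearMap.mem_ker]
    ext g
    rw [hLap]
    obtain ⟨F, hF, -, hF'⟩ := exists_MF f
    obtain ⟨G, hG, -, hG'⟩ := exists_MF g
    have hM : MF (12 * R + 2) (fun q => F q * G q) := by
      have := hF.mul hG
      rwa [show ((k' : ℕ) : ℤ) + (k : ℤ) = 12 * R + 2 by omega] at this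
    have := residue_thm R _ hM.RW2
    rw [ps_mul (hF.1.mul hG.1) (hol_Uinv R), ps_mul hF.1 hG.1, mul_comm (ps F), mul_assoc, coeff_mul_fin] at this
    rw [LinearMap.zero_apply, ← this]
    refine sum_congr rfl fun i _ => ?_
    have e1 : qe k g = ps G := hG'
    have e2 : qe k' f = ps F := hF'
    simp only [B, LinearMap.comp_apply, rtrunc, LinearMap.coe_mk, AddHom.coe_mk, e1, e2, Q]
    ring
  have hdim : ∀ k : ℕ, Even k → Module.finrank ℂ (ModularForm 𝒮ℒ (k : ℤ)) =
      if k % 12 = 2 then k / 12 else k / 12 + 1 := by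
    intro k hk
    apply Module.finrank_eq_of_rank_eq
    rw [dimension_level_one k hk]
    simp only [Nat.ModEq, Nat.reduceMod]
    by_cases h : k % 12 = 2 <;> simp [h]
  have heq : LinearMap.range B = LinearMap.ker L := by
    apply Submodule.eq_of_le_of_finrank_eq hle
    have h1 := LinearMap.finrank_range_add_finrank_ker L
    rw [LinearMap.range_eq_top.2 hL, finrank_top, Subspace.dual_finrank_eq, hdim k hk, Module.finrank_fin_fun] at h1
    rw [LinearMap.finrank_range_of_inj hB, hdim k' (by rw [Nat.even_iff] at *; omega)]
    obtain ⟨t, ht⟩ := hk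
    split_ifs at * <;> omega
  have hmem : (fun i : Fin (R + 1) => p i) ∈ LinearMap.ker L := by
    rw [LinearMap.mem_ker]; ext g
    obtain ⟨G, hG, -, hG'⟩ := exists_MF g
    rw [hLap, LinearMap.zero_apply, ← hp G hG]
    have e1 : qe k g = ps G := hG'
    rw [← Fin.sum_univ_eq_sum_range (fun n => p n * (ps G).coeff n), e1]
  rw [← heq] at hmem
  obtain ⟨f, hf⟩ := hmem
  obtain ⟨F, hF, -, hF'⟩ := exists_MF f
  refine ⟨F, hF, fun x => ?_⟩
  rw [coeff_mul_fin, ← Fin.sum_univ_eq_sum_range (fun n => p n * x.coeff n)]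
  refine sum_congr rfl fun i _ => ?_
  have := congrFun hf i
  have e2 : qe k' f = ps F := hF'
  simp only [B, LinearMap.comp_apply, rtrunc, LinearMap.coe_mk, AddHom.coe_mk, e2, Q] at this
  rw [← this, ps_mul hF.1 (hol_Uinv R)]; ring
end

lemma int_ee (n : ℤ) : ∫ x in (0:ℝ)..1, ee (n * x) = if n = 0 then 1 else 0 := by
  split_ifs with h
  · subst h; simp [ee_zero]
  · have hc : (2 * Real.pi * I * n : ℂ) ≠ 0 := mul_ne_zero Complex.two_pi_I_ne_zero (by exact_mod_cast h)
    have := integral_exp_mul_complex (a := 0) (b := 1) hc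
    simp only [ee]
    have e : ∀ x : ℝ, (2 * Real.pi * I * (n * x) : ℂ) = 2 * Real.pi * I * n * x := fun x => by ring
    simp only [e]
    rw [this]
    have h1 := ee_int n
    rw [ee] at h1
    simp [h1]

lemma norm_ee_real (x : ℝ) : ‖ee x‖ = 1 := by
  rw [ee, show (2 * Real.pi * I * x : ℂ) = ((2 * Real.pi * x : ℝ) : ℂ) * I by push_cast; ring]
  exact Complex.norm_exp_ofReal_mul_I _

lemma ee_cont : Continuous ee := by unfold ee; fun_prop

lemma fourier1 {b : ℤ → ℂ} {v : ℝ → ℂ} (h : ∀ x : ℝ, HasSum (fun r : ℤ => b r * ee (r * x)) (v x)) (r : ℤ) :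
    ∫ x in (0:ℝ)..1, v x * ee (-(r * x)) = b r := by
  have hb : Summable fun r => ‖b r‖ := by
    have := (h 0).summable.norm
    simpa [ee_zero] using this
  let f : ℤ → C(ℝ, ℂ) := fun s => ⟨fun x => b s * ee ((s - r : ℤ) * x), by
    have := ee_cont; fun_prop⟩
  have hn : ∀ s (x : ℝ), ‖f s x‖ = ‖b s‖ := fun s x => by
    simp only [f, ContinuousMap.coe_mk, norm_mul]
    have := norm_ee_real ((s - r : ℤ) * x)
    push_cast at this ⊢
    rw [this, mul_one]
  have key := intervalIntegral.hasSum_intervalIntegral_of_summable_norm (a := 0) (b := 1) (f := f) (by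
    refine hb.of_nonneg_of_le (fun _ => norm_nonneg _) fun s => ?_
    rw [ContinuousMap.norm_le _ (norm_nonneg _)]
    intro x
    exact (hn s x).le)
  have e1 : ∀ s, ∫ x in (0:ℝ)..1, f s x = if s = r then b r else 0 := fun s => by
    simp only [f, ContinuousMap.coe_mk]
    rw [intervalIntegral.integral_const_mul, int_ee]
    by_cases hs : s = r
    · simp [hs]
    · simp [hs, sub_ne_zero.2 hs]
  simp only [e1] at key
  rw [← key.unique (hasSum_ite_eq r (b r))]
  refine intervalIntegral.integral_congr fun x _ => ?_
  simp only [f, ContinuousMap.coe_mk]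
  rw [← (h x).tsum_eq, ← tsum_mul_right]
  refine tsum_congr fun s => ?_
  rw [mul_assoc, ← ee_add]; congr 2; push_cast; ring

lemma fourier_unique {b b' : ℤ → ℂ} {v : ℝ → ℂ} (h : ∀ x : ℝ, HasSum (fun r : ℤ => b r * ee (r * x)) (v x))
    (h' : ∀ x : ℝ, HasSum (fun r : ℤ => b' r * ee (r * x)) (v x)) : b = b' :=
  funext fun r => (fourier1 h r).symm.trans (fourier1 h' r)

def ZExp (c : ℤℤ) (φ : ℂℂ) : Prop := ∀ τ z : ℂ, 0 < τ.im →
  HasSum (fun p : ℤ × ℤ => c p.1 p.2 * ee (p.1 * τ + p.2 * z)) (φ τ z)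

lemma hasSum_swap {f : ℤ × ℤ → ℂ} {a : ℂ} (h : HasSum f a) : HasSum (fun r => ∑' n, f (n, r)) a := by
  have := (Equiv.prodComm ℤ ℤ).hasSum_iff.2 h
  have hs := this.summable
  exact this.prod_fiberwise fun r => (hs.prod_factor r).hasSum

lemma ZExp.rows {c : ℤℤ} {φ : ℂℂ} (h : ZExp c φ) {τ : ℂ} (ht : 0 < τ.im) :
    (∀ r, Summable fun n : ℤ => c n r * ee (n * τ)) ∧
    ∀ z, HasSum (fun r : ℤ => (∑' n : ℤ, c n r * ee (n * τ)) * ee (r * z)) (φ τ z) := by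
  constructor
  · intro r
    have := (Equiv.prodComm ℤ ℤ).summable_iff.2 (h τ 0 ht).summable
    simpa using this.prod_factor r
  · intro z
    refine (hasSum_swap (h τ z ht)).congr_fun' fun r => ?_
    rw [← tsum_mul_right]
    refine tsum_congr fun n => ?_
    rw [ee_add]; ring

lemma ZExp.unique {c c' : ℤℤ} {φ : ℂℂ} (h : ZExp c φ) (h' : ZExp c' φ) : c = c' := by
  have e : ∀ τ : ℂ, 0 < τ.im → ∀ r, ∑' n : ℤ, c n r * ee (n * τ) = ∑' n : ℤ, c' n r * ee (n * τ) := fun τ ht r => by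
    exact congrFun (fourier_unique (fun x : ℝ => (h.rows ht).2 x) fun x => (h'.rows ht).2 x) r
  funext n r
  have him : ∀ x : ℝ, 0 < (I + x : ℂ).im := fun x => by simp
  have := fourier_unique (b := fun n => c n r * ee (n * I)) (b' := fun n => c' n r * ee (n * I))
    (v := fun x : ℝ => ∑' n : ℤ, c n r * ee (n * (I + x))) (fun x => by
      refine ((h.rows (him x)).1 r).hasSum.congr_fun' fun n => ?_
      rw [mul_add, ee_add]; ring) (fun x => by
      simp only [e _ (him x)]
      refine ((h'.rows (him x)).1 r).hasSum.congr_fun' fun n => ?_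
      rw [mul_add, ee_add]; ring)
  exact mul_right_cancel₀ (ee_ne _) (congrFun this n)

def row (c : ℕ → ℤ → ℂ) (r : ℤ) (q : ℂ) : ℂ := ∑' n : ℕ, c n r * q ^ n

lemma DExp.sum_rows {c : ℕ → ℤ → ℂ} {Φ : ℂℂ} (h : DExp c Φ) {q : ℂ} (hq : ‖q‖ < 1) :
    (∀ r, Summable fun n : ℕ => c n r * q ^ n) ∧
    ∀ z, HasSum (fun r : ℤ => row c r q * ee (r * z)) (Φ q z) := by
  constructor
  · intro r
    have := (Equiv.prodComm ℤ ℕ).summable_iff.2 (h q 0 hq).summable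
    simpa [ee_zero] using this.prod_factor r
  · intro z
    have := (Equiv.prodComm ℤ ℕ).hasSum_iff.2 (h q z hq)
    have hs := this.summable
    refine (this.prod_fiberwise fun r => (hs.prod_factor r).hasSum).congr_fun' fun r => ?_
    rw [row, ← tsum_mul_right]
    refine tsum_congr fun n => ?_
    simp; ring

lemma DExp.hol_row {c : ℕ → ℤ → ℂ} {Φ : ℂℂ} (h : DExp c Φ) (r : ℤ) :
    Hol (row c r) ∧ ps (row c r) = .mk fun n => c n r :=
  hol_tsum _ fun _ hq => (h.sum_rows hq).1 r

lemma DExp.toZ {c : ℕ → ℤ → ℂ} {Φ : ℂℂ} (h : DExp c Φ) (K : ℕ) :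
    ZExp (fun n r => if 0 ≤ n + K then c (n + K).toNat r else 0) (fun τ z => ee (-(K * τ)) * Φ (ee τ) z) := by
  intro τ z ht
  have h1 := (h (ee τ) z (norm_ee ht)).mul_left (ee (-(K * τ)))
  let i : ℕ × ℤ → ℤ × ℤ := fun p => ((p.1 : ℤ) - K, p.2)
  have hi : Function.Injective i := by
    rintro ⟨a, b⟩ ⟨c, d⟩ h; simp [i] at h; simp [h]
  rw [← hi.hasSum_iff] 
  · refine h1.congr_fun' fun p => ?_
    simp only [Function.comp, i]
    rw [if_pos (by omega), ← ee_natmul, ee_add]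
    rw [show ((p.1 : ℤ) - (K : ℤ) + (K : ℤ)).toNat = p.1 by omega]
    push_cast
    rw [sub_mul, sub_eq_add_neg, ee_add]; ring
  · rintro ⟨n, r⟩ hx
    have : ¬ 0 ≤ n + K := fun h0 => hx ⟨((n + K).toNat, r), by
      simp only [i]; rw [Int.toNat_of_nonneg h0]; simp⟩
    simp [this]

lemma ZExp.congr {c : ℤℤ} {φ ψ : ℂℂ} (h : ZExp c φ) (e : ∀ τ z, 0 < τ.im → ψ τ z = φ τ z) :
    ZExp c ψ := fun τ z ht => by rw [e τ z ht]; exact h τ z ht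

structure JX (m : ℕ) (C : ℤℤ) (φ : ℂℂ) : Prop where
  exp : ZExp (fun n r => C (4 * (m : ℤ) * n - r ^ 2) r) φ
  per : ∀ Δ l : ℤ, C Δ (l + 2 * (m : ℤ)) = C Δ l
  supp : ∀ Δ l : ℤ, ¬ (4 * (m : ℤ)) ∣ (Δ + l ^ 2) → C Δ l = 0
  bd : ∃ B : ℤ, ∀ Δ l : ℤ, Δ < B → C Δ l = 0

def ElS (m : ℕ) (φ : ℂℂ) : Prop := ∀ τ z : ℂ, 0 < τ.im →
  φ τ (z + τ) = ee (-(m * (τ + 2 * z))) * φ τ z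

lemma per_int {m : ℕ} {C : ℤℤ} (per : ∀ Δ l : ℤ, C Δ (l + 2 * (m : ℤ)) = C Δ l) (Δ l k : ℤ) :
    C Δ (l + 2 * m * k) = C Δ l := by
  induction k using Int.induction_on with
  | zero => simp
  | succ k ih => have := per Δ (l + 2 * m * k); rw [← ih, ← this]; congr 1; ring
  | pred k ih => have := per Δ (l + 2 * m * (-k - 1)); rw [← ih, ← this]; congr 1; ring

lemma per_dvd {m : ℕ} {C : ℤℤ} (per : ∀ Δ l : ℤ, C Δ (l + 2 * (m : ℤ)) = C Δ l) {Δ l l' : ℤ}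
    (h : (2 * (m : ℤ)) ∣ l' - l) : C Δ l' = C Δ l := by
  obtain ⟨k, hk⟩ := h
  rw [← per_int per Δ l k, ← hk]; congr 1; ring

lemma ZExp.shift {m : ℕ} {c : ℤℤ} {φ : ℂℂ} (h : ZExp c φ) (he : ElS m φ) (n r : ℤ) :
    c (n + r + m) (r + 2 * m) = c n r := by
  have h2 : ZExp (fun N R => c (N - R + m) (R - 2 * m)) φ := by
    intro τ z ht
    have h1 := (h τ (z + τ) ht).mul_left (ee (m * (τ + 2 * z)))
    rw [he τ z ht, ← mul_assoc, ← ee_add, add_neg_cancel, ee_zero, one_mul] at h1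
    let e : ℤ × ℤ ≃ ℤ × ℤ :=
      { toFun := fun p => (p.1 - p.2 + m, p.2 - 2 * m)
        invFun := fun p => (p.1 + p.2 + m, p.2 + 2 * m)
        left_inv := fun p => by ext <;> simp; ring
        right_inv := fun p => by ext <;> simp; ring }
    rw [← e.hasSum_iff] at h1
    refine h1.congr_fun' fun p => ?_
    simp only [Function.comp, e, Equiv.coe_fn_mk]
    rw [mul_left_comm, ← ee_add]; congr 2; push_cast; ring
  have := congrFun (congrFun (h.unique h2) (n + r + m)) (r + 2 * m)
  rw [this]; congr 1 <;> ring

lemma bmod_bound (l : ℤ) {m : ℕ} (hm : 0 < m) : (Int.bmod l (2 * m)) ^ 2 ≤ (m : ℤ) ^ 2 ∧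
    (2 * (m : ℤ)) ∣ l - Int.bmod l (2 * m) := by
  constructor
  · have h1 := Int.bmod_lt (x := l) (m := 2 * m) (by omega)
    have h2 := Int.le_bmod (x := l) (m := 2 * m) (by omega)
    push_cast at h1 h2
    rw [← sq_abs]
    apply pow_le_pow_left₀ (abs_nonneg _)
    rw [abs_le]; constructor <;> omega
  · have := Int.dvd_self_sub_bmod (x := l) (m := 2 * m)
    simpa using this

lemma JX_of {m : ℕ} (hm : 0 < m) {c : ℤℤ} {φ : ℂℂ} (h : ZExp c φ) (he : ElS m φ) (K : ℕ)
    (hK : ∀ n r : ℤ, n < -(K : ℤ) → c n r = 0) :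
    ∃ C, JX m C φ ∧ ∀ n r, C (4 * m * n - r ^ 2) r = c n r := by
  set C : ℤℤ := fun Δ l => if (4 * (m : ℤ)) ∣ (Δ + l ^ 2) then c ((Δ + l ^ 2) / (4 * m)) l else 0 with hC
  have h4 : (4 * (m : ℤ)) ≠ 0 := by positivity
  have hc : ∀ n r, C (4 * m * n - r ^ 2) r = c n r := fun n r => by
    simp only [hC]
    rw [if_pos ⟨n, by ring⟩]; congr 1
    rw [show 4 * (m : ℤ) * n - r ^ 2 + r ^ 2 = 4 * m * n by ring]; exact Int.mul_ediv_cancel_left _ h4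
  have hs : ∀ Δ l : ℤ, ¬ (4 * (m : ℤ)) ∣ (Δ + l ^ 2) → C Δ l = 0 := fun Δ l h => by simp only [hC]; rw [if_neg h]
  have hper : ∀ Δ l : ℤ, C Δ (l + 2 * (m : ℤ)) = C Δ l := fun Δ l => by
    by_cases hd : (4 * (m : ℤ)) ∣ (Δ + l ^ 2)
    · obtain ⟨n, hn⟩ := hd
      have e : Δ = 4 * m * n - l ^ 2 := by linarith
      have e' : Δ = 4 * m * (n + l + m) - (l + 2 * m) ^ 2 := by rw [e]; ring
      conv_rhs => rw [e, hc, ← h.shift he, ← hc, ← e']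
    · rw [hs _ _ hd, hs]
      intro h'
      apply hd
      have : Δ + l ^ 2 = (Δ + (l + 2 * m) ^ 2) - 4 * m * (l + m) := by ring
      rw [this]; exact dvd_sub h' ⟨_, rfl⟩
  refine ⟨C, ⟨?_, hper, hs, -(4 * m * K) - m ^ 2, ?_⟩, hc⟩
  · have : (fun n r => C (4 * m * n - r ^ 2) r) = c := by funext n r; exact hc n r
    rw [this]; exact h
  · intro Δ l hΔ
    obtain ⟨hb, hd⟩ := bmod_bound l hm
    rw [per_dvd hper hd]
    set l' := Int.bmod l (2 * m)
    by_cases hd : (4 * (m : ℤ)) ∣ (Δ + l' ^ 2)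
    · obtain ⟨n, hn⟩ := hd
      have e : Δ = 4 * m * n - l' ^ 2 := by linarith
      rw [e, hc, hK]
      by_contra! hcon
      have : 4 * (m : ℤ) * (-K) ≤ 4 * m * n := mul_le_mul_of_nonneg_left hcon (by positivity)
      linarith
    · exact hs _ _ hd

lemma JX.ext {m : ℕ} {C C' : ℤℤ} {φ φ' : ℂℂ} (h : JX m C φ) (h' : JX m C' φ')
    (e : ∀ τ z, 0 < τ.im → φ τ z = φ' τ z) : C = C' := by
  funext Δ l
  by_cases hd : (4 * (m : ℤ)) ∣ (Δ + l ^ 2)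
  · obtain ⟨n, hn⟩ := hd
    have e1 : Δ = 4 * m * n - l ^ 2 := by linarith
    have := congrFun (congrFun (h.exp.unique (h'.exp.congr e)) n) l
    rw [e1]; exact this
  · rw [h.supp _ _ hd, h'.supp _ _ hd]

lemma JX.law {m : ℕ} {C : ℤℤ} {φ : ℂℂ} (h : JX m C φ) : EllipticLaw m φ := by
  intro τ ht z lam mu
  have h1 := (h.exp τ z ht).mul_left (ee (-(m : ℂ) * ((lam : ℂ) ^ 2 * τ + 2 * (lam : ℂ) * z)))
  refine HasSum.unique (h.exp τ _ ht) ?_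
  let e : ℤ × ℤ ≃ ℤ × ℤ :=
      { toFun := fun p => (p.1 + lam * p.2 + m * lam ^ 2, p.2 + 2 * m * lam)
        invFun := fun p => (p.1 - lam * p.2 + m * lam ^ 2, p.2 - 2 * m * lam)
        left_inv := fun p => by ext <;> simp; ring
        right_inv := fun p => by ext <;> simp; ring }
  rw [← e.hasSum_iff] at h1
  refine h1.congr_fun' fun p => ?_
  simp only [Function.comp, e, Equiv.coe_fn_mk]
  rw [per_int h.per, mul_left_comm, ← ee_add,
    show 4 * (m : ℤ) * (p.1 + lam * p.2 + m * lam ^ 2) - (p.2 + 2 * m * lam) ^ 2 = 4 * m * p.1 - p.2 ^ 2 by ring]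
  congr 1
  rw [← mul_one (ee _), ← ee_int (-(p.2 * mu)), ← ee_add]; congr 1; push_cast; ring

lemma JX.even {m : ℕ} {C : ℤℤ} {φ : ℂℂ} (h : JX m C φ)
    (e : ∀ τ z, 0 < τ.im → φ τ (-z) = φ τ z) : IsEvenC C := by
  have h2 : ZExp (fun n r => C (4 * (m : ℤ) * n - (-r) ^ 2) (-r)) φ := by
    intro τ z ht
    have h1 := h.exp τ (-z) ht
    rw [e τ z ht, ← ((Equiv.refl ℤ).prodCongr (Equiv.neg ℤ)).hasSum_iff] at h1
    refine h1.congr_fun' fun p => ?_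
    simp
  intro Δ l
  by_cases hd : (4 * (m : ℤ)) ∣ (Δ + l ^ 2)
  · obtain ⟨n, hn⟩ := hd
    have e1 : Δ = 4 * m * n - l ^ 2 := by linarith
    have := congrFun (congrFun (h.exp.unique h2) n) l
    simp only [neg_sq] at this
    rw [e1, this]
  · rw [h.supp _ _ hd, h.supp]; rwa [neg_sq]

lemma JX.even' {m : ℕ} {C : ℤℤ} {φ : ℂℂ} (h : JX m C φ) (he : IsEvenC C) (τ z : ℂ) (ht : 0 < τ.im) :
    φ τ (-z) = φ τ z := by
  refine HasSum.unique ?_ (h.exp τ z ht)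
  have h1 := h.exp τ (-z) ht
  rw [← ((Equiv.refl ℤ).prodCongr (Equiv.neg ℤ)).hasSum_iff] at h1
  refine h1.congr_fun' fun p => ?_
  simp [he _ _]

lemma JX.add {m : ℕ} {C C' : ℤℤ} {φ φ' : ℂℂ} (h : JX m C φ) (h' : JX m C' φ') :
    JX m (fun Δ l => C Δ l + C' Δ l) (fun τ z => φ τ z + φ' τ z) := by
  obtain ⟨B, hB⟩ := h.bd
  obtain ⟨B', hB'⟩ := h'.bd
  refine ⟨fun τ z ht => ?_, fun Δ l => by rw [h.per, h'.per], fun Δ l hd => by rw [h.supp _ _ hd, h'.supp _ _ hd, add_zero],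
    min B B', fun Δ l hd => by rw [hB _ _ (by omega), hB' _ _ (by omega), add_zero]⟩
  simpa [add_mul] using (h.exp τ z ht).add (h'.exp τ z ht)

lemma JX.smul {m : ℕ} {C : ℤℤ} {φ : ℂℂ} (h : JX m C φ) (a : ℂ) :
    JX m (fun Δ l => a * C Δ l) (fun τ z => a * φ τ z) := by
  obtain ⟨B, hB⟩ := h.bd
  refine ⟨fun τ z ht => ?_, fun Δ l => by rw [h.per], fun Δ l hd => by rw [h.supp _ _ hd, mul_zero],
    B, fun Δ l hd => by rw [hB _ _ hd, mul_zero]⟩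
  simpa [mul_assoc] using (h.exp τ z ht).mul_left a

lemma JX.bdN {m : ℕ} (hm : 0 < m) {C : ℤℤ} {φ : ℂℂ} (h : JX m C φ) :
    ∃ K0 : ℕ, ∀ Δ l : ℤ, Δ < -(4 * m * K0 : ℕ) → C Δ l = 0 := by
  obtain ⟨B, hB⟩ := h.bd
  refine ⟨B.natAbs, fun Δ l hd => hB _ _ (hd.trans_le ?_)⟩
  have : B.natAbs ≤ 4 * m * B.natAbs := Nat.le_mul_of_pos_left _ (by omega)
  omega

lemma JX.toD {m : ℕ} (hm : 0 < m) {C : ℤℤ} {φ : ℂℂ} (h : JX m C φ) {K : ℕ}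
    (hK : ∀ Δ l : ℤ, Δ < -(4 * m * K : ℕ) → C Δ l = 0) :
    ∃ Φ, DExp (fun n r => C (4 * m * ((n : ℤ) - K) - r ^ 2) r) Φ ∧
      ∀ τ z, 0 < τ.im → Φ (ee τ) z = ee (K * τ) * φ τ z := by
  have hsum : ∀ τ z, 0 < τ.im → HasSum (fun p : ℕ × ℤ => C (4 * m * ((p.1 : ℤ) - K) - p.2 ^ 2) p.2 *
      (ee τ ^ p.1 * ee (p.2 * z))) (ee (K * τ) * φ τ z) := by
    intro τ z ht
    have h1 := (h.exp τ z ht).mul_left (ee (K * τ))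
    let i : ℕ × ℤ → ℤ × ℤ := fun p => ((p.1 : ℤ) - K, p.2)
    have hi : Function.Injective i := by
      rintro ⟨a, b⟩ ⟨c, d⟩ h; simp [i] at h; simp [h]
    rw [← hi.hasSum_iff] at h1
    · refine h1.congr_fun' fun p => ?_
      simp only [Function.comp, i]
      rw [← ee_natmul, ← ee_add, mul_left_comm (ee (K * τ)), ← ee_add]; congr 2; push_cast; ring
    · rintro ⟨n, r⟩ hx
      have : ¬ 0 ≤ n + K := fun h0 => hx ⟨((n + K).toNat, r), by
        simp only [i]; rw [Int.toNat_of_nonneg h0]; simp⟩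
      simp only
      rw [hK]
      · simp
      · have h4 : (4 * m : ℤ) * (n + K) < 0 := mul_neg_of_pos_of_neg (by positivity) (by omega)
        push_cast; nlinarith [sq_nonneg r]
  refine ⟨fun q z => ∑' p : ℕ × ℤ, C (4 * m * ((p.1 : ℤ) - K) - p.2 ^ 2) p.2 * (q ^ p.1 * ee (p.2 * z)),
    fun q z hq => ?_, fun τ z ht => (hsum τ z ht).tsum_eq⟩
  apply Summable.hasSum
  by_cases h0 : q = 0
  · subst h0
    refine summable_of_ne_finset_zero (s := (({0} : Finset ℕ) ×ˢ Finset.Icc (-0 : ℤ) 0)) ?_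
    rintro ⟨n, r⟩ hx
    rcases n with _ | n
    · simp only
      rw [hK, zero_mul]
      have : r ≠ 0 := by rintro rfl; simp at hx
      have := pow_pos (abs_pos.2 this) 2
      rw [sq_abs] at this
      push_cast; linarith
    · simp
  · obtain ⟨τ, ht, rfl⟩ := ee_surj hq h0
    exact (hsum τ z ht).summable

lemma ee_pi (x : ℂ) : Complex.exp (-Real.pi * I * x) = ee (-(x / 2)) := by rw [ee]; congr 1; ring

lemma ElS_X : ElS 1 (fun τ z => Xf (ee τ) z) := fun τ z h => by
  simp only []
  rw [Xf_eq h, Xf_eq h, mul_add, jacobiTheta₂_add_left', ee_pi]; congr 2; push_cast; ring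

lemma ElS_Y : ElS 1 (fun τ z => Yf (ee τ) z) := fun τ z h => by
  simp only []
  rw [Yf_eq h, Yf_eq h, show 2 * (z + τ) + τ = (2 * z + τ) + 2 * τ by ring, jacobiTheta₂_add_left', ee_pi,
    ← mul_assoc, ← mul_assoc, ← ee_add, ← ee_add]; congr 2; push_cast; ring

lemma even_X {q : ℂ} (z : ℂ) : Xf q (-z) = Xf q z := by
  rw [Xf, ← (Equiv.neg ℤ).tsum_eq, Xf]
  refine tsum_congr fun k => ?_
  simp

lemma even_Y {q : ℂ} (z : ℂ) : Yf q (-z) = Yf q z := by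
  let e : ℤ ≃ ℤ := ⟨fun k => -k - 1, fun k => -k - 1, fun k => by ring, fun k => by ring⟩
  rw [Yf, ← e.tsum_eq, Yf]
  refine tsum_congr fun k => ?_
  simp only [e, Equiv.coe_fn_mk]
  congr 2
  · congr 1; ring
  · push_cast; ring

lemma even_A {q : ℂ} (z : ℂ) : Aff q (-z) = Aff q z := by rw [Aff, even_X, even_Y, Aff]

lemma even_B {q : ℂ} (z : ℂ) : Bff q (-z) = Bff q z := by rw [Bff, even_X, even_Y, Bff]

lemma ElS_A : ElS 1 (fun τ z => Aff (ee τ) z) := fun τ z h => by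
  have h1 := ElS_X τ z h; have h2 := ElS_Y τ z h
  simp only [Aff] at *; rw [h1, h2]; ring

lemma ElS_B : ElS 1 (fun τ z => Bff (ee τ) z) := fun τ z h => by
  have h1 := ElS_X τ z h; have h2 := ElS_Y τ z h
  simp only [Bff] at *; rw [h1, h2]; ring

lemma ElS_E : ElS 1 (fun τ z => Eff (ee τ) z) := fun τ z h => by
  have h1 := ElS_X τ z h; have h2 := ElS_Y τ z h
  simp only [Eff] at *; rw [h1, h2]; ring

lemma ElS.mul {m n : ℕ} {φ ψ : ℂℂ} (h : ElS m φ) (h' : ElS n ψ) : ElS (m + n) (fun τ z => φ τ z * ψ τ z) :=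
  fun τ z ht => by
    simp only []
    rw [h τ z ht, h' τ z ht, show -(((m + n : ℕ) : ℂ) * (τ + 2 * z)) = -(m * (τ + 2 * z)) + -(n * (τ + 2 * z)) by push_cast; ring,
      ee_add]; ring

lemma ElS.pow {m : ℕ} {φ : ℂℂ} (h : ElS m φ) (n : ℕ) : ElS (n * m) (fun τ z => φ τ z ^ n) :=
  fun τ z ht => by
    simp only []
    rw [h τ z ht, mul_pow, ← ee_natmul]; congr 2; push_cast; ring

def Bs (m j : ℕ) (q z : ℂ) : ℂ := Aff q z ^ j * Bff q z ^ (m - j)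

lemma ElS_Bs {m j : ℕ} (h : j ≤ m) : ElS m (fun τ z => Bs m j (ee τ) z) := by
  have := (ElS_A.pow j).mul (ElS_B.pow (m - j))
  rwa [show j * 1 + (m - j) * 1 = m by omega] at this

lemma even_Bs {m j : ℕ} {q : ℂ} (z : ℂ) : Bs m j q (-z) = Bs m j q z := by rw [Bs, even_A, even_B, Bs]

lemma WX_Bs {S : Subring ℂ} (hS : IsClosed (S : Set ℂ)) (m j : ℕ) : WX S (Bs m j) :=
  ((WX_A hS).pow hS j).mul hS ((WX_B hS).pow hS (m - j))

lemma hcB_ex (m j : ℕ) : ∃ c, DExp c (Bs m j) := by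
  obtain ⟨c, -, h⟩ := WX_Bs (S := ⊤) isClosed_univ m j
  exact ⟨c, h⟩

def hcB (m j : ℕ) : ℕ → ℤ → ℂ := (hcB_ex m j).choose

lemma hcB_spec (m j : ℕ) : DExp (hcB m j) (Bs m j) := (hcB_ex m j).choose_spec

def RL (m : ℕ) (ρ : ℤ → ℂ) (q : ℂ) : Prop :=
  (∀ r, ρ (-r) = ρ r) ∧ ∀ r : ℤ, 0 ≤ r + m → ρ (r + 2 * m) = q ^ (r + m).toNat * ρ r

lemma RL.zero {m : ℕ} (hm : 0 < m) {ρ : ℤ → ℂ} {q : ℂ} (h : RL m ρ q) (h0 : ∀ r : ℕ, r ≤ m → ρ r = 0) (r : ℤ) : ρ r = 0 := by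
  have key : ∀ n : ℕ, ρ n = 0 := by
    intro n
    induction n using Nat.strong_induction_on with
    | _ n ih =>
      by_cases hn : n ≤ m
      · exact h0 n hn
      · have := h.2 ((n : ℤ) - 2 * m) (by omega)
        rw [sub_add_cancel] at this
        rw [this]
        by_cases h2 : 2 * m ≤ n
        · rw [show ((n : ℤ) - 2 * m) = ((n - 2 * m : ℕ) : ℤ) by omega]
          rw [ih _ (by omega), mul_zero]
        · rw [← h.1, show -((n : ℤ) - 2 * m) = ((2 * m - n : ℕ) : ℤ) by omega, ih _ (by omega), mul_zero]
  rcases le_total 0 r with hr | hr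
  · obtain ⟨n, rfl⟩ := Int.eq_ofNat_of_zero_le hr; exact key n
  · obtain ⟨n, hn⟩ := Int.exists_eq_neg_ofNat hr; rw [hn, h.1]; exact key n

lemma DExp.RL {m : ℕ} {c : ℕ → ℤ → ℂ} {Φ : ℂℂ} (h : DExp c Φ) (he : ElS m (fun τ z => Φ (ee τ) z))
    (hev : ∀ τ z, 0 < τ.im → Φ (ee τ) (-z) = Φ (ee τ) z) {q : ℂ} (hq : ‖q‖ < 1) : RL m (fun r => row c r q) q := by
  have hz := h.toZ 0
  have hz' : ZExp _ (fun τ z => Φ (ee τ) z) := hz.congr fun τ z _ => by simp [ee_zero]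
  have hs := hz'.shift he
  constructor
  · have h2 : DExp (fun n r => c n (-r)) (fun q z => Φ q (-z)) := by
      intro q z hq
      have h1 := h q (-z) hq
      rw [← ((Equiv.refl ℕ).prodCongr (Equiv.neg ℤ)).hasSum_iff] at h1
      exact h1.congr_fun' fun p => by simp
    have hz2 := h2.toZ 0
    have hz2' : ZExp _ (fun τ z => Φ (ee τ) z) := hz2.congr fun τ z ht => by simp [ee_zero, hev τ z ht]
    have e := hz'.unique hz2'
    intro r
    simp only [row]
    refine tsum_congr fun n => ?_
    have := congrFun (congrFun e n) r
    simp at this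
    rw [this]
  · intro r hr
    obtain ⟨k, hk⟩ := Int.eq_ofNat_of_zero_le hr
    have hsum := (h.sum_rows hq).1 (r + 2 * m)
    simp only [row]
    rw [hk, Int.toNat_natCast, ← tsum_mul_left, ← Summable.sum_add_tsum_nat_add k hsum, sum_eq_zero, zero_add]
    · refine tsum_congr fun n => ?_
      have := hs n r
      simp only [Nat.cast_zero, add_zero, Int.natCast_nonneg, if_true, Int.toNat_natCast] at this
      rw [show (n : ℤ) + r + m = ((n + k : ℕ) : ℤ) by push_cast; omega, if_pos (Int.natCast_nonneg _), Int.toNat_natCast] at this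
      rw [this]; ring
    · intro n hn
      have := hs ((n : ℤ) - k) r
      have hn := mem_range.1 hn
      rw [show (n : ℤ) - k + r + m = n by omega] at this
      simp only [Nat.cast_zero, add_zero, Int.natCast_nonneg, if_true, Int.toNat_natCast] at this
      rw [if_neg (by omega)] at this
      rw [this, zero_mul]

lemma diff_X {q : ℂ} (hq : ‖q‖ < 1) : Differentiable ℂ (Xf q) := by
  by_cases h0 : q = 0
  · rw [h0, show Xf 0 = fun _ => 1 from funext Xf_zero]; fun_prop
  obtain ⟨τ, h, rfl⟩ := ee_surj hq h0
  rw [show Xf (ee τ) = fun z => jacobiTheta₂ (2 * z) (2 * τ) from funext (Xf_eq h)]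
  intro z
  exact DifferentiableAt.comp (g := fun w => jacobiTheta₂ w (2 * τ)) z (differentiableAt_jacobiTheta₂_fst _ (two_im h)) (by fun_prop)

lemma diff_ee : Differentiable ℂ ee := by unfold ee; fun_prop

lemma diff_Y {q : ℂ} (hq : ‖q‖ < 1) : Differentiable ℂ (Yf q) := by
  have := diff_ee
  by_cases h0 : q = 0
  · rw [h0, show Yf 0 = fun z => ee z + ee (-z) from funext Yf_zero]; fun_prop
  obtain ⟨τ, h, rfl⟩ := ee_surj hq h0
  rw [show Yf (ee τ) = fun z => ee z * jacobiTheta₂ (2 * z + τ) (2 * τ) from funext (Yf_eq h)]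
  intro z
  exact (this z).mul (DifferentiableAt.comp (g := fun w => jacobiTheta₂ w (2 * τ)) z (differentiableAt_jacobiTheta₂_fst _ (two_im h)) (by fun_prop))

lemma diff_A {q : ℂ} (hq : ‖q‖ < 1) : Differentiable ℂ (Aff q) := by
  have := diff_X hq; have := diff_Y hq; unfold Aff; fun_prop

lemma diff_B {q : ℂ} (hq : ‖q‖ < 1) : Differentiable ℂ (Bff q) := by
  have := diff_X hq; have := diff_Y hq; unfold Bff; fun_prop

lemma entire_mul {f g : ℂ → ℂ} (hf : Differentiable ℂ f) (hg : Differentiable ℂ g) (h : ∀ z, f z * g z = 0) :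
    (∀ z, f z = 0) ∨ ∀ z, g z = 0 := by
  rcases AnalyticOnNhd.eq_zero_or_eq_zero_of_mul_eq_zero (U := Set.univ) (f := f) (g := g)
    (fun z _ => hf.analyticAt z) (fun z _ => hg.analyticAt z) (fun z _ => h z) isPreconnected_univ with h | h
  · exact Or.inl fun z => h z trivial
  · exact Or.inr fun z => h z trivial

lemma Bs_indep {m : ℕ} {q : ℂ} (hq : ‖q‖ < 1) (x : ℕ → ℂ) (h : ∀ z, ∑ j ∈ range (m + 1), x j * Bs m j q z = 0) :
    ∀ k ≤ m, x k = 0 := by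
  intro k
  induction k using Nat.strong_induction_on with
  | _ k ih =>
    intro hk
    have hA := diff_A hq; have hB := diff_B hq
    have h1 : ∀ z, Aff q z ^ k * (∑ j ∈ Finset.Ico k (m + 1), x j * (Aff q z ^ (j - k) * Bff q z ^ (m - j))) = 0 := by
      intro z
      rw [← h z, range_eq_Ico, ← sum_Ico_consecutive _ (Nat.zero_le k) (by omega : k ≤ m + 1),
        sum_eq_zero (s := Finset.Ico 0 k), zero_add, mul_sum]
      · refine sum_congr rfl fun j hj => ?_
        have := (mem_Ico.1 hj).1
        rw [Bs, ← Nat.add_sub_cancel' this, pow_add, Nat.add_sub_cancel_left]; ring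
      · intro j hj
        have := (mem_Ico.1 hj).2
        rw [ih j this (by omega), zero_mul]
    rcases entire_mul (hA.pow k) (by fun_prop) h1 with h2 | h2
    · obtain ⟨z, hz⟩ := A_ne hq
      exact absurd (h2 z) (pow_ne_zero _ hz)
    · have := h2 0
      rw [sum_eq_single k] at this
      · rw [B_at0 hq] at this
        simpa using this
      · intro j hj hne
        have := (mem_Ico.1 hj).1
        rw [A_at0, zero_pow (by omega)]; ring
      · intro hh; exact absurd (mem_Ico.2 ⟨le_rfl, by omega⟩) hh

def Hm (m : ℕ) (q : ℂ) : Matrix (Fin (m + 1)) (Fin (m + 1)) ℂ := .of fun r j => row (hcB m j) (r : ℕ) q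

lemma RL_Bs {m : ℕ} (j : ℕ) (hj : j ≤ m) {q : ℂ} (hq : ‖q‖ < 1) : RL m (fun r => row (hcB m j) r q) q :=
  (hcB_spec m j).RL (ElS_Bs hj) (fun τ z _ => even_Bs z) hq

lemma RL.sub_sum {m : ℕ} {ρ : ℤ → ℂ} {q : ℂ} (h : RL m ρ q) (hq : ‖q‖ < 1) (x : Fin (m + 1) → ℂ) :
    RL m (fun r => ρ r - ∑ j : Fin (m + 1), x j * row (hcB m j) r q) q := by
  have hb : ∀ j : Fin (m + 1), RL m (fun r => row (hcB m j) r q) q := fun j => RL_Bs j (by omega) hq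
  refine ⟨fun r => ?_, fun r hr => ?_⟩
  · simp only []
    rw [h.1]; congr 1
    exact sum_congr rfl fun j _ => by have := (hb j).1 r; simp only [] at this; rw [this]
  · simp only []
    rw [h.2 r hr, mul_sub, mul_sum]; congr 1
    exact sum_congr rfl fun j _ => by have := (hb j).2 r hr; simp only [] at this; rw [this]; ring

lemma Bs_sum_rows {m : ℕ} {q : ℂ} (hq : ‖q‖ < 1) (x : Fin (m + 1) → ℂ) (z : ℂ) :
    HasSum (fun r : ℤ => (∑ j : Fin (m + 1), x j * row (hcB m j) r q) * ee (r * z)) (∑ j : Fin (m + 1), x j * Bs m j q z) := by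
  have : ∀ j : Fin (m + 1), j ∈ univ → HasSum (fun r : ℤ => x j * (row (hcB m j) r q * ee (r * z))) (x j * Bs m j q z) :=
    fun j _ => (((hcB_spec m j).sum_rows hq).2 z).mul_left _
  refine (hasSum_sum this).congr_fun' fun r => ?_
  rw [sum_mul]; exact sum_congr rfl fun j _ => by ring

lemma Hm_det {m : ℕ} (hm : 0 < m) {q : ℂ} (hq : ‖q‖ < 1) : (Hm m q).det ≠ 0 := by
  intro hdet
  obtain ⟨x, hx, hx0⟩ := Matrix.exists_mulVec_eq_zero_iff.2 hdet
  apply hx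
  have h0 : RL m (fun _ => (0:ℂ)) q := ⟨fun r => rfl, fun r _ => by simp⟩
  have h1 := (h0.sub_sum hq x).zero hm fun r hr => by
    have := congrFun hx0 ⟨r, by omega⟩
    simp only [Matrix.mulVec, dotProduct, Hm, Matrix.of_apply, Pi.zero_apply] at this
    rw [zero_sub, neg_eq_zero, ← this]
    exact sum_congr rfl fun j _ => mul_comm _ _
  have h2 : ∀ z, ∑ j : Fin (m + 1), x j * Bs m j q z = 0 := fun z => by
    refine (Bs_sum_rows hq x z).unique ?_
    have : ∀ r, ∑ j : Fin (m + 1), x j * row (hcB m j) r q = 0 := fun r => by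
      have := h1 r; rwa [zero_sub, neg_eq_zero] at this
    simp [this, hasSum_zero]
  have h3 := Bs_indep hq (fun j => if h : j < m + 1 then x ⟨j, h⟩ else 0) fun z => by
    conv_rhs => rw [← h2 z]
    rw [sum_range]
    exact sum_congr rfl fun j _ => by rw [dif_pos j.2]
  funext j
  have := h3 j (by omega)
  rwa [dif_pos j.2] at this

lemma Hol.prod {ι : Type*} {s : Finset ι} {F : ι → ℂ → ℂ} (hF : ∀ i ∈ s, Hol (F i)) :
    Hol (fun q => ∏ i ∈ s, F i q) := DifferentiableOn.fun_finsetProd hF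

lemma Hol.det {n : ℕ} {M : ℂ → Matrix (Fin n) (Fin n) ℂ} (h : ∀ i j, Hol fun q => M q i j) : Hol fun q => (M q).det := by
  simp only [Matrix.det_apply']
  exact Hol.sum fun σ _ => (Hol.const _).mul (Hol.prod fun i _ => h _ _)

lemma Hol.adj {n : ℕ} {M : ℂ → Matrix (Fin n) (Fin n) ℂ} (h : ∀ i j, Hol fun q => M q i j) (i j : Fin n) :
    Hol fun q => (M q).adjugate i j := by
  simp only [Matrix.adjugate_apply]
  refine Hol.det fun a b => ?_
  simp only [Matrix.updateRow_apply]
  split_ifs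
  · exact Hol.const _
  · exact h a b

lemma Hol_Hm (m : ℕ) (i j : Fin (m + 1)) : Hol fun q => Hm m q i j := ((hcB_spec m j).hol_row i).1

lemma Hol_Hinv {m : ℕ} (hm : 0 < m) (i j : Fin (m + 1)) : Hol fun q => (Hm m q)⁻¹ i j := by
  have := ((Hol.det (Hol_Hm m)).inv fun q hq => Hm_det hm hq).mul (Hol.adj (Hol_Hm m) i j)
  refine this.congr' fun q _ => ?_
  rw [Matrix.inv_def, Matrix.smul_apply, Ring.inverse_eq_inv', smul_eq_mul]

theorem structure_thm {m : ℕ} (hm : 0 < m) {c : ℕ → ℤ → ℂ} {Φ : ℂℂ} (h : DExp c Φ) (he : ElS m (fun τ z => Φ (ee τ) z))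
    (hev : ∀ τ z, 0 < τ.im → Φ (ee τ) (-z) = Φ (ee τ) z) : ∃ F : Fin (m + 1) → ℂ → ℂ, (∀ j, Hol (F j)) ∧
      (∀ q z, ‖q‖ < 1 → Φ q z = ∑ j, F j q * Bs m j q z) ∧
      ∀ q, ‖q‖ < 1 → ∀ r, row c r q = ∑ j, F j q * row (hcB m j) r q := by
  let F : Fin (m + 1) → ℂ → ℂ := fun j q => ∑ i, (Hm m q)⁻¹ j i * row c (i : ℕ) q
  have key : ∀ q, ‖q‖ < 1 → ∀ r, row c r q = ∑ j, F j q * row (hcB m j) r q := by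
    intro q hq r
    refine sub_eq_zero.1 (((h.RL he hev hq).sub_sum hq fun j => F j q).zero hm (fun r hr => ?_) r)
    have h1 : (Hm m q).mulVec ((Hm m q)⁻¹.mulVec fun i : Fin (m + 1) => row c (i : ℕ) q) = fun i : Fin (m + 1) => row c (i : ℕ) q := by
      rw [Matrix.mulVec_mulVec, Matrix.mul_nonsing_inv _ (isUnit_iff_ne_zero.2 (Hm_det hm hq)), Matrix.one_mulVec]
    have := congrFun h1 ⟨r, by omega⟩
    simp only [] at this
    rw [sub_eq_zero, ← this]
    simp only [Matrix.mulVec, dotProduct, Hm, Matrix.of_apply, F]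
    exact sum_congr rfl fun j _ => mul_comm _ _
  refine ⟨F, fun j => Hol.sum fun i _ => (Hol_Hinv hm j i).mul (h.hol_row _).1, fun q z hq => ?_, key⟩
  refine ((h.sum_rows hq).2 z).unique ((Bs_sum_rows hq (fun j => F j q) z).congr_fun' fun r => ?_)
  rw [key q hq r]

lemma den_ne {τ : ℂ} (ht : 0 < τ.im) {c d : ℤ} (h : c ≠ 0 ∨ d ≠ 0) : (c : ℂ) * τ + d ≠ 0 := by
  intro h0
  have hi : (c : ℝ) * τ.im = 0 := by simpa using congrArg Complex.im h0
  have hc : c = 0 := by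
    rcases mul_eq_zero.1 hi with h1 | h1
    · exact_mod_cast h1
    · exact absurd h1 ht.ne'
  subst hc
  simp at h0
  rcases h with h | h
  · exact h rfl
  · exact h h0

lemma det_ne {a b c d : ℤ} (h : a * d - b * c = 1) : (c ≠ 0 ∨ d ≠ 0) ∧ (a ≠ 0 ∨ b ≠ 0) := by
  constructor <;> by_contra! h' <;> simp [h'.1, h'.2] at h

lemma mob_im {τ : ℂ} (ht : 0 < τ.im) {a b c d : ℤ} (h : a * d - b * c = 1) : 0 < (((a : ℂ) * τ + b) / (c * τ + d)).im := by
  have hd := den_ne ht (det_ne h).1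
  have hn := Complex.normSq_pos.2 hd
  have h' : (a : ℝ) * d - b * c = 1 := by exact_mod_cast h
  rw [Complex.div_im]
  have : ((a : ℂ) * τ + b).im * ((c : ℂ) * τ + d).re / normSq ((c : ℂ) * τ + d) -
      ((a : ℂ) * τ + b).re * ((c : ℂ) * τ + d).im / normSq ((c : ℂ) * τ + d) = τ.im / normSq ((c : ℂ) * τ + d) := by
    rw [← sub_div]; congr 1
    simp
    linear_combination τ.im * h'
  rw [this]; positivity

def ML1 (k : ℤ) (m : ℕ) (φ : ℂℂ) (a b c d : ℤ) : Prop := ∀ τ : ℂ, 0 < τ.im → ∀ z : ℂ,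
    φ (((a : ℂ) * τ + (b : ℂ)) / ((c : ℂ) * τ + (d : ℂ))) (z / ((c : ℂ) * τ + (d : ℂ))) =
      ((c : ℂ) * τ + (d : ℂ)) ^ k *
        ee ((m : ℂ) * (c : ℂ) * z ^ 2 / ((c : ℂ) * τ + (d : ℂ))) * φ τ z

lemma ML1_S {k : ℤ} {m : ℕ} {φ : ℂℂ}
    (hS : ∀ τ z, 0 < τ.im → φ (-1 / τ) (z / τ) = τ ^ k * ee (m * (z ^ 2 / τ)) * φ τ z) {a b c d : ℤ}
    (hdet : a * d - b * c = 1) (ih : ML1 k m φ a b c d) : ML1 k m φ (-c) (-d) a b := by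
  intro τ ht z
  have ih := ih τ ht z
  have him := mob_im ht hdet
  have hd := den_ne ht (det_ne hdet).1
  have hn := den_ne ht (det_ne hdet).2
  have hdet' : (a : ℂ) * d - b * c = 1 := by exact_mod_cast hdet
  have h2 := hS _ (z / ((c : ℂ) * τ + d)) him
  rw [ih] at h2
  have en : (a : ℂ) * τ + b = a * τ + b := rfl
  push_cast
  generalize hD : (c : ℂ) * τ + d = D at *
  generalize hN : (a : ℂ) * τ + b = N at *
  rw [show -(c : ℂ) * τ + -d = -D by rw [← hD]; ring]
  rw [show -1 / (N / D) = -D / N by field_simp, show z / D / (N / D) = z / N by field_simp] at h2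
  have h3 : 1 + c * N = a * D := by rw [← hN, ← hD]; linear_combination -hdet'
  rw [h2, div_zpow, show (m : ℂ) * a * z ^ 2 / N = m * ((z / D) ^ 2 / (N / D)) + m * c * z ^ 2 / D by
    field_simp; linear_combination -(m : ℂ) * z ^ 2 * h3, ee_add]
  have := zpow_ne_zero k hd
  field_simp

lemma ML1_neg {k : ℤ} (hk : Even k) {m : ℕ} {φ : ℂℂ} (hev : ∀ τ z, 0 < τ.im → φ τ (-z) = φ τ z) {a b c d : ℤ}
    (hdet : a * d - b * c = 1) (ih : ML1 k m φ a b c d) : ML1 k m φ (-a) (-b) (-c) (-d) := by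
  intro τ ht z
  have ih := ih τ ht z
  have him := mob_im ht hdet
  push_cast
  rw [show -(c : ℂ) * τ + -d = -(c * τ + d) by ring, show -(a : ℂ) * τ + -b = -(a * τ + b) by ring, neg_div_neg_eq,
    div_neg, hev _ _ him, ih, hk.neg_zpow]
  rw [show (m : ℂ) * -(c : ℂ) * z ^ 2 / -(c * τ + d) = m * c * z ^ 2 / (c * τ + d) by
    rw [mul_neg, neg_mul, neg_div_neg_eq]]

lemma modlaw_of {k : ℤ} (hk : Even k) {m : ℕ} {φ : ℂℂ} (hT : ∀ τ z, 0 < τ.im → φ (τ + 1) z = φ τ z)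
    (hev : ∀ τ z, 0 < τ.im → φ τ (-z) = φ τ z)
    (hS : ∀ τ z, 0 < τ.im → φ (-1 / τ) (z / τ) = τ ^ k * ee (m * (z ^ 2 / τ)) * φ τ z) : ModularLaw k m φ := by
  have key : ∀ g : Matrix.SpecialLinearGroup (Fin 2) ℤ, ML1 k m φ (g 0 0) (g 0 1) (g 1 0) (g 1 1) := by
    intro g
    have hg : g ∈ Subgroup.closure {ModularGroup.S, ModularGroup.T} := by
      rw [SpecialLinearGroup.SL2Z_generators]; trivial
    induction hg using Subgroup.closure_induction_left with
    | one => intro τ ht z; simp [ee_zero]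
    | mul_left x hx g _ ih =>
      have hdet := g.det_coe
      rw [Matrix.det_fin_two] at hdet
      rcases hx with rfl | rfl
      · have e : ∀ i, (ModularGroup.S * g) 0 i = - g 1 i ∧ (ModularGroup.S * g) 1 i = g 0 i := fun i => by
          rw [Matrix.SpecialLinearGroup.coe_mul, ModularGroup.coe_S, Matrix.mul_apply, Matrix.mul_apply]
          simp [Fin.sum_univ_two]
        rw [(e 0).1, (e 0).2, (e 1).1, (e 1).2]
        exact ML1_S hS hdet ih
      · have e : ∀ i, (ModularGroup.T * g) 0 i = g 0 i + g 1 i ∧ (ModularGroup.T * g) 1 i = g 1 i := fun i => by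
          rw [Matrix.SpecialLinearGroup.coe_mul, ModularGroup.coe_T, Matrix.mul_apply, Matrix.mul_apply]
          simp [Fin.sum_univ_two]
        rw [(e 0).1, (e 0).2, (e 1).1, (e 1).2]
        intro τ ht z
        have hd := den_ne ht (det_ne hdet).1
        rw [← ih τ ht z, ← hT _ _ (mob_im ht hdet)]
        congr 1; rw [div_add_one hd]; congr 1; push_cast; ring
    | inv_mul_cancel x hx g _ ih =>
      have hdet := g.det_coe
      rw [Matrix.det_fin_two] at hdet
      rcases hx with rfl | rfl
      · have e : ∀ i, (ModularGroup.S⁻¹ * g) 0 i = g 1 i ∧ (ModularGroup.S⁻¹ * g) 1 i = -g 0 i := fun i => by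
          rw [Matrix.SpecialLinearGroup.coe_mul, Matrix.SpecialLinearGroup.coe_inv, ModularGroup.coe_S, Matrix.adjugate_fin_two,
            Matrix.mul_apply, Matrix.mul_apply]
          simp [Fin.sum_univ_two]
        rw [(e 0).1, (e 0).2, (e 1).1, (e 1).2]
        have := ML1_neg hk hev (by linarith) (ML1_S hS hdet ih)
        simpa only [neg_neg] using this
      · have e : ∀ i, (ModularGroup.T⁻¹ * g) 0 i = g 0 i - g 1 i ∧ (ModularGroup.T⁻¹ * g) 1 i = g 1 i := fun i => by
          rw [Matrix.SpecialLinearGroup.coe_mul, Matrix.SpecialLinearGroup.coe_inv, ModularGroup.coe_T, Matrix.adjugate_fin_two,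
            Matrix.mul_apply, Matrix.mul_apply]
          simp [Fin.sum_univ_two, sub_eq_add_neg]
        rw [(e 0).1, (e 0).2, (e 1).1, (e 1).2]
        intro τ ht z
        have hd := den_ne ht (det_ne hdet).1
        have h1 := mob_im ht hdet
        rw [← ih τ ht z]
        have him2 : 0 < (((g 0 0 : ℂ) * τ + (g 0 1 : ℂ)) / ((g 1 0 : ℂ) * τ + (g 1 1 : ℂ)) - 1).im := by
          rw [Complex.sub_im, Complex.one_im, sub_zero]; exact h1
        have := hT _ (z / ((g 1 0 : ℂ) * τ + (g 1 1 : ℂ))) him2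
        rw [sub_add_cancel] at this
        rw [this]
        congr 1; rw [div_sub_one hd]; congr 1; push_cast; ring
  intro τ ht z a b c d h
  have := key ⟨!![a, b; c, d], by rw [Matrix.det_fin_two_of]; exact h⟩ τ ht z
  simpa using this

def SLf (k : ℤ) (m : ℕ) (φ : ℂℂ) : Prop := ∀ τ z : ℂ, 0 < τ.im →
  φ (-1 / τ) (z / τ) = τ ^ k * ee (m * (z ^ 2 / τ)) * φ τ z

structure JF (m : ℕ) (C : ℤℤ) (φ : ℂℂ) : Prop where
  jx : JX m C φ
  law : ModularLaw 2 m φ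

lemma JF.sl {m : ℕ} {C : ℤℤ} {φ : ℂℂ} (h : JF m C φ) : SLf 2 m φ := fun τ z ht => by
  have := h.law τ ht z 0 (-1) 1 0 (by norm_num)
  simpa [mul_div_assoc] using this

lemma JF.even {m : ℕ} {C : ℤℤ} {φ : ℂℂ} (h : JF m C φ) : IsEvenC C := h.jx.even fun τ z ht => by
  have := h.law τ ht z (-1) 0 0 (-1) (by norm_num)
  simpa [ee_zero, div_neg] using this

lemma ZExp.T {c : ℤℤ} {φ : ℂℂ} (h : ZExp c φ) (τ z : ℂ) (ht : 0 < τ.im) : φ (τ + 1) z = φ τ z := by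
  refine (h (τ + 1) z (by simpa using ht)).unique ((h τ z ht).congr_fun' fun p => ?_)
  rw [show (p.1 : ℂ) * (τ + 1) + p.2 * z = (p.1 * τ + p.2 * z) + p.1 by ring, ee_add, ee_int, mul_one]

lemma JF_of_SL {m : ℕ} {C : ℤℤ} {φ : ℂℂ} (h : JX m C φ) (he : IsEvenC C) (hs : SLf 2 m φ) : JF m C φ :=
  ⟨h, modlaw_of ⟨1, rfl⟩ h.exp.T (fun τ z ht => h.even' he τ z ht) hs⟩

lemma SLaw_Bs {m j : ℕ} (h : j ≤ m) : SLaw (-(2 * j)) m (Bs m j) := fun τ z ht => by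
  have h0 := ne0_of_im ht
  rw [Bs, SLaw_A τ z ht, SLaw_B τ z ht, Bs, mul_pow, mul_pow, mul_pow, mul_pow, ← ee_natmul, ← ee_natmul, zpow_zero, one_pow,
    show (-(2 * (j : ℤ))) = (-2) * (j : ℤ) by ring, zpow_mul, zpow_natCast]
  have : ee (m * (z ^ 2 / τ)) = ee (j * ((1 : ℕ) * (z ^ 2 / τ))) * ee (((m - j : ℕ) : ℂ) * ((1 : ℕ) * (z ^ 2 / τ))) := by
    rw [← ee_add]; congr 1; rw [Nat.cast_sub h]; push_cast; ring
  rw [this]; ring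

lemma JF_mk {m : ℕ} (hm : 0 < m) {c : ℕ → ℤ → ℂ} {Φ : ℂℂ} (h : DExp c Φ) (he : ElS m (fun τ z => Φ (ee τ) z))
    (hev : ∀ τ z, 0 < τ.im → Φ (ee τ) (-z) = Φ (ee τ) z) (K : ℕ)
    (hS : SLf 2 m (fun τ z => ee (-(K * τ)) * Φ (ee τ) z)) :
    ∃ C, JF m C (fun τ z => ee (-(K * τ)) * Φ (ee τ) z) ∧
      (∀ (n : ℕ) r, C (4 * m * ((n : ℤ) - K) - r ^ 2) r = c n r) ∧
      ∀ n r : ℤ, n < -(K : ℤ) → C (4 * m * n - r ^ 2) r = 0 := by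
  obtain ⟨C, hC, hc⟩ := JX_of hm (h.toZ K) (fun τ z ht => by
    have := he τ z ht
    simp only [] at this
    rw [this]; ring) K (fun n r hn => by rw [if_neg (by omega)])
  refine ⟨C, JF_of_SL hC (hC.even fun τ z ht => by rw [hev τ z ht]) hS, fun n r => ?_, fun n r hn => ?_⟩
  · rw [hc, if_pos (by omega)]; congr 1; omega
  · rw [hc, if_neg (by omega)]

lemma JX.ElS {m : ℕ} {C : ℤℤ} {φ : ℂℂ} (h : JX m C φ) : ElS m φ := fun τ z ht => by
  have := h.law τ ht z 1 0
  simp only [Int.cast_one, Int.cast_zero, one_mul, add_zero, one_pow, mul_one] at this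
  rw [this]; congr 2; ring

theorem JX.struct {m : ℕ} (hm : 0 < m) {C : ℤℤ} {φ : ℂℂ} (h : JX m C φ) (he : IsEvenC C) {K : ℕ}
    (hK : ∀ Δ l : ℤ, Δ < -(4 * m * K : ℕ) → C Δ l = 0) : ∃ F : Fin (m + 1) → ℂ → ℂ, (∀ j, Hol (F j)) ∧
      (∀ τ z, 0 < τ.im → φ τ z = ee (-(K * τ)) * ∑ j, F j (ee τ) * Bs m j (ee τ) z) ∧
      (∀ r : ℤ, ∀ q, ‖q‖ < 1 → row (fun n r => C (4 * m * ((n : ℤ) - K) - r ^ 2) r) r q = ∑ j, F j q * row (hcB m j) r q) ∧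
      ∀ r : ℤ, Hol (row (fun n r => C (4 * m * ((n : ℤ) - K) - r ^ 2) r) r) ∧
        ps (row (fun n r => C (4 * m * ((n : ℤ) - K) - r ^ 2) r) r) = .mk fun n : ℕ => C (4 * m * ((n : ℤ) - K) - r ^ 2) r := by
  obtain ⟨Φ, hΦ, e⟩ := h.toD hm hK
  obtain ⟨F, hF, h1, h2⟩ := structure_thm hm hΦ (fun τ z ht => by
    simp only []
    rw [e _ _ ht, e _ _ ht, h.ElS τ z ht]; ring) (fun τ z ht => by rw [e _ _ ht, e _ _ ht, h.even' he τ z ht])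
  refine ⟨F, hF, fun τ z ht => ?_, fun r q hq => h2 q hq r, fun r => hΦ.hol_row r⟩
  rw [← h1 _ _ (norm_ee ht), e τ z ht, ← mul_assoc, ← ee_add, neg_add_cancel, ee_zero, one_mul]

lemma fderiv_theta {f g : ℂ × ℂ → ℂ} {p : ℂ × ℂ} (hf : DifferentiableAt ℂ f p) (hg : DifferentiableAt ℂ g p) (h : 0 < (g p).im) :
    DifferentiableAt ℂ (fun x => jacobiTheta₂ (f x) (g x)) p := by
  have h1 : DifferentiableAt ℂ (fun x : ℂ × ℂ => jacobiTheta₂ x.1 x.2) (f p, g p) := (hasFDerivAt_jacobiTheta₂ (f p) h).differentiableAt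
  exact h1.comp (f := fun x => (f x, g x)) p (hf.prodMk hg)

lemma Hol.comp_ee {F : ℂ → ℂ} (h : Hol F) {p : ℂ × ℂ} (hp : 0 < p.1.im) : DifferentiableAt ℂ (fun x : ℂ × ℂ => F (ee x.1)) p := by
  have h1 : DifferentiableAt ℂ F (ee p.1) := (h _ (by simpa using norm_ee hp)).differentiableAt (Metric.isOpen_ball.mem_nhds (by simpa using norm_ee hp))
  exact h1.comp (f := fun x : ℂ × ℂ => ee x.1) p ((diff_ee _).comp p differentiableAt_fst)

lemma jdiff_Bs (m j : ℕ) {p : ℂ × ℂ} (hp : 0 < p.1.im) : DifferentiableAt ℂ (fun x : ℂ × ℂ => Bs m j (ee x.1) x.2) p := by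
  have ho : ∀ᶠ x : ℂ × ℂ in 𝓝 p, 0 < x.1.im := by
    have : Continuous fun x : ℂ × ℂ => x.1.im := by fun_prop
    exact this.continuousAt.eventually (lt_mem_nhds hp)
  have hX : DifferentiableAt ℂ (fun x : ℂ × ℂ => Xf (ee x.1) x.2) p := by
    refine (fderiv_theta (f := fun x => 2 * x.2) (g := fun x => 2 * x.1) (by fun_prop) (by fun_prop) (two_im hp)).congr_of_eventuallyEq ?_
    filter_upwards [ho] with x hx using Xf_eq hx _
  have hY : DifferentiableAt ℂ (fun x : ℂ × ℂ => Yf (ee x.1) x.2) p := by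
    have h1 := fderiv_theta (f := fun x => 2 * x.2 + x.1) (g := fun x => 2 * x.1) (p := p) (by fun_prop) (by fun_prop) (two_im hp)
    have h2 : DifferentiableAt ℂ (fun x : ℂ × ℂ => ee x.2) p := (diff_ee _).comp p differentiableAt_snd
    refine (h2.mul h1).congr_of_eventuallyEq ?_
    filter_upwards [ho] with x hx using Yf_eq hx _
  have ha := hol_av.comp_ee hp
  have hb := hol_bv.comp_ee hp
  have hi := (Hol.id).comp_ee hp
  have hw := ((hol_Wv).inv fun _ h => Wv_ne h).comp_ee hp
  unfold Bs Aff Bff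
  fun_prop

lemma JX.diff {m : ℕ} (hm : 0 < m) {C : ℤℤ} {φ : ℂℂ} (h : JX m C φ) (he : IsEvenC C) (τ z : ℂ) (ht : 0 < τ.im) :
    DifferentiableAt ℂ (fun p : ℂ × ℂ => φ p.1 p.2) (τ, z) := by
  obtain ⟨K, hK⟩ := h.bdN hm
  obtain ⟨F, hF, h1, -⟩ := h.struct hm he hK
  have ho : ∀ᶠ x : ℂ × ℂ in 𝓝 (τ, z), 0 < x.1.im := by
    have : Continuous fun x : ℂ × ℂ => x.1.im := by fun_prop
    exact this.continuousAt.eventually (lt_mem_nhds ht)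
  have h2 : DifferentiableAt ℂ (fun x : ℂ × ℂ => ee (-(K * x.1)) * ∑ j, F j (ee x.1) * Bs m j (ee x.1) x.2) (τ, z) := by
    refine DifferentiableAt.mul ?_ (DifferentiableAt.fun_sum fun j _ => ((hF j).comp_ee ht).mul (jdiff_Bs m j ht))
    exact (diff_ee _).comp (f := fun x : ℂ × ℂ => -(K * x.1)) _ (by fun_prop)
  refine h2.congr_of_eventuallyEq ?_
  filter_upwards [ho] with x hx using h1 _ _ hx

lemma ee_Dh {τ : ℂ} (ht : 0 < τ.im) (K : ℕ) : ee (-(K * τ)) = Uv (ee τ) ^ K * (Dh (ee τ))⁻¹ ^ K := by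
  have := Uv_ne (norm_ee ht)
  rw [← mul_pow, Dh, mul_inv, mul_left_comm, mul_inv_cancel₀ this, mul_one, ee_neg, ee_natmul, inv_pow]

lemma JF.comps {m : ℕ} {C : ℤℤ} {φ : ℂℂ} (h : JF m C φ) {K : ℕ} {F : Fin (m + 1) → ℂ → ℂ} (hF : ∀ j, Hol (F j))
    (e : ∀ τ z, 0 < τ.im → φ τ z = ee (-(K * τ)) * ∑ j, F j (ee τ) * Bs m j (ee τ) z) (j : Fin (m + 1)) :
    MF (2 + 12 * K + 2 * (j : ℕ)) (fun q => F j q * Uv q ^ K) := by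
  refine ⟨(hF j).mul (hol_Uv.pow K), fun τ ht => ?_⟩
  have h0 := ne0_of_im ht
  have hi := im_S ht
  have hs : ∀ z, ∑ j : Fin (m + 1), (ee (-(K * (-1 / τ))) * F j (ee (-1 / τ)) * τ ^ (-(2 * ((j : ℕ) : ℤ))) -
      τ ^ (2 : ℤ) * (ee (-(K * τ)) * F j (ee τ))) * Bs m j (ee τ) z = 0 := by
    intro z
    have h1 := h.sl τ z ht
    rw [e _ _ hi, e _ _ ht] at h1
    have h2 : ee (m * (z ^ 2 / τ)) ≠ 0 := ee_ne _
    have h3 : ∀ j : Fin (m + 1), Bs m j (ee (-1 / τ)) (z / τ) = τ ^ (-(2 * ((j : ℕ) : ℤ))) * ee (m * (z ^ 2 / τ)) * Bs m j (ee τ) z :=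
      fun j => SLaw_Bs (Nat.lt_succ_iff.1 j.2) τ z ht
    simp only [h3, mul_sum] at h1
    rw [← sub_eq_zero, ← sum_sub_distrib] at h1
    apply mul_left_cancel₀ h2
    rw [mul_zero, ← h1, mul_sum]
    exact sum_congr rfl fun j _ => by ring
  have key := Bs_indep (m := m) (norm_ee ht) (fun j => if hj : j < m + 1 then (ee (-(K * (-1 / τ))) * F ⟨j, hj⟩ (ee (-1 / τ)) *
    τ ^ (-(2 * (j : ℤ))) - τ ^ (2 : ℤ) * (ee (-(K * τ)) * F ⟨j, hj⟩ (ee τ))) else 0) (fun z => by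
      rw [← Fin.sum_univ_eq_sum_range (fun j => (if hj : j < m + 1 then (ee (-(K * (-1 / τ))) * F ⟨j, hj⟩ (ee (-1 / τ)) *
    τ ^ (-(2 * (j : ℤ))) - τ ^ (2 : ℤ) * (ee (-(K * τ)) * F ⟨j, hj⟩ (ee τ))) else 0) * Bs m j (ee τ) z), ← hs z]
      exact sum_congr rfl fun j _ => by rw [dif_pos j.2]) j (Nat.lt_succ_iff.1 j.2)
  simp only [dif_pos j.2, Fin.eta] at key
  rw [ee_Dh ht, ee_Dh hi, MF_Dh.2 τ ht] at key
  have hd : Dh (ee τ) ≠ 0 := mul_ne_zero (ee_ne _) (Uv_ne (norm_ee ht))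
  simp only []
  rw [zpow_neg, mul_inv, mul_pow] at key
  rw [zpow_add₀ h0, zpow_add₀ h0, mul_comm (12 : ℤ), mul_comm (K : ℤ), zpow_mul, zpow_natCast]
  have hd' := pow_ne_zero K hd
  have ht' : (τ ^ (12 : ℤ)) ≠ 0 := zpow_ne_zero _ h0
  have ht3 := zpow_ne_zero (2 * ((j : ℕ) : ℤ)) h0
  simp only [inv_pow] at key
  generalize Dh (ee τ) ^ K = a at *
  have ht4 := pow_ne_zero K ht'
  generalize (τ ^ (12 : ℤ)) ^ K = b at *
  generalize τ ^ (2 * ((j : ℕ) : ℤ)) = c at *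
  generalize τ ^ (2 : ℤ) = d at *
  generalize -1 / τ = τ' at *
  field_simp at key
  linear_combination key

lemma JF_of {m : ℕ} (hm : 0 < m) {K : ℕ} {F : Fin (m + 1) → ℂ → ℂ} (hF : ∀ j : Fin (m + 1), MF (2 + 12 * K + 2 * (j : ℕ)) (F j)) :
    ∃ C φ, JF m C φ ∧ (∀ (n : ℕ) (r : ℤ), C (4 * m * ((n : ℤ) - K) - r ^ 2) r =
        ∑ j, (ps (F j) * ps (fun q => (Uv q)⁻¹ ^ K) * ps (row (hcB m j) r)).coeff n) ∧
      ∀ n r : ℤ, n < -(K : ℤ) → C (4 * m * n - r ^ 2) r = 0 := by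
  have hol1 : ∀ j, Hol fun q => F j q * (Uv q)⁻¹ ^ K := fun j => (hF j).1.mul (hol_Uinv K)
  have hw : WX ⊤ (fun q z => ∑ j : Fin (m + 1), F j q * (Uv q)⁻¹ ^ K * Bs m j q z) := by
    have : ∀ s : Finset (Fin (m + 1)), WX ⊤ (fun q z => ∑ j ∈ s, F j q * (Uv q)⁻¹ ^ K * Bs m j q z) := by
      intro s
      induction s using Finset.induction_on with
      | empty => simpa using WX.const (S := ⊤) 0 trivial
      | insert a s ha ih =>
        simp only [sum_insert ha]
        exact (((WX.disc (S := ⊤) (hol1 a) fun _ => trivial)).mul isClosed_univ (WX_Bs isClosed_univ m a)).add ih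
    exact this _
  obtain ⟨c, -, hc⟩ := hw
  obtain ⟨C, hC, h1, h2⟩ := JF_mk hm hc (fun τ z ht => by
    simp only [mul_sum]
    refine sum_congr rfl fun j _ => ?_
    have := ElS_Bs (Nat.lt_succ_iff.1 j.2) τ z ht
    simp only [] at this
    rw [this]; ring) (fun τ z ht => by simp only [even_Bs]) K (fun τ z ht => by
    have h0 := ne0_of_im ht
    have hi := im_S ht
    simp only [mul_sum]
    refine sum_congr rfl fun j _ => ?_
    have hU := Uv_ne (norm_ee ht)
    have hU' := Uv_ne (norm_ee hi)
    rw [SLaw_Bs (Nat.lt_succ_iff.1 j.2) τ z ht, (hF j).2 τ ht, ee_Dh ht, ee_Dh hi, MF_Dh.2 τ ht, zpow_neg, mul_inv, mul_pow]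
    rw [zpow_add₀ h0, zpow_add₀ h0, mul_comm (12 : ℤ), mul_comm (K : ℤ), zpow_mul, zpow_natCast]
    have hd : Dh (ee τ) ≠ 0 := mul_ne_zero (ee_ne _) (Uv_ne (norm_ee ht))
    simp only [inv_pow]
    have hd' := pow_ne_zero K hd
    have ht' := pow_ne_zero K (zpow_ne_zero 12 h0)
    have ht3 := zpow_ne_zero (2 * ((j : ℕ) : ℤ)) h0
    have hU1 := pow_ne_zero K hU
    have hU2 := pow_ne_zero K hU'
    generalize Dh (ee τ) ^ K = a at *
    generalize (τ ^ (12 : ℤ)) ^ K = b at *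
    generalize τ ^ (2 * ((j : ℕ) : ℤ)) = c at *
    generalize τ ^ (2 : ℤ) = d at *
    generalize -1 / τ = τ' at *
    generalize z ^ 2 / τ = w at *
    field_simp)
  refine ⟨C, _, hC, fun n r => ?_, h2⟩
  have hr : ∀ q, ‖q‖ < 1 → row c r q = ∑ j : Fin (m + 1), F j q * (Uv q)⁻¹ ^ K * row (hcB m j) r q := fun q hq =>
    congrFun (fourier_unique (fun x : ℝ => (hc.sum_rows hq).2 x) fun x : ℝ => Bs_sum_rows hq (fun j => F j q * (Uv q)⁻¹ ^ K) x) r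
  have hB : ∀ j : Fin (m + 1), Hol (row (hcB m j) r) := fun j => ((hcB_spec m j).hol_row r).1
  rw [h1]
  have := (hc.hol_row r).2
  rw [ps_congr hr, ps_sum fun j _ => (hol1 j).mul (hB j)] at this
  rw [show c n r = (PowerSeries.mk fun n => c n r).coeff n by simp, ← this, map_sum]
  exact sum_congr rfl fun j _ => by rw [ps_mul (hol1 j) (hB j), ps_mul (hF j).1 (hol_Uinv K)]

lemma per_gen {n : ℕ} {g : ℤ → ℂ} (hg : ∀ i, g (i + n) = g i) {x y : ℤ} (h : (n : ℤ) ∣ x - y) : g x = g y := by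
  obtain ⟨k, hk⟩ := h
  have : ∀ k : ℤ, g (y + n * k) = g y := fun k => by
    induction k using Int.induction_on with
    | zero => simp
    | succ k ih => rw [← ih, ← hg (y + n * k)]; congr 1; ring
    | pred k ih => rw [← ih, ← hg (y + n * (-k - 1))]; congr 1; ring
  rw [← this k]; congr 1; linarith

lemma sum_mod {n : ℕ} (hn : 0 < n) {g : ℤ → ℂ} (hg : ∀ i, g (i + n) = g i) (f : ℕ → ℤ)
    (hf : ∀ i < n, ∀ j < n, (n : ℤ) ∣ f i - f j → i = j) : ∑ i ∈ range n, g (f i) = ∑ i ∈ range n, g i := by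
  have hn' : (n : ℤ) ≠ 0 := by exact_mod_cast hn.ne'
  have e : ∀ i, (((f i % n).toNat : ℕ) : ℤ) = f i % n := fun i => Int.toNat_of_nonneg (Int.emod_nonneg _ hn')
  have hm : Set.MapsTo (fun i => (f i % n).toNat) (range n : Set ℕ) (range n) := fun i _ => by
    have := Int.emod_lt_of_pos (f i) (by exact_mod_cast hn : (0 : ℤ) < n)
    have := e i
    simp only [coe_range, Set.mem_Iio]; omega
  have hi : Set.InjOn (fun i => (f i % n).toNat) (range n : Set ℕ) := fun i hi j hj h => by
    simp only [coe_range, Set.mem_Iio] at hi hj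
    refine hf i hi j hj (Int.ModEq.dvd ?_)
    have h' : f i % n = f j % n := by rw [← e i, ← e j]; exact congrArg _ h
    exact h'.symm
  refine sum_nbij (fun i => (f i % n).toNat) hm hi (surjOn_of_injOn_of_card_le _ hm hi le_rfl) fun i _ => ?_
  refine per_gen hg ?_
  rw [e i]; exact Int.dvd_self_sub_emod

lemma sum_mod_neg {n : ℕ} (hn : 0 < n) {g : ℤ → ℂ} (hg : ∀ i, g (i + n) = g i) :
    ∑ i ∈ range n, g (-i) = ∑ i ∈ range n, g i :=
  sum_mod hn hg (fun i => -(i : ℤ)) fun i hi j hj ⟨k, hk⟩ => by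
    have : |(j : ℤ) - i| < n := by rw [abs_lt]; omega
    have := Int.eq_zero_of_abs_lt_dvd ⟨k, by linarith⟩ this
    omega

lemma sum_ee {a : ℕ} (ha : 0 < a) (k : ℤ) : ∑ i ∈ range a, ee (i * (k / a)) = if (a : ℤ) ∣ k then (a : ℂ) else 0 := by
  have ha' : (a : ℂ) ≠ 0 := by exact_mod_cast ha.ne'
  simp only [ee_natmul]
  split_ifs with h
  · obtain ⟨l, rfl⟩ := h
    have : ((a * l : ℤ) : ℂ) / a = l := by push_cast; field_simp
    rw [this, ee_int]; simp
  · have h1 : ee ((k : ℂ) / a) ≠ 1 := fun h1 => h (by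
      rw [ee, Complex.exp_eq_one_iff] at h1
      obtain ⟨n, hn⟩ := h1
      have hp : (2 * Real.pi * I : ℂ) ≠ 0 := Complex.two_pi_I_ne_zero
      have : (k : ℂ) / a = n := mul_left_cancel₀ hp (by rw [hn]; ring)
      rw [div_eq_iff ha'] at this
      exact ⟨n, by rw [mul_comm]; exact_mod_cast this⟩)
    rw [geom_sum_eq h1, ← ee_natmul, show (a : ℂ) * (k / a) = k by field_simp, ee_int, sub_self, zero_div]

def Ht (M a : ℕ) (φ : ℂℂ) (τ z : ℂ) (l u : ℤ) : ℂ :=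
  ee (M * (l ^ 2 * τ / a ^ 2 + 2 * l * z / a + l * u / a ^ 2)) * φ τ (z + (l * τ + u) / a)

def Hs (M a : ℕ) (φ : ℂℂ) (τ z : ℂ) : ℂ :=
  ∑ l ∈ range a, ∑ u ∈ range a, Ht M a φ τ z l u
section
variable {M a b : ℕ} {φ : ℂℂ}

lemma Ht_u (hM : M = a * b) (ha : 0 < a) (h : EllipticLaw M φ) {τ : ℂ} (ht : 0 < τ.im) (z : ℂ) (l u : ℤ) :
    Ht M a φ τ z l (u + a) = Ht M a φ τ z l u := by
  have ha' : (a : ℂ) ≠ 0 := by exact_mod_cast ha.ne'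
  have := h τ ht (z + (l * τ + u) / a) 0 1
  simp only [Int.cast_zero, zero_mul, add_zero, Int.cast_one, ne_eq, OfNat.ofNat_ne_zero, not_false_eq_true, zero_pow, mul_zero,
    ee_zero, one_mul] at this
  rw [Ht, Ht, show z + ((l : ℂ) * τ + ((u + a : ℤ) : ℂ)) / a = z + (l * τ + u) / a + 1 by
    push_cast; field_simp; ring, this]
  congr 1
  rw [show (M : ℂ) * ((l : ℂ) ^ 2 * τ / a ^ 2 + 2 * (l : ℂ) * z / a + (l : ℂ) * ((u + a : ℤ) : ℂ) / a ^ 2) =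
    (M : ℂ) * (l ^ 2 * τ / a ^ 2 + 2 * l * z / a + l * u / a ^ 2) + ((b * l : ℤ) : ℂ) by
      rw [hM]; push_cast; field_simp; ring, ee_add, ee_int, mul_one]

lemma Hs_SL {k : ℤ} (hM : M = a * b) (ha : 0 < a) (h : EllipticLaw M φ) (hs : SLf k M φ) : SLf k M (Hs M a φ) := fun τ z ht => by
  have h0 := ne0_of_im ht
  have ha' : (a : ℂ) ≠ 0 := by exact_mod_cast ha.ne'
  have e : ∀ l u : ℤ, Ht M a φ (-1 / τ) (z / τ) l u = τ ^ k * ee (M * (z ^ 2 / τ)) * Ht M a φ τ z u (-l) := fun l u => by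
    have := hs τ (z + (u * τ + ((-l : ℤ) : ℂ)) / a) ht
    rw [Ht, Ht, show z / τ + ((l : ℂ) * (-1 / τ) + u) / a = (z + (u * τ + ((-l : ℤ) : ℂ)) / a) / τ by
      push_cast; field_simp; ring, this,
      show ∀ A B C D E : ℂ, A * (B * C * D) = B * (A * C) * D from fun A B C D _ => by ring, ← ee_add,
      show ∀ A B C D : ℂ, A * B * (C * D) = A * (B * C) * D from fun A B C D => by ring, ← ee_add]
    congr 3; push_cast; field_simp; ring
    exact 0
  rw [Hs, Hs]
  simp only [e, ← mul_sum]
  congr 1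
  rw [sum_comm]
  refine sum_congr rfl fun l _ => ?_
  exact sum_mod_neg ha (g := fun u => Ht M a φ τ z l u) fun u => Ht_u hM ha h ht z l u

lemma Hs_exp (hM : M = a * b) (ha : 0 < a) {c : ℤℤ} (h : ZExp c φ) :
    ZExp (fun n r => a * ∑ l ∈ range a, if (a : ℤ) ∣ r - b * l then c (n - l * ((r - b * l) / a)) (r - 2 * b * l) else 0)
      (Hs M a φ) := fun τ z ht => by
  have ha' : (a : ℂ) ≠ 0 := by exact_mod_cast ha.ne'
  simp only [mul_sum, sum_mul]
  rw [Hs]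
  refine hasSum_sum fun l _ => ?_
  have h1 : HasSum (fun p : ℤ × ℤ => ∑ u ∈ range a, ee (M * (l ^ 2 * τ / a ^ 2 + 2 * l * z / a + l * u / a ^ 2)) *
      (c p.1 p.2 * ee (p.1 * τ + p.2 * (z + (l * τ + u) / a)))) (∑ u ∈ range a, Ht M a φ τ z l u) :=
    hasSum_sum fun u _ => by
      have := (h τ (z + (l * τ + u) / a) ht).mul_left (ee (M * (l ^ 2 * τ / a ^ 2 + 2 * l * z / a + l * u / a ^ 2)))
      rw [Ht]; push_cast; exact this
  let e : ℤ × ℤ ≃ ℤ × ℤ := ⟨fun p => (p.1 - l * ((p.2 - b * l) / a), p.2 - 2 * b * l), fun p => (p.1 + l * ((p.2 + b * l) / a), p.2 + 2 * b * l),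
    fun p => by ext <;> simp; rw [show p.2 - 2 * b * l + b * l = p.2 - b * l by ring]; ring,
    fun p => by ext <;> simp; rw [show p.2 + 2 * b * l - b * l = p.2 + b * l by ring]; ring⟩
  rw [← e.hasSum_iff] at h1
  refine h1.congr_fun' fun ⟨n, r⟩ => ?_
  simp only [Function.comp, e, Equiv.coe_fn_mk]
  have e2 : ∀ u : ℕ, ee (M * (l ^ 2 * τ / a ^ 2 + 2 * l * z / a + l * u / a ^ 2)) *
      (c (n - l * ((r - b * l) / a)) (r - 2 * b * l) * ee ((n - l * ((r - b * l) / a) : ℤ) * τ + (r - 2 * b * l : ℤ) * (z + (l * τ + u) / a))) =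
      c (n - l * ((r - b * l) / a)) (r - 2 * b * l) *
      ee ((n - l * ((r - b * l) / a) : ℤ) * τ + l * ((r - b * l : ℤ) / a) * τ + r * z) * ee (u * ((r - b * l : ℤ) / a)) := fun u => by
    rw [mul_left_comm, ← ee_add, mul_assoc (c _ _) (ee _) (ee _), ← ee_add]
    congr 2; rw [hM]; push_cast; field_simp; ring
  simp only [e2, ← mul_sum, sum_ee ha]
  split_ifs with hd
  · obtain ⟨k, hk⟩ := hd
    have : (a : ℤ) ≠ 0 := by exact_mod_cast ha.ne'
    rw [hk, Int.mul_ediv_cancel_left _ this]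
    rw [show ((n - l * k : ℤ) : ℂ) * τ + l * (((a * k : ℤ) : ℂ) / a) * τ + r * z = n * τ + r * z by push_cast; field_simp; ring]
    ring
  · ring
end
section
variable {m' t : ℕ} {C : ℤℤ} {φ : ℂℂ}

lemma CoeffU_eq (ht : 0 < t) (C : ℤℤ) (Δ l : ℤ) : CoeffU (t ^ 2 * m') t C Δ l =
    ∑ j ∈ range t, C (Δ * t ^ 2) ((l + 2 * m' * j) * t) := by
  have h : (t : ℤ) ^ 2 ≠ 0 := by positivity
  rw [CoeffU, show 2 * ((t ^ 2 * m' : ℕ) : ℤ) / (t : ℤ) ^ 2 = 2 * m' from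
    Int.ediv_eq_of_eq_mul_right h (by push_cast; ring)]

lemma CoeffU_perj (per : ∀ Δ l : ℤ, C Δ (l + 2 * ((t ^ 2 * m' : ℕ) : ℤ)) = C Δ l) (Δ l j : ℤ) :
    C (Δ * t ^ 2) ((l + 2 * m' * (j + t)) * t) = C (Δ * t ^ 2) ((l + 2 * m' * j) * t) :=
  per_dvd per ⟨1, by push_cast; ring⟩

lemma JX.U (ht : 0 < t) (h : JX (t ^ 2 * m') C φ) :
    JX m' (CoeffU (t ^ 2 * m') t C) (fun τ z => (t : ℂ)⁻¹ * Hs (t ^ 2 * m') t φ τ (z / t)) where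
  exp := by
    intro τ z hτ
    have ht' : (t : ℂ) ≠ 0 := by exact_mod_cast ht.ne'
    have ht2 : (t : ℤ) ≠ 0 := by exact_mod_cast ht.ne'
    have h1 := (Hs_exp (M := t ^ 2 * m') (b := t * m') (by ring) ht h.exp τ (z / t) hτ).mul_left (t : ℂ)⁻¹
    have hinj : Function.Injective (fun p : ℤ × ℤ => (p.1, p.2 * (t : ℤ))) := fun p p' e => by
      simp only [Prod.mk.injEq] at e
      exact Prod.ext e.1 (mul_right_cancel₀ ht2 e.2)
    rw [← hinj.hasSum_iff] at h1
    · refine h1.congr_fun' fun ⟨n, r⟩ => ?_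
      simp only [Function.comp]
      rw [CoeffU_eq ht, ← sum_mod_neg ht (g := fun j => C ((4 * m' * n - r ^ 2) * t ^ 2) ((r + 2 * m' * j) * t))
        (fun j => CoeffU_perj h.per _ _ _), mul_assoc (t : ℂ), inv_mul_cancel_left₀ ht',
        show (n : ℂ) * τ + ((r * t : ℤ) : ℂ) * (z / t) = n * τ + r * z by push_cast; field_simp]
      congr 1
      refine sum_congr rfl fun l _ => ?_
      have e : (r * t - ((t * m' : ℕ) : ℤ) * l) = t * (r - m' * l) := by push_cast; ring
      rw [e, if_pos (dvd_mul_right _ _), Int.mul_ediv_cancel_left _ ht2]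
      congr 1 <;> (push_cast; ring)
    · rintro ⟨n, r⟩ hr
      simp only []
      rw [sum_eq_zero, mul_zero, zero_mul, mul_zero]
      intro l _
      rw [if_neg]
      intro hd
      have h3 : (t : ℤ) ∣ r := (Int.dvd_iff_dvd_of_dvd_sub hd).mpr ⟨m' * l, by push_cast; ring⟩
      obtain ⟨k, rfl⟩ := h3
      exact hr ⟨(n, k), by simp [mul_comm]⟩
  per := fun Δ l => by
    rw [CoeffU_eq ht, CoeffU_eq ht, ← sum_mod ht (g := fun j => C (Δ * t ^ 2) ((l + 2 * m' * j) * t))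
        (fun j => CoeffU_perj h.per _ _ _) (fun i => (i : ℤ) + 1)]
    · refine sum_congr rfl fun j _ => ?_
      congr 1; ring
    · intro i hi j hj hd
      have : |(i : ℤ) - j| < t := by rw [abs_lt]; omega
      have := Int.eq_zero_of_abs_lt_dvd (by simpa using hd) this
      omega
  supp := fun Δ l hd => by
    have ht2 : (t : ℤ) ^ 2 ≠ 0 := by positivity
    rw [CoeffU_eq ht]
    refine sum_eq_zero fun j _ => h.supp _ _ fun ⟨k, hk⟩ => hd ?_
    refine ⟨k - l * j - m' * j ^ 2, mul_left_cancel₀ ht2 ?_⟩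
    push_cast at hk
    linear_combination hk
  bd := by
    obtain ⟨B, hB⟩ := h.bd
    refine ⟨min B 0, fun Δ l hΔ => ?_⟩
    rw [CoeffU_eq ht]
    refine sum_eq_zero fun j _ => hB _ _ ?_
    have h1 : (1 : ℤ) ≤ t := by exact_mod_cast ht
    have h2 : Δ < 0 := lt_of_lt_of_le hΔ (min_le_right _ _)
    have h3 : Δ < B := lt_of_lt_of_le hΔ (min_le_left _ _)
    have h4 : (1 : ℤ) ≤ t ^ 2 := by nlinarith
    nlinarith

lemma CoeffU_even (ht : 0 < t) (h : IsEvenC C) (per : ∀ Δ l : ℤ, C Δ (l + 2 * ((t ^ 2 * m' : ℕ) : ℤ)) = C Δ l) :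
    IsEvenC (CoeffU (t ^ 2 * m') t C) := fun Δ l => by
  rw [CoeffU_eq ht, CoeffU_eq ht, ← sum_mod_neg ht (g := fun j => C (Δ * t ^ 2) ((l + 2 * m' * j) * t))
        (fun j => CoeffU_perj per _ _ _)]
  refine sum_congr rfl fun j _ => ?_
  rw [← h]; congr 1; ring

lemma JF.U (ht : 0 < t) (h : JF (t ^ 2 * m') C φ) :
    JF m' (CoeffU (t ^ 2 * m') t C) (fun τ z => (t : ℂ)⁻¹ * Hs (t ^ 2 * m') t φ τ (z / t)) :=
  JF_of_SL (h.jx.U ht) (CoeffU_even ht h.even h.jx.per) fun τ z hτ => by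
    have ht' : (t : ℂ) ≠ 0 := by exact_mod_cast ht.ne'
    have := Hs_SL (M := t ^ 2 * m') (b := t * m') (by ring) ht h.jx.law h.sl τ (z / t) hτ
    have h0 := ne0_of_im hτ
    rw [show z / t / τ = z / τ / t by ring] at this
    rw [this, show ((t ^ 2 * m' : ℕ) : ℂ) * ((z / t) ^ 2 / τ) = m' * (z ^ 2 / τ) by push_cast; field_simp]
    ring
end

lemma CT {c : ℤℤ} {φ : ℂℂ} (h : ZExp c φ) (K : ℕ) (hK : ∀ n r, n < -(K : ℤ) → c n r = 0)
    (hs : ∀ τ : ℂ, 0 < τ.im → φ (-1 / τ) 0 = τ ^ 2 * φ τ 0) : Summable (c 0) ∧ ∑' r, c 0 r = 0 := by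
  set d : ℕ → ℂ := fun n => ∑' r, c (n - K) r with hd
  have key : ∀ τ : ℂ, 0 < τ.im → (∀ n, Summable (c n)) ∧ HasSum (fun n : ℕ => d n * ee τ ^ n) (ee (K * τ) * φ τ 0) := fun τ ht => by
    have h1 := h τ 0 ht
    simp only [mul_zero, add_zero] at h1
    have h1' : Summable (fun p : ℤ × ℤ => c p.1 p.2 * ee (p.1 * τ)) := h1.summable
    have hsum : ∀ n, Summable (c n) := fun n => by
      have h5 : Summable (fun r : ℤ => c n r * ee (n * τ)) := h1'.prod_factor n
      exact (summable_mul_right_iff (ee_ne _)).mp h5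
    refine ⟨hsum, ?_⟩
    have h2 : HasSum (fun n : ℤ => (∑' r, c n r) * ee (n * τ)) (φ τ 0) := HasSum.prod_fiberwise h1 fun n => ((hsum n).hasSum.mul_right (ee (n * τ)))
    have h3 := h2.mul_left (ee (K * τ))
    have hinj : Function.Injective (fun n : ℕ => (n : ℤ) - K) := fun a b e => by simpa using e
    rw [← hinj.hasSum_iff] at h3
    · refine h3.congr_fun' fun n => ?_
      simp only [Function.comp, hd]
      rw [mul_left_comm, ← ee_add, ← ee_natmul]; congr 2; push_cast; ring
    · intro n hn
      have : n < -(K : ℤ) := by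
        by_contra hc
        exact hn ⟨(n + K).toNat, by simp only; omega⟩
      simp [hK n _ this]
  have hI : (0 : ℝ) < I.im := by simp
  refine ⟨(key I hI).1 0, ?_⟩
  have hsm : ∀ q : ℂ, ‖q‖ < 1 → Summable (fun n => d n * q ^ n) := fun q hq => by
    rcases eq_or_ne q 0 with rfl | h0
    · refine summable_of_ne_finset_zero (s := {0}) fun n hn => ?_
      have : n ≠ 0 := by simpa using hn
      simp [this]
    · obtain ⟨τ, ht, rfl⟩ := ee_surj hq h0
      exact (key τ ht).2.summable
  obtain ⟨hH, hp⟩ := hol_tsum d hsm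
  have := residue_thm K (fun q => ∑' n, d n * q ^ n) (⟨hH, fun τ ht => by
    have hS := im_S ht
    simp only [((key τ ht).2).tsum_eq, ((key _ hS).2).tsum_eq]
    rw [hs τ ht, ← ee_natmul, ← ee_natmul]; ring⟩ : RW2 K (fun q => ∑' n, d n * q ^ n))
  rw [hp, PowerSeries.coeff_mk] at this
  simpa [hd] using this

lemma JF.R0 {a b : ℕ} (ha : 0 < a) (hb : 0 < b) (hab : Nat.Coprime a b) {C : ℤℤ} {φ : ℂℂ} (h : JF (a * b) C φ) :
    ∑' r : ℤ, C (-(r ^ 2)) (lstar a b r) = 0 := by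
  have haZ : (0 : ℤ) < a := by exact_mod_cast ha
  have hg : (1 : ℤ) = a * Nat.gcdA a b + b * Nat.gcdB a b := by
    rw [← Nat.gcd_eq_gcd_ab, hab.gcd_eq_one]; rfl
  set x := Nat.gcdA a b
  set y := Nat.gcdB a b
  obtain ⟨K, hK⟩ := h.jx.bdN (Nat.mul_pos ha hb)
  have h1 := Hs_exp (M := a * b) rfl ha h.jx.exp
  have h2 := Hs_SL (M := a * b) rfl ha h.jx.law h.sl
  have e : ∀ n r : ℤ, ((a : ℂ) * ∑ l ∈ range a, if (a : ℤ) ∣ r - b * l then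
      C (4 * ((a * b : ℕ) : ℤ) * (n - l * ((r - b * l) / a)) - (r - 2 * b * l) ^ 2) (r - 2 * b * l) else 0) =
      a * C (4 * ((a * b : ℕ) : ℤ) * n - r ^ 2) (lstar a b r) := fun n r => by
    congr 1
    have hl : (((r * y % a).toNat : ℕ) : ℤ) = r * y % a := Int.toNat_of_nonneg (Int.emod_nonneg _ haZ.ne')
    have hlt := Int.emod_lt_of_pos (r * y) haZ
    have hdm := Int.emod_add_mul_ediv (r * y) a
    rw [sum_eq_single (r * y % a).toNat]
    · rw [hl]
      have e1 : r - b * (r * y % a) = a * (r * x + b * (r * y / a)) := by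
        linear_combination r * hg - b * hdm
      rw [e1, if_pos (dvd_mul_right _ _), Int.mul_ediv_cancel_left _ haZ.ne']
      rw [show 4 * ((a * b : ℕ) : ℤ) * (n - (r * y % a) * (r * x + b * (r * y / a))) - (r - 2 * b * (r * y % a)) ^ 2 =
        4 * ((a * b : ℕ) : ℤ) * n - r ^ 2 by push_cast; linear_combination 4 * b * (r * y % a) * e1]
      refine per_dvd h.jx.per ⟨r * y / a, ?_⟩
      rw [lstar]; push_cast
      linear_combination (-2 * b) * hdm + r * hg
    · intro l hl1 hl2
      rw [if_neg]
      rintro ⟨k, hk⟩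
      apply hl2
      have : r * y - l = a * (y * k - x * l) := by linear_combination y * hk - l * hg
      have h3 : r * y % a = l % a := Int.ModEq.symm ((Int.modEq_iff_dvd).mpr ⟨_, this⟩)
      rw [h3]
      have := mem_range.mp hl1
      rw [Int.emod_eq_of_lt (by positivity) (by exact_mod_cast this)]; simp
    · intro hc
      exact absurd (mem_range.mpr (by omega)) hc
  simp only [e] at h1
  have := (CT h1 K (fun n r hn => by
    rw [hK, mul_zero]
    have : (0 : ℤ) < ((a * b : ℕ) : ℤ) := by exact_mod_cast Nat.mul_pos ha hb
    push_cast at this ⊢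
    nlinarith [sq_nonneg r]) fun τ ht => by
      have := h2 τ 0 ht
      simpa [ee_zero] using this).2
  simp only [mul_zero, zero_sub] at this
  rw [tsum_mul_left] at this
  exact (mul_eq_zero.mp this).resolve_left (by exact_mod_cast ha.ne')

lemma JF.R {m m₁ m₂ : ℕ} (hm : 0 < m) (he : m₁ * m₂ = m) {C : ℤℤ} {φ : ℂℂ} (h : JF m C φ) :
    Rfactor m C m₁ m₂ = 0 := by
  subst he
  obtain ⟨a, b, hab, h1, h2⟩ := Nat.exists_coprime m₁ m₂
  have hp1 := Nat.pos_of_mul_pos_right hm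
  have hp2 := Nat.pos_of_mul_pos_left hm
  set t := Nat.gcd m₁ m₂ with ht
  have ht0 : 0 < t := Nat.gcd_pos_of_pos_left _ hp1
  rw [Rfactor, ← ht, show m₁ / t = a by rw [h1, Nat.mul_div_cancel _ ht0], show m₂ / t = b by rw [h2, Nat.mul_div_cancel _ ht0]]
  have e : m₁ * m₂ = t ^ 2 * (a * b) := by rw [h1, h2]; ring
  rw [e] at h hm ⊢
  have hab0 : 0 < a * b := Nat.pos_of_mul_pos_left hm
  exact (h.U ht0).R0 (Nat.pos_of_mul_pos_right hab0) (Nat.pos_of_mul_pos_left hab0) hab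

lemma JF.resPrim {m : ℕ} (hm : 0 < m) {C : ℤℤ} {φ : ℂℂ} (h : JF m C φ) : ResPrim m C := by
  intro t ht hd m₁ m₂ he
  obtain ⟨m', rfl⟩ := hd
  have ht0 : 0 < t := by omega
  rw [Nat.mul_div_cancel_left _ (by positivity)] at he ⊢
  exact (h.U ht0).R (Nat.pos_of_mul_pos_left hm) he

lemma sum_range_mul' (t g : ℕ) (f : ℕ → ℂ) : ∑ i ∈ range (t * g), f i = ∑ i ∈ range t, ∑ j ∈ range g, f (g * i + j) := by
  induction t with
  | zero => simp
  | succ t ih => rw [sum_range_succ, ← ih, Nat.succ_mul, sum_range_add]; simp only [mul_comm]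

lemma CoeffU_CoeffU {m t g : ℕ} (ht : 0 < t) (hg : 0 < g) (C : ℤℤ) :
    CoeffU (g ^ 2 * m) g (CoeffU (t ^ 2 * (g ^ 2 * m)) t C) = CoeffU ((t * g) ^ 2 * m) (t * g) C := by
  ext Δ l
  rw [CoeffU_eq hg, CoeffU_eq (by positivity)]
  simp only [CoeffU_eq ht]
  rw [sum_range_mul', sum_comm]
  refine sum_congr rfl fun i _ => sum_congr rfl fun j _ => ?_
  congr 1 <;> (push_cast; ring)

def Vp (p : ℕ) (φ : ℂℂ) (τ z : ℂ) : ℂ := p * φ (p * τ) (p * z) + (p : ℂ)⁻¹ * ∑ b ∈ range p, φ ((τ + b) / p) z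

lemma im_pmul {τ : ℂ} (ht : 0 < τ.im) {p : ℕ} (hp : 0 < p) : 0 < ((p : ℂ) * τ).im := by
  have : (0 : ℝ) < p := by exact_mod_cast hp
  simp; positivity

lemma im_pdiv {τ : ℂ} (ht : 0 < τ.im) {p : ℕ} (hp : 0 < p) (b : ℤ) : 0 < ((τ + b) / p : ℂ).im := by
  have : (0 : ℝ) < p := by exact_mod_cast hp
  rw [show (p : ℂ) = ((p : ℝ) : ℂ) by simp, Complex.div_ofReal_im]
  simp; positivity
section
variable {m p : ℕ} {φ : ℂℂ} {C : ℤℤ}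

lemma Vp_ElS (hp : 0 < p) (h : EllipticLaw m φ) : ElS (m * p) (Vp p φ) := fun τ z ht => by
  have hp' : (p : ℂ) ≠ 0 := by exact_mod_cast hp.ne'
  have h1 := h _ (im_pmul ht hp) (p * z) 1 0
  simp only [Int.cast_one, Int.cast_zero, one_mul, add_zero, one_pow, mul_one] at h1
  rw [Vp, Vp, mul_add (p : ℂ) z τ, h1, show -(m : ℂ) * (p * τ + 2 * (p * z)) = -((m * p : ℕ) * (τ + 2 * z)) by push_cast; ring]
  have h2 : ∀ b : ℕ, φ ((τ + b) / p) (z + τ) = ee (-((m * p : ℕ) * (τ + 2 * z))) * φ ((τ + b) / p) z := fun b => by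
    have := h _ (im_pdiv ht hp b) z p (-b)
    rw [show z + ((p : ℤ) : ℂ) * ((τ + (b : ℤ)) / p) + ((-b : ℤ) : ℂ) = z + τ by push_cast; field_simp; ring,
      show -(m : ℂ) * (((p : ℤ) : ℂ) ^ 2 * ((τ + (b : ℤ)) / p) + 2 * ((p : ℤ) : ℂ) * z) = -((m * p : ℕ) * (τ + 2 * z)) + ((-(m * p * b) : ℤ) : ℂ) by
        push_cast; field_simp; ring, ee_add, ee_int, mul_one] at this
    simpa using this
  simp only [h2, ← mul_sum]; ring

lemma Vp_SL [hpp : Fact p.Prime] (h : ModularLaw 2 m φ) : SLf 2 (m * p) (Vp p φ) := fun τ z ht => by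
  have hp : 0 < p := hpp.out.pos
  have h0 := ne0_of_im ht
  have hp' : (p : ℂ) ≠ 0 := by exact_mod_cast hp.ne'
  have hS : SLf 2 m φ := fun τ z ht => by
    have := h τ ht z 0 (-1) 1 0 (by norm_num)
    simp only [Int.cast_zero, zero_mul, Int.cast_neg, Int.cast_one, zero_add, one_mul, add_zero, mul_one] at this
    rw [this, mul_div_assoc]
  have hT : ∀ τ z, 0 < τ.im → φ (τ + 1) z = φ τ z := fun τ z ht => by
    have := h τ ht z 1 1 0 1 (by norm_num)
    simpa [ee_zero] using this
  set J := τ ^ (2 : ℤ) * ee ((m * p : ℕ) * (z ^ 2 / τ)) with hJ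
  have a1 : (p : ℂ) * φ (p * (-1 / τ)) (p * (z / τ)) = J * ((p : ℂ)⁻¹ * φ ((τ + (0 : ℤ)) / p) z) := by
    have := hS _ z (im_pdiv ht hp 0)
    simp only [Int.cast_zero, add_zero] at this ⊢
    rw [show (p : ℂ) * (-1 / τ) = -1 / (τ / p) by field_simp, show (p : ℂ) * (z / τ) = z / (τ / p) by field_simp, this, hJ,
      show (m : ℂ) * (z ^ 2 / (τ / p)) = (m * p : ℕ) * (z ^ 2 / τ) by push_cast; field_simp, div_zpow]
    generalize ee _ = E
    rw [zpow_ofNat, zpow_ofNat]; field_simp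
  have a2 : φ ((-1 / τ + (0 : ℕ)) / p) (z / τ) = J * (p ^ 2 * φ (p * τ) (p * z)) := by
    have := hS _ (p * z) (im_pmul ht hp)
    rw [show (-1 / τ + (0 : ℕ)) / p = -1 / (p * τ) by simp; field_simp, show z / τ = p * z / (p * τ) by field_simp, this, hJ,
      show (m : ℂ) * ((p * z) ^ 2 / (p * τ)) = (m * p : ℕ) * (z ^ 2 / τ) by push_cast; field_simp, mul_zpow]
    generalize ee _ = E
    rw [zpow_ofNat, zpow_ofNat]; ring
  have hinv : ∀ b : ℕ, b ≠ 0 → b < p → ∃ x b' : ℤ, b * b' + x * p = -1 := fun b hb hbp => by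
    have hc : Nat.Coprime b p := ((Nat.Prime.coprime_iff_not_dvd hpp.out).mpr fun hd => absurd (Nat.le_of_dvd (by omega) hd) (by omega)).symm
    have := Nat.gcd_eq_gcd_ab b p
    rw [hc.gcd_eq_one] at this
    exact ⟨-Nat.gcdB b p, -Nat.gcdA b p, by push_cast at this; linear_combination this⟩
  choose! x b' hb using hinv
  have a3 : ∀ b : ℕ, b ≠ 0 → b < p → φ ((-1 / τ + b) / p) (z / τ) = J * φ ((τ + b' b) / p) z := fun b h1 h2 => by
    have e := hb b h1 h2
    have e' : (b : ℂ) * b' b + x b * p = -1 := by exact_mod_cast e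
    have := h _ (im_pdiv ht hp (b' b)) z b (x b) p (-(b' b)) (by linear_combination -e)
    have hd : ((p : ℤ) : ℂ) * ((τ + b' b) / p) + ((-(b' b) : ℤ) : ℂ) = τ := by push_cast; field_simp; ring
    rw [hd] at this
    rw [show (-1 / τ + b) / (p : ℂ) = (((b : ℤ) : ℂ) * ((τ + b' b) / p) + x b) / τ by
      push_cast; field_simp; linear_combination -e', this, hJ]
    congr 3; push_cast; ring
  set g : ℤ → ℂ := fun i => φ ((τ + i) / p) z with hg
  have hgp : ∀ i, g (i + p) = g i := fun i => by
    have := hT _ z (im_pdiv ht hp i)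
    simp only [hg]; rw [← this]; congr 1; push_cast; field_simp; ring
  set f : ℕ → ℤ := fun i => if i = 0 then 0 else b' i with hf
  have hsum := sum_mod hp hgp f (fun i hi j hj ⟨k, hk⟩ => by
    simp only [hf] at hk
    have key : ∀ i j : ℕ, i < p → j < p → (p : ℤ) ∣ i - j → i = j := fun i j hi hj hd => by
      have : |(i : ℤ) - j| < p := by rw [abs_lt]; omega
      have := Int.eq_zero_of_abs_lt_dvd hd this
      omega
    have np : ∀ i y : ℤ, (p : ℤ) * i ≠ -1 := fun i y hh => by
      have : (p : ℤ) ∣ 1 := ⟨-i, by linarith⟩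
      have := Int.eq_one_of_dvd_one (by positivity) this
      exact hpp.out.one_lt.ne' (by exact_mod_cast this)
    split_ifs at hk with h1 h2 h2
    · omega
    · exact (np (-(j * k) + x j) 0 (by linear_combination hb j h2 hj + (j : ℤ) * hk)).elim
    · exact (np ((i * k) + x i) 0 (by linear_combination hb i h1 hi - (i : ℤ) * hk)).elim
    · refine key i j hi hj ⟨(i * j * k) + j * x i - i * x j, ?_⟩
      linear_combination i * (hb j h2 hj) - j * hb i h1 hi + (i * j : ℤ) * hk)
  obtain ⟨p', rfl⟩ : ∃ p', p = p' + 1 := ⟨p - 1, by omega⟩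
  rw [Vp, Vp, a1]
  have s1 : ∑ b ∈ range (p' + 1), φ ((τ + b) / (p' + 1 : ℕ)) z = ∑ i ∈ range (p' + 1), g i :=
    sum_congr rfl fun i _ => by simp [hg]
  rw [s1, ← hsum, sum_range_succ', sum_range_succ', a2]
  rw [sum_congr rfl fun i hi => a3 (i + 1) (by omega) (by have := mem_range.mp hi; omega), ← mul_sum]
  have s2 : ∑ i ∈ range p', g (f (i + 1)) = ∑ i ∈ range p', φ ((τ + b' (i + 1)) / (p' + 1 : ℕ)) z :=
    sum_congr rfl fun i _ => by simp [hg, hf]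
  rw [s2, show g (f 0) = φ ((τ + (0 : ℤ)) / (p' + 1 : ℕ)) z by simp [hg, hf]]
  generalize ((p' + 1 : ℕ) : ℂ) = P at *
  field_simp; ring

lemma Vp_exp (hp : 0 < p) {c : ℤℤ} (h : ZExp c φ) :
    ZExp (fun n r => c (n * p) r + if (p : ℤ) ∣ n ∧ (p : ℤ) ∣ r then p * c (n / p) (r / p) else 0) (Vp p φ) := fun τ z ht => by
  have hp' : (p : ℂ) ≠ 0 := by exact_mod_cast hp.ne'
  have hp2 : (p : ℤ) ≠ 0 := by exact_mod_cast hp.ne'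
  rw [Vp, add_comm]
  simp only [add_mul]
  refine HasSum.add ?_ ?_
  · have h1 : HasSum (fun q : ℤ × ℤ => ∑ b ∈ range p, c q.1 q.2 * ee (q.1 * ((τ + b) / p) + q.2 * z)) (∑ b ∈ range p, φ ((τ + b) / p) z) :=
      hasSum_sum fun b _ => h _ z (by simpa using im_pdiv ht hp b)
    have h2 := h1.mul_left (p : ℂ)⁻¹
    have hinj : Function.Injective (fun q : ℤ × ℤ => (q.1 * (p : ℤ), q.2)) := fun q q' e => by
      simp only [Prod.mk.injEq] at e
      exact Prod.ext (mul_right_cancel₀ hp2 e.1) e.2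
    have e2 : ∀ n r : ℤ, ∑ b ∈ range p, c n r * ee (n * ((τ + b) / p) + r * z) = c n r * ee (n * (τ / p) + r * z) * if (p : ℤ) ∣ n then (p : ℂ) else 0 := fun n r => by
      rw [← sum_ee hp, mul_sum]
      refine sum_congr rfl fun b _ => ?_
      rw [mul_assoc, ← ee_add]; congr 2; ring
    simp only [e2] at h2
    rw [← hinj.hasSum_iff] at h2
    · refine h2.congr_fun' fun ⟨n, r⟩ => ?_
      simp only [Function.comp]
      rw [if_pos (dvd_mul_left _ _), show ((n * p : ℤ) : ℂ) * (τ / p) = n * τ by push_cast; field_simp]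
      field_simp
    · rintro ⟨n, r⟩ hr
      simp only []
      rw [if_neg, mul_zero, mul_zero]
      rintro ⟨k, rfl⟩
      exact hr ⟨(k, r), by simp [mul_comm]⟩
  · have h2 := (h _ (p * z) (im_pmul ht hp)).mul_left (p : ℂ)
    have hinj : Function.Injective (fun q : ℤ × ℤ => (q.1 * (p : ℤ), q.2 * (p : ℤ))) := fun q q' e => by
      simp only [Prod.mk.injEq] at e
      exact Prod.ext (mul_right_cancel₀ hp2 e.1) (mul_right_cancel₀ hp2 e.2)
    refine (hinj.hasSum_iff ?_).mp (h2.congr_fun' fun ⟨n, r⟩ => ?_)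
    · rintro ⟨n, r⟩ hr
      rw [if_neg, zero_mul]
      rintro ⟨⟨k, hk⟩, ⟨l, hl⟩⟩
      exact hr ⟨(k, l), by simp only [] at hk hl ⊢; rw [hk, hl, mul_comm, mul_comm l]⟩
    · simp only [Function.comp]
      rw [if_pos ⟨dvd_mul_left _ _, dvd_mul_left _ _⟩, Int.mul_ediv_cancel _ hp2, Int.mul_ediv_cancel _ hp2, mul_assoc]
      congr 3; push_cast; ring

lemma JF.V (hm : 0 < m) (hpp : p.Prime) (h : JF m C φ) : ∃ C', JF (m * p) C' (Vp p φ) ∧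
    ∀ n r : ℤ, C' (4 * (m * p : ℕ) * n - r ^ 2) r = C (4 * m * (n * p) - r ^ 2) r +
      if (p : ℤ) ∣ n ∧ (p : ℤ) ∣ r then p * C (4 * m * (n / p) - (r / p) ^ 2) (r / p) else 0 := by
  have hp := hpp.pos
  have := Fact.mk hpp
  have hmp : 0 < m * p := Nat.mul_pos hm hp
  have hmZ : (0 : ℤ) < m := by exact_mod_cast hm
  have hpZ : (0 : ℤ) < p := by exact_mod_cast hp
  have hpZ1 : (1 : ℤ) ≤ p := by exact_mod_cast hp
  obtain ⟨K, hK⟩ := h.jx.bdN hm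
  have hK' : ∀ n r r' : ℤ, n < -(K : ℤ) → C (4 * m * n - r ^ 2) r' = 0 := fun n r r' hn => hK _ _ (by
    push_cast; nlinarith [sq_nonneg r])
  obtain ⟨C', h1, h2⟩ := JX_of hmp (Vp_exp hp h.jx.exp) (Vp_ElS hp h.jx.law) (p * K) (fun n r hn => by
    push_cast at hn
    rw [hK', zero_add]
    · split_ifs with hd
      · obtain ⟨⟨k, rfl⟩, -⟩ := hd
        rw [Int.mul_ediv_cancel_left _ hpZ.ne', hK', mul_zero]
        nlinarith
      · rfl
    · have : (K : ℤ) ≤ p * K := by nlinarith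
      nlinarith)
  refine ⟨C', JF_of_SL h1 (h1.even fun τ z ht => ?_) (Vp_SL h.law), h2⟩
  have hev := fun τ z ht => h.jx.even' h.even τ z ht
  rw [Vp, Vp, mul_neg, hev _ _ (im_pmul ht hp)]
  congr 2
  exact sum_congr rfl fun b _ => hev _ _ (by simpa using im_pdiv ht hp b)
end

def nuP (p : ℕ) (Δ : ℤ) : ℕ := ((range p).filter fun s : ℕ => (p : ℤ) ∣ Δ + (s : ℤ) ^ 2).card

lemma cop_dvd {p m : ℕ} (hp : p.Prime) (hpm : ¬ p ∣ 2 * m) {x : ℤ} : (p : ℤ) ∣ 2 * m * x → (p : ℤ) ∣ x := fun h => by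
  rcases (Nat.prime_iff_prime_int.mp hp).dvd_or_dvd h with h | h
  · exact (hpm (by exact_mod_cast h)).elim
  · exact h

lemma sum_lin {p m : ℕ} (hp : p.Prime) (hpm : ¬ p ∣ 2 * m) {g : ℤ → ℂ} (hg : ∀ i, g (i + p) = g i) (l : ℤ) :
    ∑ j ∈ range p, g (l + 2 * m * j) = ∑ j ∈ range p, g j :=
  sum_mod hp.pos hg (fun j => l + 2 * m * j) fun i hi j hj hd => by
    have h1 : (p : ℤ) ∣ (i : ℤ) - j := cop_dvd hp hpm (by convert hd using 1; ring)
    have : |(i : ℤ) - j| < p := by rw [abs_lt]; omega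
    have := Int.eq_zero_of_abs_lt_dvd h1 this
    omega

lemma JF.hecke {m p : ℕ} {φ : ℂℂ} {C : ℤℤ} (hm : 0 < m) (hp : p.Prime) (hpm : ¬ p ∣ 2 * m) {pb : ℤ} (hpb : 2 * (m : ℤ) ∣ pb * p - 1)
    (h : JF m C φ) : ∃ C' φ', JF m C' φ' ∧ ∀ Δ l : ℤ, (4 * (m : ℤ)) ∣ Δ + l ^ 2 →
      C' Δ l = p * (C (Δ * p ^ 2) (p * l) + (p + nuP p Δ) * C Δ l + if (p : ℤ) ^ 2 ∣ Δ then p * C (Δ / p ^ 2) (pb * l) else 0) := by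
  obtain ⟨C1, h1, e1⟩ := h.V hm hp
  obtain ⟨C2, h2, e2⟩ := h1.V (Nat.mul_pos hm hp.pos) hp
  have hpZ : (p : ℤ) ≠ 0 := by exact_mod_cast hp.ne_zero
  have hpP : Prime (p : ℤ) := Nat.prime_iff_prime_int.mp hp
  rw [show m * p * p = p ^ 2 * m by ring] at h2
  refine ⟨_, _, h2.U hp.pos, fun Δ l hd => ?_⟩
  rw [CoeffU_eq hp.pos]
  have key : ∀ j ∈ range p, C2 (Δ * p ^ 2) ((l + 2 * m * j) * p) =
      C (Δ * p ^ 2) (p * l) + p * C Δ l + p * C Δ l * (if (p : ℤ) ∣ Δ + (l + 2 * m * j) ^ 2 then 1 else 0) +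
      (if (p : ℤ) ^ 2 ∣ Δ then p ^ 2 * C (Δ / p ^ 2) (pb * l) else 0) * (if (p : ℤ) ∣ (l + 2 * m * j) then 1 else 0) := by
    intro j _
    set s := l + 2 * m * j with hs
    obtain ⟨n, hn⟩ : (4 * (m : ℤ)) ∣ Δ + s ^ 2 := by
      obtain ⟨k, hk⟩ := hd
      exact ⟨k + j * l + m * j ^ 2, by rw [hs]; linear_combination hk⟩
    have hps : p * s = (p : ℤ) * l + 2 * m * (p * j) := by rw [hs]; ring
    have q1 := e2 n (s * p)
    rw [e1, e1, if_pos ⟨dvd_mul_left _ _, dvd_mul_left _ _⟩, Int.mul_ediv_cancel _ hpZ, Int.mul_ediv_cancel _ hpZ,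
      show 4 * ((m * p * p : ℕ) : ℤ) * n - (s * p) ^ 2 = Δ * p ^ 2 by push_cast; linear_combination -(p : ℤ) ^ 2 * hn,
      show 4 * (m : ℤ) * (n * p * p) - (s * p) ^ 2 = Δ * p ^ 2 by linear_combination -(p : ℤ) ^ 2 * hn,
      show 4 * (m : ℤ) * n - s ^ 2 = Δ by linear_combination -hn, mul_comm s, hps, per_int h.jx.per] at q1
    have hsl : C Δ s = C Δ l := by rw [hs]; exact per_int h.jx.per _ _ _
    rw [hsl] at q1
    rw [mul_comm s, hps, q1, add_assoc (C (Δ * p ^ 2) (p * l) + p * C Δ l)]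
    congr 1
    have hpn : (p : ℤ) ∣ Δ + s ^ 2 ↔ (p : ℤ) ∣ n := by
      constructor
      · intro h3; rw [hn] at h3
        have h4 : (p : ℤ) ∣ 2 * m * (2 * n) := by convert h3 using 1; ring
        have h5 := cop_dvd hp hpm h4
        rcases hpP.dvd_or_dvd h5 with h6 | h6
        · exact (hpm (Dvd.dvd.mul_right (by exact_mod_cast h6) _)).elim
        · exact h6
      · intro h3; rw [hn]; exact h3.mul_left _
    by_cases hpn' : (p : ℤ) ∣ n
    · rw [if_pos ⟨hpn', by rw [← hps]; exact dvd_mul_right _ _⟩, if_pos (hpn.mpr hpn'), mul_one]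
      obtain ⟨n, rfl⟩ := hpn'
      rw [Int.mul_ediv_cancel_left _ hpZ, show 4 * (m : ℤ) * (n * p) - s ^ 2 = Δ by linear_combination -hn, hsl, mul_add]
      congr 1
      by_cases hps' : (p : ℤ) ∣ s
      · rw [if_pos hps', mul_one]
        obtain ⟨k, hk⟩ := hps'
        have hiff : (p : ℤ) ∣ n ↔ (p : ℤ) ^ 2 ∣ Δ := by
          constructor
          · rintro ⟨u, rfl⟩
            exact ⟨4 * m * u - k ^ 2, by rw [hk] at hn; linear_combination hn⟩
          · rintro ⟨u, rfl⟩
            have h4 : (p : ℤ) ∣ 2 * m * (2 * n) := ⟨u + k ^ 2, mul_left_cancel₀ hpZ (by rw [hk] at hn; linear_combination -hn)⟩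
            have h5 := cop_dvd hp hpm h4
            rcases hpP.dvd_or_dvd h5 with h6 | h6
            · exact (hpm (Dvd.dvd.mul_right (by exact_mod_cast h6) _)).elim
            · exact h6
        by_cases hq : (p : ℤ) ^ 2 ∣ Δ
        · rw [if_pos hq, if_pos ⟨hiff.mpr hq, ⟨k, hk⟩⟩]
          obtain ⟨u, rfl⟩ := hiff.mpr hq
          rw [hk] at hn ⊢
          rw [Int.mul_ediv_cancel_left _ hpZ, Int.mul_ediv_cancel_left _ hpZ,
            show Δ = (p : ℤ) ^ 2 * (4 * m * u - k ^ 2) by linear_combination hn, Int.mul_ediv_cancel_left _ (pow_ne_zero 2 hpZ),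
            ← mul_assoc, ← sq]
          congr 1
          refine per_dvd h.jx.per ?_
          obtain ⟨v, hv⟩ := hpb
          exact ⟨pb * j - v * k, by rw [hk] at hs; linear_combination pb * hs - k * hv⟩
        · rw [if_neg hq, if_neg fun h => hq (hiff.mp h.1), mul_zero]
      · rw [if_neg hps', if_neg fun h => hps' h.2, mul_zero, mul_zero]
    · rw [if_neg fun h => hpn' h.1, if_neg fun h => hpn' (hpn.mp h)]
      have : ¬ ((p : ℤ) ^ 2 ∣ Δ ∧ (p : ℤ) ∣ s) := fun ⟨h3, h4⟩ => hpn' (hpn.mp (dvd_add ((dvd_pow_self _ two_ne_zero).trans h3) (h4.trans (dvd_pow_self _ two_ne_zero))))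
      by_cases h3 : (p : ℤ) ^ 2 ∣ Δ
      · rw [if_neg fun h4 => this ⟨h3, h4⟩]; simp
      · rw [if_neg h3]; simp
  rw [sum_congr rfl key, sum_add_distrib, sum_add_distrib, ← mul_sum, ← mul_sum,
    sum_lin hp hpm (g := fun s => if (p : ℤ) ∣ Δ + s ^ 2 then 1 else 0), sum_lin hp hpm (g := fun s => if (p : ℤ) ∣ s then 1 else 0),
    sum_boole, sum_boole, sum_const, card_range, nsmul_eq_mul, ← nuP]
  · have : ((range p).filter fun s : ℕ => (p : ℤ) ∣ s) = {0} := by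
      ext s
      simp only [mem_filter, mem_range, mem_singleton]
      constructor
      · rintro ⟨h3, h4⟩
        exact Nat.eq_zero_of_dvd_of_lt (by exact_mod_cast h4) h3
      · rintro rfl; exact ⟨hp.pos, by simp⟩
    rw [this, card_singleton]
    split_ifs <;> (push_cast; ring)
  · intro s; simp only [dvd_add_self_right]
  · intro s
    have : (p : ℤ) ∣ Δ + (s + p) ^ 2 ↔ (p : ℤ) ∣ Δ + s ^ 2 := by
      rw [show Δ + (s + p) ^ 2 = Δ + s ^ 2 + p * (2 * s + p) by ring]; exact dvd_add_left (dvd_mul_right _ _)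
    simp only [this]

def pair (m : ℕ) (b C : ℤℤ) : ℂ := ∑' N : ℕ, ∑ l ∈ range (2 * m), b N l * C (-N) l

structure KB (m : ℕ) (b : ℤℤ) : Prop where
  per : ∀ N l : ℤ, b N (l + 2 * (m : ℤ)) = b N l
  even : ∀ N l : ℤ, b N (-l) = b N l
  supp : ∀ N l : ℤ, ¬ (4 * (m : ℤ)) ∣ (N - l ^ 2) → b N l = 0
  neg : ∀ N l : ℤ, N < 0 → b N l = 0
  kill : ∀ C φ, JF m C φ → pair m b C = 0

lemma pair_fin {m : ℕ} {b C : ℤℤ} (h : ∃ B : ℤ, ∀ Δ l : ℤ, Δ < B → C Δ l = 0) :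
    Summable (fun N : ℕ => ∑ l ∈ range (2 * m), b N l * C (-N) l) := by
  obtain ⟨B, hB⟩ := h
  refine summable_of_ne_finset_zero (s := range (B.natAbs + 1)) fun N hN => ?_
  refine sum_eq_zero fun l _ => ?_
  rw [hB, mul_zero]
  simp at hN; omega

lemma pair_add {m : ℕ} {b b' C : ℤℤ} (h : ∃ B : ℤ, ∀ Δ l : ℤ, Δ < B → C Δ l = 0) :
    pair m (b + b') C = pair m b C + pair m b' C := by
  rw [pair, pair, pair, ← (pair_fin h).tsum_add (pair_fin h)]
  congr 1; ext N
  rw [← sum_add_distrib]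
  exact sum_congr rfl fun l _ => by simp [add_mul]

lemma pair_smul {m : ℕ} {b C : ℤℤ} (a : ℂ) : pair m (a • b) C = a * pair m b C := by
  rw [pair, pair, ← tsum_mul_left]
  congr 1; ext N
  rw [mul_sum]
  exact sum_congr rfl fun l _ => by simp [mul_assoc]

def Wm (m : ℕ) : Submodule ℂ ℤℤ where
  carrier := {b | KB m b}
  zero_mem' := ⟨by simp, by simp, by simp, by simp, fun C φ _ => by simp [pair]⟩
  add_mem' := fun {b b'} h h' => ⟨fun N l => by simp [h.per, h'.per], fun N l => by simp [h.even, h'.even],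
    fun N l hd => by simp [h.supp _ _ hd, h'.supp _ _ hd], fun N l hd => by simp [h.neg _ _ hd, h'.neg _ _ hd],
    fun C φ hC => by rw [pair_add hC.jx.bd, h.kill _ _ hC, h'.kill _ _ hC, add_zero]⟩
  smul_mem' := fun a b h => ⟨fun N l => by simp [h.per], fun N l => by simp [h.even],
    fun N l hd => by simp [h.supp _ _ hd], fun N l hd => by simp [h.neg _ _ hd],
    fun C φ hC => by rw [pair_smul, h.kill _ _ hC, mul_zero]⟩

lemma sum_mulmod {n : ℕ} (hn : 0 < n) {g : ℤ → ℂ} (hg : ∀ i, g (i + n) = g i) {u v : ℤ} (huv : (n : ℤ) ∣ v * u - 1) :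
    ∑ i ∈ range n, g (u * i) = ∑ i ∈ range n, g i :=
  sum_mod hn hg (fun i => u * i) fun i hi j hj hd => by
    obtain ⟨k, hk⟩ := huv
    obtain ⟨k', hk'⟩ := hd
    have h1 : (n : ℤ) ∣ (i : ℤ) - j := ⟨v * k' - k * (i - j), by linear_combination v * hk' - (i - j : ℤ) * hk⟩
    have : |(i : ℤ) - j| < n := by rw [abs_lt]; omega
    have := Int.eq_zero_of_abs_lt_dvd h1 this
    omega

def hk (p : ℕ) (pb : ℤ) (b : ℤℤ) (N l : ℤ) : ℂ :=
  p * b (p ^ 2 * N) (p * l) + ((nuP p (-N) : ℂ) - 1) * b N l + if (p : ℤ) ^ 2 ∣ N then b (N / p ^ 2) (pb * l) else 0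

lemma KB.hk {m p : ℕ} {b : ℤℤ} (hm : 0 < m) (hp : p.Prime) (hpm : ¬ p ∣ 2 * m) {pb : ℤ} (hpb : 2 * (m : ℤ) ∣ pb * p - 1)
    (h : KB m b) : KB m (hk p pb b) where
  per := fun N l => by
    rw [_root_.hk, _root_.hk, h.per, per_dvd h.per (l := p * l) ⟨p, by ring⟩, per_dvd h.per (l := pb * l) (l' := pb * (l + 2 * m)) ⟨pb, by ring⟩]
  even := fun N l => by
    rw [_root_.hk, _root_.hk, mul_neg, mul_neg, h.even, h.even, h.even]
  supp := fun N l hd => by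
    have hcop : IsCoprime (4 * (m : ℤ)) ((p : ℤ) ^ 2) := by
      have h2 : Nat.Coprime (4 * m) (p ^ 2) := Nat.Coprime.pow_right _ (Nat.Coprime.symm ((Nat.Prime.coprime_iff_not_dvd hp).mpr fun hd =>
        hpm (by
          rcases (Nat.Prime.dvd_mul hp).mp hd with h1 | h1
          · exact Dvd.dvd.mul_right ((Nat.prime_dvd_prime_iff_eq hp Nat.prime_two).mpr ((Nat.prime_dvd_prime_iff_eq hp Nat.prime_two).mp (hp.dvd_of_dvd_pow (n := 2) (by simpa using h1))) |>.trans dvd_rfl) _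
          · exact h1.mul_left _)))
      exact_mod_cast Nat.isCoprime_iff_coprime.mpr h2
    rw [_root_.hk, h.supp N l hd, h.supp (p ^ 2 * N) (p * l), mul_zero, mul_zero, zero_add, zero_add]
    · split_ifs with h1
      · refine h.supp _ _ fun h2 => hd ?_
        obtain ⟨u, rfl⟩ := h1
        rw [Int.mul_ediv_cancel_left _ (pow_ne_zero 2 (by exact_mod_cast hp.ne_zero))] at h2
        obtain ⟨k, hk⟩ := h2
        obtain ⟨v, hv⟩ := hpb
        exact ⟨p ^ 2 * k + l ^ 2 * (v + m * v ^ 2), by linear_combination (p : ℤ) ^ 2 * hk + (l ^ 2) * (pb * p + 1 + 2 * m * v) * hv⟩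
      · rfl
    · intro h1
      refine hd (hcop.dvd_of_dvd_mul_left (z := N - l ^ 2) ?_)
      rw [show (p : ℤ) ^ 2 * (N - l ^ 2) = p ^ 2 * N - (p * l) ^ 2 by ring]; exact h1
  neg := fun N l hN => by
    have hp2 : (0 : ℤ) < p ^ 2 := pow_pos (by exact_mod_cast hp.pos) _
    rw [_root_.hk, h.neg N l hN, h.neg (p ^ 2 * N) (p * l) (by nlinarith), h.neg (N / p ^ 2) _ (Int.ediv_neg_of_neg_of_pos hN hp2)]
    simp
  kill := fun C φ hC => by
    obtain ⟨C', φ', h', e⟩ := hC.hecke hm hp hpm hpb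
    have hp0 : (p : ℂ) ≠ 0 := by exact_mod_cast hp.ne_zero
    have hp2 : p ^ 2 ≠ 0 := pow_ne_zero 2 hp.ne_zero
    have hpZ2 : (p : ℤ) ^ 2 ≠ 0 := pow_ne_zero 2 (by exact_mod_cast hp.ne_zero)
    have hm2 : 0 < 2 * m := by omega
    have hpb' : (((2 * m : ℕ) : ℤ)) ∣ pb * p - 1 := by exact_mod_cast hpb
    have hpb'' : (((2 * m : ℕ) : ℤ)) ∣ p * pb - 1 := by rw [mul_comm (p : ℤ)]; exact hpb'
    have k1 := h.kill _ _ h'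
    have k2 := h.kill _ _ hC
    obtain ⟨B, hB⟩ := hC.jx.bd
    have cper := fun Δ i => hC.jx.per Δ i
    have bper := h.per
    set f1 : ℕ → ℂ := fun N => ∑ l ∈ range (2 * m), b N l * C (-(N * p ^ 2)) (p * l) with hf1
    set f3 : ℕ → ℂ := fun N => ∑ l ∈ range (2 * m), b N l * (if (p : ℤ) ^ 2 ∣ (-(N : ℤ)) then p * C (-N / p ^ 2) (pb * l) else 0) with hf3
    set g1 : ℕ → ℂ := fun N => ∑ l ∈ range (2 * m), (if (p : ℤ) ^ 2 ∣ N then b (N / p ^ 2) (pb * l) else 0) * C (-N) l with hg1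
    set g3 : ℕ → ℂ := fun N => ∑ l ∈ range (2 * m), p * b (p ^ 2 * N) (p * l) * C (-N) l with hg3
    have hinj : Function.Injective (fun N : ℕ => p ^ 2 * N) := fun x y hxy => Nat.eq_of_mul_eq_mul_left (by positivity) hxy
    have t1 : ∑' N, f1 N = ∑' N, g1 N := by
      rw [← hinj.tsum_eq (f := g1)]
      · congr 1; ext N
        simp only [hf1, hg1]
        rw [← sum_mulmod hm2 (g := fun l => b N l * C (-(N * p ^ 2)) (p * l)) (fun i => ?_) hpb'']
        · refine sum_congr rfl fun l _ => ?_
          push_cast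
          rw [if_pos (dvd_mul_right _ _), Int.mul_ediv_cancel_left _ hpZ2, mul_comm (N : ℤ)]
          congr 1
          refine per_dvd cper ?_
          have := hpb.mul_right (l : ℤ)
          rw [show p * (pb * (l : ℤ)) - l = (pb * p - 1) * l by ring]; exact this
        · push_cast
          rw [bper, per_dvd cper (l := p * i) ⟨p, by ring⟩]
      · intro N hN
        by_contra hc
        refine hN (sum_eq_zero fun l _ => ?_)
        rw [if_neg, zero_mul]
        intro hk
        have : p ^ 2 ∣ N := by exact_mod_cast hk
        obtain ⟨k', hk'⟩ := this
        exact hc ⟨k', hk'.symm⟩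
    have t3 : ∑' N, f3 N = ∑' N, g3 N := by
      rw [← hinj.tsum_eq (f := f3)]
      · congr 1; ext N
        simp only [hf3, hg3]
        rw [← sum_mulmod hm2 (g := fun l => b ((p ^ 2 * N : ℕ) : ℤ) l * (if (p : ℤ) ^ 2 ∣ (-((p ^ 2 * N : ℕ) : ℤ)) then p * C (-((p ^ 2 * N : ℕ) : ℤ) / p ^ 2) (pb * l) else 0)) (fun i => ?_) hpb']
        · refine sum_congr rfl fun l _ => ?_
          push_cast
          rw [← mul_neg, if_pos (dvd_mul_right _ _), Int.mul_ediv_cancel_left _ hpZ2]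
          rw [per_dvd cper (l := l) (l' := pb * (p * l))]
          · ring
          · have := hpb.mul_right (l : ℤ)
            rw [show pb * (p * (l : ℤ)) - l = (pb * p - 1) * l by ring]; exact this
        · push_cast
          rw [bper, per_dvd cper (l := pb * i) (l' := pb * (i + 2 * m)) ⟨pb, by ring⟩]
      · intro N hN
        by_contra hc
        refine hN (sum_eq_zero fun l _ => ?_)
        rw [if_neg, mul_zero]
        rw [dvd_neg]
        intro hk
        have : p ^ 2 ∣ N := by exact_mod_cast hk
        obtain ⟨k', hk'⟩ := this
        exact hc ⟨k', hk'.symm⟩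
    have sF : ∀ f : ℕ → ℂ, (∀ N : ℕ, (p ^ 2 * B.natAbs < N) → f N = 0) → Summable f := fun f hf =>
      summable_of_ne_finset_zero (s := range (p ^ 2 * B.natAbs + 1)) fun N hN => hf N (by simp at hN; omega)
    have hp1 : 1 ≤ p ^ 2 := Nat.one_le_iff_ne_zero.mpr hp2
    have hle : B.natAbs ≤ p ^ 2 * B.natAbs := Nat.le_mul_of_pos_left _ hp1
    have z0 : ∀ (N : ℕ) (l : ℤ), (p ^ 2 * B.natAbs < N) → C (-N) l = 0 := fun N l hN => hB _ _ (by omega)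
    have s1 : Summable f1 := sF _ fun N hN => sum_eq_zero fun l _ => by
      have := z0 (N * p ^ 2) (p * l) (hN.trans_le (Nat.le_mul_of_pos_right _ hp1))
      push_cast at this; rw [this, mul_zero]
    have s3 : Summable f3 := sF _ fun N hN => sum_eq_zero fun l _ => by
      split_ifs with hd
      · obtain ⟨k, hk⟩ := hd
        rw [hk, Int.mul_ediv_cancel_left _ hpZ2, hB, mul_zero, mul_zero]
        have h5 : (p : ℤ) ^ 2 * (-k) = N := by linarith
        have h6 : ((p ^ 2 * B.natAbs : ℕ) : ℤ) < N := by exact_mod_cast hN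
        push_cast at h6
        have h7 : |B| < -k := lt_of_mul_lt_mul_left (by rw [h5]; exact h6) (by positivity : (0 : ℤ) ≤ (p : ℤ) ^ 2)
        have := neg_abs_le B
        linarith
      · exact mul_zero _
    have sg1 : Summable g1 := sF _ fun N hN => sum_eq_zero fun l _ => by rw [z0 N l hN, mul_zero]
    have sg3 : Summable g3 := sF _ fun N hN => sum_eq_zero fun l _ => by rw [z0 N l hN, mul_zero]
    set f2 : ℕ → ℂ := fun N => ∑ l ∈ range (2 * m), b N l * ((nuP p (-N) - 1 : ℂ) * C (-N) l) with hf2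
    set f0 : ℕ → ℂ := fun N => ∑ l ∈ range (2 * m), b N l * C (-N) l with hf0
    have s2 : Summable f2 := sF _ fun N hN => sum_eq_zero fun l _ => by rw [z0 N l hN, mul_zero, mul_zero]
    have s0 : Summable f0 := sF _ fun N hN => sum_eq_zero fun l _ => by rw [z0 N l hN, mul_zero]
    have k1' : pair m b C' = p * ((∑' N, f1 N) + ∑' N, f2 N + ∑' N, f3 N + (p + 1) * ∑' N, f0 N) := by
      rw [← s1.tsum_add s2, ← (s1.add s2).tsum_add s3, ← tsum_mul_left, ← ((s1.add s2).add s3).tsum_add (s0.mul_left _), ← tsum_mul_left, pair]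
      congr 1; ext N
      simp only [hf1, hf2, hf3, hf0]
      rw [mul_sum, ← sum_add_distrib, ← sum_add_distrib, ← sum_add_distrib, mul_sum]
      refine sum_congr rfl fun l _ => ?_
      by_cases hd : (4 * (m : ℤ)) ∣ N - l ^ 2
      · rw [e _ _ (by rw [show -(N : ℤ) + (l : ℤ) ^ 2 = -(N - l ^ 2) by ring]; exact (dvd_neg).mpr hd), neg_mul]
        ring
      · rw [h.supp _ _ hd]; ring
    have k2' : ∑' N, f0 N = 0 := k2
    rw [k1, k2', mul_zero, add_zero, t1, t3] at k1'
    have k3 := (mul_eq_zero.mp k1'.symm).resolve_left hp0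
    rw [← k3, ← sg1.tsum_add s2, ← (sg1.add s2).tsum_add sg3, pair]
    congr 1; ext N
    simp only [hg1, hf2, hg3]
    rw [← sum_add_distrib, ← sum_add_distrib]
    refine sum_congr rfl fun l _ => ?_
    rw [_root_.hk]; ring

def wt (m r : ℕ) : ℤ := (if r < m then 1 else 0) + if 0 < r then 1 else 0

lemma wt_two {m r : ℕ} (hm : 0 < m) : ∃ k : ℤ, k * wt m r = 2 := by
  unfold wt; split_ifs with h1 h2 h2
  · exact ⟨1, by norm_num⟩
  · exact ⟨2, by norm_num⟩
  · exact ⟨2, by norm_num⟩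
  · omega

lemma sum_fold {m : ℕ} {F : ℤ → ℂ} (hp : ∀ l, F (l + 2 * m) = F l) (he : ∀ l, F (-l) = F l) :
    ∑ l ∈ range (2 * m), F l = ∑ r ∈ range (m + 1), (wt m r : ℂ) * F r := by
  have h1 : ∑ r ∈ range (m + 1), (wt m r : ℂ) * F r = ∑ r ∈ range m, F r + ∑ r ∈ range m, F ((r + 1 : ℕ)) := by
    simp only [wt, Int.cast_add, add_mul, sum_add_distrib]
    rw [sum_range_succ, sum_range_succ' (fun r : ℕ => (((if 0 < r then 1 else 0 : ℤ)) : ℂ) * F r)]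
    simp only [lt_irrefl, if_false, Int.cast_zero, zero_mul, add_zero, Nat.succ_pos, if_true, Int.cast_one, one_mul]
    congr 1
    exact sum_congr rfl fun r hr => by rw [if_pos (mem_range.1 hr)]; simp
  rw [h1, two_mul, sum_range_add]
  congr 1
  rw [← sum_range_reflect]
  refine sum_congr rfl fun r hr => ?_
  rw [← he, ← hp]
  congr 1
  have := mem_range.1 hr
  omega

lemma pair_fold {m ν : ℕ} (hm : 0 < m) {b C : ℤℤ} (bp : ∀ N l : ℤ, b N (l + 2 * (m : ℤ)) = b N l)
    (be : ∀ N l : ℤ, b N (-l) = b N l) (bn : ∀ N l : ℤ, N < 0 → b N l = 0)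
    (cp : ∀ N l : ℤ, C N (l + 2 * (m : ℤ)) = C N l) (ce : IsEvenC C) (cs : ∀ Δ l : ℤ, ¬ (4 * (m : ℤ)) ∣ (Δ + l ^ 2) → C Δ l = 0)
    (hν : ∀ n r : ℤ, n < -(ν : ℤ) → C (4 * m * n - r ^ 2) r = 0) :
    pair m b C = ∑ r ∈ range (m + 1), (wt m r : ℂ) * ∑ i ∈ range (ν + m + 1),
      b (4 * m * ((i : ℤ) - m) + (r : ℤ) ^ 2) r * C (4 * m * ((m : ℤ) - i) - (r : ℤ) ^ 2) r := by
  have h1 : ∀ r ∈ range (m + 1), HasSum (fun N : ℕ => b N r * C (-N) r) (∑ i ∈ range (ν + m + 1),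
      b (4 * m * ((i : ℤ) - m) + (r : ℤ) ^ 2) r * C (4 * m * ((m : ℤ) - i) - (r : ℤ) ^ 2) r) := fun r hr => by
    have hr' := Nat.lt_succ_iff.1 (mem_range.1 hr)
    have h2 : HasSum (fun N : ℤ => b N r * C (-N) r) (∑ N ∈ (range (ν + m + 1)).image (fun i : ℕ => 4 * (m : ℤ) * ((i : ℤ) - m) + (r : ℤ) ^ 2), b N r * C (-N) r) := by
      refine hasSum_sum_of_ne_finset_zero fun N hN => ?_
      by_contra h0
      have hb : b N r ≠ 0 := left_ne_zero_of_mul h0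
      have hc : C (-N) r ≠ 0 := right_ne_zero_of_mul h0
      have hN0 : 0 ≤ N := by by_contra h; exact hb (bn _ _ (by omega))
      have hd : 4 * (m : ℤ) ∣ -N + (r : ℤ) ^ 2 := by by_contra h; exact hc (cs _ _ h)
      obtain ⟨k, hk⟩ := hd
      have hk1 : -(ν : ℤ) ≤ k := by
        by_contra h
        exact hc (by rw [show -N = 4 * m * k - (r : ℤ) ^ 2 by linear_combination hk]; exact hν _ _ (by omega))
      have hk2 : k ≤ m := by
        by_contra h
        have : (r : ℤ) ≤ m := by exact_mod_cast hr'
        have h3 : (0 : ℤ) < m := by exact_mod_cast hm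
        nlinarith
      refine hN (mem_image.2 ⟨(m - k).toNat, mem_range.2 (by omega), ?_⟩)
      rw [Int.toNat_of_nonneg (by omega)]; linear_combination hk
    rw [sum_image] at h2
    · rw [← Function.Injective.hasSum_iff (Nat.cast_injective (R := ℤ)) (fun x hx => ?_)] at h2
      · rw [sum_congr rfl fun i _ => by rw [show 4 * m * ((m : ℤ) - i) - (r : ℤ) ^ 2 = -(4 * (m : ℤ) * ((i : ℤ) - m) + (r : ℤ) ^ 2) by ring]]
        exact h2
      · rw [bn, zero_mul]
        by_contra h
        exact hx ⟨x.toNat, by omega⟩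
    · intro i _ j _ hij
      have h3 : (4 * (m : ℤ)) ≠ 0 := by positivity
      have := mul_left_cancel₀ h3 (add_right_cancel hij)
      omega
  have h2 : ∀ N : ℕ, ∑ l ∈ range (2 * m), b N l * C (-N) l = ∑ r ∈ range (m + 1), (wt m r : ℂ) * (b N r * C (-N) r) := fun N =>
    sum_fold (F := fun l => b N l * C (-N) l) (fun l => by simp only [bp, cp]) (fun l => by simp only [be, ce _ l])
  rw [pair]
  simp only [h2]
  exact (hasSum_sum fun r hr => (h1 r hr).mul_left _).tsum_eq

lemma A_pow_exp (r : ℕ) : ∃ a : ℤ → ℂ, (∀ s : ℤ, (r : ℤ) < |s| → a s = 0) ∧ a r = 1 ∧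
    ∀ z, HasSum (fun s : ℤ => a s * ee (s * z)) ((ee z - 2 + ee (-z)) ^ r) := by
  induction r with
  | zero =>
    refine ⟨fun s => if s = 0 then 1 else 0, fun s hs => if_neg (by rintro rfl; simp at hs), by simp, fun z => ?_⟩
    have := hasSum_single (f := fun s : ℤ => (if s = 0 then (1 : ℂ) else 0) * ee (s * z)) 0 fun s hs => by simp [hs]
    simpa [ee_zero] using this
  | succ r ih =>
    obtain ⟨a, h1, h2, h3⟩ := ih
    refine ⟨fun s => a (s - 1) - 2 * a s + a (s + 1), fun s hs => ?_, ?_, fun z => ?_⟩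
    · rw [lt_abs] at hs
      push_cast at hs
      simp only []
      rw [h1, h1 s, h1] <;> (try rw [lt_abs]) <;> (try omega); ring
    · simp only []
      push_cast
      rw [h1 (r + 1), h1 (r + 1 + 1), add_sub_cancel_right, h2] <;> (try rw [lt_abs]) <;> (try omega); ring
    · have k1 := ((Equiv.subRight (1 : ℤ)).hasSum_iff.2 (h3 z)).mul_left (ee z)
      have k2 := ((Equiv.addRight (1 : ℤ)).hasSum_iff.2 (h3 z)).mul_left (ee (-z))
      have k3 := (h3 z).mul_left 2
      have := (k1.sub k3).add k2
      rw [show (ee z - 2 + ee (-z)) ^ (r + 1) = ee z * (ee z - 2 + ee (-z)) ^ r - 2 * (ee z - 2 + ee (-z)) ^ r + ee (-z) * (ee z - 2 + ee (-z)) ^ r by ring]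
      refine this.congr_fun' fun s => ?_
      simp only [Function.comp, Equiv.subRight_apply, Equiv.coe_addRight]
      have e1 : ee (s * z) = ee z * ee ((s - 1 : ℤ) * z) := by rw [← ee_add]; congr 1; push_cast; ring
      have e2 : ee (s * z) = ee (-z) * ee ((s + 1 : ℤ) * z) := by rw [← ee_add]; congr 1; push_cast; ring
      have : ∀ x y w : ℂ, (x - 2 * y + w) * ee (s * z) = x * ee (s * z) - 2 * (y * ee (s * z)) + w * ee (s * z) := fun _ _ _ => by ring
      rw [this]
      nth_rewrite 1 [e1]
      nth_rewrite 2 [e2]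
      ring

lemma even_E (q z : ℂ) : Eff q (-z) = Eff q z := by rw [Eff, even_X, even_Y, Eff]

lemma ElS.onel {f : ℂ → ℂ} {m : ℕ} {Φ : ℂℂ} (h : ElS m Φ) : ElS m (fun τ z => f τ * Φ τ z) := fun τ z ht => by
  have := h τ z ht
  simp only []
  rw [this]; ring

def SZ : Subring ℂ := (Int.castRingHom ℂ).range

lemma SZ_closed : IsClosed (SZ : Set ℂ) := by
  have : (SZ : Set ℂ) = Set.range ((↑) : ℤ → ℂ) := by ext x; simp [SZ]
  rw [this]
  have h : Set.range ((↑) : ℤ → ℂ) = (fun x : ℝ => (x : ℂ)) '' Set.range ((↑) : ℤ → ℝ) := by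
    rw [← Set.range_comp]; rfl
  rw [h]
  exact Complex.isometry_ofReal.isClosedEmbedding.isClosedMap _ Int.isClosedEmbedding_coe_real.isClosed_range

lemma int_form {m : ℕ} (hm : 0 < m) {ν r α β : ℕ} (hr : r ≤ m) (hw : 4 * α + 6 * β + 4 * m = 2 + 12 * ν + 6 * r) :
    ∃ C φ, JF m C φ ∧ (∀ Δ l, ∃ k : ℤ, C Δ l = k) ∧ (∀ n r : ℤ, n < -(ν : ℤ) → C (4 * m * n - r ^ 2) r = 0) ∧
      C (4 * m * (-(ν : ℤ)) - (r : ℤ) ^ 2) r = 1 ∧ ∀ s : ℤ, (r : ℤ) < |s| → C (4 * m * (-(ν : ℤ)) - s ^ 2) s = 0 := by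
  have hS := SZ_closed
  obtain ⟨c, hc, hd⟩ : WX SZ (fun q z => (Uv q)⁻¹ ^ ν * e4 q ^ α * e6 q ^ β * (Aff q z ^ r * Eff q z ^ (m - r))) :=
    ((((WX_Uinv hS).pow hS ν).mul hS ((WX_e4 hS).pow hS α)).mul hS ((WX_e6 hS).pow hS β)).mul hS
      (((WX_A hS).pow hS r).mul hS ((WX_E hS).pow hS (m - r)))
  obtain ⟨C, h1, h2, h3⟩ := JF_mk hm hd (by
    have h := (ElS_A.pow r).mul (ElS_E.pow (m - r))
    rw [show r * 1 + (m - r) * 1 = m by omega] at h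
    exact h.onel (f := fun τ => (Uv (ee τ))⁻¹ ^ ν * e4 (ee τ) ^ α * e6 (ee τ) ^ β)) (fun τ z _ => by simp only [even_A, even_E]) ν (fun τ z ht => by
    have h0 := ne0_of_im ht
    have hi := im_S ht
    have hU := Uv_ne (norm_ee ht)
    have hU' := Uv_ne (norm_ee hi)
    simp only []
    rw [ee_Dh ht, ee_Dh hi, MF_Dh.2 τ ht, MF_e4.2 τ ht, MF_e6.2 τ ht, SLaw_A τ z ht, SLaw_E τ z ht]
    have hd : Dh (ee τ) ≠ 0 := mul_ne_zero (ee_ne _) (Uv_ne (norm_ee ht))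
    have e1 : ee (m * (z ^ 2 / τ)) = ee ((1 : ℕ) * (z ^ 2 / τ)) ^ r * ee ((1 : ℕ) * (z ^ 2 / τ)) ^ (m - r) := by
      rw [← pow_add, show r + (m - r) = m by omega, ← ee_natmul]; congr 1; push_cast; ring
    rw [e1]
    have e2 : τ ^ (2 : ℤ) * (τ ^ (12 : ℤ)) ^ ν * (τ ^ 2) ^ r = (τ ^ (4 : ℤ)) ^ α * (τ ^ (6 : ℤ)) ^ β * (τ ^ (4 : ℤ)) ^ (m - r) := by
      have a1 : ∀ n : ℕ, τ ^ (n : ℤ) = τ ^ n := fun n => zpow_natCast _ _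
      have a2 := a1 2; have a12 := a1 12; have a4 := a1 4; have a6 := a1 6
      push_cast at a2 a12 a4 a6
      rw [a2, a12, a4, a6]
      simp only [← pow_mul, ← pow_add]
      congr 1
      omega
    rw [show (τ ^ (-2 : ℤ)) = (τ ^ 2)⁻¹ by rw [zpow_neg]; norm_cast]
    simp only [inv_pow, mul_pow, mul_inv]
    have d1 := pow_ne_zero ν hd
    have d2 := pow_ne_zero ν (zpow_ne_zero 12 h0)
    have d3 := pow_ne_zero r (pow_ne_zero 2 h0)
    have hU1 := pow_ne_zero ν hU
    have hU2 := pow_ne_zero ν hU'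
    generalize Dh (ee τ) ^ ν = a at *
    generalize (τ ^ (12 : ℤ)) ^ ν = b at *
    generalize (τ ^ 2) ^ r = b' at *
    generalize ee ((1 : ℕ) * (z ^ 2 / τ)) = c at *
    generalize -1 / τ = τ' at *
    generalize (τ ^ (4 : ℤ)) ^ α = f1 at *
    generalize (τ ^ (6 : ℤ)) ^ β = f2 at *
    generalize (τ ^ (4 : ℤ)) ^ (m - r) = f3 at *
    generalize τ ^ (2 : ℤ) = f4 at *
    field_simp
    linear_combination (- c ^ r * c ^ (m - r) * e4 (ee τ) ^ α * e6 (ee τ) ^ β * Aff (ee τ) z ^ r * Eff (ee τ) z ^ (m - r)) * e2)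
  obtain ⟨a, ha1, ha2, ha3⟩ := A_pow_exp r
  have h0 : ∀ s : ℤ, c 0 s = a s := fun s => by
    have := (hd.sum_rows (q := 0) (by simp)).2
    simp only [A_q0, E_q0, Uv_zero, e4_zero, e6_zero, inv_one, one_pow, one_mul, mul_one] at this
    have h5 := congrFun (fourier_unique (fun x : ℝ => this x) fun x : ℝ => ha3 x) s
    rw [← h5, row, tsum_eq_single 0 fun n hn => by simp [hn]]
    simp
  refine ⟨C, _, h1, fun Δ l => ?_, h3, ?_, fun s hs => ?_⟩
  · by_cases hdv : 4 * (m : ℤ) ∣ Δ + l ^ 2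
    · obtain ⟨k, hk⟩ := hdv
      rw [show Δ = 4 * m * k - l ^ 2 by linear_combination hk]
      by_cases hk2 : k < -(ν : ℤ)
      · exact ⟨0, by rw [h3 _ _ hk2]; simp⟩
      · have := h2 (k + ν).toNat l
        rw [Int.toNat_of_nonneg (by omega), add_sub_cancel_right] at this
        obtain ⟨i, hi⟩ := hc (k + ν).toNat l
        exact ⟨i, by rw [this, ← hi]; simp⟩
    · exact ⟨0, by rw [h1.jx.supp _ _ hdv]; simp⟩
  · have := h2 0 r
    rw [h0, ha2] at this
    rw [← this]; simp
  · have := h2 0 s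
    rw [h0, ha1 _ hs] at this
    rw [← this]; simp

lemma NK {A : Type*} [AddCommGroup A] [IsAddTorsionFree A] (M : Submodule ℤ A) (hM : M.FG) (T : A →ₗ[ℤ] A) {p : ℕ}
    (hp : p.Prime) (u : ℕ → A) (hu : ∀ i, u i ∈ M) (h0 : T (u 0) = (p : ℤ) • u 1)
    (h1 : ∀ i, T (u (i + 1)) = (p : ℤ) • u (i + 2) + u i) : ∀ i, u i = 0 := by
  set U : Submodule ℤ A := Submodule.span ℤ (Set.range u) with hU
  have hmem : ∀ i, u i ∈ U := fun i => Submodule.subset_span ⟨i, rfl⟩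
  have hle : U ≤ M := Submodule.span_le.2 (by rintro _ ⟨i, rfl⟩; exact hu i)
  have : Module.Finite ℤ M := Module.Finite.iff_fg.2 hM
  have hfg : U.FG := (isNoetherian_submodule.1 (inferInstance : IsNoetherian ℤ M)) U hle
  have : Module.Finite ℤ U := Module.Finite.iff_fg.2 hfg
  have hT : ∀ x ∈ U, T x ∈ U := fun x hx => by
    have : U ≤ U.comap T := by
      rw [hU, Submodule.span_le]
      rintro _ ⟨i, rfl⟩
      rw [← hU]
      cases i with
      | zero => simp only [SetLike.mem_coe, Submodule.mem_comap, h0]; exact U.smul_mem _ (hmem _)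
      | succ i => simp only [SetLike.mem_coe, Submodule.mem_comap, h1]; exact U.add_mem (U.smul_mem _ (hmem _)) (hmem _)
    exact this hx
  let TU : U →ₗ[ℤ] U := T.restrict hT
  let P : Submodule ℤ U := LinearMap.range (LinearMap.lsmul ℤ U (p : ℤ))
  have hP : P ≤ P.comap TU := by
    rintro _ ⟨x, rfl⟩
    exact ⟨TU x, by simp⟩
  let Q := P.mapQ P TU hP
  let v : ℕ → U := fun i => ⟨u i, hmem i⟩
  have hv : Submodule.span ℤ (Set.range v) = ⊤ := by
    apply Submodule.map_injective_of_injective U.injective_subtype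
    rw [Submodule.map_span, ← Set.range_comp, Submodule.map_top, Submodule.range_subtype]; rfl
  have e0 : TU (v 0) = (p : ℤ) • v 1 := Subtype.ext h0
  have e1 : ∀ i, TU (v (i + 1)) = (p : ℤ) • v (i + 2) + v i := fun i => Subtype.ext (h1 i)
  have hq : ∀ x : U, (P.mkQ ((p : ℤ) • x)) = 0 := fun x => by
    rw [Submodule.mkQ_apply, Submodule.Quotient.mk_eq_zero]; exact ⟨x, by simp⟩
  have hsurj : Function.Surjective Q := by
    rw [← LinearMap.range_eq_top, eq_top_iff]
    have : (⊤ : Submodule ℤ (U ⧸ P)) = Submodule.span ℤ (Set.range fun i => P.mkQ (v i)) := by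
      rw [← Submodule.range_mkQ P, ← Submodule.map_top, ← hv, Submodule.map_span, ← Set.range_comp]; rfl
    rw [this, Submodule.span_le]
    rintro _ ⟨i, rfl⟩
    refine ⟨P.mkQ (v (i + 1)), ?_⟩
    rw [Submodule.mkQ_apply, Submodule.mapQ_apply, e1, ← Submodule.mkQ_apply, map_add, hq, zero_add]
  have hinj : Function.Injective Q := OrzechProperty.injective_of_surjective_endomorphism Q hsurj
  have hz : ∀ i, P.mkQ (v i) = 0 := fun i => by
    induction i with
    | zero => apply hinj; rw [Submodule.mkQ_apply, Submodule.mapQ_apply, e0, ← Submodule.mkQ_apply, hq, map_zero]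
    | succ i ih => apply hinj; rw [Submodule.mkQ_apply, Submodule.mapQ_apply, e1, ← Submodule.mkQ_apply, map_add, hq, ih, map_zero, add_zero]
  have hUI : U ≤ (Ideal.span {(p : ℤ)}) • U := by
    conv_lhs => rw [hU]
    rw [Submodule.span_le]
    rintro _ ⟨i, rfl⟩
    obtain ⟨x, hx⟩ := (Submodule.Quotient.mk_eq_zero _).1 (hz i)
    have : u i = (p : ℤ) • (x : A) := by
      have := congrArg Subtype.val hx
      rw [← show ((v i : U) : A) = u i from rfl, ← this]; simp
    rw [SetLike.mem_coe, this]
    exact Submodule.smul_mem_smul (Ideal.mem_span_singleton_self _) x.2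
  obtain ⟨r, hr, hr2⟩ := Submodule.exists_sub_one_mem_and_smul_eq_zero_of_fg_of_le_smul _ U hfg hUI
  have hr0 : r ≠ 0 := by
    rintro rfl
    rw [Ideal.mem_span_singleton] at hr
    have := Int.natAbs_dvd_natAbs.2 hr
    simp at this
    exact hp.one_lt.ne' this
  exact fun i => by
    have := hr2 _ (hmem i)
    exact (smul_eq_zero.1 this).resolve_left hr0

def gW (m i r : ℕ) (b : Wm m) : ℂ := (wt m r : ℂ) * b.1 (4 * m * ((i : ℤ) - m) + (r : ℤ) ^ 2) r

lemma fg_eval {m : ℕ} (hm : 0 < m) : ∃ M : Submodule ℤ (Wm m → ℂ), M.FG ∧ ∀ N l : ℤ, (fun b : Wm m => 2 * b.1 N l) ∈ M := by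
  set M : Submodule ℤ (Wm m → ℂ) := Submodule.span ℤ (((range (2 * m + 1) ×ˢ range (m + 1)).image fun x => gW m x.1 x.2 : Finset _) : Set (Wm m → ℂ)) with hM
  have key : ∀ i r : ℕ, r ≤ m → gW m i r ∈ M := fun i => by
    induction i using Nat.strong_induction_on with
    | _ i ih =>
    by_cases hi : i < 2 * m + 1
    · exact fun r hr => Submodule.subset_span (mem_coe.2 (mem_image.2 ⟨(i, r), by simp; omega, rfl⟩))
    intro r
    induction r using Nat.strong_induction_on with
    | _ r ihr =>
    intro hr
    obtain ⟨ν, rfl⟩ : ∃ ν, i = ν + m := ⟨i - m, by omega⟩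
    obtain ⟨α, β, hab⟩ : ∃ α β : ℕ, 4 * α + 6 * β + 4 * m = 2 + 12 * ν + 6 * r := by
      rcases Nat.even_or_odd (1 + 6 * ν + 3 * r) with h | h
      · exact ⟨(1 + 6 * ν + 3 * r) / 2 - m, 0, by obtain ⟨k, hk⟩ := h; omega⟩
      · exact ⟨(1 + 6 * ν + 3 * r - 3) / 2 - m, 1, by obtain ⟨k, hk⟩ := h; omega⟩
    obtain ⟨C, φ, hJ, hint, hb, h1, hz⟩ := int_form hm hr hab
    choose k hk using hint
    have hrel : ∑ x ∈ range (m + 1) ×ˢ range (ν + m + 1),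
        k (4 * m * ((m : ℤ) - x.2) - (x.1 : ℤ) ^ 2) x.1 • gW m x.2 x.1 = 0 := by
      ext b
      have := b.2.kill C φ hJ
      rw [pair_fold hm b.2.per b.2.even b.2.neg hJ.jx.per hJ.even hJ.jx.supp hb] at this
      rw [sum_product, Finset.sum_apply, Pi.zero_apply, ← this]
      refine sum_congr rfl fun r' _ => ?_
      rw [Finset.sum_apply, mul_sum]
      refine sum_congr rfl fun i' _ => ?_
      rw [Pi.smul_apply, gW, hk, zsmul_eq_mul]; ring
    rw [← add_sum_erase _ _ (show (r, ν + m) ∈ _ by simp; omega)] at hrel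
    have hk1 : k (4 * m * ((m : ℤ) - (ν + m : ℕ)) - (r : ℤ) ^ 2) r = 1 := by
      have := hk (4 * m * ((m : ℤ) - (ν + m : ℕ)) - (r : ℤ) ^ 2) r
      rw [show ((m : ℤ) - (ν + m : ℕ)) = -(ν : ℤ) by push_cast; ring, h1] at this
      rw [show ((m : ℤ) - (ν + m : ℕ)) = -(ν : ℤ) by push_cast; ring]
      exact_mod_cast this.symm
    simp only [hk1, one_smul] at hrel
    rw [eq_neg_of_add_eq_zero_left hrel]
    refine M.neg_mem (M.sum_mem fun x hx => ?_)
    rw [mem_erase, mem_product, mem_range, mem_range] at hx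
    obtain ⟨hx1, hx2, hx3⟩ := hx
    by_cases hx4 : x.2 < ν + m
    · exact M.smul_mem _ (ih _ hx4 _ (by omega))
    · have e : x.2 = ν + m := by omega
      by_cases hx5 : x.1 < r
      · rw [e]; exact M.smul_mem _ (ihr _ hx5 (by omega))
      · have hx6 : r < x.1 := by
          rcases lt_trichotomy x.1 r with h | h | h
          · omega
          · exact absurd (Prod.ext h e) hx1
          · exact h
        have := hk (4 * m * ((m : ℤ) - x.2) - (x.1 : ℤ) ^ 2) x.1
        rw [e, show ((m : ℤ) - (ν + m : ℕ)) = -(ν : ℤ) by push_cast; ring, hz _ (by rw [Nat.abs_cast]; exact_mod_cast hx6)] at this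
        rw [e, show ((m : ℤ) - (ν + m : ℕ)) = -(ν : ℤ) by push_cast; ring, show k _ _ = 0 by exact_mod_cast this.symm, zero_smul]
        exact M.zero_mem
  refine ⟨M, ⟨_, rfl⟩, fun N l => ?_⟩
  obtain ⟨h1, h2⟩ := bmod_bound l hm
  set r : ℕ := (l.bmod (2 * m)).natAbs with hr
  have hr2 : (r : ℤ) ^ 2 = (l.bmod (2 * m)) ^ 2 := by rw [hr, Int.natCast_natAbs, sq_abs]
  have hrm : r ≤ m := by
    have : (r : ℤ) ^ 2 ≤ (m : ℤ) ^ 2 := by rw [hr2]; exact h1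
    exact_mod_cast abs_le_of_sq_le_sq' this (by positivity) |>.2
  have hbl : ∀ b : Wm m, b.1 N l = b.1 N r := fun b => by
    have e1 : b.1 N l = b.1 N (l.bmod (2 * m)) := per_dvd b.2.per h2
    rw [e1, hr]
    rcases Int.natAbs_eq (l.bmod (2 * m)) with h | h
    · rw [← h]
    · conv_lhs => rw [h]
      exact b.2.even _ _
  by_cases hc : 0 ≤ N ∧ 4 * (m : ℤ) ∣ N - (r : ℤ) ^ 2
  · obtain ⟨hN, k, hk⟩ := hc
    have hkm : -(m : ℤ) ≤ k := by
      by_contra h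
      have : (r : ℤ) ≤ m := by exact_mod_cast hrm
      have h3 : (0 : ℤ) < m := by exact_mod_cast hm
      nlinarith
    obtain ⟨c, hc⟩ := wt_two (r := r) hm
    have := M.smul_mem c (key (k + m).toNat r hrm)
    convert this using 1
    ext b
    have hc' : (c : ℂ) * (wt m r : ℂ) = 2 := by exact_mod_cast hc
    rw [Pi.smul_apply, gW, zsmul_eq_mul, ← mul_assoc, hc', hbl, Int.toNat_of_nonneg (by omega)]
    rw [show 4 * (m : ℤ) * (k + m - m) + (r : ℤ) ^ 2 = N by linear_combination -hk]
  · convert M.zero_mem using 1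
    ext b
    rw [hbl, Pi.zero_apply]
    rw [not_and_or] at hc
    rcases hc with h | h
    · rw [b.2.neg _ _ (by omega), mul_zero]
    · rw [b.2.supp _ _ h, mul_zero]

lemma nuP_dvd {p : ℕ} (hp : p.Prime) {N : ℤ} (h : (p : ℤ) ∣ N) : nuP p (-N) = 1 := by
  rw [nuP, card_eq_one]
  refine ⟨0, ?_⟩
  ext s
  rw [mem_filter, mem_singleton, mem_range]
  constructor
  · rintro ⟨h1, h2⟩
    have h3 : (p : ℤ) ∣ (s : ℤ) ^ 2 := by rw [show (s : ℤ) ^ 2 = (-N + (s : ℤ) ^ 2) + N by ring]; exact dvd_add h2 h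
    have h4 : p ∣ s := hp.dvd_of_dvd_pow (by exact_mod_cast h3)
    exact Nat.eq_zero_of_dvd_of_lt h4 h1
  · rintro rfl
    exact ⟨hp.pos, by simpa using h⟩

lemma nuP_sq {p : ℕ} (hp : p.Prime) (h2 : p ≠ 2) {n : ℕ} (h : ¬ p ∣ n) : nuP p (-((n : ℤ) ^ 2)) = 2 := by
  have hn := Nat.mod_lt n hp.pos
  have hn0 : n % p ≠ 0 := fun h' => h (Nat.dvd_of_mod_eq_zero h')
  have hd := Nat.div_add_mod n p
  rw [nuP, card_eq_two]
  refine ⟨n % p, p - n % p, fun he => ?_, ?_⟩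
  · have : p = 2 * (n % p) := by omega
    rcases hp.eq_one_or_self_of_dvd 2 ⟨_, this⟩ with h3 | h3
    · omega
    · exact h2 h3.symm
  · ext s
    rw [mem_filter, mem_insert, mem_singleton, mem_range]
    have hd' : (n : ℤ) = p * (n / p : ℕ) + (n % p : ℕ) := by exact_mod_cast hd.symm
    generalize n / p = k at *
    generalize n % p = r at *
    constructor
    · rintro ⟨h1, h3⟩
      rw [show -((n : ℤ) ^ 2) + (s : ℤ) ^ 2 = ((s : ℤ) - n) * (s + n) by ring] at h3
      rcases (Nat.prime_iff_prime_int.1 hp).dvd_or_dvd h3 with h4 | h4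
      · left
        have h5 : (p : ℤ) ∣ (s : ℤ) - r := by
          rw [show (s : ℤ) - r = (s - n) + p * k by rw [hd']; ring]; exact dvd_add h4 ⟨_, rfl⟩
        have := Int.eq_zero_of_abs_lt_dvd h5 (by rw [abs_lt]; omega)
        omega
      · right
        have h5 : (p : ℤ) ∣ (s : ℤ) + r - p := by
          rw [show (s : ℤ) + r - p = (s + n) + p * (-k - 1) by rw [hd']; ring]; exact dvd_add h4 ⟨_, rfl⟩
        have := Int.eq_zero_of_abs_lt_dvd h5 (by rw [abs_lt]; omega)
        omega
    · have hnp := hp.pos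
      rintro (rfl | rfl)
      · exact ⟨hn, ⟨k * (-2 * s - p * k), by rw [hd']; ring⟩⟩
      · refine ⟨by omega, ⟨-2 * r + p - p * k ^ 2 - 2 * k * r, ?_⟩⟩
        rw [hd', Nat.cast_sub hn.le]; ring
section tower
variable {m p : ℕ} {b : ℤℤ}

def hkW (hm : 0 < m) (hp : p.Prime) (hpm : ¬ p ∣ 2 * m) {pb : ℤ} (hpb : 2 * (m : ℤ) ∣ pb * p - 1) (b : Wm m) : Wm m :=
  ⟨hk p pb b.1, KB.hk hm hp hpm hpb b.2⟩

def EW (m p : ℕ) (N l : ℤ) (i : ℕ) (b : Wm m) : ℂ := 2 * b.1 (N * (p : ℤ) ^ (2 * i)) ((p : ℤ) ^ i * l)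

lemma EW_zero (hm : 0 < m) (hp : p.Prime) (hpm : ¬ p ∣ 2 * m) {pb : ℤ} (hpb : 2 * (m : ℤ) ∣ pb * p - 1) {N l : ℤ}
    (hN : ¬ (p : ℤ) ^ 2 ∣ N) (b : Wm m) :
    EW m p N l 0 (hkW hm hp hpm hpb b) = p * EW m p N l 1 b + ((nuP p (-N) : ℂ) - 1) * EW m p N l 0 b := by
  simp only [EW, hkW, hk, mul_zero, pow_zero, mul_one, one_mul, pow_one, if_neg hN, add_zero]
  rw [mul_comm ((p : ℤ) ^ 2) N]; ring

lemma EW_succ (hm : 0 < m) (hp : p.Prime) (hpm : ¬ p ∣ 2 * m) {pb : ℤ} (hpb : 2 * (m : ℤ) ∣ pb * p - 1) {N l : ℤ}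
    (i : ℕ) (b : Wm m) :
    EW m p N l (i + 1) (hkW hm hp hpm hpb b) = p * EW m p N l (i + 2) b + EW m p N l i b := by
  have hp0 : (p : ℤ) ≠ 0 := by exact_mod_cast hp.ne_zero
  have e : N * (p : ℤ) ^ (2 * (i + 1)) = (p : ℤ) ^ 2 * (N * (p : ℤ) ^ (2 * i)) := by ring
  have hd : (p : ℤ) ^ 2 ∣ N * (p : ℤ) ^ (2 * (i + 1)) := ⟨_, e⟩
  have hd1 : (p : ℤ) ∣ N * (p : ℤ) ^ (2 * (i + 1)) := (dvd_pow_self _ two_ne_zero).trans hd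
  simp only [EW, hkW, hk, if_pos hd, nuP_dvd hp hd1, Nat.cast_one, sub_self, zero_mul, add_zero]
  rw [e, Int.mul_ediv_cancel_left _ (pow_ne_zero 2 hp0), ← e,
    show (p : ℤ) ^ 2 * (N * (p : ℤ) ^ (2 * (i + 1))) = N * (p : ℤ) ^ (2 * (i + 2)) by ring,
    show (p : ℤ) * ((p : ℤ) ^ (i + 1) * l) = (p : ℤ) ^ (i + 2) * l by ring,
    per_dvd b.2.per (l := (p : ℤ) ^ i * l) (l' := pb * ((p : ℤ) ^ (i + 1) * l))]
  · ring
  · rw [show pb * ((p : ℤ) ^ (i + 1) * l) - (p : ℤ) ^ i * l = (pb * p - 1) * ((p : ℤ) ^ i * l) by ring]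
    exact hpb.mul_right _

lemma pb_ex (hp : p.Prime) (hpm : ¬ p ∣ 2 * m) : ∃ pb : ℤ, 2 * (m : ℤ) ∣ pb * p - 1 := by
  have h : IsCoprime (p : ℤ) ((2 * m : ℕ) : ℤ) := Nat.isCoprime_iff_coprime.2 ((Nat.Prime.coprime_iff_not_dvd hp).2 hpm)
  obtain ⟨a, c, hac⟩ := h
  push_cast at hac
  exact ⟨a, -c, by linear_combination hac⟩

lemma towerA (hm : 0 < m) (hp : p.Prime) (hpm : ¬ p ∣ 2 * m) (h : KB m b) {N : ℤ} (l : ℤ) (h1 : (p : ℤ) ∣ N) (h2 : ¬ (p : ℤ) ^ 2 ∣ N)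
    (i : ℕ) : b (N * (p : ℤ) ^ (2 * i)) ((p : ℤ) ^ i * l) = 0 := by
  obtain ⟨pb, hpb⟩ := pb_ex hp hpm
  obtain ⟨M, hM, hMe⟩ := fg_eval hm
  have := NK M hM (LinearMap.funLeft ℤ ℂ (hkW hm hp hpm hpb)) hp (EW m p N l) (fun i => hMe _ _)
    (by ext b; rw [LinearMap.funLeft_apply, EW_zero hm hp hpm hpb h2, nuP_dvd hp h1]; simp)
    (fun i => by ext b; rw [LinearMap.funLeft_apply, EW_succ]; simp) i
  have := congrFun this ⟨b, h⟩
  simpa [EW] using this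

lemma towerB (hm : 0 < m) (hp : p.Prime) (hpm : ¬ p ∣ 2 * m) (h : KB m b) {n : ℕ} (l : ℤ) (h1 : ¬ p ∣ n)
    (i : ℕ) : b ((n : ℤ) ^ 2 * (p : ℤ) ^ (2 * i)) ((p : ℤ) ^ i * l) = b ((n : ℤ) ^ 2) l := by
  obtain ⟨pb, hpb⟩ := pb_ex hp hpm
  obtain ⟨M, hM, hMe⟩ := fg_eval hm
  have hp2 : p ≠ 2 := by rintro rfl; exact hpm ⟨m, rfl⟩
  have h2 : ¬ (p : ℤ) ^ 2 ∣ (n : ℤ) ^ 2 := fun hd => h1 (hp.dvd_of_dvd_pow ((dvd_pow_self p two_ne_zero).trans (by exact_mod_cast hd)))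
  have := NK M hM (LinearMap.funLeft ℤ ℂ (hkW hm hp hpm hpb)) hp (fun i => EW m p ((n : ℤ) ^ 2) l (i + 1) - EW m p ((n : ℤ) ^ 2) l i)
    (fun i => M.sub_mem (hMe _ _) (hMe _ _))
    (by
      ext b
      simp only [map_sub, Pi.sub_apply, Pi.smul_apply, LinearMap.funLeft_apply]
      rw [EW_zero hm hp hpm hpb h2, nuP_sq hp hp2 h1, EW_succ, zsmul_eq_mul]; push_cast; ring)
    (fun i => by
      ext b
      simp only [map_sub, Pi.sub_apply, Pi.add_apply, Pi.smul_apply, LinearMap.funLeft_apply]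
      rw [EW_succ, EW_succ, zsmul_eq_mul]; push_cast; ring)
  induction i with
  | zero => simp
  | succ i ih =>
    have := congrFun (this i) ⟨b, h⟩
    simp only [EW, Pi.sub_apply, Pi.zero_apply] at this
    rw [← ih]
    linear_combination this / 2
end tower

lemma KB.coprime_zero {m : ℕ} {b : ℤℤ} (hm : 0 < m) (h : KB m b) (h1 : ∀ l, b 1 l = 0) {N l : ℤ}
    (hl : IsCoprime l (2 * (m : ℤ))) : b N l = 0 := by
  by_contra hne
  have hN0 : 0 ≤ N := by by_contra hh; exact hne (h.neg _ _ (by omega))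
  have hd : 4 * (m : ℤ) ∣ N - l ^ 2 := by by_contra hh; exact hne (h.supp _ _ hh)
  lift N to ℕ using hN0
  have hcop : ∀ p : ℕ, p.Prime → p ∣ N → ¬ p ∣ 2 * m := fun p hp hpN hpm => by
    have a1 : (p : ℤ) ∣ 2 * (m : ℤ) := by exact_mod_cast hpm
    have a2 : (p : ℤ) ∣ (N : ℤ) - l ^ 2 := a1.trans (Dvd.dvd.trans ⟨2, by ring⟩ hd)
    have a3 : (p : ℤ) ∣ l ^ 2 := by
      rw [show l ^ 2 = N - ((N : ℤ) - l ^ 2) by ring]; exact dvd_sub (by exact_mod_cast hpN) a2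
    have a4 := (Nat.prime_iff_prime_int.1 hp).dvd_of_dvd_pow a3
    exact (Nat.prime_iff_prime_int.1 hp).not_unit (hl.isUnit_of_dvd' a4 a1)
  have hpl : ∀ p : ℕ, p.Prime → ¬ p ∣ 2 * m → ∀ (i : ℕ) (M l : ℤ), ∃ l', b M l = b M ((p : ℤ) ^ i * l') := fun p hp hpm i M l => by
    obtain ⟨pb, hpb⟩ := pb_ex hp hpm
    refine ⟨pb ^ i * l, (per_dvd h.per ?_).symm⟩
    rw [show (p : ℤ) ^ i * (pb ^ i * l) - l = ((pb * p) ^ i - 1 ^ i) * l by rw [one_pow, mul_pow]; ring]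
    exact (hpb.trans (sub_dvd_pow_sub_pow _ _ i)).mul_right _
  have hsq : ∀ n : ℕ, n ≠ 0 → (∀ p : ℕ, p.Prime → p ∣ n → ¬ p ∣ 2 * m) → ∀ l, b ((n : ℤ) ^ 2) l = 0 := fun n => by
    induction n using Nat.strong_induction_on with
    | _ n ih =>
    intro hn0 hc l
    by_cases hn1 : n = 1
    · rw [hn1]; simpa using h1 l
    have hp := Nat.minFac_prime hn1
    have hpn := Nat.minFac_dvd n
    have hpm := hc _ hp hpn
    generalize n.minFac = p at *
    obtain ⟨i, n0, hpn0, rfl⟩ := Nat.exists_eq_pow_mul_and_not_dvd hn0 p hp.ne_one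
    obtain ⟨l', hl'⟩ := hpl p hp hpm i (((p ^ i * n0 : ℕ) : ℤ) ^ 2) l
    rw [hl', show (((p ^ i * n0 : ℕ) : ℤ) ^ 2) = (n0 : ℤ) ^ 2 * (p : ℤ) ^ (2 * i) by push_cast; ring, towerB hm hp hpm h _ hpn0]
    have hi : i ≠ 0 := by rintro rfl; simp at hpn; exact hpn0 hpn
    have hn00 : n0 ≠ 0 := by rintro rfl; simp at hn0
    refine ih n0 ?_ hn00 (fun q hq hqn => hc q hq (hqn.mul_left _)) _
    have := Nat.one_lt_pow hi hp.one_lt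
    nlinarith [Nat.pos_of_ne_zero hn00]
  have hNne : N ≠ 0 := by
    rintro rfl
    exact hcop 2 Nat.prime_two (dvd_zero _) ⟨m, rfl⟩
  obtain ⟨a, c, rfl, ha⟩ := Nat.sq_mul_squarefree N
  have hc0 : c ≠ 0 := by rintro rfl; simp at hNne
  by_cases ha1 : a = 1
  · subst ha1
    apply hne
    have := hsq c hc0 (fun p hp hpc => hcop p hp ((hpc.mul_left c).trans (by rw [mul_one, sq]))) l
    simpa using this
  · have hp := Nat.minFac_prime ha1
    have hpa := Nat.minFac_dvd a
    generalize a.minFac = p at *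
    have hpm := hcop p hp (hpa.mul_left _)
    obtain ⟨i, n0, hpn0, rfl⟩ := Nat.exists_eq_pow_mul_and_not_dvd hc0 p hp.ne_one
    apply hne
    obtain ⟨l', hl'⟩ := hpl p hp hpm i (((p ^ i * n0) ^ 2 * a : ℕ) : ℤ) l
    rw [hl', show (((p ^ i * n0) ^ 2 * a : ℕ) : ℤ) = ((n0 : ℤ) ^ 2 * a) * (p : ℤ) ^ (2 * i) by push_cast; ring]
    refine towerA hm hp hpm h _ (Dvd.dvd.mul_left (by exact_mod_cast hpa) _) (fun hd => ?_) i
    have hd' : p ^ 2 ∣ n0 ^ 2 * a := by exact_mod_cast hd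
    have : Nat.Coprime (p ^ 2) (n0 ^ 2) := Nat.Coprime.pow _ _ ((Nat.Prime.coprime_iff_not_dvd hp).2 hpn0)
    have h3 := this.dvd_of_dvd_mul_left hd'
    rw [sq] at h3
    exact hp.not_isUnit (ha p h3)

def Gam (m : ℕ) (f : Fin (m + 1) → ℂ → ℂ) (r : ℕ) (q : ℂ) : ℂ :=
  ∑ j, f j q * (Uv q)⁻¹ ^ m * (Hm m q)⁻¹ j (Fin.ofNat (m + 1) r)

def rr (m : ℕ) (l : ℤ) : ℕ := (l.bmod (2 * m)).natAbs

def bG (m : ℕ) (f : Fin (m + 1) → ℂ → ℂ) (N l : ℤ) : ℂ :=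
  if 4 * (m : ℤ) ∣ N - (rr m l : ℤ) ^ 2 ∧ 0 ≤ (N - (rr m l : ℤ) ^ 2) / (4 * m) + m then
    (ps (Gam m f (rr m l))).coeff ((N - (rr m l : ℤ) ^ 2) / (4 * m) + m).toNat / wt m (rr m l) else 0

lemma rr_le {m : ℕ} (hm : 0 < m) (l : ℤ) : rr m l ≤ m := by
  have : ((rr m l : ℕ) : ℤ) ^ 2 ≤ (m : ℤ) ^ 2 := by rw [rr, Int.natCast_natAbs, sq_abs]; exact (bmod_bound l hm).1
  exact_mod_cast abs_le_of_sq_le_sq' this (by positivity) |>.2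

lemma rr_spec {m : ℕ} (hm : 0 < m) (l : ℤ) : 2 * (m : ℤ) ∣ l - rr m l ∨ 2 * (m : ℤ) ∣ l + rr m l := by
  have h := (bmod_bound l hm).2
  rcases Int.natAbs_eq (l.bmod (2 * m)) with h1 | h1
  · left; rw [rr, ← h1]; exact h
  · right; rw [rr]; rw [h1, sub_neg_eq_add] at h; exact h

lemma rr_eq {m : ℕ} (hm : 0 < m) {l : ℤ} {r : ℕ} (hr : r ≤ m) (h : 2 * (m : ℤ) ∣ l - r ∨ 2 * (m : ℤ) ∣ l + r) : rr m l = r := by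
  have h1 := rr_le hm l
  have h2 := rr_spec hm l
  generalize rr m l = s at *
  have key : (2 * (m : ℤ) ∣ (s : ℤ) - r) ∨ (2 * (m : ℤ) ∣ (s : ℤ) + r) := by
    rcases h with h | h <;> rcases h2 with h2 | h2
    · left; rw [show (s : ℤ) - r = (l - r) - (l - s) by ring]; exact dvd_sub h h2
    · right; rw [show (s : ℤ) + r = (l + s) - (l - r) by ring]; exact dvd_sub h2 h
    · right; rw [show (s : ℤ) + r = (l + r) - (l - s) by ring]; exact dvd_sub h h2
    · left; rw [show (s : ℤ) - r = (l + s) - (l + r) by ring]; exact dvd_sub h2 h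
  rcases key with h | h
  · have := Int.eq_zero_of_abs_lt_dvd h (by rw [abs_lt]; omega)
    omega
  · obtain ⟨k, hk⟩ := h
    have : 0 ≤ k := by by_contra hh; nlinarith
    have : k ≤ 1 := by by_contra hh; nlinarith
    interval_cases k <;> omega

lemma wt_ne {m r : ℕ} (hm : 0 < m) : (wt m r : ℂ) ≠ 0 := by
  obtain ⟨k, hk⟩ := wt_two (r := r) hm
  intro h
  have h : wt m r = 0 := by exact_mod_cast h
  rw [h] at hk; simp at hk
section
variable {m : ℕ} {f : Fin (m + 1) → ℂ → ℂ}

lemma bG_at (hm : 0 < m) {r : ℕ} (hr : r ≤ m) (i : ℕ) :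
    (wt m r : ℂ) * bG m f (4 * m * ((i : ℤ) - m) + (r : ℤ) ^ 2) r = (ps (Gam m f r)).coeff i := by
  have e : rr m (r : ℤ) = r := rr_eq hm hr (Or.inl (by simp))
  have h4 : (4 * (m : ℤ)) ≠ 0 := by positivity
  rw [bG, e, add_sub_cancel_right, Int.mul_ediv_cancel_left _ h4, if_pos ⟨⟨_, rfl⟩, by omega⟩, sub_add_cancel, Int.toNat_natCast,
    mul_div_cancel₀ _ (wt_ne hm)]

lemma bG_rr (hm : 0 < m) (N l : ℤ) : bG m f N l = bG m f N (rr m l) := by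
  have e : rr m (rr m l : ℤ) = rr m l := rr_eq hm (rr_le hm l) (Or.inl (by simp))
  rw [bG, bG, e]

lemma bG_ne (hm : 0 < m) {N l : ℤ} (h : bG m f N l ≠ 0) : ∃ i : ℕ, N = 4 * m * ((i : ℤ) - m) + (rr m l : ℤ) ^ 2 ∧
    (ps (Gam m f (rr m l))).coeff i ≠ 0 := by
  rw [bG] at h
  split_ifs at h with h1
  · obtain ⟨⟨k, hk⟩, h2⟩ := h1
    have h4 : (4 * (m : ℤ)) ≠ 0 := by positivity
    rw [hk, Int.mul_ediv_cancel_left _ h4] at h h2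
    refine ⟨(k + m).toNat, ?_, (div_ne_zero_iff.1 h).1⟩
    rw [Int.toNat_of_nonneg h2]; linear_combination hk
  · exact absurd rfl h

lemma Gam_hol (hm : 0 < m) (hf : ∀ j, Hol (f j)) (r : ℕ) : Hol (Gam m f r) :=
  Hol.sum fun j _ => ((hf j).mul (hol_Uinv m)).mul (Hol_Hinv hm _ _)

lemma Gam_mul (hm : 0 < m) {q : ℂ} (hq : ‖q‖ < 1) (j : Fin (m + 1)) :
    ∑ r : Fin (m + 1), Hm m q r j * Gam m f r q = f j q * (Uv q)⁻¹ ^ m := by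
  have h1 := Matrix.nonsing_inv_mul (Hm m q) (isUnit_iff_ne_zero.2 (Hm_det hm hq))
  have h2 : ∀ j' : Fin (m + 1), ∑ r : Fin (m + 1), (Hm m q)⁻¹ j' r * Hm m q r j = if j' = j then 1 else 0 := fun j' => by
    have := congrFun (congrFun h1 j') j
    rwa [Matrix.mul_apply, Matrix.one_apply] at this
  simp only [Gam, mul_sum]
  rw [sum_comm]
  have : ∀ j' : Fin (m + 1), ∑ r : Fin (m + 1), Hm m q r j * (f j' q * (Uv q)⁻¹ ^ m * (Hm m q)⁻¹ j' (Fin.ofNat (m + 1) r)) =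
      f j' q * (Uv q)⁻¹ ^ m * if j' = j then 1 else 0 := fun j' => by
    rw [← h2, mul_sum]
    exact sum_congr rfl fun r _ => by rw [show Fin.ofNat (m + 1) (r : ℕ) = r by simp]; ring
  simp only [this]; simp

lemma bG_per (hm : 0 < m) (N l : ℤ) : bG m f N (l + 2 * (m : ℤ)) = bG m f N l := by
  rw [bG_rr hm, bG_rr hm N l]; congr 2
  refine rr_eq hm (rr_le hm l) ?_
  rcases rr_spec hm l with h | h
  · left; rw [show l + 2 * (m : ℤ) - rr m l = (l - rr m l) + 2 * m by ring]; exact dvd_add h dvd_rfl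
  · right; rw [show l + 2 * (m : ℤ) + rr m l = (l + rr m l) + 2 * m by ring]; exact dvd_add h dvd_rfl

lemma bG_even (hm : 0 < m) (N l : ℤ) : bG m f N (-l) = bG m f N l := by
  rw [bG_rr hm, bG_rr hm N l]; congr 2
  refine rr_eq hm (rr_le hm l) ?_
  rcases rr_spec hm l with h | h
  · right; rw [show -l + (rr m l : ℤ) = -(l - rr m l) by ring]; exact h.neg_right
  · left; rw [show -l - (rr m l : ℤ) = -(l + rr m l) by ring]; exact h.neg_right

lemma pair_bG (hm : 0 < m) {C : ℤℤ} {ν : ℕ} (bn : ∀ N l : ℤ, N < 0 → bG m f N l = 0)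
    (cp : ∀ N l : ℤ, C N (l + 2 * (m : ℤ)) = C N l) (ce : IsEvenC C) (cs : ∀ Δ l : ℤ, ¬ (4 * (m : ℤ)) ∣ (Δ + l ^ 2) → C Δ l = 0)
    (hν : ∀ n r : ℤ, n < -(ν : ℤ) → C (4 * m * n - r ^ 2) r = 0) :
    pair m (bG m f) C = ∑ r ∈ range (m + 1), ∑ i ∈ range (ν + m + 1),
      (ps (Gam m f r)).coeff i * C (4 * m * ((m : ℤ) - i) - (r : ℤ) ^ 2) r := by
  rw [pair_fold hm (bG_per hm) (bG_even hm) bn cp ce cs hν]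
  refine sum_congr rfl fun r hr => ?_
  rw [mul_sum]
  refine sum_congr rfl fun i _ => ?_
  rw [← mul_assoc, bG_at hm (Nat.lt_succ_iff.1 (mem_range.1 hr))]

lemma bG_KB (hm : 0 < m) (hf : ∀ j : Fin (m + 1), MF (12 * m - 2 * (j : ℕ)) (f j)) (bn : ∀ N l : ℤ, N < 0 → bG m f N l = 0) :
    KB m (bG m f) where
  per := bG_per hm
  even := bG_even hm
  neg := bn
  supp := fun N l hd => by
    by_contra h
    obtain ⟨i, hi, _⟩ := bG_ne hm h
    apply hd
    have h2 : 4 * (m : ℤ) ∣ (rr m l : ℤ) ^ 2 - l ^ 2 := by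
      rcases rr_spec hm l with ⟨k, hk⟩ | ⟨k, hk⟩
      · exact ⟨-k * rr m l - m * k ^ 2, by rw [show l ^ 2 = (rr m l + 2 * m * k) ^ 2 by rw [← hk]; ring]; ring⟩
      · exact ⟨k * rr m l - m * k ^ 2, by rw [show l ^ 2 = (2 * m * k - rr m l) ^ 2 by rw [← hk]; ring]; ring⟩
    rw [hi, add_sub_assoc]
    exact dvd_add ⟨_, rfl⟩ h2
  kill := fun C φ hC => by
    obtain ⟨K, hK⟩ := hC.jx.bdN hm
    have hν : ∀ n r : ℤ, n < -(K : ℤ) → C (4 * m * n - r ^ 2) r = 0 := fun n r hn => hK _ _ (by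
      push_cast
      have : (0 : ℤ) < m := by exact_mod_cast hm
      nlinarith [sq_nonneg r])
    rw [pair_bG hm bn hC.jx.per hC.even hC.jx.supp hν]
    obtain ⟨F, hF, e1, e2, e3⟩ := hC.jx.struct hm hC.even hK
    set ρ : ℤ → ℂ → ℂ := fun r => row (fun n r => C (4 * m * ((n : ℤ) - K) - r ^ 2) r) r with hρ
    have hh : ∀ r ∈ range (m + 1), ∑ i ∈ range (K + m + 1), (ps (Gam m f r)).coeff i * C (4 * m * ((m : ℤ) - i) - (r : ℤ) ^ 2) r =
        (ps (fun q => Gam m f r q * ρ r q)).coeff (K + m) := fun r _ => by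
      rw [ps_mul (Gam_hol hm (fun j => (hf j).1) r) (e3 r).1, coeff_mul_fin, ← Fin.sum_univ_eq_sum_range
        (fun i => (ps (Gam m f r)).coeff i * C (4 * m * ((m : ℤ) - i) - (r : ℤ) ^ 2) r)]
      refine sum_congr rfl fun i _ => ?_
      rw [(e3 r).2, PowerSeries.coeff_mk, Nat.cast_sub (Nat.lt_succ_iff.1 i.2)]
      congr 3; push_cast; ring
    have hhol : ∀ r ∈ range (m + 1), Hol (fun q => Gam m f r q * ρ r q) := fun r _ => (Gam_hol hm (fun j => (hf j).1) r).mul (e3 r).1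
    rw [sum_congr rfl hh, ← map_sum, ← ps_sum hhol]
    have hG : MF (12 * ((K + m : ℕ) : ℤ) + 2) (fun q => ∑ j : Fin (m + 1), (F j q * Uv q ^ K) * f j q) := by
      refine ⟨Hol.sum fun j _ => ((hF j).mul (hol_Uv.pow K)).mul (hf j).1, fun τ ht => ?_⟩
      rw [mul_sum]
      refine sum_congr rfl fun j _ => ?_
      have := ((hC.comps hF e1 j).mul (hf j)).2 τ ht
      rw [show (2 + 12 * (K : ℤ) + 2 * (j : ℕ) + (12 * m - 2 * (j : ℕ))) = 12 * ((K + m : ℕ) : ℤ) + 2 by push_cast; ring] at this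
      exact this
    have := residue_thm _ _ hG.RW2
    rw [← this]
    congr 1
    refine ps_congr fun q hq => ?_
    rw [sum_range (fun r => Gam m f r q * ρ r q), sum_mul]
    have : ∀ r : Fin (m + 1), Gam m f r q * ρ (r : ℕ) q = ∑ j, F j q * (Hm m q r j * Gam m f r q) := fun r => by
      rw [hρ]; simp only []
      rw [e2 _ q hq, mul_sum]
      exact sum_congr rfl fun j _ => by rw [Hm, Matrix.of_apply]; ring
    simp only [this]
    rw [sum_comm]
    refine sum_congr rfl fun j _ => ?_
    rw [← mul_sum, Gam_mul hm hq]
    have hU := pow_ne_zero K (Uv_ne hq)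
    rw [pow_add, inv_pow, inv_pow]
    field_simp
end

lemma C3 {m : ℕ} (hm : 0 < m) (K : ℕ) (lam : ℕ → ℕ → ℂ)
    (hkill : ∀ C φ, JF m C φ → (∀ n r : ℤ, n < -(K : ℤ) → C (4 * m * n - r ^ 2) r = 0) →
      ∑ r ∈ range (m + 1), ∑ n ∈ range (K + m + 1), lam r n * C (4 * m * ((n : ℤ) - K) - (r : ℤ) ^ 2) r = 0) :
    ∃ f : Fin (m + 1) → ℂ → ℂ, (∀ j : Fin (m + 1), MF (12 * m - 2 * (j : ℕ)) (f j)) ∧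
      ∀ r ≤ m, ∀ i ≤ K + m, (ps (Gam m f r)).coeff i = lam r (K + m - i) := by
  set R := K + m with hR
  set L : Fin (m + 1) → PowerSeries ℂ := fun r => ∑ n ∈ range (R + 1), PowerSeries.C (lam r n) * PowerSeries.X ^ (R - n) with hL
  set UK := ps (fun q => (Uv q)⁻¹ ^ K) with hUK
  set Hs : Fin (m + 1) → Fin (m + 1) → PowerSeries ℂ := fun r j => ps (fun q => Hm m q r j) with hHs
  set G : Fin (m + 1) → PowerSeries ℂ := fun j => ∑ r, UK * Hs r j * L r with hG
  have hcoef : ∀ (y : PowerSeries ℂ) (r : Fin (m + 1)), (y * L r).coeff R = ∑ n ∈ range (R + 1), lam r n * y.coeff n := fun y r => by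
    rw [hL, mul_sum, map_sum]
    refine sum_congr rfl fun n hn => ?_
    rw [← mul_assoc, PowerSeries.coeff_mul_X_pow', if_pos (by omega), mul_comm, PowerSeries.coeff_C_mul, Nat.sub_sub_self (Nat.lt_succ_iff.1 (mem_range.1 hn))]
  have hLi : ∀ (r : Fin (m + 1)) (i : ℕ), i ≤ R → (L r).coeff i = lam r (R - i) := fun r i hi => by
    rw [hL, map_sum, sum_eq_single (R - i)]
    · rw [PowerSeries.coeff_C_mul, PowerSeries.coeff_X_pow, if_pos (by omega), mul_one]
    · intro n hn hne
      rw [mem_range] at hn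
      rw [PowerSeries.coeff_C_mul, PowerSeries.coeff_X_pow, if_neg (by omega), mul_zero]
    · intro h; exact absurd (mem_range.2 (by omega)) h
  have hsum : ∀ (j : Fin (m + 1)) (x : PowerSeries ℂ), ∑ n ∈ range (R + 1), (G j).coeff (R - n) * x.coeff n = (x * G j).coeff R := fun j x => by
    rw [coeff_mul_fin, sum_range]
    exact sum_congr rfl fun i _ => mul_comm _ _
  have hex : ∀ j : Fin (m + 1), ∃ f, MF (12 * m - 2 * (j : ℕ)) f ∧
      PowerSeries.X ^ (R + 1) ∣ (∑ r, Hs r j * L r) - ps (fun q => f q * (Uv q)⁻¹ ^ m) := fun j => by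
    obtain ⟨f, hf1, hf2⟩ := duality (k := 2 + 12 * K + 2 * j) (R := R) ⟨1 + 6 * K + j, by ring⟩ (by omega)
      (fun n => (G j).coeff (R - n)) (fun F hF => by
        rw [hsum]
        obtain ⟨C, φ, h1, h2, h3⟩ := JF_of hm (K := K) (F := fun j' => if j' = j then F else fun _ => 0) (fun j' => by
          by_cases h : j' = j
          · subst h; simp only [if_true]; exact_mod_cast hF
          · simp only [if_neg h]; exact ⟨Hol.const _, fun τ _ => by simp⟩)
        have := hkill C φ h1 h3
        rw [← this, hG, mul_sum, map_sum, sum_range]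
        refine sum_congr rfl fun r _ => ?_
        rw [← mul_assoc, hcoef]
        refine sum_congr rfl fun n _ => ?_
        rw [h2, sum_eq_single j]
        · simp only [if_true]; rw [hUK, hHs, ← mul_assoc]; rfl
        · intro j' _ hj'
          simp only [if_neg hj']
          rw [ps_const]; simp
        · simp)
    have hf1' : MF (12 * m - 2 * (j : ℕ)) f := by
      have e : ((12 * R + 2 - (2 + 12 * K + 2 * j) : ℕ) : ℤ) = 12 * m - 2 * (j : ℕ) := by omega
      rwa [e] at hf1
    refine ⟨f, hf1', ?_⟩
    have hd : PowerSeries.X ^ (R + 1) ∣ G j - ps (fun q => f q * (Uv q)⁻¹ ^ R) := by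
      rw [PowerSeries.X_pow_dvd_iff]
      intro i hi
      have := hf2 (PowerSeries.X ^ (R - i))
      rw [hsum, PowerSeries.coeff_X_pow_mul', PowerSeries.coeff_X_pow_mul', if_pos (by omega), if_pos (by omega),
        Nat.sub_sub_self (by omega)] at this
      rw [map_sub, this, sub_self]
    have hU1 : ps (fun q => Uv q ^ K) * UK = 1 := by
      rw [hUK, ← ps_mul (hol_Uv.pow K) (hol_Uinv K), ps_congr (G := fun _ => 1), ps_const]
      · simp
      · intro q hq
        have := pow_ne_zero K (Uv_ne hq)
        simp only [inv_pow]; field_simp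
    have hU2 : ps (fun q => Uv q ^ K) * ps (fun q => f q * (Uv q)⁻¹ ^ R) = ps (fun q => f q * (Uv q)⁻¹ ^ m) := by
      rw [← ps_mul (hol_Uv.pow K) (hf1.1.mul (hol_Uinv R))]
      refine ps_congr fun q hq => ?_
      have := pow_ne_zero K (Uv_ne hq)
      rw [hR, pow_add]
      simp only [inv_pow]; field_simp
    have := hd.mul_left (ps (fun q => Uv q ^ K))
    rw [mul_sub, hU2, hG] at this
    simp only [] at this
    rw [mul_sum] at this
    convert this using 3 with r
    rw [← mul_assoc, ← mul_assoc, hU1, one_mul]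
  choose f hf1 hf2 using hex
  refine ⟨f, hf1, fun r hr i hi => ?_⟩
  set r' : Fin (m + 1) := ⟨r, by omega⟩ with hr'
  have hro : Fin.ofNat (m + 1) r = r' := by ext; simp [hr']; omega
  have hinv : ∀ s : Fin (m + 1), ∑ j, Hs s j * ps (fun q => (Hm m q)⁻¹ j r') = if s = r' then 1 else 0 := fun s => by
    have : ∀ j ∈ univ, Hs s j * ps (fun q => (Hm m q)⁻¹ j r') = ps (fun q => Hm m q s j * (Hm m q)⁻¹ j r') := fun j _ =>
      (ps_mul (Hol_Hm m s j) (Hol_Hinv hm j r')).symm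
    rw [sum_congr rfl this, ← ps_sum fun j _ => (Hol_Hm m s j).mul (Hol_Hinv hm j r')]
    rw [ps_congr (G := fun _ => if s = r' then 1 else 0), ps_const]
    · split_ifs <;> simp
    · intro q hq
      have := congrFun (congrFun (Matrix.mul_nonsing_inv (Hm m q) (isUnit_iff_ne_zero.2 (Hm_det hm hq))) s) r'
      rwa [Matrix.mul_apply, Matrix.one_apply] at this
  have hgam : ps (Gam m f r) = ∑ j, ps (fun q => f j q * (Uv q)⁻¹ ^ m) * ps (fun q => (Hm m q)⁻¹ j r') := by
    have : ∀ j ∈ univ, ps (fun q => f j q * (Uv q)⁻¹ ^ m) * ps (fun q => (Hm m q)⁻¹ j r') = ps (fun q => f j q * (Uv q)⁻¹ ^ m * (Hm m q)⁻¹ j r') :=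
      fun j _ => (ps_mul ((hf1 j).1.mul (hol_Uinv m)) (Hol_Hinv hm j r')).symm
    rw [sum_congr rfl this, ← ps_sum fun j _ => ((hf1 j).1.mul (hol_Uinv m)).mul (Hol_Hinv hm j r')]
    unfold Gam; rw [hro]
  have hLr : L r' = ∑ j, (∑ s, Hs s j * L s) * ps (fun q => (Hm m q)⁻¹ j r') := by
    simp only [sum_mul]
    rw [sum_comm]
    have : ∀ s, ∑ j, Hs s j * L s * ps (fun q => (Hm m q)⁻¹ j r') = L s * if s = r' then 1 else 0 := fun s => by
      rw [← hinv, mul_sum]; exact sum_congr rfl fun j _ => by ring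
    simp only [this]; simp
  have hd : PowerSeries.X ^ (R + 1) ∣ L r' - ps (Gam m f r) := by
    rw [hLr, hgam, ← sum_sub_distrib]
    refine dvd_sum fun j _ => ?_
    rw [← sub_mul]
    exact (hf2 j).mul_right _
  have := PowerSeries.X_pow_dvd_iff.1 hd i (by omega)
  rw [map_sub, sub_eq_zero, hLi _ _ hi] at this
  exact this.symm

lemma hasSum_res {n : ℕ} (hn : 0 < n) {f : ℤ → ℂ} {a : ℕ → ℂ} (h : ∀ l < n, HasSum (fun k : ℤ => f (l + n * k)) (a l)) :
    HasSum f (∑ l ∈ range n, a l) := by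
  have hn' : (0 : ℤ) < n := by exact_mod_cast hn
  have h1 : ∀ l ∈ range n, HasSum (fun r : ℤ => if r % n = l then f r else 0) (a l) := by
    intro l hl
    have hl := mem_range.1 hl
    have inj : Function.Injective (fun k : ℤ => (l : ℤ) + n * k) := fun x y hxy => by
      have : (n : ℤ) * x = n * y := by simpa using hxy
      exact mul_left_cancel₀ hn'.ne' this
    rw [← inj.hasSum_iff]
    · refine (h l hl).congr_fun' fun k => ?_
      simp only [Function.comp]
      rw [if_pos]
      rw [Int.add_mul_emod_self_left, Int.emod_eq_of_lt (by omega) (by omega)]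
    · intro r hr
      rw [if_neg]
      intro he
      apply hr
      exact ⟨r / n, by simp only []; rw [← he]; exact Int.emod_add_mul_ediv r n⟩
  refine (hasSum_sum h1).congr_fun' fun r => ?_
  have h0 := Int.emod_nonneg r hn'.ne'
  have h2 := Int.emod_lt_of_pos r hn'
  rw [sum_eq_single (r % n).toNat]
  · rw [if_pos (by omega)]
  · intro b _ hb; rw [if_neg (by omega)]
  · intro hh; exact absurd (mem_range.2 (by omega)) hh

def vh (m : ℕ) (h : ℤ → ℂ) (τ z : ℂ) : ℂ :=
  ∑ l ∈ range (2 * m), h l * (ee ((l : ℂ) ^ 2 * τ / (4 * m) + l * z) * jacobiTheta₂ (l * τ + 2 * m * z) (2 * m * τ))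

lemma vh_sum {m : ℕ} (hm : 0 < m) {h : ℤ → ℂ} (hp : ∀ l, h (l + 2 * m) = h l) {τ : ℂ} (ht : 0 < τ.im) (z : ℂ) :
    HasSum (fun r : ℤ => h r * ee ((r : ℂ) ^ 2 * τ / (4 * m) + r * z)) (vh m h τ z) := by
  refine hasSum_res (n := 2 * m) (by omega) fun l hl => ?_
  have h' : 0 < (2 * (m : ℂ) * τ).im := by
    have : (2 * (m : ℂ) * τ).im = 2 * m * τ.im := by
      rw [show 2 * (m : ℂ) = ((2 * m : ℝ) : ℂ) by push_cast; ring, Complex.im_ofReal_mul]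
    rw [this]; positivity
  have hm' : (m : ℂ) ≠ 0 := by exact_mod_cast hm.ne'
  refine (((hasSum_jacobiTheta₂_term (l * τ + 2 * m * z) h').mul_left _).mul_left (h l)).congr_fun' fun k => ?_
  rw [per_gen (n := 2 * m) (g := h) (fun l => by simpa using hp l) (x := (l : ℤ) + (2 * m : ℕ) * k) (y := l) (by simp)]
  congr 1
  simp only [jacobiTheta₂_term, ee, ← Complex.exp_add]
  congr 1; push_cast; field_simp; ring

def Fh (m : ℕ) (h : ℤ → ℂ) (r : ℤ) : ℂ := ∑ l ∈ range (2 * m), ee (-(r * l / (2 * m))) * h l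

lemma Fh_per {m : ℕ} (hm : 0 < m) (h : ℤ → ℂ) (r : ℤ) : Fh m h (r + 2 * m) = Fh m h r := by
  have hm' : (m : ℂ) ≠ 0 := by exact_mod_cast hm.ne'
  refine sum_congr rfl fun l _ => ?_
  rw [show -(((r + 2 * m : ℤ) : ℂ) * l / (2 * m)) = -(r * l / (2 * m)) + ((-(l : ℤ) : ℤ) : ℂ) by push_cast; field_simp; ring,
    ee_add, ee_int, mul_one]

lemma vh_S {m : ℕ} (hm : 0 < m) {h : ℤ → ℂ} {τ : ℂ} (ht : 0 < τ.im) :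
    ∃ s : ℂ, s ≠ 0 ∧ ∀ z, vh m h (-1 / τ) (z / τ) = s * ee (m * (z ^ 2 / τ)) * vh m (Fh m h) τ z := by
  have h0 := ne0_of_im ht
  have hm' : (m : ℂ) ≠ 0 := by exact_mod_cast hm.ne'
  have hs : (-I * (τ / (2 * m))) ^ (1 / 2 : ℂ) ≠ 0 := by
    rw [Ne, Complex.cpow_eq_zero_iff]; simp [h0, hm']
  have h' : 0 < (τ / (2 * m)).im := by
    have : (τ / (2 * m)).im = τ.im / (2 * m) := by
      rw [show 2 * (m : ℂ) = ((2 * m : ℝ) : ℂ) by push_cast; ring, Complex.div_ofReal_im]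
    rw [this]; positivity
  refine ⟨_, hs, fun z => ?_⟩
  have e1 : vh m (Fh m h) τ z = ∑ l ∈ range (2 * m), h l * jacobiTheta₂ (z - l / (2 * m)) (τ / (2 * m)) := by
    refine (vh_sum hm (Fh_per hm h) ht z).unique ?_
    refine (hasSum_sum fun (l : ℕ) _ => (hasSum_jacobiTheta₂_term (z - (l : ℂ) / (2 * m)) h').mul_left (h l)).congr_fun' fun r => ?_
    rw [Fh, sum_mul]
    refine sum_congr rfl fun l _ => ?_
    have : ee (-(r * l / (2 * m))) * ee ((r : ℂ) ^ 2 * τ / (4 * m) + r * z) = jacobiTheta₂_term r (z - l / (2 * m)) (τ / (2 * m)) := by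
      simp only [jacobiTheta₂_term, ee, ← Complex.exp_add]
      congr 1; push_cast; field_simp; ring
    rw [← this]; ring
  rw [e1, vh, mul_sum]
  refine sum_congr rfl fun l _ => ?_
  have := jacobiTheta₂_functional_equation (z - l / (2 * m)) (τ / (2 * m))
  rw [this, show (z - l / (2 * m)) / (τ / (2 * m)) = l * (-1 / τ) + 2 * m * (z / τ) by field_simp; ring,
    show -1 / (τ / (2 * m)) = 2 * m * (-1 / τ) by field_simp]
  have : cexp (-Real.pi * I * (z - l / (2 * m)) ^ 2 / (τ / (2 * m))) * ee (m * (z ^ 2 / τ)) = ee ((l : ℂ) ^ 2 * (-1 / τ) / (4 * m) + l * (z / τ)) := by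
    simp only [ee, ← Complex.exp_add]; congr 1; field_simp; ring
  rw [← this]
  field_simp

def xh (m : ℕ) (h : ℤ → ℂ) (τ : ℂ) (j : ℕ) : ℂ :=
  ∑ r : Fin (m + 1), (Hm m (ee τ))⁻¹ (Fin.ofNat (m + 1) j) r * (h (r : ℕ) * ee ((r : ℕ) ^ 2 * τ / (4 * m)))

lemma ofNat_fin {m : ℕ} (j : Fin (m + 1)) : Fin.ofNat (m + 1) (j : ℕ) = j := by
  ext; simp [Fin.ofNat, Nat.mod_eq_of_lt j.2]

lemma vh_x {m : ℕ} (hm : 0 < m) {h : ℤ → ℂ} (hp : ∀ l, h (l + 2 * m) = h l) (he : ∀ l, h (-l) = h l) {τ : ℂ} (ht : 0 < τ.im) (z : ℂ) :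
    vh m h τ z = ∑ j ∈ range (m + 1), xh m h τ j * Bs m j (ee τ) z := by
  have hm' : (m : ℂ) ≠ 0 := by exact_mod_cast hm.ne'
  have hq := norm_ee ht
  have hR : RL m (fun r : ℤ => h r * ee ((r : ℂ) ^ 2 * τ / (4 * m))) (ee τ) := by
    refine ⟨fun r => ?_, fun r hr => ?_⟩
    · simp only []; rw [he]; congr 2; push_cast; ring
    · simp only []
      rw [hp, ← ee_natmul, mul_left_comm, ← ee_add]
      have : ((((r + m).toNat : ℕ) : ℂ)) = r + m := by
        have : (((r + m).toNat : ℕ) : ℤ) = r + m := Int.toNat_of_nonneg hr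
        exact_mod_cast congrArg (fun x : ℤ => (x : ℂ)) this
      rw [this]
      congr 2; push_cast; field_simp; ring
  have hz := RL.zero hm (hR.sub_sum hq (fun j => xh m h τ j)) (fun r hr => ?_)
  · refine (vh_sum hm hp ht z).unique ?_
    rw [← Fin.sum_univ_eq_sum_range (fun j => xh m h τ j * Bs m j (ee τ) z)]
    refine (Bs_sum_rows hq (fun j => xh m h τ j) z).congr_fun' fun r => ?_
    have := hz r
    rw [← sub_eq_zero.1 this, ee_add, mul_assoc]
  · rw [sub_eq_zero]
    have h1 := Matrix.mul_nonsing_inv (Hm m (ee τ)) (isUnit_iff_ne_zero.2 (Hm_det hm hq))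
    let w : Fin (m + 1) → ℂ := fun r => h (r : ℕ) * ee ((r : ℕ) ^ 2 * τ / (4 * m))
    have h2 : (Hm m (ee τ)).mulVec ((Hm m (ee τ))⁻¹.mulVec w) = w := by
      rw [Matrix.mulVec_mulVec, h1, Matrix.one_mulVec]
    have h3 := congrFun h2 ⟨r, by omega⟩
    rw [Matrix.mulVec, dotProduct] at h3
    simp only [w] at h3
    push_cast
    rw [← h3]
    refine sum_congr rfl fun j _ => ?_
    rw [mul_comm]
    congr 1
    rw [xh, ofNat_fin]; rfl

lemma Fh_even {m : ℕ} {h : ℤ → ℂ} (hm : 0 < m) (hp : ∀ l, h (l + 2 * m) = h l) (he : ∀ l, h (-l) = h l) (r : ℤ) : Fh m h (-r) = Fh m h r := by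
  have hm' : (m : ℂ) ≠ 0 := by exact_mod_cast hm.ne'
  have := sum_mod_neg (n := 2 * m) (g := fun l : ℤ => ee (-(r * l / (2 * m))) * h l) (by omega) (fun l => by
    rw [show (l + (2 * m : ℕ) : ℤ) = l + 2 * m by push_cast; ring, hp, show -((r : ℂ) * ((l + 2 * m : ℤ) : ℂ) / (2 * m)) = -(r * l / (2 * m)) + ((-r : ℤ) : ℂ) by push_cast; field_simp; ring,
      ee_add, ee_int, mul_one])
  simp only [Int.cast_natCast] at this
  rw [Fh, Fh, ← this]
  refine sum_congr rfl fun l _ => ?_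
  rw [he]; congr 2; push_cast; ring

lemma xh_S {m : ℕ} (hm : 0 < m) {h : ℤ → ℂ} (hp : ∀ l, h (l + 2 * m) = h l) (he : ∀ l, h (-l) = h l) {τ : ℂ} (ht : 0 < τ.im) :
    ∃ s : ℂ, s ≠ 0 ∧ ∀ j ≤ m, xh m h (-1 / τ) j * τ ^ (-(2 * j) : ℤ) = s * xh m (Fh m h) τ j := by
  obtain ⟨s, hs, h1⟩ := vh_S hm (h := h) ht
  refine ⟨s, hs, fun j hj => ?_⟩
  have := Bs_indep (norm_ee ht) (fun j : ℕ => xh m h (-1 / τ) j * τ ^ (-(2 * j) : ℤ) - s * xh m (Fh m h) τ j) (fun z => ?_) j hj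
  · exact sub_eq_zero.1 this
  · have h2 := h1 z
    rw [vh_x hm hp he (im_S ht), vh_x hm (Fh_per hm h) (Fh_even hm hp he) ht, mul_sum] at h2
    have h3 : ee (m * (z ^ 2 / τ)) * ∑ j ∈ range (m + 1), (xh m h (-1 / τ) j * τ ^ (-(2 * j) : ℤ) - s * xh m (Fh m h) τ j) * Bs m j (ee τ) z = 0 := by
      rw [← sub_eq_zero, ← sum_sub_distrib] at h2
      rw [← h2, mul_sum]
      refine sum_congr rfl fun j hj => ?_
      rw [SLaw_Bs (by have := mem_range.1 hj; omega) τ z ht]; ring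
    exact (mul_eq_zero.1 h3).resolve_left (ee_ne _)
section
variable {m : ℕ} {f : Fin (m + 1) → ℂ → ℂ}

def Sh (m : ℕ) (f : Fin (m + 1) → ℂ → ℂ) (h : ℤ → ℂ) (τ : ℂ) : ℂ :=
  ∑ r ∈ range (m + 1), h r * (ee ((r : ℂ) ^ 2 * τ / (4 * m)) * Gam m f r (ee τ))

lemma Sh_x (h : ℤ → ℂ) (τ : ℂ) : Sh m f h τ = ∑ j : Fin (m + 1), xh m h τ j * (f j (ee τ) * (Uv (ee τ))⁻¹ ^ m) := by
  rw [Sh, ← Fin.sum_univ_eq_sum_range (fun r : ℕ => h r * (ee ((r : ℂ) ^ 2 * τ / (4 * m)) * Gam m f r (ee τ)))]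
  simp only [Gam, xh, mul_sum, sum_mul]
  rw [sum_comm]
  refine sum_congr rfl fun j _ => sum_congr rfl fun r _ => ?_
  rw [ofNat_fin, ofNat_fin]; ring

lemma Sh_F (hm : 0 < m) (hf : ∀ j : Fin (m + 1), MF (12 * m - 2 * (j : ℕ)) (f j)) {h : ℤ → ℂ} (hp : ∀ l, h (l + 2 * m) = h l) (he : ∀ l, h (-l) = h l)
    (hz : ∀ τ : ℂ, 0 < τ.im → Sh m f h τ = 0) {τ : ℂ} (ht : 0 < τ.im) : Sh m f (Fh m h) τ = 0 := by
  obtain ⟨s, hs, h1⟩ := xh_S hm hp he ht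
  have h0 := ne0_of_im ht
  have h2 := hz _ (im_S ht)
  have hU := pow_ne_zero m (inv_ne_zero (Uv_ne (norm_ee ht)))
  have hU' := pow_ne_zero m (inv_ne_zero (Uv_ne (norm_ee (im_S ht))))
  rw [Sh_x] at h2
  have h3 : Sh m f (Fh m h) τ * (s * τ ^ (12 * m : ℤ) * (Uv (ee (-1 / τ)))⁻¹ ^ m) = 0 := by
    rw [Sh_x, sum_mul, ← mul_zero ((Uv (ee τ))⁻¹ ^ m), ← h2, mul_sum]
    refine sum_congr rfl fun j _ => ?_
    have h4 := h1 j (by omega)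
    rw [(hf j).2 τ ht, sub_eq_add_neg, zpow_add₀ h0]
    linear_combination (-(f j (ee τ) * (Uv (ee τ))⁻¹ ^ m * (Uv (ee (-1 / τ)))⁻¹ ^ m * τ ^ (12 * m : ℤ))) * h4
  refine (mul_eq_zero.1 h3).resolve_right ?_
  exact mul_ne_zero (mul_ne_zero hs (zpow_ne_zero _ h0)) hU'

lemma Sh_iff (hm : 0 < m) (hf : ∀ j, Hol (f j)) {h : ℤ → ℂ} (hp : ∀ l, h (l + 2 * m) = h l) (he : ∀ l, h (-l) = h l) :
    (∀ τ : ℂ, 0 < τ.im → Sh m f h τ = 0) ↔ ∀ N : ℤ, ∑ l ∈ range (2 * m), h l * bG m f N l = 0 := by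
  have hm' : (m : ℂ) ≠ 0 := by exact_mod_cast hm.ne'
  let c : ℕ → ℂ := fun n => ∑ l ∈ range (2 * m), h l * bG m f ((n : ℤ) - 4 * m ^ 2) l
  have hc : ∀ n, c n = ∑ r ∈ range (m + 1), (wt m r : ℂ) * (h r * bG m f ((n : ℤ) - 4 * m ^ 2) r) := fun n =>
    sum_fold (F := fun l => h l * bG m f ((n : ℤ) - 4 * m ^ 2) l) (fun l => by rw [hp, bG_per hm]) (fun l => by rw [he, bG_even hm])
  have hN : ∀ N l : ℤ, N < -(4 * m ^ 2) → bG m f N l = 0 := fun N l hN => by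
    by_contra hh
    obtain ⟨i, hi, _⟩ := bG_ne hm hh
    nlinarith [sq_nonneg (rr m l : ℤ)]
  have hsum : ∀ t : ℂ, ‖t‖ < 1 → HasSum (fun n : ℕ => c n * t ^ n) (∑ r ∈ range (m + 1), h r * (t ^ (r ^ 2) * Gam m f r (t ^ (4 * m)))) := by
    intro t ht
    have hq : ‖t ^ (4 * m)‖ < 1 := by rw [norm_pow]; exact pow_lt_one₀ (norm_nonneg _) ht (by omega)
    have h1 : ∀ r ∈ range (m + 1), HasSum (fun n : ℕ => (wt m r : ℂ) * (h r * bG m f ((n : ℤ) - 4 * m ^ 2) r) * t ^ n) (h r * (t ^ (r ^ 2) * Gam m f r (t ^ (4 * m)))) := by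
      intro r hr
      have hr := mem_range.1 hr
      have h2 := ((hol_hasSum (Gam_hol hm hf r) hq).mul_left (t ^ (r ^ 2))).mul_left (h r)
      have inj : Function.Injective (fun i : ℕ => 4 * m * i + r ^ 2) := fun x y hxy => by
        have : 4 * m * x = 4 * m * y := by simpa using hxy
        exact Nat.eq_of_mul_eq_mul_left (by omega) this
      rw [← inj.hasSum_iff]
      · refine h2.congr_fun' fun i => ?_
        simp only [Function.comp]
        rw [← bG_at hm (by omega : r ≤ m) i, pow_add, pow_mul, show ((4 * m * i + r ^ 2 : ℕ) : ℤ) - 4 * m ^ 2 = 4 * m * ((i : ℤ) - m) + (r : ℤ) ^ 2 by push_cast; ring]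
        ring
      · intro n hn
        suffices bG m f ((n : ℤ) - 4 * m ^ 2) r = 0 by rw [this]; ring
        by_contra hh
        obtain ⟨i, hi, _⟩ := bG_ne hm hh
        rw [rr_eq hm (by omega : r ≤ m) (Or.inl (by simp))] at hi
        apply hn
        refine ⟨i, ?_⟩
        zify; linear_combination -hi
    refine (hasSum_sum h1).congr_fun' fun n => ?_
    rw [hc, sum_mul]
  have hΦ := hol_tsum c fun q hq => (hsum q hq).summable
  have hS : ∀ σ : ℂ, 0 < σ.im → Sh m f h (4 * m * σ) = ∑' n, c n * ee σ ^ n := fun σ hσ => by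
    rw [(hsum _ (norm_ee hσ)).tsum_eq, Sh]
    refine sum_congr rfl fun r _ => ?_
    rw [← ee_natmul, ← ee_natmul]
    push_cast
    rw [show (r : ℂ) ^ 2 * (4 * m * σ) / (4 * m) = r ^ 2 * σ by field_simp]
  have him : ∀ σ : ℂ, (4 * m * σ).im = 4 * m * σ.im := fun σ => by
    rw [show 4 * (m : ℂ) = ((4 * m : ℝ) : ℂ) by push_cast; ring, Complex.im_ofReal_mul]
  constructor
  · intro h1 N
    by_cases hNN : N < -(4 * m ^ 2)
    · exact sum_eq_zero fun l _ => by rw [hN N l hNN, mul_zero]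
    · have h2 : ∀ q : ℂ, ‖q‖ < 1 → ∑' n, c n * q ^ n = (fun _ => (0 : ℂ)) q := fun q hq =>
        hol_eq hΦ.1 (Hol.const 0) (fun σ hσ => by
          rw [← hS σ hσ, h1]; rw [him]; positivity) hq
      have h3 := hΦ.2
      rw [ps_congr h2, ps_const, map_zero] at h3
      have h4 := congrArg (PowerSeries.coeff (N + 4 * m ^ 2).toNat) h3
      rw [PowerSeries.coeff_mk, map_zero] at h4
      simp only [c] at h4
      rw [Int.toNat_of_nonneg (by omega), add_sub_cancel_right] at h4
      exact h4.symm
  · intro h1 τ ht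
    have := hS (τ / (4 * m)) (by
      rw [show 4 * (m : ℂ) = ((4 * m : ℝ) : ℂ) by push_cast; ring, Complex.div_ofReal_im]; positivity)
    rw [show 4 * m * (τ / (4 * m)) = τ by field_simp] at this
    rw [this]
    have hc0 : ∀ n, c n = 0 := fun n => h1 _
    simp [hc0]

def V0 (m : ℕ) (b : ℤℤ) (h : ℤ → ℂ) : Prop := ∀ N : ℤ, ∑ l ∈ range (2 * m), h l * b N l = 0

lemma V0_F (hm : 0 < m) (hf : ∀ j : Fin (m + 1), MF (12 * m - 2 * (j : ℕ)) (f j)) {h : ℤ → ℂ} (hp : ∀ l, h (l + 2 * m) = h l)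
    (hz : V0 m (bG m f) h) : V0 m (bG m f) (Fh m h) := by
  have hm' : (m : ℂ) ≠ 0 := by exact_mod_cast hm.ne'
  have neg : ∀ g : ℤ → ℂ, (∀ l, g (l + 2 * m) = g l) → ∀ N, ∑ l ∈ range (2 * m), g (-l) * bG m f N l = ∑ l ∈ range (2 * m), g l * bG m f N l := by
    intro g hg N
    rw [← sum_mod_neg (n := 2 * m) (g := fun l => g l * bG m f N l) (by omega) (fun l => by
      rw [show (l + (2 * m : ℕ) : ℤ) = l + 2 * m by push_cast; ring, hg, bG_per hm])]
    exact sum_congr rfl fun l _ => by rw [bG_even hm]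
  have hp' : ∀ l, h (-(l + 2 * m)) = h (-l) := fun l => by
    rw [← hp (-(l + 2 * m))]; congr 1; ring
  let g : ℤ → ℂ := fun l => h l + h (-l)
  have gp : ∀ l, g (l + 2 * m) = g l := fun l => by simp only [g]; rw [hp, hp']
  have ge : ∀ l, g (-l) = g l := fun l => by simp only [g]; rw [neg_neg, add_comm]
  have gz : V0 m (bG m f) g := fun N => by
    simp only [g, add_mul, sum_add_distrib]
    rw [neg h hp, hz N, add_zero]
  have gF : V0 m (bG m f) (Fh m g) :=
    (Sh_iff hm (fun j => (hf j).1) (Fh_per hm g) (Fh_even hm gp ge)).1 fun τ ht =>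
      Sh_F hm hf gp ge ((Sh_iff hm (fun j => (hf j).1) gp ge).2 gz) ht
  have e : ∀ r, Fh m g r = Fh m h r + Fh m h (-r) := fun r => by
    have := sum_mod_neg (n := 2 * m) (g := fun l : ℤ => ee (r * l / (2 * m)) * h l) (by omega) (fun l => by
      rw [show (l + (2 * m : ℕ) : ℤ) = l + 2 * m by push_cast; ring, hp, show ((r : ℂ) * ((l + 2 * m : ℤ) : ℂ) / (2 * m)) = (r * l / (2 * m)) + (r : ℤ) by push_cast; field_simp; try ring,
        ee_add, ee_int, mul_one])
    simp only [Int.cast_natCast] at this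
    simp only [Fh, g, mul_add, sum_add_distrib]
    congr 1
    calc _ = ∑ i ∈ range (2 * m), ee (r * ((-(i : ℤ) : ℤ) : ℂ) / (2 * m)) * h (-i) := sum_congr rfl fun i _ => by congr 2; push_cast; ring
      _ = _ := this
      _ = _ := sum_congr rfl fun i _ => by congr 2; push_cast; ring
  intro N
  have h1 := gF N
  simp only [e, add_mul, sum_add_distrib] at h1
  rw [neg (Fh m h) (Fh_per hm h)] at h1
  linear_combination h1 / 2
end

def Pr (m : ℕ) (h : ℤ → ℂ) : Prop := ∀ l, h (l + 2 * m) = h l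

def XX (m : ℕ) (u v : ℤ) (h : ℤ → ℂ) (r : ℤ) : ℂ := ee (v * (2 * r - u) / (4 * m)) * h (r - u)

def ZZ (m : ℕ) (x : ℕ × ℤ × ℤ) (h : ℤ → ℂ) (r : ℤ) : ℂ := h r - XX m (((2 * m / x.1 : ℕ) : ℤ) * x.2.1) (((2 * m / x.1 : ℕ) : ℤ) * x.2.2) h r

def ZL (m : ℕ) : List (ℕ × ℤ × ℤ) → (ℤ → ℂ) → ℤ → ℂ
  | [], h => h
  | x :: M, h => ZZ m x (ZL m M h)

def Tk (m : ℕ) (k : ℤ) (h : ℤ → ℂ) (r : ℤ) : ℂ := ee (k * r ^ 2 / (4 * m)) * h r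
section
variable {m : ℕ}

lemma Pr.gen {h : ℤ → ℂ} (hp : Pr m h) {x y : ℤ} (hd : 2 * (m : ℤ) ∣ x - y) : h x = h y :=
  per_gen (n := 2 * m) (fun i => by simpa using hp i) (by push_cast; exact hd)

lemma XX_per (hm : 0 < m) {h : ℤ → ℂ} (hp : Pr m h) (u v : ℤ) : Pr m (XX m u v h) := fun l => by
  have hm' : (m : ℂ) ≠ 0 := by exact_mod_cast hm.ne'
  rw [XX, XX, hp.gen (x := l + 2 * m - u) (y := l - u) (by ring_nf; simp),
    show (v : ℂ) * (2 * ((l + 2 * m : ℤ) : ℂ) - u) / (4 * m) = v * (2 * l - u) / (4 * m) + (v : ℤ) by push_cast; field_simp; ring,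
    ee_add, ee_int, mul_one]

lemma ZZ_per (hm : 0 < m) {h : ℤ → ℂ} (hp : Pr m h) (x) : Pr m (ZZ m x h) := fun l => by
  rw [ZZ, ZZ, hp, XX_per hm hp]

lemma ZL_per (hm : 0 < m) {h : ℤ → ℂ} (hp : Pr m h) (M) : Pr m (ZL m M h) := by
  induction M with
  | nil => exact hp
  | cons x M ih => exact ZZ_per hm ih x

lemma Tk_per (hm : 0 < m) {h : ℤ → ℂ} (hp : Pr m h) (k : ℤ) : Pr m (Tk m k h) := fun l => by
  have hm' : (m : ℂ) ≠ 0 := by exact_mod_cast hm.ne'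
  rw [Tk, Tk, hp, show (k : ℂ) * ((l + 2 * m : ℤ) : ℂ) ^ 2 / (4 * m) = k * l ^ 2 / (4 * m) + ((k * (l + m) : ℤ) : ℂ) by push_cast; field_simp; ring,
    ee_add, ee_int, mul_one]

lemma sum_shift (hm : 0 < m) {h : ℤ → ℂ} (hp : Pr m h) (u : ℤ) : ∑ l ∈ range (2 * m), h (l + u) = ∑ l ∈ range (2 * m), h l :=
  sum_mod (n := 2 * m) (by omega) (fun i => by simpa using hp i) (fun i => (i : ℤ) + u) fun i hi j hj hd => by
    have : |(i : ℤ) - j| < (2 * m : ℕ) := by rw [abs_lt]; omega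
    have := Int.eq_zero_of_abs_lt_dvd (by rw [show (i : ℤ) + u - (j + u) = i - j by ring] at hd; exact hd) this
    omega

lemma Fh_XX (hm : 0 < m) {h : ℤ → ℂ} (hp : Pr m h) (u v : ℤ) : Fh m (XX m u v h) = XX m v (-u) (Fh m h) := by
  have hm' : (m : ℂ) ≠ 0 := by exact_mod_cast hm.ne'
  ext r
  have hq : Pr m (fun l : ℤ => ee (-(r * l / (2 * m))) * XX m u v h l) := fun l => by
    simp only []
    rw [XX_per hm hp, show -((r : ℂ) * ((l + 2 * m : ℤ) : ℂ) / (2 * m)) = -(r * l / (2 * m)) + ((-r : ℤ) : ℂ) by push_cast; field_simp; ring,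
      ee_add, ee_int, mul_one]
  have := sum_shift hm hq u
  simp only [Int.cast_natCast] at this
  rw [Fh, ← this, XX, Fh, mul_sum]
  refine sum_congr rfl fun l _ => ?_
  rw [XX, add_sub_cancel_right, ← mul_assoc, ← mul_assoc, ← ee_add, ← ee_add]
  congr 2; push_cast; field_simp; ring

lemma Tk_XX (hm : 0 < m) (h : ℤ → ℂ) (k u v : ℤ) : Tk m k (XX m u v h) = XX m u (v + k * u) (Tk m k h) := by
  have hm' : (m : ℂ) ≠ 0 := by exact_mod_cast hm.ne'
  ext r
  rw [Tk, XX, XX, Tk, ← mul_assoc, ← mul_assoc, ← ee_add, ← ee_add]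
  congr 2; push_cast; field_simp; ring

lemma Fh_ZL (hm : 0 < m) {h : ℤ → ℂ} (hp : Pr m h) (M : List (ℕ × ℤ × ℤ)) :
    Fh m (ZL m M h) = ZL m (M.map fun x => (x.1, x.2.2, -x.2.1)) (Fh m h) := by
  induction M with
  | nil => rfl
  | cons x M ih =>
    rw [List.map_cons, ZL, ZL, ← ih]
    ext r
    rw [ZZ]
    simp only []
    rw [mul_neg, ← Fh_XX hm (ZL_per hm hp M)]
    simp only [Fh, ZZ, mul_sub, sum_sub_distrib]

lemma Tk_ZL (hm : 0 < m) (h : ℤ → ℂ) (k : ℤ) (M : List (ℕ × ℤ × ℤ)) :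
    Tk m k (ZL m M h) = ZL m (M.map fun x => (x.1, x.2.1, x.2.2 + k * x.2.1)) (Tk m k h) := by
  induction M with
  | nil => rfl
  | cons x M ih =>
    rw [List.map_cons, ZL, ZL, ← ih]
    ext r
    rw [ZZ]
    simp only []
    rw [mul_add, mul_left_comm, ← Tk_XX hm]
    simp only [Tk, ZZ, mul_sub]

lemma Fh_Fh (hm : 0 < m) {h : ℤ → ℂ} (hp : Pr m h) (r : ℤ) : Fh m (Fh m h) r = 2 * m * h (-r) := by
  have hm' : (m : ℂ) ≠ 0 := by exact_mod_cast hm.ne'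
  have e : ∀ s : ℕ, ∑ l ∈ range (2 * m), ee (-(r * l / (2 * m))) * ee (-(((l : ℤ) : ℂ) * s / (2 * m))) = if 2 * (m : ℤ) ∣ s + r then 2 * (m : ℂ) else 0 := fun s => by
    have := sum_ee (a := 2 * m) (by omega) (-(s + r))
    simp only [dvd_neg] at this
    push_cast at this
    rw [← this]
    refine sum_congr rfl fun l _ => ?_
    rw [← ee_add]; congr 1; push_cast; field_simp; ring
  have h2 : Fh m (Fh m h) r = ∑ s ∈ range (2 * m), (fun s : ℤ => (if 2 * (m : ℤ) ∣ s + r then 2 * (m : ℂ) else 0) * h s) s := by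
    rw [Fh]
    simp only [Fh, mul_sum]
    rw [sum_comm]
    refine sum_congr rfl fun s _ => ?_
    rw [← e, sum_mul]
    exact sum_congr rfl fun l _ => by ring
  have hp' : Pr m (fun s : ℤ => (if 2 * (m : ℤ) ∣ s + r then 2 * (m : ℂ) else 0) * h s) := fun l => by
    simp only []
    rw [hp]
    congr 1
    simp only [show l + 2 * m + r = l + r + 2 * m by ring, dvd_add_self_right]
  rw [h2, ← sum_shift hm hp' (-r), sum_eq_single 0]
  · simp
  · intro b hb hb0
    have := mem_range.1 hb
    rw [if_neg, zero_mul]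
    rw [neg_add_cancel_right]
    intro hd
    have := Int.eq_zero_of_abs_lt_dvd hd (by rw [abs_lt]; omega)
    omega
  · intro hh; exact absurd (mem_range.2 (by omega)) hh

lemma Fh_surj (hm : 0 < m) {h : ℤ → ℂ} (hp : Pr m h) : ∃ g, Pr m g ∧ Fh m g = h := by
  have hm' : (m : ℂ) ≠ 0 := by exact_mod_cast hm.ne'
  have hn : Pr m (fun l => h (-l)) := fun l => hp.gen (by ring_nf; simp)
  refine ⟨fun l => (2 * m : ℂ)⁻¹ * Fh m (fun l => h (-l)) l, fun l => ?_, ?_⟩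
  · simp only []; rw [Fh_per hm]
  · ext r
    have := Fh_Fh hm hn r
    rw [neg_neg] at this
    rw [Fh]
    rw [Fh] at this
    simp only [mul_left_comm, ← mul_sum]
    rw [this]; field_simp
variable {b : ℤℤ}

structure VB (m : ℕ) (b : ℤℤ) : Prop where
  hF : ∀ h, Pr m h → V0 m b h → V0 m b (Fh m h)
  hs : ∀ N l, b N l ≠ 0 → 4 * (m : ℤ) ∣ N - l ^ 2
  hc : ∀ N l, IsCoprime l (2 * (m : ℤ)) → b N l = 0

lemma VB.hT (hb : VB m b) (hm : 0 < m) {h : ℤ → ℂ} (hz : V0 m b h) (k : ℤ) : V0 m b (Tk m k h) := fun N => by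
  have hm' : (m : ℂ) ≠ 0 := by exact_mod_cast hm.ne'
  have : ∑ l ∈ range (2 * m), Tk m k h l * b N l = ee (k * N / (4 * m)) * ∑ l ∈ range (2 * m), h l * b N l := by
    rw [mul_sum]
    refine sum_congr rfl fun l _ => ?_
    by_cases h0 : b N l = 0
    · rw [h0]; ring
    · obtain ⟨d, hd⟩ := hb.hs N l h0
      have hd : (N : ℂ) = l ^ 2 + 4 * m * d := by
        have : N = (l : ℤ) ^ 2 + 4 * m * d := by linarith
        rw [this]; push_cast; ring
      rw [Tk, hd, show (k : ℂ) * ((l : ℂ) ^ 2 + 4 * m * d) / (4 * m) = k * ((l : ℤ) : ℂ) ^ 2 / (4 * m) + ((k * d : ℤ) : ℂ) by push_cast; field_simp,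
        ee_add, ee_int]; ring
  rw [this, hz N, mul_zero]

def QL (m : ℕ) (b : ℤℤ) (M : List (ℕ × ℤ × ℤ)) : Prop := ∀ h, Pr m h → V0 m b (ZL m M h)

lemma QL.S (hb : VB m b) (hm : 0 < m) {M} (h : QL m b M) : QL m b (M.map fun x => (x.1, x.2.2, -x.2.1)) := fun k hk => by
  obtain ⟨g, hg, rfl⟩ := Fh_surj hm hk
  rw [← Fh_ZL hm hg]
  exact hb.hF _ (ZL_per hm hg M) (h g hg)

lemma QL.T (hb : VB m b) (hm : 0 < m) {M} (h : QL m b M) (k : ℤ) : QL m b (M.map fun x => (x.1, x.2.1, x.2.2 + k * x.2.1)) := fun g hg => by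
  have e : g = Tk m k (Tk m (-k) g) := by
    ext r
    rw [Tk, Tk, ← mul_assoc, ← ee_add]
    rw [show (k : ℂ) * r ^ 2 / (4 * m) + ((-k : ℤ) : ℂ) * r ^ 2 / (4 * m) = 0 by push_cast; ring, ee_zero, one_mul]
  rw [e, ← Tk_ZL hm]
  exact hb.hT hm (h _ (Tk_per hm hg _)) k

lemma ZL_supp (hm : 0 < m) {r : ℤ} : ∀ (PL : List ℕ) (h : ℤ → ℂ), (∀ p ∈ PL, 0 < p ∧ p ∣ 2 * m) → (∃ p ∈ PL, (p : ℤ) ∣ r) →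
    ZL m (PL.map fun p => (p, 0, 1)) h r = 0
  | [], _, _, h2 => by simp at h2
  | p :: PL, h, h1, h2 => by
    have hm' : (m : ℂ) ≠ 0 := by exact_mod_cast hm.ne'
    obtain ⟨hp0, a, ha⟩ := h1 p (by simp)
    have hp' : (p : ℂ) ≠ 0 := by exact_mod_cast hp0.ne'
    have ha' : 2 * (m : ℂ) = p * a := by exact_mod_cast ha
    have e : ∀ g : ℤ → ℂ, ZZ m (p, 0, 1) g r = (1 - ee (r / p)) * g r := fun g => by
      rw [ZZ, XX]
      simp only [ha, Nat.mul_div_cancel_left a hp0]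
      rw [show (((a : ℤ) * 1 : ℤ) : ℂ) * (2 * r - (((a : ℤ) * 0 : ℤ) : ℂ)) / (4 * m) = r / p by
        rw [show 4 * (m : ℂ) = 2 * (p * a) by rw [← ha']; ring]
        have : (a : ℂ) ≠ 0 := by rintro h; rw [h, mul_zero] at ha'; simp [hm'] at ha'
        push_cast; field_simp; ring]
      simp; ring
    rw [List.map_cons, ZL, e]
    rw [List.exists_mem_cons_iff] at h2
    rcases h2 with ⟨k, hk⟩ | h2
    · rw [hk, show (((p : ℤ) * k : ℤ) : ℂ) / p = (k : ℤ) by push_cast; field_simp, ee_int]; ring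
    · rw [ZL_supp hm PL h (fun p hp => h1 p (List.mem_cons_of_mem _ hp)) h2, mul_zero]

lemma QL_cop (hb : VB m b) (hm : 0 < m) {PL : List ℕ} (hP : ∀ p, p.Prime → (p ∈ PL ↔ p ∣ 2 * m)) (hP' : ∀ p ∈ PL, p.Prime) :
    ∀ (n : ℕ) (x y : ℤ), x.natAbs = n → IsCoprime x y → QL m b (PL.map fun p => (p, x, y)) := by
  have h01 : QL m b (PL.map fun p => (p, 0, 1)) := fun h _ N => sum_eq_zero fun l _ => by
    by_cases hl : IsCoprime (l : ℤ) (2 * (m : ℤ))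
    · rw [hb.hc N l hl, mul_zero]
    · rw [ZL_supp hm PL h (fun p hp => ⟨(hP' p hp).pos, (hP p (hP' p hp)).1 hp⟩), zero_mul]
      rw [show 2 * (m : ℤ) = ((2 * m : ℕ) : ℤ) by push_cast; ring, Nat.isCoprime_iff_coprime, Nat.Prime.not_coprime_iff_dvd] at hl
      obtain ⟨p, hp, h1, h2⟩ := hl
      exact ⟨p, (hP p hp).2 h2, by exact_mod_cast h1⟩
  intro n
  induction n using Nat.strong_induction_on with
  | _ n ih =>
    intro x y hx hxy
    by_cases h0 : x = 0
    · subst h0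
      rw [isCoprime_zero_left, Int.isUnit_iff] at hxy
      rcases hxy with rfl | rfl
      · exact h01
      · have := (h01.S hb hm).S hb hm
        simpa [List.map_map, Function.comp_def] using this
    · have h1 : |y % x| < |x| := by rw [abs_of_nonneg (Int.emod_nonneg y h0)]; exact Int.emod_lt_abs y h0
      rw [Int.abs_eq_natAbs, Int.abs_eq_natAbs] at h1
      have e := Int.emod_add_mul_ediv y x
      have h3 : IsCoprime (-(y % x)) x := by
        have : y % x = y + x * (-(y / x)) := by linarith
        rw [this, IsCoprime.neg_left_iff]
        exact (hxy.symm).add_mul_left_left _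
      have h2 := (((ih (-(y % x)).natAbs (by rw [Int.natAbs_neg]; omega) _ _ rfl h3).S hb hm).T hb hm (y / x))
      simp only [List.map_map, Function.comp_def, neg_neg] at h2
      rw [mul_comm, e] at h2
      exact h2
end
section
variable {m : ℕ}

lemma XX_congr (hm : 0 < m) {h : ℤ → ℂ} (hp : Pr m h) {p a : ℕ} (ha : 2 * m = p * a) (x y k l : ℤ) :
    XX m (a * (x + p ^ 2 * k)) (a * (y + p ^ 2 * l)) h = XX m (a * x) (a * y) h := by
  have hm' : (m : ℂ) ≠ 0 := by exact_mod_cast hm.ne'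
  have ha' : (m : ℂ) = p * a / 2 := by rw [eq_div_iff two_ne_zero, mul_comm]; exact_mod_cast ha
  have hp0 : (p : ℂ) ≠ 0 := by rintro h; rw [h] at ha'; simp [hm'] at ha'
  have ha0 : (a : ℂ) ≠ 0 := by rintro h; rw [h] at ha'; simp [hm'] at ha'
  have haZ : 2 * (m : ℤ) = p * a := by exact_mod_cast ha
  ext r
  rw [XX, XX, hp.gen (x := r - a * (x + p ^ 2 * k)) (y := r - a * x) ⟨-(p * k), by rw [haZ]; ring⟩,
    show (((a * (y + p ^ 2 * l) : ℤ) : ℂ) * (2 * r - ((a * (x + p ^ 2 * k) : ℤ) : ℂ)) / (4 * m)) =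
      (((a * y : ℤ) : ℂ) * (2 * r - ((a * x : ℤ) : ℂ)) / (4 * m)) + ((-y * m * k + p * l * r - l * m * x - l * p ^ 2 * m * k : ℤ) : ℂ) by
      push_cast; rw [ha']; field_simp; ring, ee_add, ee_int, mul_one]

def good (x : ℕ × ℤ × ℤ) : Prop := (x.2.1 = 0 ∧ x.2.2 = 0) ∨ ¬ ((x.1 : ℤ) ∣ x.2.1 ∧ (x.1 : ℤ) ∣ x.2.2)

lemma ZL_congr (hm : 0 < m) {h : ℤ → ℂ} (hp : Pr m h) (x y : ℤ) : ∀ M : List (ℕ × ℤ × ℤ), (∀ e ∈ M, 0 < e.1 ∧ e.1 ∣ 2 * m ∧ (e.1 : ℤ) ^ 2 ∣ x - e.2.1 ∧ (e.1 : ℤ) ^ 2 ∣ y - e.2.2) →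
    ZL m M h = ZL m ((M.map Prod.fst).map fun p => (p, x, y)) h
  | [], _ => rfl
  | e :: M, hM => by
    obtain ⟨h0, ⟨a, ha⟩, ⟨k, hk⟩, ⟨l, hl⟩⟩ := hM e (by simp)
    rw [List.map_cons, List.map_cons, ZL, ZL, ← ZL_congr hm hp x y M fun e he => hM e (List.mem_cons_of_mem _ he)]
    have hx : x = e.2.1 + e.1 ^ 2 * k := by linarith
    have hy : y = e.2.2 + e.1 ^ 2 * l := by linarith
    ext r
    rw [ZZ, ZZ]
    simp only [ha, Nat.mul_div_cancel_left a h0]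
    rw [hx, hy, XX_congr hm (ZL_per hm hp M) ha]

lemma crt_ex (M : List (ℕ × ℤ × ℤ)) (hP : ∀ e ∈ M, e.1.Prime) (hN : (M.map Prod.fst).Nodup)
    (hg : ∀ e ∈ M, ¬ ((e.1 : ℤ) ∣ e.2.1 ∧ (e.1 : ℤ) ∣ e.2.2)) :
    ∃ x y : ℤ, IsCoprime x y ∧ ∀ e ∈ M, (e.1 : ℤ) ^ 2 ∣ x - e.2.1 ∧ (e.1 : ℤ) ^ 2 ∣ y - e.2.2 := by
  have pw : ∀ (L : List (ℕ × ℤ × ℤ)) (s : ℕ × ℤ × ℤ → ℕ), (∀ e ∈ L, e.1.Prime) → (L.map Prod.fst).Nodup → (∀ e, s e ∣ e.1 ^ 2) →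
      L.Pairwise (Function.onFun Nat.Coprime s) := by
    intro L s h1 h2 hs
    rw [List.Nodup, List.pairwise_map] at h2
    refine h2.imp_of_mem fun {a c} ha hc hac => ?_
    exact Nat.Coprime.coprime_dvd_left (hs a) (Nat.Coprime.coprime_dvd_right (hs c) (Nat.Coprime.pow 2 2 ((Nat.coprime_primes (h1 a ha) (h1 c hc)).2 hac)))
  have conv : ∀ (e : ℕ × ℤ × ℤ) (w : ℤ) (k : ℕ), 0 < e.1 → k ≡ (w % (e.1 : ℤ) ^ 2).toNat [MOD e.1 ^ 2] → (e.1 : ℤ) ^ 2 ∣ k - w := by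
    intro e w k he hk
    have h0 : 0 < (e.1 : ℤ) ^ 2 := by positivity
    have h1 := (Nat.modEq_iff_dvd.1 hk.symm)
    push_cast at h1
    rw [Int.toNat_of_nonneg (Int.emod_nonneg _ h0.ne')] at h1
    have h2 : (e.1 : ℤ) ^ 2 ∣ w % (e.1 : ℤ) ^ 2 - w := by rw [Int.emod_def]; exact ⟨-(w / (e.1 : ℤ) ^ 2), by ring⟩
    have := dvd_add h1 h2
    rwa [sub_add_sub_cancel] at this
  obtain ⟨k, hk⟩ := Nat.chineseRemainderOfList (fun e : ℕ × ℤ × ℤ => (e.2.1 % (e.1 : ℤ) ^ 2).toNat) (fun e => e.1 ^ 2) M (pw M _ hP hN fun e => dvd_rfl)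
  let Pi := (M.map fun e => e.1 ^ 2).prod
  have hPi : 0 < Pi := List.prod_pos_iff_forall_pos_nat.2 fun a ha => by
    obtain ⟨e, he, rfl⟩ := List.mem_map.1 ha
    exact pow_pos (hP e he).pos 2
  let X := k + Pi
  have hX : X ≠ 0 := by simp only [X]; omega
  have hx : ∀ e ∈ M, (e.1 : ℤ) ^ 2 ∣ (X : ℤ) - e.2.1 := fun e he => by
    have h1 := conv e e.2.1 k (hP e he).pos (hk e he)
    have h2 : (e.1 : ℤ) ^ 2 ∣ (Pi : ℤ) := by
      have : e.1 ^ 2 ∣ Pi := List.dvd_prod (List.mem_map.2 ⟨e, he, rfl⟩)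
      exact_mod_cast this
    have := dvd_add h1 h2
    simp only [X]; push_cast; rwa [show (k : ℤ) + Pi - e.2.1 = k - e.2.1 + Pi by ring]
  let S := (X.primeFactors.filter fun l => l ∉ M.map Prod.fst).toList
  have hS : ∀ l, l ∈ S ↔ (l ∈ X.primeFactors ∧ l ∉ M.map Prod.fst) := fun l => by simp only [S]; rw [mem_toList, mem_filter]
  let L := M ++ S.map fun l => ((l, 1, 1) : ℕ × ℤ × ℤ)
  have hL1 : ∀ e ∈ L, e.1.Prime := fun e he => by
    rcases List.mem_append.1 he with h | h
    · exact hP e h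
    · obtain ⟨l, hl, rfl⟩ := List.mem_map.1 h
      exact Nat.prime_of_mem_primeFactors ((hS l).1 hl).1
  have hL2 : (L.map Prod.fst).Nodup := by
    simp only [L, List.map_append, List.map_map, Function.comp_def, List.map_id']
    refine List.Nodup.append hN (nodup_toList _) fun l h1 h2 => ((hS l).1 h2).2 h1
  obtain ⟨Y, hY⟩ := Nat.chineseRemainderOfList (fun e : ℕ × ℤ × ℤ => (e.2.2 % (e.1 : ℤ) ^ 2).toNat) (fun e => e.1 ^ 2) L (pw L _ hL1 hL2 fun e => dvd_rfl)
  have hy : ∀ e ∈ L, (e.1 : ℤ) ^ 2 ∣ (Y : ℤ) - e.2.2 := fun e he => conv e e.2.2 Y (hL1 e he).pos (hY e he)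
  refine ⟨X, Y, ?_, fun e he => ⟨hx e he, hy e (List.mem_append_left _ he)⟩⟩
  rw [Nat.isCoprime_iff_coprime]
  by_contra hh
  obtain ⟨l, hl, h1, h2⟩ := Nat.Prime.not_coprime_iff_dvd.1 hh
  have h1' : (l : ℤ) ∣ X := by exact_mod_cast h1
  have h2' : (l : ℤ) ∣ Y := by exact_mod_cast h2
  by_cases hlM : l ∈ M.map Prod.fst
  · obtain ⟨e, he, rfl⟩ := List.mem_map.1 hlM
    refine hg e he ⟨?_, ?_⟩
    · have := dvd_sub h1' ((dvd_pow_self (e.1 : ℤ) two_ne_zero).trans (hx e he))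
      rwa [sub_sub_cancel] at this
    · have := dvd_sub h2' ((dvd_pow_self (e.1 : ℤ) two_ne_zero).trans (hy e (List.mem_append_left _ he)))
      rwa [sub_sub_cancel] at this
  · have he : ((l, 1, 1) : ℕ × ℤ × ℤ) ∈ L := List.mem_append_right _ (List.mem_map.2 ⟨l, (hS l).2 ⟨Nat.mem_primeFactors.2 ⟨hl, h1, hX⟩, hlM⟩, rfl⟩)
    have := dvd_sub h2' ((dvd_pow_self (l : ℤ) two_ne_zero).trans (hy _ he))
    rw [sub_sub_cancel] at this
    have := Int.eq_one_of_dvd_one (by positivity) this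
    exact hl.one_lt.ne' (by exact_mod_cast this)

lemma ZL_append (M : List (ℕ × ℤ × ℤ)) (M' : List (ℕ × ℤ × ℤ)) (h : ℤ → ℂ) : ZL m (M ++ M') h = ZL m M (ZL m M' h) := by
  induction M with
  | nil => rfl
  | cons x M ih => rw [List.cons_append, ZL, ZL, ih]

lemma ZL_sum {ι : Type} (s : Finset ι) (g : ι → ℤ → ℂ) (M : List (ℕ × ℤ × ℤ)) (r : ℤ) :
    ZL m M (fun r => ∑ i ∈ s, g i r) r = ∑ i ∈ s, ZL m M (g i) r := by
  induction M generalizing r with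
  | nil => rfl
  | cons x M ih =>
    rw [ZL, ZZ, XX, ih, ih, mul_sum, ← sum_sub_distrib]; rfl

lemma ZL_smul (c : ℂ) (g : ℤ → ℂ) (M : List (ℕ × ℤ × ℤ)) (r : ℤ) : ZL m M (fun r => c * g r) r = c * ZL m M g r := by
  induction M generalizing r with
  | nil => rfl
  | cons x M ih => rw [ZL, ZZ, XX, ih, ih, ZL, ZZ, XX]; ring

lemma ZL_nul (M : List (ℕ × ℤ × ℤ)) (h : ℤ → ℂ) (hM : ∃ e ∈ M, e.2.1 = 0 ∧ e.2.2 = 0) (r : ℤ) : ZL m M h r = 0 := by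
  induction M generalizing r with
  | nil => simp at hM
  | cons x M ih =>
    rw [List.exists_mem_cons_iff] at hM
    rcases hM with hM | hM
    · rw [ZL, ZZ, hM.1, hM.2, XX]; simp [ee_zero]
    · rw [ZL, ZZ, XX, ih hM, ih hM]; ring
variable {b : ℤℤ}

def DL (m : ℕ) (b : ℤℤ) (L : List ℕ) : Prop := ∀ M, M.map Prod.fst = L → (∀ e ∈ M, good e) → QL m b M

lemma DL_full (hb : VB m b) (hm : 0 < m) {PL : List ℕ} (hP : ∀ p, p.Prime → (p ∈ PL ↔ p ∣ 2 * m)) (hP' : ∀ p ∈ PL, p.Prime) (hN : PL.Nodup) : DL m b PL := by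
  intro M hM hg h hp
  have hfst : ∀ e ∈ M, e.1 ∈ PL := fun e he => by rw [← hM]; exact List.mem_map.2 ⟨e, he, rfl⟩
  by_cases hz : ∃ e ∈ M, e.2.1 = 0 ∧ e.2.2 = 0
  · intro N; exact sum_eq_zero fun l _ => by rw [ZL_nul M h hz, zero_mul]
  · push Not at hz
    obtain ⟨x, y, hxy, h1⟩ := crt_ex M (fun e he => hP' _ (hfst e he)) (by rw [hM]; exact hN) (fun e he => by
      rcases hg e he with h | h
      · exact absurd h.2 (hz e he h.1)
      · exact h)
    rw [ZL_congr hm hp x y M fun e he => ⟨(hP' _ (hfst e he)).pos, (hP _ (hP' _ (hfst e he))).1 (hfst e he), h1 e he⟩, hM]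
    exact QL_cop hb hm hP hP' _ x y rfl hxy h hp

lemma V0_sum {ι : Type} (s : Finset ι) (g : ι → ℤ → ℂ) (hg : ∀ i ∈ s, V0 m b (g i)) : V0 m b (fun r => ∑ i ∈ s, g i r) := fun N => by
  simp only [sum_mul]
  rw [sum_comm]
  exact sum_eq_zero fun i hi => hg i hi N

def ZRep (m p : ℕ) (g h : ℤ → ℂ) : Prop := ∃ Y : Finset (ℕ × ℕ), (∀ y ∈ Y, good (p, y.1, y.2)) ∧ ∀ r, h r = ∑ y ∈ Y, ZZ m (p, y.1, y.2) g r

lemma ZRep.ZL {p : ℕ} {g h : ℤ → ℂ} (hr : ZRep m p g h) (M : List (ℕ × ℤ × ℤ))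
    (hz : ∀ e, good (p, e) → V0 m b (ZL m (M ++ [(p, e)]) g)) : V0 m b (ZL m M h) := by
  obtain ⟨Y, hY, h1⟩ := hr
  have : h = fun r => ∑ y ∈ Y, ZZ m (p, y.1, y.2) g r := funext h1
  rw [this]
  have e : _root_.ZL m M (fun r => ∑ y ∈ Y, ZZ m (p, y.1, y.2) g r) = fun r => ∑ y ∈ Y, _root_.ZL m (M ++ [(p, (y.1 : ℤ), (y.2 : ℤ))]) g r := by
    ext r; rw [ZL_sum]
    exact sum_congr rfl fun y _ => by rw [ZL_append]; rfl
  rw [e]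
  exact V0_sum _ _ fun y hy => hz _ (hY y hy)

lemma DL.peel {p : ℕ} {L : List ℕ} (hs : ∀ h, Pr m h → ∃ g, Pr m g ∧ ZRep m p g h) (hd : DL m b (L ++ [p])) : DL m b L := by
  intro M hM hg h hp
  obtain ⟨g, hgp, hr⟩ := hs h hp
  refine hr.ZL M fun e he => hd _ (by simp [hM]) (fun e' he' => ?_) g hgp
  rcases List.mem_append.1 he' with h1 | h1
  · exact hg e' h1
  · rw [List.mem_singleton.1 h1]; exact he

lemma DL.peels {L : List ℕ} (L' : List ℕ) (hs : ∀ p ∈ L', ∀ h, Pr m h → ∃ g, Pr m g ∧ ZRep m p g h) (hd : DL m b (L ++ L')) : DL m b L := by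
  induction L' generalizing L with
  | nil => simpa using hd
  | cons p L' ih =>
    refine DL.peel (hs p (by simp)) (ih (fun p hp => hs p (List.mem_cons_of_mem _ hp)) ?_)
    simpa using hd

def PP (m t : ℕ) (h : ℤ → ℂ) (r : ℤ) : ℂ := (t : ℂ)⁻¹ * if (t : ℤ) ∣ r then ∑ i ∈ range t, h (r + (2 * m / t : ℕ) * i) else 0

def BL (m : ℕ) : List ℕ → (ℤ → ℂ) → ℤ → ℂ
  | [], h => h
  | p :: L, h => fun r => BL m L h r - PP m p (BL m L h) r

lemma PP_per {t : ℕ} (ht : t ∣ 2 * m) {h : ℤ → ℂ} (hp : Pr m h) : Pr m (PP m t h) := fun r => by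
  rw [PP, PP]
  have h1 : (t : ℤ) ∣ r + 2 * m ↔ (t : ℤ) ∣ r := dvd_add_left (by exact_mod_cast ht)
  simp only [h1]
  congr 2
  exact sum_congr rfl fun i _ => hp.gen (by ring_nf; simp)

lemma BL_per {L : List ℕ} (hL : ∀ p ∈ L, p ∣ 2 * m) {h : ℤ → ℂ} (hp : Pr m h) : Pr m (BL m L h) := by
  induction L with
  | nil => exact hp
  | cons p L ih =>
    have ih := ih fun p hp => hL p (List.mem_cons_of_mem _ hp)
    intro r
    rw [BL]; simp only []
    rw [ih, PP_per (hL p (by simp)) ih]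

lemma DL.mix {L : List ℕ} (L' : List ℕ) (hs : ∀ p ∈ L', ∀ h, Pr m h → ZRep m p (fun r => ((p : ℂ) ^ 2)⁻¹ * h r) (fun r => h r - PP m p h r))
    (hB : ∀ p ∈ L', p ∣ 2 * m) (hd : DL m b (L ++ L')) (M : List (ℕ × ℤ × ℤ)) (hM : M.map Prod.fst = L) (hg : ∀ e ∈ M, good e) {h : ℤ → ℂ} (hp : Pr m h) :
    V0 m b (ZL m M (BL m L' h)) := by
  induction L' generalizing L M with
  | nil => exact hd M (by simpa using hM) hg h hp
  | cons p L' ih =>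
    rw [BL]
    refine (hs p (by simp) _ (BL_per (fun p hp => hB p (List.mem_cons_of_mem _ hp)) hp)).ZL M fun e he N => ?_
    simp only [ZL_smul, mul_assoc]
    rw [← mul_sum]
    rw [ih (L := L ++ [p]) (fun p hp => hs p (List.mem_cons_of_mem _ hp)) (fun p hp => hB p (List.mem_cons_of_mem _ hp)) (by simpa using hd) (M ++ [(p, e)]) (by simp [hM]) (fun e' he' => ?_) N, mul_zero]
    rcases List.mem_append.1 he' with h1 | h1
    · exact hg e' h1
    · rw [List.mem_singleton.1 h1]; exact he
end
section
variable {m : ℕ}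

lemma good_range {p : ℕ} : ∀ y ∈ range p ×ˢ range p, good (p, (y.1 : ℤ), (y.2 : ℤ)) := fun y hy => by
  rw [mem_product, mem_range, mem_range] at hy
  rw [good]
  by_cases h : (p : ℤ) ∣ y.1 ∧ (p : ℤ) ∣ y.2
  · left
    have h1 := Int.eq_zero_of_abs_lt_dvd h.1 (by rw [abs_lt]; omega)
    have h2 := Int.eq_zero_of_abs_lt_dvd h.2 (by rw [abs_lt]; omega)
    exact ⟨h1, h2⟩
  · right; exact h

lemma ZZ_sum (hm : 0 < m) {p a : ℕ} (ha : m = p * a) (g : ℤ → ℂ) (r : ℤ) :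
    ∑ y ∈ range p ×ˢ range p, ZZ m (p, (y.1 : ℤ), (y.2 : ℤ)) g r =
      p ^ 2 * g r - p * ∑ l ∈ range p, if (p : ℤ) ∣ r - a * l then g (r - 2 * a * l) else 0 := by
  have hp : 0 < p := by rcases Nat.eq_zero_or_pos p with h | h; · simp [h] at ha; omega
                        · exact h
  have ha0 : 0 < a := by rcases Nat.eq_zero_or_pos a with h | h; · simp [h] at ha; omega
                         · exact h
  have hp' : (p : ℂ) ≠ 0 := by exact_mod_cast hp.ne'
  have ha' : (a : ℂ) ≠ 0 := by exact_mod_cast ha0.ne'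
  simp only [ZZ]
  rw [sum_sub_distrib, sum_const, card_product, card_range, nsmul_eq_mul]
  congr 1
  · push_cast; ring
  · rw [sum_product, mul_sum]
    refine sum_congr rfl fun l _ => ?_
    have e : 2 * m / p = 2 * a := by rw [ha, show 2 * (p * a) = p * (2 * a) by ring, Nat.mul_div_cancel_left _ hp]
    have h1 := sum_ee hp (r - a * l)
    simp only [XX, e]
    rw [show r - ((2 * a : ℕ) : ℤ) * (l : ℤ) = r - 2 * a * l by push_cast; ring, ← sum_mul]
    have h2 : ∑ i ∈ range p, ee ((((2 * a : ℕ) : ℤ) * (i : ℤ) : ℤ) * (2 * (r : ℂ) - ((((2 * a : ℕ) : ℤ) * (l : ℤ) : ℤ) : ℂ)) / (4 * m)) = if (p : ℤ) ∣ r - a * l then (p : ℂ) else 0 := by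
      rw [← h1]
      refine sum_congr rfl fun i _ => ?_
      rw [ha]; congr 1; push_cast; field_simp; ring
    rw [h2]; split_ifs <;> ring

lemma rep_non (hm : 0 < m) {p : ℕ} (hp : p.Prime) (hpm : p ^ 2 ∣ m) {h : ℤ → ℂ} (hh : Pr m h) :
    ZRep m p (fun r => ((p : ℂ) ^ 2)⁻¹ * h r) (fun r => h r - PP m p h r) := by
  refine ⟨_, good_range, fun r => ?_⟩
  obtain ⟨c, hc⟩ := hpm
  have ha : m = p * (p * c) := by rw [hc]; ring
  have hp' : (p : ℂ) ≠ 0 := by exact_mod_cast hp.ne_zero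
  rw [ZZ_sum hm ha, ← mul_assoc, mul_inv_cancel₀ (pow_ne_zero 2 hp'), one_mul]
  simp only [PP]
  congr 1
  have h1 : ∀ l : ℕ, (p : ℤ) ∣ r - ((p * c : ℕ) : ℤ) * l ↔ (p : ℤ) ∣ r := fun l => dvd_sub_left ⟨c * l, by push_cast; ring⟩
  simp only [h1]
  split_ifs with hd
  · rw [mul_sum, mul_sum]
    have e : 2 * m / p = 2 * (p * c) := by rw [ha, show 2 * (p * (p * c)) = p * (2 * (p * c)) by ring, Nat.mul_div_cancel_left _ hp.pos]
    have h3 := sum_mod_neg (n := p) (g := fun i : ℤ => h (r + 2 * (p * c : ℕ) * i)) hp.pos (fun i => hh.gen (by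
      rw [ha]; push_cast; exact ⟨1, by ring⟩))
    rw [← mul_sum, e]
    push_cast at h3 ⊢
    rw [← h3, mul_sum]
    refine sum_congr rfl fun i _ => ?_
    rw [show r - 2 * ((p : ℤ) * c) * i = r + 2 * (p * c) * -i by ring]
    field_simp
  · simp

lemma rep_simple (hm : 0 < m) {p : ℕ} (hp : p.Prime) (h1 : p ∣ m) (h2 : ¬ p ^ 2 ∣ m) {h : ℤ → ℂ} (hh : Pr m h) :
    ∃ g, Pr m g ∧ ZRep m p g h := by
  obtain ⟨a, ha⟩ := h1
  have hp' : (p : ℂ) ≠ 0 := by exact_mod_cast hp.ne_zero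
  have hpp := Nat.prime_iff_prime_int.mp hp
  have hpa : ¬ (p : ℤ) ∣ a := fun hd => h2 (by
    obtain ⟨c, hc⟩ := Int.natCast_dvd_natCast.1 hd
    exact ⟨c, by rw [ha, hc]; ring⟩)
  obtain ⟨u, v, huv⟩ : IsCoprime (a : ℤ) p := (hpp.coprime_iff_not_dvd.2 hpa).symm
  have haZ : (m : ℤ) = p * a := by exact_mod_cast ha
  set κ : ℤ := 1 - 2 * a * u with hκ
  have hκ2 : ∀ r, 2 * (m : ℤ) ∣ κ * (κ * r) - r := fun r => ⟨-2 * u * v * r, by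
    rw [haZ, hκ]; linear_combination (4 * a * u * r) * huv⟩
  have key : ∀ g, Pr m g → ∀ r, ∑ y ∈ range p ×ˢ range p, ZZ m (p, (y.1 : ℤ), (y.2 : ℤ)) g r = p ^ 2 * g r - p * g (κ * r) := by
    intro g hg r
    rw [ZZ_sum hm ha]
    congr 2
    have h3 := sum_mod (n := p) (g := fun l : ℤ => if (p : ℤ) ∣ r - a * l then g (r - 2 * a * l) else 0) hp.pos (fun l => by
      have e1 : (p : ℤ) ∣ r - a * (l + p) ↔ (p : ℤ) ∣ r - a * l := by
        rw [show r - a * (l + p) = r - a * l - p * a by ring]; exact dvd_sub_left ⟨a, rfl⟩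
      simp only [e1]
      rw [hg.gen (x := r - 2 * a * (l + p)) (y := r - 2 * a * l) ⟨-1, by rw [haZ]; ring⟩]) (fun l => l + u * r) (fun i hi j hj hd => by
        have : |(i : ℤ) - j| < p := by rw [abs_lt]; omega
        have := Int.eq_zero_of_abs_lt_dvd (by rw [show (i : ℤ) + u * r - (j + u * r) = i - j by ring] at hd; exact hd) this
        omega)
    rw [← h3, sum_eq_single 0]
    · rw [if_pos ⟨v * r, by push_cast; linear_combination (-r) * huv⟩]
      congr 1; push_cast; rw [hκ]; ring
    · intro l hl hl0
      rw [if_neg]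
      intro hd
      have h4 : (p : ℤ) ∣ a * l := by
        have : (p : ℤ) ∣ (r - a * (l + u * r)) - p * (v * r) := dvd_sub hd ⟨_, rfl⟩
        rw [show r - a * (l + u * r) - p * (v * r) = -(a * l) by linear_combination (-r) * huv] at this
        exact (dvd_neg.1 this)
      rcases hpp.dvd_or_dvd h4 with h5 | h5
      · exact hpa h5
      · have := mem_range.1 hl
        have := Int.eq_zero_of_abs_lt_dvd h5 (by rw [abs_lt]; omega)
        omega
    · intro hn; exact absurd (mem_range.2 hp.pos) hn
  have hκp : ∀ r, h (κ * (r + 2 * m)) = h (κ * r) := fun r => hh.gen ⟨κ, by ring⟩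
  have hp1 : (p : ℂ) ^ 2 - 1 ≠ 0 := by
    intro h0
    have h0 : (p : ℂ) ^ 2 = 1 := sub_eq_zero.1 h0
    have : p ^ 2 = 1 := by exact_mod_cast h0
    have := hp.two_le; nlinarith
  refine ⟨fun r => ((p : ℂ) ^ 2 - 1)⁻¹ * (h r + (p : ℂ)⁻¹ * h (κ * r)), fun r => ?_, _, good_range, fun r => ?_⟩
  · simp only []; rw [hh, hκp r]
  · rw [key _ (fun r => ?_)]
    · rw [hh.gen (hκ2 r)]; field_simp; ring
    · rw [hh, hκp r]

lemma rep_two (hm : 0 < m) (h2 : ¬ 2 ∣ m) {h : ℤ → ℂ} (hh : Pr m h) : ∃ g, Pr m g ∧ ZRep m 2 g h := by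
  have hm' : (m : ℂ) ≠ 0 := by exact_mod_cast hm.ne'
  refine ⟨fun r => h r / 2, fun r => by simp only []; rw [hh], {(0, 1), (2, 1)}, fun y hy => ?_, fun r => ?_⟩
  · right
    rw [mem_insert, mem_singleton] at hy
    rcases hy with rfl | rfl <;> norm_num
  · rw [sum_pair (by simp), ZZ, ZZ, XX, XX]
    simp only [Nat.mul_div_cancel_left m two_pos]
    rw [hh.gen (x := r - (m : ℤ) * ((2 : ℕ) : ℤ)) (y := r) ⟨-1, by push_cast; ring⟩]
    obtain ⟨c, hc⟩ : Odd m := Nat.not_even_iff_odd.1 fun he => h2 he.two_dvd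
    have e : (((m : ℤ) * ((1 : ℕ) : ℤ) : ℤ) : ℂ) * (2 * r - (((m : ℤ) * ((2 : ℕ) : ℤ) : ℤ) : ℂ)) / (4 * m) = (((m : ℤ) * ((1 : ℕ) : ℤ) : ℤ) : ℂ) * (2 * r - (((m : ℤ) * ((0 : ℕ) : ℤ) : ℤ) : ℂ)) / (4 * m) + (1 / 2 + ((-c - 1 : ℤ) : ℂ)) := by
      have : (m : ℂ) = 2 * c + 1 := by rw [hc]; push_cast; ring
      push_cast; field_simp; rw [this]; ring
    rw [e, ee_add, ee_add, ee_int, ee_half]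
    push_cast; simp
end
section
variable {m : ℕ} {b : ℤℤ}

lemma PP_one {h : ℤ → ℂ} : PP m 1 h = h := by ext r; simp [PP]

lemma PP_PP {p t : ℕ} (hp : 0 < p) (ht : 0 < t) (hc : Nat.Coprime p t) (hd : p * t ∣ m) {h : ℤ → ℂ} (hh : Pr m h) :
    PP m p (PP m t h) = PP m (p * t) h := by
  obtain ⟨a, rfl⟩ := hd
  ext r
  have e1 : 2 * (p * t * a) / p = t * (2 * a) := by rw [show 2 * (p * t * a) = p * (t * (2 * a)) by ring, Nat.mul_div_cancel_left _ hp]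
  have e2 : 2 * (p * t * a) / t = p * (2 * a) := by rw [show 2 * (p * t * a) = t * (p * (2 * a)) by ring, Nat.mul_div_cancel_left _ ht]
  have e3 : 2 * (p * t * a) / (p * t) = 2 * a := by rw [show 2 * (p * t * a) = p * t * (2 * a) by ring, Nat.mul_div_cancel_left _ (by positivity)]
  have hcZ : IsCoprime (p : ℤ) t := Nat.isCoprime_iff_coprime.2 hc
  simp only [PP, e1, e2, e3]
  have h1 : ∀ i : ℕ, (t : ℤ) ∣ r + ((t * (2 * a) : ℕ) : ℤ) * i ↔ (t : ℤ) ∣ r := fun i => dvd_add_left ⟨2 * a * i, by push_cast; ring⟩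
  simp only [h1]
  have h2 : ((p * t : ℕ) : ℤ) ∣ r ↔ (p : ℤ) ∣ r ∧ (t : ℤ) ∣ r := by
    constructor
    · intro h; push_cast at h; exact ⟨(dvd_mul_right _ _).trans h, (dvd_mul_left _ _).trans h⟩
    · intro h; push_cast; exact hcZ.mul_dvd h.1 h.2
  simp only [h2]
  by_cases hr : (p : ℤ) ∣ r
  swap
  · simp [hr]
  by_cases hr' : (t : ℤ) ∣ r
  swap
  · simp [hr']
  simp only [hr, hr', and_self, if_true]
  rw [← mul_sum, ← mul_assoc, ← mul_inv, ← Nat.cast_mul]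
  congr 1
  set G : ℤ → ℂ := fun k => h (r + 2 * a * k) with hG
  have hGp : ∀ x y, ((p * t : ℕ) : ℤ) ∣ x - y → G x = G y := fun x y ⟨k, hk⟩ => hh.gen ⟨k, by push_cast at hk ⊢; linear_combination 2 * a * hk⟩
  have h3 : ∑ k ∈ range (p * t), G (k : ℕ) = ∑ j ∈ range t, ∑ i ∈ range p, G (t * i + j) := by
    rw [sum_range_mul' p t (fun k => G (k : ℕ)), sum_comm]; push_cast; rfl
  have h4 := sum_mod (n := t) (g := fun j => ∑ i ∈ range p, G (t * i + j)) ht (fun j => by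
    have := sum_mod (n := p) (g := fun i => G (t * i + j)) hp (fun i => hGp _ _ ⟨1, by push_cast; ring⟩) (fun i => i + 1) (fun i hi j hj hd => by
      have := Int.eq_zero_of_abs_lt_dvd hd (by rw [abs_lt]; omega)
      omega)
    beta_reduce at this ⊢
    rw [← this]
    exact sum_congr rfl fun i _ => by congr 1; ring) (fun j => p * j) (fun i hi j hj hd => by
      rw [← mul_sub] at hd
      have := Int.eq_zero_of_abs_lt_dvd (hcZ.symm.dvd_of_dvd_mul_left hd) (by rw [abs_lt]; omega)
      omega)
  have h5 : ∀ i : ℕ, h (r + ((2 * a : ℕ) : ℤ) * i) = G i := fun i => by rw [hG]; push_cast; rfl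
  simp only [h5]
  rw [h3, ← h4, sum_comm]
  refine sum_congr rfl fun i _ => sum_congr rfl fun j _ => ?_
  rw [hG]; congr 1; push_cast; ring

lemma PP_sub (t : ℕ) (g h : ℤ → ℂ) (r : ℤ) : PP m t (fun r => g r - h r) r = PP m t g r - PP m t h r := by
  simp only [PP]
  split_ifs
  · rw [sum_sub_distrib]; ring
  · simp

lemma BL_sub (L : List ℕ) (g h : ℤ → ℂ) (r : ℤ) : BL m L (fun r => g r - h r) r = BL m L g r - BL m L h r := by
  induction L generalizing r with
  | nil => rfl
  | cons p L ih =>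
    simp only [BL]
    rw [funext ih, PP_sub]; ring

lemma BL_snoc (L : List ℕ) (p : ℕ) (h : ℤ → ℂ) : BL m (L ++ [p]) h = BL m L (fun r => h r - PP m p h r) := by
  induction L with
  | nil => rfl
  | cons q L ih => simp only [List.cons_append, BL, ih]

def FF (m K : ℕ) (b : ℤℤ) (H : ℕ → ℤ → ℂ) : ℂ := ∑ N ∈ range K, ∑ l ∈ range (2 * m), H N l * b N l

lemma FF_tel {K : ℕ} {H : ℕ → ℤ → ℂ} (hH : ∀ N, Pr m (H N)) (h0 : ∀ s, 1 < s → s ^ 2 ∣ m → FF m K b (fun N => PP m s (H N)) = 0)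
    (L : List ℕ) (hL : ∀ p ∈ L, 1 < p) (hc : L.Pairwise Nat.Coprime) (t : ℕ) (ht : 0 < t) (hct : ∀ p ∈ L, Nat.Coprime p t)
    (hd : (L.prod * t) ^ 2 ∣ m) : FF m K b (fun N => BL m L (PP m t (H N))) = FF m K b (fun N => PP m t (H N)) := by
  induction L using List.reverseRecOn generalizing t with
  | nil => rfl
  | append_singleton L p ih =>
    have hp : 1 < p := hL p (by simp)
    rw [List.pairwise_append] at hc
    have hpt : Nat.Coprime p t := hct p (by simp)
    have e : (L ++ [p]).prod * t = L.prod * (p * t) := by simp; ring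
    rw [e] at hd
    have hpm : (p * t) ^ 2 ∣ m := (pow_dvd_pow_of_dvd (dvd_mul_left _ _) 2).trans hd
    have hL' : ∀ q ∈ L, 1 < q := fun q hq => hL q (by simp [hq])
    have i1 := ih hL' hc.1 t ht (fun q hq => hct q (by simp [hq])) ((pow_dvd_pow_of_dvd ⟨p, by ring⟩ 2).trans hd)
    have i2 := ih hL' hc.1 (p * t) (by positivity) (fun q hq => Nat.Coprime.mul_right (hc.2.2 q hq p (by simp)) (hct q (by simp [hq]))) hd
    rw [h0 (p * t) (by nlinarith) hpm] at i2
    rw [← i1]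
    have : FF m K b (fun N => BL m (L ++ [p]) (PP m t (H N))) = FF m K b (fun N => BL m L (PP m t (H N))) - FF m K b (fun N => BL m L (PP m (p * t) (H N))) := by
      rw [FF, FF, FF, ← sum_sub_distrib]
      refine sum_congr rfl fun N _ => ?_
      rw [← sum_sub_distrib]
      refine sum_congr rfl fun l _ => ?_
      rw [BL_snoc, BL_sub, PP_PP (by omega) ht hpt ((dvd_pow_self _ two_ne_zero).trans hpm) (hH N)]; ring
    rw [this, i2, sub_zero]

lemma JF.scale {t m' : ℕ} (ht : 0 < t) {C : ℤℤ} {φ : ℂℂ} (h : JF m' C φ) :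
    JF (t ^ 2 * m') (fun Δ l => if (t : ℤ) ^ 2 ∣ Δ ∧ (t : ℤ) ∣ l then C (Δ / t ^ 2) (l / t) else 0) (fun τ z => φ τ (t * z)) := by
  have ht' : (t : ℤ) ≠ 0 := by exact_mod_cast ht.ne'
  have ht2 : (t : ℤ) ^ 2 ≠ 0 := pow_ne_zero 2 ht'
  refine ⟨⟨fun τ z hτ => ?_, fun Δ l => ?_, fun Δ l hs => ?_, ?_⟩, fun τ hτ z a b c d hd => ?_⟩
  · have h1 := h.jx.exp τ (t * z) hτ
    have hi : Function.Injective (fun p : ℤ × ℤ => (p.1, (t : ℤ) * p.2)) := fun p q hpq => by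
      rw [Prod.mk.injEq] at hpq
      exact Prod.ext hpq.1 (mul_left_cancel₀ ht' hpq.2)
    rw [← hi.hasSum_iff]
    · refine h1.congr_fun' fun p => ?_
      simp only [Function.comp]
      have e : 4 * ((t ^ 2 * m' : ℕ) : ℤ) * p.1 - (t * p.2) ^ 2 = t ^ 2 * (4 * m' * p.1 - p.2 ^ 2) := by push_cast; ring
      rw [e, if_pos ⟨dvd_mul_right _ _, dvd_mul_right _ _⟩, Int.mul_ediv_cancel_left _ ht2, Int.mul_ediv_cancel_left _ ht']
      congr 2; push_cast; ring
    · intro p hp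
      beta_reduce
      rw [if_neg, zero_mul]
      rintro ⟨-, k, hk⟩
      exact hp ⟨(p.1, k), Prod.ext rfl hk.symm⟩
  · have e1 : (t : ℤ) ∣ l + 2 * ((t ^ 2 * m' : ℕ) : ℤ) ↔ (t : ℤ) ∣ l := dvd_add_left ⟨2 * t * m', by push_cast; ring⟩
    simp only [e1]
    split_ifs with hd
    · obtain ⟨k, rfl⟩ := hd.2
      rw [show (t : ℤ) * k + 2 * ((t ^ 2 * m' : ℕ) : ℤ) = t * (k + 2 * m' * t) by push_cast; ring, Int.mul_ediv_cancel_left _ ht', Int.mul_ediv_cancel_left _ ht']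
      exact per_dvd h.jx.per ⟨t, by ring⟩
    · rfl
  · split_ifs with hd
    · obtain ⟨⟨a, rfl⟩, ⟨k, rfl⟩⟩ := hd
      rw [Int.mul_ediv_cancel_left _ ht', Int.mul_ediv_cancel_left _ ht2]
      refine h.jx.supp _ _ fun ⟨c, hc⟩ => hs ⟨c, ?_⟩
      push_cast; linear_combination (t : ℤ) ^ 2 * hc
    · rfl
  · obtain ⟨B, hB⟩ := h.jx.bd
    refine ⟨-(t ^ 2 * |B|), fun Δ l hl => ?_⟩
    split_ifs with hd
    · obtain ⟨⟨a, rfl⟩, -⟩ := hd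
      rw [Int.mul_ediv_cancel_left _ ht2]
      refine hB _ _ (lt_of_lt_of_le ?_ (neg_abs_le B))
      have : (0 : ℤ) < t ^ 2 := by positivity
      nlinarith
    · rfl
  · have := h.law τ hτ (t * z) a b c d hd
    rw [show (t : ℂ) * (z / (c * τ + d)) = t * z / (c * τ + d) by ring, this]
    congr 3; push_cast; ring

lemma Lam_zero (hk : KB m b) {t m' : ℕ} (ht : 0 < t) (hm : m = t ^ 2 * m') {C C' : ℤℤ} {ψ : ℂℂ}
    (hψ : JF m' C' ψ) (hC : ∀ Δ l, Δ ≤ 0 → C' Δ l = CoeffU m t C Δ l) {K : ℕ} (hK : ∀ Δ l : ℤ, Δ ≤ -K → C Δ l = 0) :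
    FF m K b (fun N => PP m t (fun l => C (-N) l)) = 0 := by
  subst hm
  have ht' : (t : ℤ) ≠ 0 := by exact_mod_cast ht.ne'
  have ht2 : (t : ℤ) ^ 2 ≠ 0 := pow_ne_zero 2 ht'
  have htp : (0 : ℤ) < t ^ 2 := by positivity
  have h1 := hk.kill _ _ (hψ.scale ht)
  rw [pair, tsum_eq_sum (s := range K)] at h1
  · rw [← mul_zero (t : ℂ)⁻¹, ← h1, FF, mul_sum]
    refine sum_congr rfl fun N _ => ?_
    rw [mul_sum]
    refine sum_congr rfl fun l _ => ?_
    by_cases hb : b N l = 0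
    · rw [hb]; ring
    rw [PP]
    by_cases hl : (t : ℤ) ∣ l
    swap
    · simp [hl]
    obtain ⟨k, hk'⟩ := hl
    have hs : 4 * ((t ^ 2 * m' : ℕ) : ℤ) ∣ N - (l : ℤ) ^ 2 := by by_contra hh; exact hb (hk.supp _ _ hh)
    obtain ⟨c, hc⟩ := hs
    have hN : (N : ℤ) = t ^ 2 * (4 * m' * c + k ^ 2) := by
      rw [hk'] at hc; push_cast at hc; linear_combination hc
    rw [if_pos ⟨k, hk'⟩, if_pos ⟨by rw [hN, dvd_neg]; exact dvd_mul_right _ _, ⟨k, hk'⟩⟩, hN, hk', ← mul_neg, Int.mul_ediv_cancel_left _ ht', Int.mul_ediv_cancel_left _ ht2,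
      hC _ _ (by have : (0 : ℤ) ≤ N := by positivity
                 rw [hN] at this; nlinarith), CoeffU_eq ht]
    have e : 2 * (t ^ 2 * m') / t = 2 * m' * t := by rw [show 2 * (t ^ 2 * m') = t * (2 * m' * t) by ring, Nat.mul_div_cancel_left _ ht]
    have hS : ∑ j ∈ range t, C (-(4 * m' * c + k ^ 2) * t ^ 2) ((k + 2 * m' * j) * t) = ∑ i ∈ range t, C (t ^ 2 * -(4 * m' * c + k ^ 2)) (t * k + (2 * m' * t : ℕ) * i) :=
      sum_congr rfl fun i _ => by congr 1 <;> push_cast <;> ring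
    rw [e, hS]; ring
  · intro N hN
    rw [mem_range, not_lt] at hN
    refine sum_eq_zero fun l _ => ?_
    rw [mul_eq_zero]; right
    split_ifs with hd
    · obtain ⟨⟨a, ha⟩, -⟩ := hd
      rw [ha, Int.mul_ediv_cancel_left _ ht2, hC _ _ (by nlinarith), CoeffU_eq ht]
      refine sum_eq_zero fun i _ => hK _ _ (by rw [mul_comm, ← ha]; omega)
    · rfl
end

lemma C4 {m : ℕ} (hm : 0 < m) {f : Fin (m + 1) → ℂ → ℂ} (hf : ∀ j : Fin (m + 1), MF (12 * m - 2 * (j : ℕ)) (f j)) (hk : KB m (bG m f))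
    (h1 : ∀ l, bG m f 1 l = 0) {C : ℤℤ} (per : ∀ Δ l : ℤ, C Δ (l + 2 * (m : ℤ)) = C Δ l) (bd : ∃ B : ℤ, ∀ Δ l : ℤ, Δ < B → C Δ l = 0)
    (hu : ∀ t m', 1 < t → m = t ^ 2 * m' → ∃ C' ψ, JF m' C' ψ ∧ ∀ Δ l, Δ ≤ 0 → C' Δ l = CoeffU m t C Δ l) :
    pair m (bG m f) C = 0 := by
  have hb : VB m (bG m f) := ⟨fun h hp hz => V0_F hm hf hp hz, fun N l hne => by by_contra hh; exact hne (hk.supp _ _ hh), fun N l hc => hk.coprime_zero hm h1 hc⟩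
  obtain ⟨K, hK⟩ : ∃ K : ℕ, ∀ Δ l : ℤ, Δ ≤ -K → C Δ l = 0 := by
    obtain ⟨B, hB⟩ := bd
    exact ⟨B.natAbs + 1, fun Δ l h => hB _ _ (by omega)⟩
  set A := (2 * m).primeFactors.filter (fun p => p ^ 2 ∣ m) with hA
  set A' := (2 * m).primeFactors.filter (fun p => ¬ p ^ 2 ∣ m) with hA'
  have hAm : ∀ p, p ∈ A.toList ↔ p.Prime ∧ p ∣ 2 * m ∧ p ^ 2 ∣ m := fun p => by
    rw [mem_toList, hA, mem_filter, Nat.mem_primeFactors]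
    exact ⟨fun h => ⟨h.1.1, h.1.2.1, h.2⟩, fun h => ⟨⟨h.1, h.2.1, by omega⟩, h.2.2⟩⟩
  have hAm' : ∀ p, p ∈ A'.toList ↔ p.Prime ∧ p ∣ 2 * m ∧ ¬ p ^ 2 ∣ m := fun p => by
    rw [mem_toList, hA', mem_filter, Nat.mem_primeFactors]
    exact ⟨fun h => ⟨h.1.1, h.1.2.1, h.2⟩, fun h => ⟨⟨h.1, h.2.1, by omega⟩, h.2.2⟩⟩
  have hD : DL m (bG m f) (A.toList ++ A'.toList) := by
    refine DL_full hb hm (fun p hp => ?_) (fun p hp => ?_) ?_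
    · rw [List.mem_append, hAm, hAm']; tauto
    · rw [List.mem_append, hAm, hAm'] at hp; tauto
    · refine List.Nodup.append (nodup_toList _) (nodup_toList _) fun p hp hp' => ?_
      rw [hAm] at hp; rw [hAm'] at hp'; exact hp'.2.2 hp.2.2
  have hD' := DL.peels (L := A.toList) A'.toList (fun p hp h hh => by
    rw [hAm'] at hp
    by_cases hpm : p ∣ m
    · exact rep_simple hm hp.1 hpm hp.2.2 hh
    · have : p = 2 := by
        rcases hp.1.dvd_mul.1 hp.2.1 with h | h
        · exact (Nat.prime_dvd_prime_iff_eq hp.1 Nat.prime_two).1 h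
        · exact absurd h hpm
      subst this
      exact rep_two hm hpm hh) hD
  have hV : ∀ h, Pr m h → V0 m (bG m f) (BL m A.toList h) := fun h hh =>
    DL.mix (L := []) A.toList (fun p hp h hh => rep_non hm ((hAm p).1 hp).1 ((hAm p).1 hp).2.2 hh) (fun p hp => ((hAm p).1 hp).2.1) hD' [] rfl (by simp) hh
  have hPr : ∀ N : ℕ, Pr m (fun l => C (-N) l) := fun N l => per _ _
  have ht := FF_tel (b := bG m f) (K := K) (H := fun N l => C (-N) l) hPr (fun s hs ⟨m', hm'⟩ => by
    obtain ⟨C', ψ, hψ, hC⟩ := hu s m' hs hm'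
    exact Lam_zero hk (by omega) hm' hψ hC hK) A.toList (fun p hp => ((hAm p).1 hp).1.one_lt)
    (List.Nodup.pairwise_of_forall_ne (nodup_toList _) fun p hp q hq hne => (Nat.coprime_primes ((hAm p).1 hp).1 ((hAm q).1 hq).1).2 hne) 1 one_pos
    (fun p _ => Nat.coprime_one_right p) (by
      rw [mul_one, prod_toList, ← prod_pow]
      refine prod_dvd_of_isRelPrime (fun p hp q hq hne => ?_) fun p hp => (mem_filter.1 hp).2
      have hp := ((hAm p).1 (mem_toList.2 hp)).1
      have hq := ((hAm q).1 (mem_toList.2 hq)).1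
      exact Nat.coprime_iff_isRelPrime.1 (((Nat.coprime_primes hp hq).2 hne).pow 2 2))
  simp only [PP_one] at ht
  rw [pair, tsum_eq_sum (s := range K) (fun N hN => sum_eq_zero fun l _ => by
    rw [mem_range, not_lt] at hN
    rw [hK _ _ (by omega), mul_zero])]
  rw [FF, FF] at ht
  rw [sum_eq_zero fun N _ => hV _ (hPr N) N] at ht
  simp only [mul_comm (bG m f _ _)]
  exact ht.symm

lemma CoeffU_one (m : ℕ) {C : ℤℤ} : CoeffU m 1 C = C := by ext Δ l; simp [CoeffU]

lemma CoeffU_sub (m t : ℕ) (C D : ℤℤ) : CoeffU m t (fun Δ l => C Δ l - D Δ l) = fun Δ l => CoeffU m t C Δ l - CoeffU m t D Δ l := by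
  ext Δ l; simp only [CoeffU]; rw [sum_sub_distrib]

def Bd (C : ℤℤ) : Prop := ∃ B : ℤ, ∀ Δ l : ℤ, Δ < B → C Δ l = 0

lemma CoeffU_bd (m : ℕ) {t : ℕ} (ht : 0 < t) {C : ℤℤ} (h : Bd C) : Bd (CoeffU m t C) := by
  obtain ⟨B, hB⟩ := h
  refine ⟨-|B|, fun Δ l hl => sum_eq_zero fun j _ => hB _ _ (lt_of_lt_of_le ?_ (neg_abs_le B))⟩
  have : (0 : ℤ) < t ^ 2 := by positivity
  nlinarith [abs_nonneg B]

lemma Rf_summable (m : ℕ) {C : ℤℤ} (h : Bd C) {a b : ℕ} (hab : 0 < Nat.gcd a b) :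
    Summable fun r : ℤ => CoeffU m (Nat.gcd a b) C (-(r ^ 2)) (lstar (a / Nat.gcd a b) (b / Nat.gcd a b) r) := by
  obtain ⟨B, hB⟩ := CoeffU_bd m hab h
  refine summable_of_ne_finset_zero (s := Finset.Icc (-|B|) |B|) fun r hr => hB _ _ ?_
  rw [mem_Icc, ← abs_le, not_le] at hr
  have h1 : |B| < r ^ 2 := by rw [← sq_abs]; nlinarith [abs_nonneg B]
  linarith [neg_abs_le B]

lemma Rf_sub (m : ℕ) {C D : ℤℤ} (h : Bd C) (h' : Bd D) {a b : ℕ} (hab : 0 < Nat.gcd a b) :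
    Rfactor m (fun Δ l => C Δ l - D Δ l) a b = Rfactor m C a b - Rfactor m D a b := by
  rw [Rfactor, Rfactor, Rfactor, CoeffU_sub, ← (Rf_summable m h hab).tsum_sub (Rf_summable m h' hab)]

lemma gcd_pos_of {m a b : ℕ} (hm : 0 < m) (h : a * b = m) : 0 < Nat.gcd a b :=
  Nat.gcd_pos_of_pos_left _ (Nat.pos_of_ne_zero fun h0 => by simp [h0] at h; omega)

lemma ResPrim.sub {m : ℕ} (hm : 0 < m) {C D : ℤℤ} (hb : Bd C) (hb' : Bd D) (h : ResPrim m C) (h' : ResPrim m D) :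
    ResPrim m (fun Δ l => C Δ l - D Δ l) := fun t ht hd a b hab => by
  have hp : 0 < m / t ^ 2 := Nat.div_pos (Nat.le_of_dvd hm hd) (by positivity)
  rw [CoeffU_sub, Rf_sub _ (CoeffU_bd m (by omega) hb) (CoeffU_bd m (by omega) hb') (gcd_pos_of hp hab), h t ht hd a b hab, h' t ht hd a b hab, sub_zero]

lemma ResPrim.u {m t m' : ℕ} (hm : 0 < m) (ht : 1 < t) (he : m = t ^ 2 * m') {C : ℤℤ} (h : ResPrim m C) : ResPrim m' (CoeffU m t C) := by
  intro g hg hd a b hab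
  obtain ⟨c, rfl⟩ := hd
  have e1 : g ^ 2 * c / g ^ 2 = c := Nat.mul_div_cancel_left _ (by positivity)
  have e2 : m = (t * g) ^ 2 * c := by rw [he]; ring
  have e3 : m / (t * g) ^ 2 = c := by rw [e2]; exact Nat.mul_div_cancel_left _ (by positivity)
  rw [e1] at hab ⊢
  have := h (t * g) (by nlinarith) ⟨c, e2⟩ a b (by rw [e3, hab])
  rw [e3] at this
  rw [he, CoeffU_CoeffU (by omega) (by omega), ← e2, this]

lemma star_ex {m : ℕ} (hm : 0 < m) {l : ℤ} (hl : 4 * (m : ℤ) ∣ l ^ 2 - 1) : ∃ a b : ℕ, a * b = m ∧ Nat.Coprime a b ∧ 2 * (m : ℤ) ∣ l - lstar a b 1 := by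
  have hodd : Odd l := by
    by_contra h
    rw [Int.not_odd_iff_even] at h
    obtain ⟨k, rfl⟩ := h
    obtain ⟨c, hc⟩ := hl
    have : 4 * (m * c - k ^ 2) = -1 := by linear_combination -hc
    omega
  obtain ⟨y, rfl⟩ := hodd
  have hc : Nat.Coprime (y + 1).natAbs y.natAbs := by
    rw [← Int.isCoprime_iff_nat_coprime]; exact ⟨1, -1, by ring⟩
  have hd : m ∣ (y + 1).natAbs * y.natAbs := by
    rw [← Int.natAbs_mul, ← Int.natCast_dvd]
    obtain ⟨c, hc⟩ := hl
    exact ⟨c, by linarith⟩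
  set a := Nat.gcd m (y + 1).natAbs with ha
  set b := Nat.gcd m y.natAbs with hb
  have hab : a * b = m := by rw [ha, hb, ← Nat.Coprime.gcd_mul m hc, Nat.gcd_eq_left hd]
  have hcab : Nat.Coprime a b := Nat.Coprime.coprime_dvd_left (Nat.gcd_dvd_right _ _) (hc.coprime_dvd_right (Nat.gcd_dvd_right _ _))
  have h1 : (a : ℤ) ∣ y + 1 := Int.natCast_dvd.2 (Nat.gcd_dvd_right _ _)
  have h2 : (b : ℤ) ∣ y := Int.natCast_dvd.2 (Nat.gcd_dvd_right _ _)
  refine ⟨a, b, hab, hcab, ?_⟩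
  have hbz := Nat.gcd_eq_gcd_ab a b
  rw [hcab.gcd_eq_one] at hbz
  push_cast at hbz
  rw [lstar, ← hab]
  have h3 : (a : ℤ) * b ∣ y + 1 - a * Nat.gcdA a b := by
    refine (Nat.isCoprime_iff_coprime.2 hcab).mul_dvd (dvd_sub h1 (dvd_mul_right _ _)) ?_
    rw [show y + 1 - a * Nat.gcdA a b = y + b * Nat.gcdB a b by linear_combination hbz]
    exact dvd_add h2 (dvd_mul_right _ _)
  obtain ⟨k, hk⟩ := h3
  exact ⟨k, by push_cast; linear_combination 2 * hk - hbz⟩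

lemma Rf_OG {m : ℕ} {C : ℤℤ} (ho : IsOGC C) (he : IsEvenC C) {a b : ℕ} (hc : Nat.Coprime a b) :
    Rfactor m C a b = C 0 0 + 2 * C (-1) (lstar a b 1) := by
  rw [Rfactor, hc.gcd_eq_one, CoeffU_one, Nat.div_one, Nat.div_one, tsum_eq_sum (s := {0, 1, -1}) (fun r hr => ho _ _ (by
    simp only [mem_insert, mem_singleton, not_or] at hr
    have : 1 < |r| := by rcases abs_cases r with h | h <;> omega
    have : 1 < r ^ 2 := by rw [← sq_abs]; nlinarith
    omega))]
  have e : lstar a b (-1) = - lstar a b 1 := by rw [lstar, lstar]; ring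
  rw [sum_insert (by decide), sum_insert (by decide), sum_singleton, e, he]
  simp [lstar]; ring

lemma OG_key {m : ℕ} (hm : 0 < m) {C : ℤℤ} (ho : IsOGC C) (he : IsEvenC C) (per : ∀ Δ l : ℤ, C Δ (l + 2 * (m : ℤ)) = C Δ l)
    (hr : ∀ a b, a * b = m → Rfactor m C a b = 0) {l : ℤ} (hl : 4 * (m : ℤ) ∣ l ^ 2 - 1) : C (-1) l = -C 0 0 / 2 := by
  obtain ⟨a, b, hab, hc, hd⟩ := star_ex hm hl
  have := hr a b hab
  rw [Rf_OG ho he hc] at this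
  rw [per_dvd per hd]
  linear_combination this / 2

lemma OG_key0 {m : ℕ} (hm : 0 < m) {C : ℤℤ} (ho : IsOGC C) (he : IsEvenC C) (per : ∀ Δ l : ℤ, C Δ (l + 2 * (m : ℤ)) = C Δ l)
    (supp : ∀ Δ l : ℤ, ¬ (4 * (m : ℤ)) ∣ (Δ + l ^ 2) → C Δ l = 0)
    (hr : ∀ a b, a * b = m → Rfactor m C a b = 0) (h0 : C 0 0 = 0) : IsHolC C := fun Δ l hΔ => by
  rcases lt_or_eq_of_le (show Δ ≤ -1 by omega) with h | rfl
  · exact ho _ _ h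
  · by_cases hl : 4 * (m : ℤ) ∣ l ^ 2 - 1
    · rw [OG_key hm ho he per hr hl, h0]; simp
    · exact supp _ _ (by rwa [neg_add_eq_sub])

lemma JF.add {m : ℕ} {C C' : ℤℤ} {φ φ' : ℂℂ} (h : JF m C φ) (h' : JF m C' φ') :
    JF m (fun Δ l => C Δ l + C' Δ l) (fun τ z => φ τ z + φ' τ z) := ⟨h.jx.add h'.jx, fun τ ht z a b c d hd => by
  rw [h.law τ ht z a b c d hd, h'.law τ ht z a b c d hd]; ring⟩

lemma JF.smul {m : ℕ} {C : ℤℤ} {φ : ℂℂ} (h : JF m C φ) (x : ℂ) :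
    JF m (fun Δ l => x * C Δ l) (fun τ z => x * φ τ z) := ⟨h.jx.smul x, fun τ ht z a b c d hd => by
  rw [h.law τ ht z a b c d hd]; ring⟩

lemma JF.zero (m : ℕ) : JF m (fun _ _ => 0) (fun _ _ => 0) := by
  refine ⟨⟨fun τ z _ => ?_, fun _ _ => rfl, fun _ _ _ => rfl, 0, fun _ _ _ => rfl⟩, fun _ _ _ _ _ _ _ _ => by simp⟩
  simpa using (hasSum_zero : HasSum (fun _ : ℤ × ℤ => (0 : ℂ)) 0)

lemma Ex_step {m : ℕ} (hm : 0 < m) {C : ℤℤ} {φ : ℂℂ} (h : JX m C φ) (he : IsEvenC C)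
    (hu : ∀ t m', 1 < t → m = t ^ 2 * m' → ∃ C' ψ, JF m' C' ψ ∧ ∀ Δ l, Δ ≤ 0 → C' Δ l = CoeffU m t C Δ l) :
    ∃ C' ψ, JF m C' ψ ∧ ∀ Δ l, Δ ≤ 0 → Δ ≠ -1 → C' Δ l = C Δ l := by
  obtain ⟨K, hK0⟩ := h.bdN hm
  have hmZ : (0 : ℤ) < m := by exact_mod_cast hm
  have hK : ∀ n r : ℤ, n < -(K : ℤ) → C (4 * m * n - r ^ 2) r = 0 := fun n r hn => hK0 _ _ (by push_cast; nlinarith [sq_nonneg r])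
  set s : Finset (ℕ × ℕ) := (range (m + 1) ×ˢ range (K + m + 1)).filter (fun x => 4 * (m : ℤ) * ((x.2 : ℤ) - K) - (x.1 : ℤ) ^ 2 ≤ 0 ∧ 4 * (m : ℤ) * ((x.2 : ℤ) - K) - (x.1 : ℤ) ^ 2 ≠ -1) with hs
  set D : ℤℤ → ℕ × ℕ → ℂ := fun C x => C (4 * m * ((x.2 : ℤ) - K) - (x.1 : ℤ) ^ 2) x.1 with hD
  set W : Submodule ℂ (s → ℂ) :=
    { carrier := {v | ∃ C' ψ, JF m C' ψ ∧ (∀ n r : ℤ, n < -(K : ℤ) → C' (4 * m * n - r ^ 2) r = 0) ∧ ∀ x : s, v x = D C' x}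
      zero_mem' := ⟨_, _, JF.zero m, fun _ _ _ => rfl, fun _ => rfl⟩
      add_mem' := by
        rintro v w ⟨C1, ψ1, h1, k1, e1⟩ ⟨C2, ψ2, h2, k2, e2⟩
        exact ⟨_, _, h1.add h2, fun n r hn => by rw [k1 _ _ hn, k2 _ _ hn, add_zero], fun x => by rw [Pi.add_apply, e1, e2]⟩
      smul_mem' := by
        rintro a v ⟨C1, ψ1, h1, k1, e1⟩
        exact ⟨_, _, h1.smul a, fun n r hn => by rw [k1 _ _ hn, mul_zero], fun x => by rw [Pi.smul_apply, e1, smul_eq_mul]⟩ } with hW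
  have hmem : (fun x : s => D C x) ∈ W := by
    by_contra hn
    obtain ⟨F, hF, hker⟩ := Submodule.exists_le_ker_of_notMem hn
    set lam : ℕ → ℕ → ℂ := fun r n => if hx : (r, n) ∈ s then F (Pi.single ⟨(r, n), hx⟩ 1) else 0 with hlam
    have hsum : ∀ C', ∑ r ∈ range (m + 1), ∑ n ∈ range (K + m + 1), lam r n * C' (4 * m * ((n : ℤ) - K) - (r : ℤ) ^ 2) r = F (fun x : s => D C' x) := by
      intro C'
      rw [← sum_product', LinearMap.pi_apply_eq_sum_univ F]
      rw [← sum_subset (filter_subset _ _ : s ⊆ _) (fun x _ hx => by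
        rw [hlam]; simp only; rw [dif_neg hx, zero_mul]), ← sum_coe_sort]
      refine sum_congr rfl fun x _ => ?_
      rw [hlam, smul_eq_mul]; simp only
      rw [dif_pos x.2, mul_comm]
      congr 2
      ext y
      rw [Pi.single_apply]
      exact if_congr eq_comm rfl rfl
    obtain ⟨f, hf, hfl⟩ := C3 hm K lam (fun C' ψ hψ hk => by
      rw [hsum]
      exact LinearMap.mem_ker.1 (hker ⟨C', ψ, hψ, hk, fun _ => rfl⟩))
    have hz : ∀ N l : ℤ, N < 0 ∨ N = 1 → bG m f N l = 0 := fun N l hN => by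
      by_contra hne
      obtain ⟨i, hi, hc⟩ := bG_ne hm hne
      have hi' : i ≤ m := by
        by_contra hgt
        push Not at hgt
        have h1 : (1 : ℤ) ≤ i - m := by omega
        have h2 : 4 * (m : ℤ) ≤ 4 * m * (i - m) := by nlinarith
        have h3 := sq_nonneg (rr m l : ℤ)
        rcases hN with hN | hN <;> omega
      rw [hfl _ (rr_le hm l) i (by omega), hlam] at hc
      simp only at hc
      rw [dif_neg] at hc
      · exact hc rfl
      · intro hx
        have hx := (mem_filter.1 hx).2
        simp only at hx
        rw [show 4 * (m : ℤ) * (((K + m - i : ℕ) : ℤ) - K) - (rr m l : ℤ) ^ 2 = -N by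
          rw [hi, Nat.cast_sub (by omega)]; push_cast; ring] at hx
        rcases hN with hN | hN <;> omega
    have hkb := bG_KB hm hf (fun N l hN => hz N l (Or.inl hN))
    have h4 := C4 hm hf hkb (fun l => hz 1 l (Or.inr rfl)) h.per h.bd hu
    rw [pair_bG hm hkb.neg h.per he h.supp hK] at h4
    apply hF
    rw [← hsum, ← h4]
    refine sum_congr rfl fun r hr => ?_
    rw [← sum_range_reflect]
    refine sum_congr rfl fun i hi => ?_
    rw [mem_range] at hi hr
    rw [hfl r (by omega) i (by omega), show K + m + 1 - 1 - i = K + m - i by omega, Nat.cast_sub (by omega)]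
    congr 2; push_cast; ring
  obtain ⟨C', ψ, hψ, hk, hx⟩ := hmem
  refine ⟨C', ψ, hψ, fun Δ l h0 h1 => ?_⟩
  by_cases hd : (4 * (m : ℤ)) ∣ (Δ + l ^ 2)
  swap
  · rw [h.supp _ _ hd, hψ.jx.supp _ _ hd]
  have key : ∀ {E : ℤℤ}, (∀ Δ l : ℤ, E Δ (l + 2 * (m : ℤ)) = E Δ l) → IsEvenC E → E Δ l = E Δ (rr m l) := fun {E} hp hev => by
    rcases rr_spec hm l with h2 | h2
    · exact per_dvd hp h2
    · rw [← hev Δ (rr m l)]; exact per_dvd hp (by rwa [sub_neg_eq_add])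
  rw [key h.per he, key hψ.jx.per hψ.even]
  have hr := rr_le hm l
  obtain ⟨n, hn⟩ : 4 * (m : ℤ) ∣ Δ + (rr m l : ℤ) ^ 2 := by
    obtain ⟨c, hc⟩ := hd
    rcases rr_spec hm l with ⟨k, h2⟩ | ⟨k, h2⟩
    · exact ⟨c - k * l + m * k ^ 2, by rw [show (rr m l : ℤ) = l - 2 * m * k by linarith]; linear_combination hc⟩
    · exact ⟨c - k * l + m * k ^ 2, by rw [show (rr m l : ℤ) = 2 * m * k - l by linarith]; linear_combination hc⟩
  generalize rr m l = r at *
  obtain rfl : Δ = 4 * m * n - (r : ℤ) ^ 2 := by linarith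
  by_cases hnK : n < -(K : ℤ)
  · rw [hk _ _ hnK, hK _ _ hnK]
  have hnm : n ≤ m := by
    by_contra hgt
    push Not at hgt
    have : (r : ℤ) ^ 2 ≤ m ^ 2 := by gcongr
    nlinarith
  have e : ((n + K).toNat : ℤ) - K = n := by omega
  have hmem' : (r, (n + K).toNat) ∈ s := by
    rw [hs, mem_filter, mem_product, mem_range, mem_range]
    simp only [e]
    exact ⟨⟨by omega, by omega⟩, h0, h1⟩
  have := hx ⟨_, hmem'⟩
  simp only [hD, e] at this
  exact this.symm

lemma JX.sub {m : ℕ} {C C' : ℤℤ} {φ φ' : ℂℂ} (h : JX m C φ) (h' : JX m C' φ') :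
    JX m (fun Δ l => C Δ l - C' Δ l) (fun τ z => φ τ z - φ' τ z) := by
  have := h.add (h'.smul (-1))
  simpa only [neg_one_mul, ← sub_eq_add_neg] using this

lemma Ex : ∀ m : ℕ, 0 < m → ∀ (C : ℤℤ) (φ : ℂℂ), JX m C φ → IsEvenC C → ResPrim m C →
    ∃ C' ψ, JF m C' ψ ∧ ∀ Δ l, Δ ≤ 0 → Δ ≠ -1 → C' Δ l = C Δ l := by
  intro m
  induction m using Nat.strong_induction_on with
  | _ m ih =>
    intro hm C φ h he hR
    refine Ex_step hm h he fun t m' ht hmt => ?_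
    have ht0 : 0 < t := by omega
    have hm' : 0 < m' := Nat.pos_of_ne_zero fun h0 => by rw [h0] at hmt; simp at hmt; omega
    obtain ⟨φ', h1⟩ : ∃ φ', JX m' (CoeffU m t C) φ' := by rw [hmt] at h ⊢; exact ⟨_, h.U ht0⟩
    have h2 : IsEvenC (CoeffU m t C) := by have := h.per; rw [hmt] at this ⊢; exact CoeffU_even ht0 he this
    have h4 : 4 ≤ t ^ 2 := by nlinarith
    have hlt : m' < m := by have := Nat.mul_le_mul_right m' h4; omega
    obtain ⟨C', ψ, hψ, hC⟩ := ih m' hlt hm' _ _ h1 h2 (hR.u hm ht hmt)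
    refine ⟨C', ψ, hψ, fun Δ l h0 => ?_⟩
    by_cases hΔ : Δ = -1
    swap
    · exact hC _ _ h0 hΔ
    subst hΔ
    have h3 := h1.sub hψ.jx
    have := OG_key0 hm' (C := fun Δ l => CoeffU m t C Δ l - C' Δ l) (fun Δ l hl => by beta_reduce; rw [hC _ _ (by omega) (by omega), sub_self])
      (fun Δ l => by beta_reduce; rw [h2, hψ.even]) h3.per h3.supp (fun a b hab => by
        have hg := gcd_pos_of hm' hab
        rw [Rf_sub _ h1.bd hψ.jx.bd hg, hψ.R hm' hab, sub_zero]
        have e : m / t ^ 2 = m' := by rw [hmt]; exact Nat.mul_div_cancel_left _ (by positivity)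
        have := hR t ht ⟨m', hmt⟩ a b (by rw [e, hab])
        rwa [e] at this) (by rw [hC _ _ le_rfl (by omega), sub_self]) (-1) l (by omega)
    exact (sub_eq_zero.1 this).symm

def C0 (m : ℕ) (Δ l : ℤ) : ℂ := if Δ = 0 ∧ 4 * (m : ℤ) ∣ l ^ 2 then (ee (l / (2 * m)) + ee (-(l / (2 * m)))) / 2 else 0

lemma C0_JX {m : ℕ} (hm : 0 < m) : ∃ φ, JX m (C0 m) φ := by
  have hm' : (m : ℂ) ≠ 0 := by exact_mod_cast hm.ne'
  have hmZ : 4 * (m : ℤ) ≠ 0 := by positivity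
  refine ⟨fun τ z => ∑' p : ℤ × ℤ, C0 m (4 * (m : ℤ) * p.1 - p.2 ^ 2) p.2 * ee (p.1 * τ + p.2 * z), fun τ z hτ => ?_, fun Δ l => ?_, fun Δ l hl => ?_, 0, fun Δ l hl => ?_⟩
  · refine Summable.hasSum (f := fun p : ℤ × ℤ => C0 m (4 * (m : ℤ) * p.1 - p.2 ^ 2) p.2 * ee (p.1 * τ + p.2 * z)) ?_
    have hi : Function.Injective (fun r : ℤ => (r ^ 2 / (4 * (m : ℤ)), r)) := fun x y h => (Prod.mk.inj h).2
    have ht : 0 < (τ / (2 * m)).im := by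
      rw [show τ / (2 * m) = ((2 * m : ℝ)⁻¹ : ℝ) * τ by push_cast; field_simp, Complex.im_ofReal_mul]
      positivity
    have h1 := ((summable_jacobiTheta₂_term_iff (z + 1 / (2 * m)) _).2 ht).add ((summable_jacobiTheta₂_term_iff (z - 1 / (2 * m)) _).2 ht)
    have h2 := (h1.div_const 2).indicator {r : ℤ | 4 * (m : ℤ) ∣ r ^ 2}
    rw [← hi.summable_iff]
    · refine h2.congr fun r => ?_
      simp only [Function.comp, Set.indicator, Set.mem_setOf_eq]
      by_cases hr : 4 * (m : ℤ) ∣ r ^ 2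
      · obtain ⟨k, hk⟩ := hr
        have hk' : (k : ℂ) = r ^ 2 / (4 * m) := by
          have : ((r ^ 2 : ℤ) : ℂ) = ((4 * (m : ℤ) * k : ℤ) : ℂ) := by rw [hk]
          push_cast at this; rw [this]; field_simp
        rw [hk, Int.mul_ediv_cancel_left _ hmZ, sub_self, if_pos ⟨k, rfl⟩, C0, if_pos ⟨rfl, by rw [hk]; exact ⟨k, rfl⟩⟩, div_mul_eq_mul_div, add_mul, ← ee_add, ← ee_add, hk']
        simp only [jacobiTheta₂_term, ee]
        congr 2 <;> congr 1 <;> field_simp <;> ring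
      · rw [if_neg hr, C0, if_neg fun h => hr h.2, zero_mul]
    · intro p hp
      rw [C0, if_neg, zero_mul]
      rintro ⟨h3, k, hk⟩
      refine hp ⟨p.2, Prod.ext ?_ rfl⟩
      have : p.2 ^ 2 = 4 * (m : ℤ) * p.1 := by linarith
      simp only [this]
      exact Int.mul_ediv_cancel_left _ hmZ
  · have e : 4 * (m : ℤ) ∣ (l + 2 * m) ^ 2 ↔ 4 * (m : ℤ) ∣ l ^ 2 := by
      rw [show (l + 2 * (m : ℤ)) ^ 2 = l ^ 2 + 4 * m * (l + m) by ring]; exact dvd_add_left ⟨_, rfl⟩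
    have e2 : ee (((l + 2 * (m : ℤ) : ℤ) : ℂ) / (2 * m)) = ee (l / (2 * m)) := by
      rw [show ((l + 2 * (m : ℤ) : ℤ) : ℂ) / (2 * m) = l / (2 * m) + (1 : ℤ) by push_cast; field_simp, ee_add, ee_int, mul_one]
    simp only [C0, e, ee_neg, e2]
  · rw [C0, if_neg]
    rintro ⟨rfl, h⟩
    exact hl (by rwa [zero_add])
  · rw [C0, if_neg fun h => by omega]

lemma C0_even {m : ℕ} : IsEvenC (C0 m) := fun Δ l => by
  rw [C0, C0, neg_sq]; push_cast; rw [neg_div, neg_neg, add_comm (ee _)]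

lemma C0_res {m : ℕ} (hm : 0 < m) : ResPrim m (C0 m) := fun t ht hd a b hab => by
  obtain ⟨m', rfl⟩ := hd
  have ht0 : 0 < t := by omega
  have hm0 : 0 < m' := Nat.pos_of_ne_zero fun h => by simp [h] at hm
  have ht' : (t : ℂ) ≠ 0 := by exact_mod_cast ht0.ne'
  have hm' : (m' : ℂ) ≠ 0 := by exact_mod_cast hm0.ne'
  have hz : CoeffU (t ^ 2 * m') t (C0 (t ^ 2 * m')) = fun _ _ => 0 := by
    ext Δ l
    rw [CoeffU_eq ht0]
    by_cases h0 : Δ = 0 ∧ 4 * (m' : ℤ) ∣ l ^ 2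
    · obtain ⟨rfl, k, hk⟩ := h0
      have h1 : ∀ j : ℕ, C0 (t ^ 2 * m') (0 * t ^ 2) ((l + 2 * m' * j) * t) = (ee (l / (2 * m' * t)) * ee (j * ((1 : ℤ) / t)) + ee (-(l / (2 * m' * t))) * ee (j * ((-1 : ℤ) / t))) / 2 := fun j => by
        rw [C0, if_pos ⟨by ring, k + l * j + m' * j ^ 2, by push_cast; linear_combination (t : ℤ) ^ 2 * hk⟩, ← ee_add, ← ee_add]
        congr 3 <;> push_cast <;> field_simp <;> ring
      have n1 : ¬ (t : ℤ) ∣ 1 := fun h => by have := Int.le_of_dvd one_pos h; omega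
      rw [sum_congr rfl fun j _ => h1 j, ← sum_div, sum_add_distrib, ← mul_sum, ← mul_sum, sum_ee ht0, sum_ee ht0, if_neg n1, if_neg (by rwa [dvd_neg])]
      simp
    · refine sum_eq_zero fun j _ => ?_
      rw [C0, if_neg]
      rintro ⟨h1, c, hc⟩
      have ht2 : (t : ℤ) ^ 2 ≠ 0 := by positivity
      refine h0 ⟨(mul_eq_zero.1 h1).resolve_right ht2, c - l * j - m' * j ^ 2, mul_left_cancel₀ ht2 ?_⟩
      push_cast at hc; linear_combination hc
  rw [hz]
  simp [Rfactor, CoeffU]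

lemma chi_ex {m : ℕ} (hm : 0 < m) : ∃ C ψ, JF m C ψ ∧ IsOGC C ∧ C 0 0 = 1 := by
  obtain ⟨φ, h⟩ := C0_JX hm
  obtain ⟨C, ψ, hψ, hC⟩ := Ex m hm _ _ h C0_even (C0_res hm)
  refine ⟨C, ψ, hψ, fun Δ l hl => ?_, ?_⟩
  · rw [hC _ _ (by omega) (by omega), C0, if_neg fun h => by omega]
  · rw [hC _ _ le_rfl (by omega), C0, if_pos ⟨rfl, by simp⟩]; simp [ee_zero]

def SF (m : ℕ) (st : Fin 3) (C : ℤℤ) : ℂ := if st = 0 then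
    (∑ r ∈ (range m).filter (fun r => 0 < r ∧ (4 * (m : ℤ)) ∣ ((r : ℤ) ^ 2 - 1)), C (-1) (r : ℤ)) else if st = 1 then C (-1) 1 else C 0 0

lemma SF_iff (m : ℕ) (st : Fin 3) (C : ℤℤ) : StarCond m st C ↔ SF m st C = 0 := by
  rw [StarCond, SF]; split_ifs <;> rfl

lemma SF_sub (m : ℕ) (st : Fin 3) (C D : ℤℤ) : SF m st (fun Δ l => C Δ l - D Δ l) = SF m st C - SF m st D := by
  simp only [SF]; split_ifs
  · rw [sum_sub_distrib]
  · rfl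
  · rfl

lemma SF_smul (m : ℕ) (st : Fin 3) (x : ℂ) (C : ℤℤ) : SF m st (fun Δ l => x * C Δ l) = x * SF m st C := by
  simp only [SF]; split_ifs
  · rw [mul_sum]
  · rfl
  · rfl

lemma SF_ex {m : ℕ} (hm : 1 < m) (st : Fin 3) : ∃ κ : ℂ, κ ≠ 0 ∧ ∀ C ψ, JF m C ψ → IsOGC C → SF m st C = κ * C 0 0 := by
  have key : ∀ C ψ, JF m C ψ → IsOGC C → ∀ l : ℤ, 4 * (m : ℤ) ∣ l ^ 2 - 1 → C (-1) l = -C 0 0 / 2 := fun C ψ h ho l hl =>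
    OG_key (by omega) ho h.even h.jx.per (fun a b hab => h.R (by omega) hab) hl
  by_cases h0 : st = 0
  · refine ⟨((range m).filter (fun r => 0 < r ∧ (4 * (m : ℤ)) ∣ ((r : ℤ) ^ 2 - 1))).card * (-1 / 2), mul_ne_zero ?_ (by norm_num), fun C ψ h ho => ?_⟩
    · rw [Nat.cast_ne_zero, card_ne_zero]
      exact ⟨1, mem_filter.2 ⟨by simpa using hm, one_pos, by simp⟩⟩
    · rw [SF, if_pos h0, sum_congr rfl fun r hr => key C ψ h ho r (mem_filter.1 hr).2.2, sum_const, nsmul_eq_mul]; ring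
  · by_cases h1 : st = 1
    · exact ⟨-1 / 2, by norm_num, fun C ψ h ho => by rw [SF, if_neg h0, if_pos h1, key C ψ h ho 1 (by simp)]; ring⟩
    · exact ⟨1, one_ne_zero, fun C ψ h ho => by rw [SF, if_neg h0, if_neg h1, one_mul]⟩

lemma JF.inter {m : ℕ} (hm : 1 < m) (st : Fin 3) {C : ℤℤ} {ψ : ℂℂ} (h : JF m C ψ) : (IsOGC C ∧ StarCond m st C) ↔ IsHolC C := by
  obtain ⟨κ, hκ, hS⟩ := SF_ex hm st
  constructor
  · rintro ⟨ho, hs⟩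
    rw [SF_iff, hS C ψ h ho] at hs
    exact OG_key0 (by omega) ho h.even h.jx.per h.jx.supp (fun a b hab => h.R (by omega) hab) ((mul_eq_zero.1 hs).resolve_left hκ)
  · intro hh
    have ho : IsOGC C := fun Δ l hl => hh Δ l (by omega)
    refine ⟨ho, ?_⟩
    have := h.R (m₁ := 1) (m₂ := m) (by omega) (one_mul m)
    rw [Rf_OG ho h.even (Nat.coprime_one_left m), hh (-1) _ (by omega), mul_zero, add_zero] at this
    rw [SF_iff, hS C ψ h ho, this, mul_zero]

lemma EllFormData.jx {m : ℕ} (hm : 0 < m) (φ : EllFormData m) (h : IsWeakC m φ.coeff) : JX m φ.coeff φ.toFun := by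
  refine ⟨φ.expansion, φ.periodic, φ.support, -m ^ 2, fun Δ l hl => ?_⟩
  by_cases hd : 4 * (m : ℤ) ∣ Δ + l ^ 2
  swap
  · exact φ.support _ _ hd
  obtain ⟨h1, k, hk⟩ := bmod_bound l hm
  rw [per_dvd φ.periodic ⟨k, hk⟩]
  generalize l.bmod (2 * m) = r at *
  obtain ⟨c, hc⟩ := hd
  have e : Δ = 4 * m * (c - k * l + m * k ^ 2) - r ^ 2 := by rw [show r = l - 2 * m * k by linarith]; linear_combination hc
  have hmZ : (0 : ℤ) < m := by exact_mod_cast hm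
  generalize c - k * l + m * k ^ 2 = n at e
  rw [e]
  exact h n r (by by_contra hn; push Not at hn; nlinarith [mul_nonneg hmZ.le hn])

def JX.mk' {m : ℕ} (hm : 0 < m) {C : ℤℤ} {φ : ℂℂ} (h : JX m C φ) (he : IsEvenC C) : EllFormData m :=
  ⟨φ, C, h.diff hm he, h.law, h.exp, h.per, h.supp⟩

lemma OG_weak {m : ℕ} (hm : 0 < m) {C : ℤℤ} (h : IsOGC C) : IsWeakC m C := fun n r hn => h _ _ (by
  have hmZ : (0 : ℤ) < m := by exact_mod_cast hm
  nlinarith [sq_nonneg r])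

lemma decomp {m : ℕ} (hm : 1 < m) (st : Fin 3) (φ : EllFormData m) (he : IsEvenC φ.coeff) (hw : IsWeakC m φ.coeff) (hR : ResPrim m φ.coeff) :
    ∃ ψ e : EllFormData m, ModularLaw 2 m ψ.toFun ∧ IsWeakC m ψ.coeff ∧
          ResPrim m ψ.coeff ∧ IsEvenC e.coeff ∧ IsWeakC m e.coeff ∧ ResPrim m e.coeff ∧
          IsOGC e.coeff ∧ StarCond m st e.coeff ∧ SumEq m φ ψ e := by
  have hm0 : 0 < m := by omega
  have hφ := φ.jx hm0 hw
  obtain ⟨C, ψ, hψ, hC⟩ := Ex m hm0 _ _ hφ he hR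
  obtain ⟨D, χ, hχ, hχo, hχ1⟩ := chi_ex hm0
  obtain ⟨κ, hκ, hS⟩ := SF_ex hm st
  set x : ℂ := SF m st (fun Δ l => φ.coeff Δ l - C Δ l) / κ with hx
  have h1 := hψ.add (hχ.smul x)
  have h2 := hφ.sub h1.jx
  have ho : IsOGC (fun Δ l => φ.coeff Δ l - (C Δ l + x * D Δ l)) := fun Δ l hl => by
    beta_reduce
    rw [hC _ _ (by omega) (by omega), hχo _ _ hl]; ring
  have hev : IsEvenC (fun Δ l => φ.coeff Δ l - (C Δ l + x * D Δ l)) := fun Δ l => by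
    beta_reduce
    rw [he, hψ.even, hχ.even]
  refine ⟨h1.jx.mk' hm0 h1.even, h2.mk' hm0 hev, h1.law, fun n r hn => ?_, h1.resPrim hm0, hev, OG_weak hm0 ho, ResPrim.sub hm0 hφ.bd h1.jx.bd hR (h1.resPrim hm0), ho, ?_, fun τ z _ => ?_⟩
  · have := OG_weak hm0 ho n r hn
    beta_reduce at this
    rw [hw n r hn, zero_sub, neg_eq_zero] at this
    exact this
  · rw [SF_iff]
    have e : (fun Δ l => φ.coeff Δ l - (C Δ l + x * D Δ l)) = fun Δ l => (fun Δ l => φ.coeff Δ l - C Δ l) Δ l - (fun Δ l => x * D Δ l) Δ l := by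
      ext Δ l; ring
    change SF m st (fun Δ l => φ.coeff Δ l - (C Δ l + x * D Δ l)) = 0
    rw [e, SF_sub, SF_smul, hS D χ hχ hχo, hχ1, hx]
    field_simp; ring
  · change φ.toFun τ z = (ψ τ z + x * χ τ z) + (φ.toFun τ z - (ψ τ z + x * χ τ z)); ring

lemma uniq {m : ℕ} (hm : 1 < m) (st : Fin 3) (φ ψ₁ e₁ ψ₂ e₂ : EllFormData m)
    (l1 : ModularLaw 2 m ψ₁.toFun) (w1 : IsWeakC m ψ₁.coeff) (v1 : IsWeakC m e₁.coeff) (o1 : IsOGC e₁.coeff) (s1 : StarCond m st e₁.coeff) (q1 : SumEq m φ ψ₁ e₁)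
    (l2 : ModularLaw 2 m ψ₂.toFun) (w2 : IsWeakC m ψ₂.coeff) (v2 : IsWeakC m e₂.coeff) (o2 : IsOGC e₂.coeff) (s2 : StarCond m st e₂.coeff) (q2 : SumEq m φ ψ₂ e₂) :
    ∀ Δ l : ℤ, Δ < 0 → ψ₁.coeff Δ l = ψ₂.coeff Δ l := by
  have hm0 : 0 < m := by omega
  have h1 : JF m _ _ := ⟨ψ₁.jx hm0 w1, l1⟩
  have h2 : JF m _ _ := ⟨ψ₂.jx hm0 w2, l2⟩
  have h3 := h1.add (h2.smul (-1))
  have h4 := (e₂.jx hm0 v2).sub (e₁.jx hm0 v1)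
  have e := h3.jx.ext h4 (fun τ z ht => by have := q1 τ z ht; have := q2 τ z ht; linear_combination q2 τ z ht - q1 τ z ht)
  have h5 := (h3.inter hm st).1 (by
    rw [e]
    refine ⟨fun Δ l hl => by beta_reduce; rw [o1 _ _ hl, o2 _ _ hl, sub_zero], ?_⟩
    rw [SF_iff] at *
    rw [SF_sub, s1, s2, sub_zero])
  intro Δ l hl
  have := h5 Δ l hl
  beta_reduce at this
  linear_combination this
end

/-- Theorem: let `m > 1` and `⋆ ∈ {I, II, III}`. For squarefree `m`: every even weak
elliptic form of index `m` is the sum of a weak Jacobi form of weight 2 and index `m` and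
an element of `E^{OG,⋆}_m`; the intersection of `E^{OG,⋆}_m` with the weak Jacobi forms of
weight 2 and index `m` is exactly the holomorphic Jacobi forms; and the decomposition is
unique up to a holomorphic Jacobi form.  For arbitrary `m > 1` the same assertions hold
with everything restricted to forms `φ` with `R(φ|u_t) ≡ 0` for all `t > 1`. -/
theorem optimal_growth_decomposition (m : ℕ) (hm : 1 < m) (st : Fin 3) :
    (Squarefree m →
      (∀ φ : EllFormData m, IsEvenC φ.coeff → IsWeakC m φ.coeff →
        ∃ ψ e : EllFormData m, ModularLaw 2 m ψ.toFun ∧ IsWeakC m ψ.coeff ∧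
          IsEvenC e.coeff ∧ IsWeakC m e.coeff ∧ IsOGC e.coeff ∧ StarCond m st e.coeff ∧
          SumEq m φ ψ e) ∧
      (∀ χ : EllFormData m, IsEvenC χ.coeff → IsWeakC m χ.coeff → ModularLaw 2 m χ.toFun →
        ((IsOGC χ.coeff ∧ StarCond m st χ.coeff) ↔ IsHolC χ.coeff)) ∧
      (∀ φ ψ₁ e₁ ψ₂ e₂ : EllFormData m, IsEvenC φ.coeff → IsWeakC m φ.coeff →
        (ModularLaw 2 m ψ₁.toFun ∧ IsWeakC m ψ₁.coeff ∧ IsEvenC e₁.coeff ∧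
          IsWeakC m e₁.coeff ∧ IsOGC e₁.coeff ∧ StarCond m st e₁.coeff ∧ SumEq m φ ψ₁ e₁) →
        (ModularLaw 2 m ψ₂.toFun ∧ IsWeakC m ψ₂.coeff ∧ IsEvenC e₂.coeff ∧
          IsWeakC m e₂.coeff ∧ IsOGC e₂.coeff ∧ StarCond m st e₂.coeff ∧ SumEq m φ ψ₂ e₂) →
        ∀ Δ l : ℤ, Δ < 0 → ψ₁.coeff Δ l = ψ₂.coeff Δ l)) ∧
    ((∀ φ : EllFormData m, IsEvenC φ.coeff → IsWeakC m φ.coeff → ResPrim m φ.coeff →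
        ∃ ψ e : EllFormData m, ModularLaw 2 m ψ.toFun ∧ IsWeakC m ψ.coeff ∧
          ResPrim m ψ.coeff ∧ IsEvenC e.coeff ∧ IsWeakC m e.coeff ∧ ResPrim m e.coeff ∧
          IsOGC e.coeff ∧ StarCond m st e.coeff ∧ SumEq m φ ψ e) ∧
      (∀ χ : EllFormData m, IsEvenC χ.coeff → IsWeakC m χ.coeff → ResPrim m χ.coeff →
        ModularLaw 2 m χ.toFun →
        ((IsOGC χ.coeff ∧ StarCond m st χ.coeff) ↔ IsHolC χ.coeff)) ∧
      (∀ φ ψ₁ e₁ ψ₂ e₂ : EllFormData m, IsEvenC φ.coeff → IsWeakC m φ.coeff →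
        ResPrim m φ.coeff →
        (ModularLaw 2 m ψ₁.toFun ∧ IsWeakC m ψ₁.coeff ∧ ResPrim m ψ₁.coeff ∧
          IsEvenC e₁.coeff ∧ IsWeakC m e₁.coeff ∧ ResPrim m e₁.coeff ∧ IsOGC e₁.coeff ∧
          StarCond m st e₁.coeff ∧ SumEq m φ ψ₁ e₁) →
        (ModularLaw 2 m ψ₂.toFun ∧ IsWeakC m ψ₂.coeff ∧ ResPrim m ψ₂.coeff ∧
          IsEvenC e₂.coeff ∧ IsWeakC m e₂.coeff ∧ ResPrim m e₂.coeff ∧ IsOGC e₂.coeff ∧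
          StarCond m st e₂.coeff ∧ SumEq m φ ψ₂ e₂) →
        ∀ Δ l : ℤ, Δ < 0 → ψ₁.coeff Δ l = ψ₂.coeff Δ l)) := by
  have hm0 : 0 < m := by omega
  refine ⟨fun hsq => ⟨fun φ he hw => ?_, fun χ _ hw hl => JF.inter hm st ⟨χ.jx hm0 hw, hl⟩, ?_⟩, fun φ he hw hR => decomp hm st φ he hw hR, fun χ _ hw _ hl => JF.inter hm st ⟨χ.jx hm0 hw, hl⟩, ?_⟩
  · obtain ⟨ψ, e, a1, a2, _, a3, a4, _, a5, a6, a7⟩ := decomp hm st φ he hw (fun t ht hd => by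
      rw [sq] at hd
      have := Nat.isUnit_iff.1 (hsq t hd)
      omega)
    exact ⟨ψ, e, a1, a2, a3, a4, a5, a6, a7⟩
  · rintro φ ψ₁ e₁ ψ₂ e₂ _ _ ⟨a1, a2, _, a3, a4, a5, a6⟩ ⟨b1, b2, _, b3, b4, b5, b6⟩
    exact uniq hm st φ ψ₁ e₁ ψ₂ e₂ a1 a2 a3 a4 a5 a6 b1 b2 b3 b4 b5 b6
  · rintro φ ψ₁ e₁ ψ₂ e₂ _ _ _ ⟨a1, a2, _, _, a3, _, a4, a5, a6⟩ ⟨b1, b2, _, _, b3, _, b4, b5, b6⟩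
    exact uniq hm st φ ψ₁ e₁ ψ₂ e₂ a1 a2 a3 a4 a5 a6 b1 b2 b3 b4 b5 b6
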